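/- Let w₀ be the solution of the linear wave equation ∂_t²w − Δw = 0 on [0,∞)×ℝ² with w(0,·) = φ₀, ∂_tw(0,·) = φ₁, let χ ∈ C^∞(ℝ) with χ(s) = 1 for s ≤ 1 and χ(s) = 0 for s ≥ 2, let V be the smooth solution of problem (2.1) on [0,τ₀), and with q = r − t, ω = x/r, τ = ε√(1+t), set u_a(t,x) = ε χ(εt) w₀(t,x) + (ε/√r)(1 − χ(εt)) χ(−3εq) V(q,ω,τ) and J_a = Σ_{i,j=0}^2 g_ij(u_a, ∇u_a) ∂_{ij}u_a. Then for every b with 0 < b < τ₀ and every product Z^α of Klainerman vector fields there is a constant C_{α,b} such that for all sufficiently small ε > 0, ∫_0^{b²/ε²−1} ‖Z^α J_a(t,·)‖_{L²(ℝ²)} dt ≤ C_{α,b} ε^{3/2}. -/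

import Mathlib

open Real MeasureTheory Filter Topology Asymptotics

noncomputable section

/-- Partial derivative in the `i`-th coordinate direction on `Fin 3 → ℝ`
(coordinates `y = (t, x₁, x₂)`). -/
def pd (i : Fin 3) (f : (Fin 3 → ℝ) → ℝ) : (Fin 3 → ℝ) → ℝ :=
  fun y => fderiv ℝ f y (Pi.single i 1)

/-- Radon transform of `v : ℝ² → ℝ` over the line `x · ω = s`, where
`ω = (cos θ, sin θ)`. -/
def radon (v : ℝ × ℝ → ℝ) (s θ : ℝ) : ℝ :=
  ∫ t : ℝ, v (s * Real.cos θ - t * Real.sin θ, s * Real.sin θ + t * Real.cos θ)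

/-- `ω̂ = (-1, cos θ, sin θ)`. -/
def omegaHat (θ : ℝ) : Fin 3 → ℝ := ![(-1 : ℝ), Real.cos θ, Real.sin θ]

/-- The Friedlander radiation field `F₀` associated with the data `(φ₀, φ₁)`. -/
def F0 (φ0 φ1 : ℝ × ℝ → ℝ) (σ θ : ℝ) : ℝ :=
  (1 / (2 * Real.pi * Real.sqrt 2)) *
    ∫ s in Set.Ioi σ,
      (radon φ1 s θ - deriv (fun s' => radon φ0 s' θ) s) / Real.sqrt (s - σ)

/-- `F₁(σ,θ) = (Σ d_ij ω̂_i ω̂_j) ∂_σ F₀(σ,θ)`. -/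
def F1 (d : Fin 3 → Fin 3 → ℝ) (φ0 φ1 : ℝ × ℝ → ℝ) (σ θ : ℝ) : ℝ :=
  (∑ i : Fin 3, ∑ j : Fin 3, d i j * omegaHat θ i * omegaHat θ j) *
    deriv (fun σ' => F0 φ0 φ1 σ' θ) σ

/-- `F₂(σ,θ) = (Σ e_ij^k ω̂_i ω̂_j ω̂_k) ∂²_σ F₀(σ,θ)`. -/
def F2 (e : Fin 3 → Fin 3 → Fin 3 → ℝ) (φ0 φ1 : ℝ × ℝ → ℝ) (σ θ : ℝ) : ℝ :=
  (∑ i : Fin 3, ∑ j : Fin 3, ∑ k : Fin 3,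
      e i j k * omegaHat θ i * omegaHat θ j * omegaHat θ k) *
    deriv (fun σ' => deriv (fun σ'' => F0 φ0 φ1 σ'' θ) σ') σ

/-- `G₀(σ,θ) = (1/F₁) log(1 + F₁/F₂)`. -/
def G0 (d : Fin 3 → Fin 3 → ℝ) (e : Fin 3 → Fin 3 → Fin 3 → ℝ)
    (φ0 φ1 : ℝ × ℝ → ℝ) (σ θ : ℝ) : ℝ :=
  (1 / F1 d φ0 φ1 σ θ) * Real.log (1 + F1 d φ0 φ1 σ θ / F2 e φ0 φ1 σ θ)

/-- The set `A`. -/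
def setA (M : ℝ) (d : Fin 3 → Fin 3 → ℝ) (e : Fin 3 → Fin 3 → Fin 3 → ℝ)
    (φ0 φ1 : ℝ × ℝ → ℝ) : Set (ℝ × ℝ) :=
  {p | p.1 < M ∧ p.2 ∈ Set.Icc 0 (2 * Real.pi) ∧
    F1 d φ0 φ1 p.1 p.2 ≠ 0 ∧ F2 e φ0 φ1 p.1 p.2 ≠ 0 ∧
    0 < 1 + F1 d φ0 φ1 p.1 p.2 / F2 e φ0 φ1 p.1 p.2}

/-- The set `B = {(σ,θ) ∈ A : G₀(σ,θ) > 0}`. -/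
def setB (M : ℝ) (d : Fin 3 → Fin 3 → ℝ) (e : Fin 3 → Fin 3 → Fin 3 → ℝ)
    (φ0 φ1 : ℝ × ℝ → ℝ) : Set (ℝ × ℝ) :=
  {p ∈ setA M d e φ0 φ1 | 0 < G0 d e φ0 φ1 p.1 p.2}

/-- `τ₀ = inf_{(σ,θ) ∈ B} G₀(σ,θ)`. -/
def tau0 (M : ℝ) (d : Fin 3 → Fin 3 → ℝ) (e : Fin 3 → Fin 3 → Fin 3 → ℝ)
    (φ0 φ1 : ℝ × ℝ → ℝ) : ℝ :=
  sInf ((fun p : ℝ × ℝ => G0 d e φ0 φ1 p.1 p.2) '' setB M d e φ0 φ1)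

/-- The set `D = {(σ,θ) : σ < M, F₁ = 0, F₂ > 0}`. -/
def setD (M : ℝ) (d : Fin 3 → Fin 3 → ℝ) (e : Fin 3 → Fin 3 → Fin 3 → ℝ)
    (φ0 φ1 : ℝ × ℝ → ℝ) : Set (ℝ × ℝ) :=
  {p | p.1 < M ∧ p.2 ∈ Set.Icc 0 (2 * Real.pi) ∧
    F1 d φ0 φ1 p.1 p.2 = 0 ∧ 0 < F2 e φ0 φ1 p.1 p.2}

/-- `φ` is supported in the closed disk of radius `M` centered at the origin. -/
def SuppIn (M : ℝ) (φ : ℝ × ℝ → ℝ) : Prop :=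
  ∀ x : ℝ × ℝ, M ^ 2 < x.1 ^ 2 + x.2 ^ 2 → φ x = 0

/-- The cubic form `Σ e_ij^k ξ_i ξ_j ξ_k` does not satisfy the null condition:
it does not vanish identically on the light cone. -/
def NullCondFails (e : Fin 3 → Fin 3 → Fin 3 → ℝ) : Prop :=
  ∃ ξ : Fin 3 → ℝ, ξ 0 ^ 2 = ξ 1 ^ 2 + ξ 2 ^ 2 ∧ (ξ 1 ≠ 0 ∨ ξ 2 ≠ 0) ∧
    (∑ i : Fin 3, ∑ j : Fin 3, ∑ k : Fin 3, e i j k * ξ i * ξ j * ξ k) ≠ 0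

/-- Hessian (as a 2×2 matrix) of a function of two real variables. -/
def hessCurried (f : ℝ → ℝ → ℝ) (σ θ : ℝ) : Matrix (Fin 2) (Fin 2) ℝ :=
  !![deriv (fun a => deriv (fun b => f b θ) a) σ,
     deriv (fun a => deriv (fun b => f a b) θ) σ;
     deriv (fun b => deriv (fun a => f a b) σ) θ,
     deriv (fun b => deriv (fun b' => f σ b') b) θ]

/-- Minkowski coefficients: `Σ c_ij ∂_ij = ∂_t² - Δ`. -/
def cMink : Fin 3 → Fin 3 → ℝ := fun i j =>
  if i = j then (if i = 0 then 1 else -1) else 0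

/-- `u` is a `C^∞` solution of problem (1.1) on `[0,T) × ℝ²`. -/
def IsSol (g : Fin 3 → Fin 3 → ℝ → (Fin 3 → ℝ) → ℝ) (ε : ℝ)
    (φ0 φ1 : ℝ × ℝ → ℝ) (u : (Fin 3 → ℝ) → ℝ) (T : ℝ) : Prop :=
  ContDiffOn ℝ (⊤ : ℕ∞) u {y | 0 ≤ y 0 ∧ y 0 < T} ∧
  (∀ y : Fin 3 → ℝ, 0 ≤ y 0 → y 0 < T →
    ∑ i : Fin 3, ∑ j : Fin 3,
      g i j (u y) (fun k => pd k u y) * pd i (pd j u) y = 0) ∧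
  (∀ x : ℝ × ℝ, u ![0, x.1, x.2] = ε * φ0 x ∧ pd 0 u ![0, x.1, x.2] = ε * φ1 x)

/-- The lifespan `T_ε`: the supremum of times of existence of smooth solutions. -/
def lifespan (g : Fin 3 → Fin 3 → ℝ → (Fin 3 → ℝ) → ℝ) (ε : ℝ)
    (φ0 φ1 : ℝ × ℝ → ℝ) : ℝ :=
  sSup {T : ℝ | ∃ u, IsSol g ε φ0 φ1 u T}

/-- `V` is a `C^∞` solution of the profile problem (2.1) on `ℝ × S¹ × [0, τmax)`. -/
def IsProfileSol (M : ℝ) (d : Fin 3 → Fin 3 → ℝ) (e : Fin 3 → Fin 3 → Fin 3 → ℝ)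
    (φ0 φ1 : ℝ × ℝ → ℝ) (τmax : ℝ) (V : ℝ → ℝ → ℝ → ℝ) : Prop :=
  ContDiffOn ℝ (⊤ : ℕ∞) (fun p : ℝ × ℝ × ℝ => V p.1 p.2.1 p.2.2)
    {p : ℝ × ℝ × ℝ | 0 ≤ p.2.2 ∧ p.2.2 < τmax} ∧
  (∀ q θ τ : ℝ, V q (θ + 2 * Real.pi) τ = V q θ τ) ∧
  (∀ q θ τ : ℝ, M < q → V q θ τ = 0) ∧
  (∀ q θ : ℝ, V q θ 0 = F0 φ0 φ1 q θ) ∧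
  (∀ q θ τ : ℝ, 0 ≤ τ → τ < τmax →
    deriv (fun τ' => deriv (fun q' => V q' θ τ') q) τ -
      ∑ i : Fin 3, ∑ j : Fin 3,
        (d i j * V q θ τ +
          ∑ k : Fin 3, e i j k * omegaHat θ k * deriv (fun q' => V q' θ τ) q) *
        omegaHat θ i * omegaHat θ j *
        deriv (fun q' => deriv (fun q'' => V q'' θ τ) q') q = 0)

/-- The Jacobian `∂_s q` of the characteristic flow. -/
def kfun (d : Fin 3 → Fin 3 → ℝ) (e : Fin 3 → Fin 3 → Fin 3 → ℝ)
    (φ0 φ1 : ℝ × ℝ → ℝ) (ρ θ τ : ℝ) : ℝ :=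
  if F1 d φ0 φ1 ρ θ = 0 then 1 - τ * F2 e φ0 φ1 ρ θ
  else Real.exp (-τ * F1 d φ0 φ1 ρ θ) * (1 + F2 e φ0 φ1 ρ θ / F1 d φ0 φ1 ρ θ)
        - F2 e φ0 φ1 ρ θ / F1 d φ0 φ1 ρ θ

/-- Partial derivatives on `ℝ × ℝ × ℝ` (coordinates `(s, θ, τ)`). -/
def pd3 : Fin 3 → (ℝ × ℝ × ℝ → ℝ) → ℝ × ℝ × ℝ → ℝ :=
  ![fun f p => deriv (fun a => f (a, p.2.1, p.2.2)) p.1,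
    fun f p => deriv (fun a => f (p.1, a, p.2.2)) p.2.1,
    fun f p => deriv (fun a => f (p.1, p.2.1, a)) p.2.2]

/-- Hessian in the first two variables `(s, θ)` of a function on `ℝ × ℝ × ℝ`. -/
def hessST (f : ℝ × ℝ × ℝ → ℝ) (p : ℝ × ℝ × ℝ) : Matrix (Fin 2) (Fin 2) ℝ :=
  !![pd3 0 (pd3 0 f) p, pd3 0 (pd3 1 f) p;
     pd3 1 (pd3 0 f) p, pd3 1 (pd3 1 f) p]

/-- The Klainerman vector fields on `ℝ_t × ℝ²`:
`∂_t, ∂_1, ∂_2, S = t∂_t + x₁∂_1 + x₂∂_2, H₁, H₂, R`. -/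
def KOp : Fin 7 → ((Fin 3 → ℝ) → ℝ) → (Fin 3 → ℝ) → ℝ :=
  ![fun f => pd 0 f,
    fun f => pd 1 f,
    fun f => pd 2 f,
    fun f y => y 0 * pd 0 f y + y 1 * pd 1 f y + y 2 * pd 2 f y,
    fun f y => y 1 * pd 0 f y + y 0 * pd 1 f y,
    fun f y => y 2 * pd 0 f y + y 0 * pd 2 f y,
    fun f y => y 1 * pd 2 f y - y 2 * pd 1 f y]

/-- `Z^α`: iterated product of Klainerman vector fields indexed by a list. -/
def Zpow (α : List (Fin 7)) (f : (Fin 3 → ℝ) → ℝ) : (Fin 3 → ℝ) → ℝ :=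
  α.foldr (fun i acc => KOp i acc) f

end
open scoped ContDiff
set_option linter.unusedVariables false
set_option linter.unusedSimpArgs false

noncomputable section

/-! ### Symbol classes -/

abbrev R3 := Fin 3 → ℝ

/-- Derivative along a vector field. -/
def Dv (v : R3 → R3) (f : R3 → ℝ) : R3 → ℝ := fun p => fderiv ℝ f p (v p)

/-- Vector fields together with a family of open domains. -/
structure Geo (ι : Type) where
  v : ι → R3 → R3
  D : ℝ → Set R3
  hv : ∀ i, ContDiff ℝ ∞ (v i)
  hD : ∀ a, IsOpen (D a)

variable {ι κ : Type} {G : Geo ι}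

def SymN (G : Geo ι) : ℕ → (ℝ → R3 → ℝ) → (ℝ → R3 → ℝ) → Prop
  | 0, w, f => (∀ a, ContDiffOn ℝ ∞ (f a) (G.D a)) ∧
      ∃ C, 0 ≤ C ∧ ∀ a, ∀ p ∈ G.D a, |f a p| ≤ C * w a p
  | n + 1, w, f => ((∀ a, ContDiffOn ℝ ∞ (f a) (G.D a)) ∧
      ∃ C, 0 ≤ C ∧ ∀ a, ∀ p ∈ G.D a, |f a p| ≤ C * w a p) ∧
      ∀ i, SymN G n w (fun a => Dv (G.v i) (f a))

def Smb (G : Geo ι) (w f : ℝ → R3 → ℝ) : Prop := ∀ n, SymN G n w f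

theorem SymN.zero {n} {w f : ℝ → R3 → ℝ} (h : SymN G n w f) : SymN G 0 w f := by
  cases n with
  | zero => exact h
  | succ n => exact h.1

theorem SymN.smooth {n} {w f : ℝ → R3 → ℝ} (h : SymN G n w f) (a : ℝ) :
    ContDiffOn ℝ ∞ (f a) (G.D a) := h.zero.1 a

theorem SymN.bound {n} {w f : ℝ → R3 → ℝ} (h : SymN G n w f) :
    ∃ C, 0 ≤ C ∧ ∀ a, ∀ p ∈ G.D a, |f a p| ≤ C * w a p := h.zero.2

theorem SymN.at {n} {w f : ℝ → R3 → ℝ} (h : SymN G n w f) {a : ℝ} {p : R3} (hp : p ∈ G.D a) :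
    ContDiffAt ℝ ∞ (f a) p := (h.smooth a).contDiffAt ((G.hD a).mem_nhds hp)

theorem SymN.diffAt {n} {w f : ℝ → R3 → ℝ} (h : SymN G n w f) {a : ℝ} {p : R3}
    (hp : p ∈ G.D a) : DifferentiableAt ℝ (f a) p :=
  (h.at hp).differentiableAt (by simp)

theorem SymN.pred {n} {w f : ℝ → R3 → ℝ} (h : SymN G (n+1) w f) : SymN G n w f := by
  induction n generalizing f with
  | zero => exact h.1
  | succ n ih => exact ⟨h.1, fun i => ih (h.2 i)⟩

theorem SymN.mk_succ {n} {w f : ℝ → R3 → ℝ} (h : SymN G 0 w f)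
    (h2 : ∀ i, SymN G n w (fun a => Dv (G.v i) (f a))) : SymN G (n+1) w f := ⟨h, h2⟩


theorem SymN.congr {n} {w f f' : ℝ → R3 → ℝ} (h : SymN G n w f)
    (hE : ∀ a, ∀ p ∈ G.D a, f' a p = f a p) : SymN G n w f' := by
  induction n generalizing f f' with
  | zero =>
    refine ⟨fun a => (h.1 a).congr (hE a), ?_⟩
    obtain ⟨C, h0, hC⟩ := h.2
    exact ⟨C, h0, fun a p hp => by rw [hE a p hp]; exact hC a p hp⟩
  | succ n ih =>
    refine ⟨⟨fun a => (h.1.1 a).congr (hE a), ?_⟩, fun i => ih (h.2 i) ?_⟩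
    · obtain ⟨C, h0, hC⟩ := h.1.2
      exact ⟨C, h0, fun a p hp => by rw [hE a p hp]; exact hC a p hp⟩
    · intro a p hp
      have : f' a =ᶠ[𝓝 p] f a := by
        filter_upwards [(G.hD a).mem_nhds hp] with x hx using hE a x hx
      simp only [Dv]; rw [this.fderiv_eq]

theorem SymN.mono {n} {w w' f : ℝ → R3 → ℝ} (h : SymN G n w f) {K : ℝ} (hK : 0 ≤ K)
    (hw : ∀ a, ∀ p ∈ G.D a, w a p ≤ K * w' a p) : SymN G n w' f := by
  have key : ∀ f : ℝ → R3 → ℝ, SymN G 0 w f → SymN G 0 w' f := by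
    intro f h
    refine ⟨h.1, ?_⟩
    obtain ⟨C, h0, hC⟩ := h.2
    refine ⟨C * K, by positivity, fun a p hp => (hC a p hp).trans ?_⟩
    rw [mul_assoc]; exact mul_le_mul_of_nonneg_left (hw a p hp) h0
  induction n generalizing f with
  | zero => exact key f h
  | succ n ih => exact ⟨key f h.1, fun i => ih (h.2 i)⟩

theorem SymN.add {n} {w f g : ℝ → R3 → ℝ} (h : SymN G n w f) (h' : SymN G n w g) :
    SymN G n w (fun a p => f a p + g a p) := by
  have key : ∀ {f g : ℝ → R3 → ℝ}, SymN G 0 w f → SymN G 0 w g →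
      SymN G 0 w (fun a p => f a p + g a p) := by
    intro f g h h'
    refine ⟨fun a => (h.1 a).add (h'.1 a), ?_⟩
    obtain ⟨C, h0, hC⟩ := h.2
    obtain ⟨C', h0', hC'⟩ := h'.2
    refine ⟨C + C', by positivity, fun a p hp => (abs_add_le _ _).trans ?_⟩
    rw [add_mul]; exact add_le_add (hC a p hp) (hC' a p hp)
  induction n generalizing f g with
  | zero => exact key h h'
  | succ n ih =>
    refine ⟨key h.1 h'.1, fun i => (ih (h.2 i) (h'.2 i)).congr ?_⟩
    intro a p hp
    simp only [Dv]
    rw [fderiv_fun_add (h.diffAt hp) (h'.diffAt hp)]; rfl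

theorem SymN.mul {n} {w w' f g : ℝ → R3 → ℝ} (h : SymN G n w f) (h' : SymN G n w' g) :
    SymN G n (fun a p => w a p * w' a p) (fun a p => f a p * g a p) := by
  have key : ∀ {f g : ℝ → R3 → ℝ}, SymN G 0 w f → SymN G 0 w' g →
      SymN G 0 (fun a p => w a p * w' a p) (fun a p => f a p * g a p) := by
    intro f g h h'
    refine ⟨fun a => (h.1 a).mul (h'.1 a), ?_⟩
    obtain ⟨C, h0, hC⟩ := h.2
    obtain ⟨C', h0', hC'⟩ := h'.2
    refine ⟨C * C', by positivity, fun a p hp => ?_⟩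
    rw [abs_mul]
    calc |f a p| * |g a p| ≤ (C * w a p) * (C' * w' a p) :=
          mul_le_mul (hC a p hp) (hC' a p hp) (abs_nonneg _)
            ((abs_nonneg _).trans (hC a p hp))
      _ = _ := by ring
  induction n generalizing f g with
  | zero => exact key h h'
  | succ n ih =>
    refine ⟨key h.1 h'.1, fun i => ((ih (h.2 i) h'.pred).add (ih h.pred (h'.2 i))).congr ?_⟩
    intro a p hp
    simp only [Dv]
    rw [fderiv_fun_mul (h.diffAt hp) (h'.diffAt hp)]
    simp; ring

theorem SymN.const {n} (c : ℝ → ℝ) : SymN G n (fun a _ => |c a|) (fun a _ => c a) := by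
  have zero : ∀ n, SymN G n (fun a _ => |c a|) (fun _ _ => 0) := by
    intro n
    have k0 : SymN G 0 (fun a _ => |c a|) (fun _ _ => (0:ℝ)) :=
      ⟨fun a => contDiffOn_const, 0, le_rfl, fun a p hp => by simp⟩
    induction n with
    | zero => exact k0
    | succ n ih => exact ⟨k0, fun i => ih.congr (fun a p hp => by simp [Dv])⟩
  have k0 : SymN G 0 (fun a _ => |c a|) (fun a _ => c a) :=
    ⟨fun a => contDiffOn_const, 1, zero_le_one, fun a p hp => by simp⟩
  cases n with
  | zero => exact k0
  | succ n => exact ⟨k0, fun i => (zero n).congr (fun a p hp => by simp [Dv])⟩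

theorem SymN.one {n} (c : ℝ) : SymN G n (fun _ _ => 1) (fun _ _ => c) :=
  (SymN.const (fun _ => c)).mono (abs_nonneg c) (fun a p _ => by simp)

theorem SymN.one_mul {n} {w f g : ℝ → R3 → ℝ} (h : SymN G n (fun _ _ => 1) f)
    (h' : SymN G n w g) : SymN G n w (fun a p => f a p * g a p) :=
  (h.mul h').mono zero_le_one (fun a p _ => by simp)

theorem SymN.const_mul {n} {w f : ℝ → R3 → ℝ} (h : SymN G n w f) (c : ℝ) :
    SymN G n w (fun a p => c * f a p) := (SymN.one c).one_mul h

theorem SymN.neg {n} {w f : ℝ → R3 → ℝ} (h : SymN G n w f) :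
    SymN G n w (fun a p => - f a p) :=
  (h.const_mul (-1)).congr (fun a p _ => by ring)

theorem SymN.sub {n} {w f g : ℝ → R3 → ℝ} (h : SymN G n w f) (h' : SymN G n w g) :
    SymN G n w (fun a p => f a p - g a p) :=
  (h.add h'.neg).congr (fun a p _ => by ring)

theorem SymN.zero_mem {n} {w : ℝ → R3 → ℝ} (hw : ∀ a, ∀ p ∈ G.D a, 0 ≤ w a p) :
    SymN G n w (fun _ _ => 0) :=
  (SymN.const (fun _ => 0)).mono zero_le_one (fun a p hp => by simpa using hw a p hp)

theorem SymN.weight_nonneg {n} {w f : ℝ → R3 → ℝ} (h : SymN G n w f) :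
    SymN G n w (fun _ _ => 0) := by
  exact (h.const_mul 0).congr (fun a p _ => by ring)

theorem SymN.sum {n} {w : ℝ → R3 → ℝ} (hw : ∀ a, ∀ p ∈ G.D a, 0 ≤ w a p) {J : Type*}
    (s : Finset J) {f : J → ℝ → R3 → ℝ}
    (h : ∀ j ∈ s, SymN G n w (f j)) : SymN G n w (fun a p => ∑ j ∈ s, f j a p) := by
  classical
  induction s using Finset.induction_on with
  | empty => simpa using SymN.zero_mem hw
  | insert j s hj ih =>
    refine ((h j (by simp)).add (ih fun k hk => h k (by simp [hk]))).congr ?_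
    intro a p hp; rw [Finset.sum_insert hj]

theorem SymN.fsum {n} {w : ℝ → R3 → ℝ} {m : ℕ} {f : Fin (m+1) → ℝ → R3 → ℝ}
    (h : ∀ j, SymN G n w (f j)) : SymN G n w (fun a p => ∑ j, f j a p) := by
  induction m with
  | zero => simpa using h 0
  | succ m ih =>
    refine ((h 0).add (ih (fun j => h j.succ))).congr ?_
    intro a p _; rw [Fin.sum_univ_succ]

theorem SymN.inv {n} {w f : ℝ → R3 → ℝ} (h : SymN G n w f) {c : ℝ} (hc : 0 < c)
    (hw : ∀ a, ∀ p ∈ G.D a, 0 < w a p ∧ c * w a p ≤ f a p) :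
    SymN G n (fun a p => (w a p)⁻¹) (fun a p => (f a p)⁻¹) := by
  have hpos : ∀ a, ∀ p ∈ G.D a, 0 < f a p := fun a p hp =>
    lt_of_lt_of_le (mul_pos hc (hw a p hp).1) (hw a p hp).2
  have k0 : SymN G 0 (fun a p => (w a p)⁻¹) (fun a p => (f a p)⁻¹) := by
    refine ⟨fun a => (h.smooth a).inv (fun p hp => (hpos a p hp).ne'), c⁻¹, by positivity,
      fun a p hp => ?_⟩
    rw [abs_of_pos (inv_pos.2 (hpos a p hp)), ← mul_inv]
    exact inv_anti₀ (mul_pos hc (hw a p hp).1) (hw a p hp).2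
  induction n with
  | zero => exact k0
  | succ n ih =>
    refine ⟨k0, fun i => ?_⟩
    have hi := ih h.pred
    refine ((((h.2 i).mul hi).mul hi).neg.mono zero_le_one ?_).congr ?_
    · intro a p hp
      have := (hw a p hp).1
      apply le_of_eq; field_simp
    · intro a p hp
      simp only [Dv]
      have := ((hasDerivAt_inv (hpos a p hp).ne').comp_hasFDerivAt p (h.diffAt hp).hasFDerivAt).fderiv
      simp only [Function.comp_def] at this
      rw [this]; simp
      have := (hpos a p hp).ne'
      field_simp

theorem SymN.sqrt {n} {w f : ℝ → R3 → ℝ} (h : SymN G n w f) {c : ℝ} (hc : 0 < c)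
    (hw : ∀ a, ∀ p ∈ G.D a, 0 < w a p ∧ c * w a p ≤ f a p) :
    SymN G n (fun a p => √(w a p)) (fun a p => √(f a p)) := by
  have hpos : ∀ a, ∀ p ∈ G.D a, 0 < f a p := fun a p hp =>
    lt_of_lt_of_le (mul_pos hc (hw a p hp).1) (hw a p hp).2
  have k0 : SymN G 0 (fun a p => √(w a p)) (fun a p => √(f a p)) := by
    obtain ⟨C, h0, hC⟩ := h.bound
    refine ⟨fun a => (h.smooth a).sqrt (fun p hp => (hpos a p hp).ne'), √C, by positivity,
      fun a p hp => ?_⟩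
    rw [abs_of_nonneg (Real.sqrt_nonneg _), ← Real.sqrt_mul h0]
    exact Real.sqrt_le_sqrt ((le_abs_self _).trans (hC a p hp))
  induction n with
  | zero => exact k0
  | succ n ih =>
    refine ⟨k0, fun i => ?_⟩
    have hi := ih h.pred
    refine ((((h.2 i).mul (h.pred.inv hc hw)).mul hi).const_mul (1/2) |>.mono zero_le_one ?_).congr ?_
    · intro a p hp
      have := (hw a p hp).1
      apply le_of_eq; field_simp
    · intro a p hp
      simp only [Dv]
      have := ((h.diffAt hp).hasFDerivAt.sqrt (hpos a p hp).ne').fderiv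
      rw [this]; simp
      have h1 := (hpos a p hp)
      have h2 : √(f a p) ≠ 0 := (Real.sqrt_pos.2 h1).ne'
      have h3 := Real.sq_sqrt h1.le
      field_simp
      rw [h3]; ring

/-! Restricting the domain -/
theorem SymN.restrict {n} {w f : ℝ → R3 → ℝ} (h : SymN G n w f) (G' : Geo ι) (hv : G'.v = G.v)
    (hD : ∀ a, G'.D a ⊆ G.D a) : SymN G' n w f := by
  have key : ∀ f : ℝ → R3 → ℝ, SymN G 0 w f → SymN G' 0 w f := by
    intro f h
    obtain ⟨C, h0, hC⟩ := h.2
    exact ⟨fun a => (h.1 a).mono (hD a), C, h0, fun a p hp => hC a p (hD a hp)⟩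
  induction n generalizing f with
  | zero => exact key f h
  | succ n ih => exact ⟨key f h.1, fun i => by rw [hv]; exact ih (h.2 i)⟩

/-! Symbol level -/
theorem Smb.deriv {w f : ℝ → R3 → ℝ} (h : Smb G w f) (i : ι) :
    Smb G w (fun a => Dv (G.v i) (f a)) := fun n => (h (n+1)).2 i
theorem Smb.congr {w f f' : ℝ → R3 → ℝ} (h : Smb G w f)
    (hE : ∀ a, ∀ p ∈ G.D a, f' a p = f a p) : Smb G w f' := fun n => (h n).congr hE
theorem Smb.mono {w w' f : ℝ → R3 → ℝ} (h : Smb G w f) {K : ℝ} (hK : 0 ≤ K)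
    (hw : ∀ a, ∀ p ∈ G.D a, w a p ≤ K * w' a p) : Smb G w' f := fun n => (h n).mono hK hw
theorem Smb.wcongr {w w' f : ℝ → R3 → ℝ} (h : Smb G w f)
    (hw : ∀ a, ∀ p ∈ G.D a, w a p = w' a p) : Smb G w' f :=
  h.mono zero_le_one (fun a p hp => by rw [hw a p hp, one_mul])
theorem Smb.add {w f g : ℝ → R3 → ℝ} (h : Smb G w f) (h' : Smb G w g) :
    Smb G w (fun a p => f a p + g a p) := fun n => (h n).add (h' n)
theorem Smb.sub {w f g : ℝ → R3 → ℝ} (h : Smb G w f) (h' : Smb G w g) :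
    Smb G w (fun a p => f a p - g a p) := fun n => (h n).sub (h' n)
theorem Smb.neg {w f : ℝ → R3 → ℝ} (h : Smb G w f) :
    Smb G w (fun a p => - f a p) := fun n => (h n).neg
theorem Smb.mul {w w' f g : ℝ → R3 → ℝ} (h : Smb G w f) (h' : Smb G w' g) :
    Smb G (fun a p => w a p * w' a p) (fun a p => f a p * g a p) := fun n => (h n).mul (h' n)
theorem Smb.one_mul {w f g : ℝ → R3 → ℝ} (h : Smb G (fun _ _ => 1) f) (h' : Smb G w g) :
    Smb G w (fun a p => f a p * g a p) := fun n => (h n).one_mul (h' n)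
theorem Smb.mul_one {w f g : ℝ → R3 → ℝ} (h' : Smb G w g) (h : Smb G (fun _ _ => 1) f) :
    Smb G w (fun a p => g a p * f a p) := (h.one_mul h').congr (fun a p _ => mul_comm _ _)
theorem Smb.const (c : ℝ → ℝ) : Smb G (fun a _ => |c a|) (fun a _ => c a) :=
  fun _ => SymN.const c
theorem Smb.one (c : ℝ) : Smb G (fun _ _ => 1) (fun _ _ => c) := fun _ => SymN.one c
theorem Smb.const_mul {w f : ℝ → R3 → ℝ} (h : Smb G w f) (c : ℝ) :
    Smb G w (fun a p => c * f a p) := fun n => (h n).const_mul c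
theorem Smb.fsum {w : ℝ → R3 → ℝ} {m : ℕ} {f : Fin (m+1) → ℝ → R3 → ℝ}
    (h : ∀ j, Smb G w (f j)) : Smb G w (fun a p => ∑ j, f j a p) :=
  fun n => SymN.fsum (fun j => h j n)
theorem Smb.inv {w f : ℝ → R3 → ℝ} (h : Smb G w f) {c : ℝ} (hc : 0 < c)
    (hw : ∀ a, ∀ p ∈ G.D a, 0 < w a p ∧ c * w a p ≤ f a p) :
    Smb G (fun a p => (w a p)⁻¹) (fun a p => (f a p)⁻¹) := fun n => (h n).inv hc hw
theorem Smb.sqrt {w f : ℝ → R3 → ℝ} (h : Smb G w f) {c : ℝ} (hc : 0 < c)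
    (hw : ∀ a, ∀ p ∈ G.D a, 0 < w a p ∧ c * w a p ≤ f a p) :
    Smb G (fun a p => √(w a p)) (fun a p => √(f a p)) := fun n => (h n).sqrt hc hw
theorem Smb.restrict {w f : ℝ → R3 → ℝ} (h : Smb G w f) (G' : Geo ι) (hv : G'.v = G.v)
    (hD : ∀ a, G'.D a ⊆ G.D a) : Smb G' w f := fun n => (h n).restrict G' hv hD
theorem Smb.bound {w f : ℝ → R3 → ℝ} (h : Smb G w f) :
    ∃ C, 0 ≤ C ∧ ∀ a, ∀ p ∈ G.D a, |f a p| ≤ C * w a p := (h 0).bound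
theorem Smb.smooth {w f : ℝ → R3 → ℝ} (h : Smb G w f) (a : ℝ) :
    ContDiffOn ℝ ∞ (f a) (G.D a) := (h 0).smooth a
theorem Smb.at {w f : ℝ → R3 → ℝ} (h : Smb G w f) {a : ℝ} {p : R3} (hp : p ∈ G.D a) :
    ContDiffAt ℝ ∞ (f a) p := (h 0).at hp
theorem Smb.diffAt {w f : ℝ → R3 → ℝ} (h : Smb G w f) {a : ℝ} {p : R3}
    (hp : p ∈ G.D a) : DifferentiableAt ℝ (f a) p := (h 0).diffAt hp


/-! Composition with smooth functions of several variables. -/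

theorem Dv_comp {m : ℕ} {f : Fin m → R3 → ℝ} {p : R3} (v : R3 → R3)
    (hf : ∀ k, DifferentiableAt ℝ (f k) p)
    {h : (Fin m → ℝ) → ℝ} (hh : DifferentiableAt ℝ h (fun k => f k p)) :
    Dv v (fun p => h (fun k => f k p)) p =
      ∑ k, fderiv ℝ h (fun k => f k p) (Pi.single k 1) * Dv v (f k) p := by
  simp only [Dv]
  have h1 : HasFDerivAt (fun p => (fun k => f k p)) (ContinuousLinearMap.pi
      (fun k => fderiv ℝ (f k) p)) p :=
    hasFDerivAt_pi.2 (fun k => (hf k).hasFDerivAt)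
  have h2 := hh.hasFDerivAt.comp p h1
  have h3 := h2.fderiv
  simp only [Function.comp_def] at h3
  rw [h3]
  simp only [ContinuousLinearMap.comp_apply]
  set L := fderiv ℝ h (fun k => f k p)
  have : (ContinuousLinearMap.pi (fun k => fderiv ℝ (f k) p)) (v p)
      = ∑ k, (fderiv ℝ (f k) p (v p)) • (Pi.single k (1:ℝ) : Fin m → ℝ) := by
    ext j
    simp [Finset.sum_apply, Pi.single_apply]
  rw [this, map_sum]
  simp [mul_comm]

theorem contDiff_pd {m : ℕ} {h : (Fin m → ℝ) → ℝ} (hh : ContDiff ℝ ∞ h) (k : Fin m) :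
    ContDiff ℝ ∞ (fun z => fderiv ℝ h z (Pi.single k 1)) :=
  (hh.fderiv_right (by simp)).clm_apply contDiff_const

theorem SymN.comp0 {n m : ℕ} {f : Fin m → ℝ → R3 → ℝ} (hf : ∀ k, SymN G n (fun _ _ => 1) (f k))
    {h : (Fin m → ℝ) → ℝ} (hh : ContDiff ℝ ∞ h) :
    SymN G n (fun _ _ => 1) (fun a p => h (fun k => f k a p)) := by
  have k0 : ∀ h : (Fin m → ℝ) → ℝ, ContDiff ℝ ∞ h → (∀ k, SymN G 0 (fun _ _ => 1) (f k)) →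
      SymN G 0 (fun _ _ => 1) (fun a p => h (fun k => f k a p)) := by
    intro h hh hf
    refine ⟨fun a => hh.comp_contDiffOn (contDiffOn_pi.2 fun k => (hf k).smooth a), ?_⟩
    choose C hC0 hC using fun k => (hf k).bound
    obtain ⟨B, hB⟩ := (isCompact_univ_pi (fun k => isCompact_Icc (a := -C k) (b := C k))
      ).exists_bound_of_continuousOn (f := h) hh.continuous.continuousOn
    refine ⟨|B|, abs_nonneg B, fun a p hp => ?_⟩
    have := hB (fun k => f k a p) (by
      intro k _
      have := hC k a p hp
      rw [mul_one] at this
      exact abs_le.1 this)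
    rw [Real.norm_eq_abs] at this
    simpa using this.trans (le_abs_self B)
  induction n generalizing h with
  | zero => exact k0 h hh hf
  | succ n ih =>
    refine ⟨k0 h hh (fun k => (hf k).zero), fun i => ?_⟩
    refine (SymN.sum (fun a p hp => zero_le_one) Finset.univ
      (f := fun k a p => fderiv ℝ h (fun k => f k a p) (Pi.single k 1) * Dv (G.v i) (f k a) p)
      (fun k _ => (ih (fun k => (hf k).pred) (contDiff_pd hh k)).one_mul ((hf k).2 i))).congr ?_
    intro a p hp
    exact Dv_comp _ (fun k => (hf k).diffAt hp) (hh.differentiable (by simp) _)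

theorem bound_of_isBigO {m j : ℕ} {h : (Fin m → ℝ) → ℝ} (hh : Continuous h)
    (hO : h =O[𝓝 0] fun z => ‖z‖ ^ j) (R : ℝ) :
    ∃ K, 0 ≤ K ∧ ∀ z, ‖z‖ ≤ R → |h z| ≤ K * ‖z‖ ^ j := by
  obtain ⟨c, hc⟩ := hO.bound
  obtain ⟨r, hr, hrc⟩ := Metric.eventually_nhds_iff.1 hc
  obtain ⟨B, hB⟩ := (isCompact_closedBall (0 : Fin m → ℝ) R).exists_bound_of_continuousOn
    hh.continuousOn
  refine ⟨|c| + |B| / r ^ j, by positivity, fun z hz => ?_⟩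
  rcases lt_or_ge ‖z‖ r with h1 | h1
  · have := hrc (y := z) (by simpa using h1)
    rw [norm_pow, norm_norm, Real.norm_eq_abs] at this
    have h9 : 0 ≤ ‖z‖ ^ j := by positivity
    refine this.trans (mul_le_mul_of_nonneg_right ?_ h9)
    have : 0 ≤ |B| / r ^ j := by positivity
    linarith [le_abs_self c]
  · have h2 := hB z (by simpa using hz)
    rw [Real.norm_eq_abs] at h2
    have h3 : r ^ j ≤ ‖z‖ ^ j := pow_le_pow_left₀ hr.le h1 j
    calc |h z| ≤ |B| := h2.trans (le_abs_self B)
      _ = |B| / r ^ j * r ^ j := by field_simp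
      _ ≤ |B| / r ^ j * ‖z‖ ^ j := by gcongr
      _ ≤ _ := by
        apply mul_le_mul_of_nonneg_right _ (by positivity)
        linarith [abs_nonneg c]

theorem symN_comp_base {m j : ℕ} {f : Fin m → ℝ → R3 → ℝ} {δ : ℝ → R3 → ℝ}
    (hδ : ∃ K, 0 ≤ K ∧ ∀ a, ∀ p ∈ G.D a, 0 ≤ δ a p ∧ δ a p ≤ K)
    (hf : ∀ k, SymN G 0 δ (f k)) {h : (Fin m → ℝ) → ℝ} (hh : ContDiff ℝ ∞ h)
    (hO : h =O[𝓝 0] fun z => ‖z‖ ^ j) :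
    SymN G 0 (fun a p => δ a p ^ j) (fun a p => h (fun k => f k a p)) := by
  refine ⟨fun a => hh.comp_contDiffOn (contDiffOn_pi.2 fun k => (hf k).smooth a), ?_⟩
  obtain ⟨K, hK0, hK⟩ := hδ
  choose C hC0 hC using fun k => (hf k).bound
  have hS : ∀ a, ∀ p ∈ G.D a, ‖(fun k => f k a p)‖ ≤ (∑ k, C k) * δ a p := by
    intro a p hp
    refine (pi_norm_le_iff_of_nonneg (mul_nonneg (Finset.sum_nonneg fun k _ => hC0 k)
      (hK a p hp).1)).2 fun k => ?_
    refine (hC k a p hp).trans (mul_le_mul_of_nonneg_right ?_ (hK a p hp).1)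
    exact Finset.single_le_sum (fun i _ => hC0 i) (Finset.mem_univ k)
  have hS0 : 0 ≤ ∑ k, C k := Finset.sum_nonneg fun k _ => hC0 k
  obtain ⟨B, hB0, hB⟩ := bound_of_isBigO hh.continuous hO ((∑ k, C k) * K)
  refine ⟨B * (∑ k, C k) ^ j, by positivity, fun a p hp => ?_⟩
  refine (hB _ ((hS a p hp).trans (mul_le_mul_of_nonneg_left (hK a p hp).2 hS0))).trans ?_
  rw [mul_assoc, ← mul_pow]
  exact mul_le_mul_of_nonneg_left (pow_le_pow_left₀ (norm_nonneg _) (hS a p hp) j) hB0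

theorem SymN.comp1 {n m : ℕ} {f : Fin m → ℝ → R3 → ℝ} {δ : ℝ → R3 → ℝ}
    (hδ : ∃ K, 0 ≤ K ∧ ∀ a, ∀ p ∈ G.D a, 0 ≤ δ a p ∧ δ a p ≤ K)
    (hf : ∀ k, SymN G n δ (f k)) {h : (Fin m → ℝ) → ℝ} (hh : ContDiff ℝ ∞ h) (h0 : h 0 = 0) :
    SymN G n δ (fun a p => h (fun k => f k a p)) := by
  have hO : h =O[𝓝 0] fun z => ‖z‖ ^ 1 := by
    have := (hh.differentiable (by simp) 0).isBigO_sub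
    simpa [h0] using this.norm_right
  have k0 := (symN_comp_base hδ (fun k => (hf k).zero) hh hO).mono zero_le_one (w' := δ)
    (by simp)
  have hf1 : ∀ k, SymN G n (fun _ _ => 1) (f k) := by
    obtain ⟨K, hK0, hK⟩ := hδ
    exact fun k => (hf k).mono hK0 (fun a p hp => by simpa using (hK a p hp).2)
  cases n with
  | zero => exact k0
  | succ n =>
    refine ⟨k0, fun i => ?_⟩
    refine (SymN.sum (fun a p hp => (hδ.choose_spec.2 a p hp).1) Finset.univ
      (f := fun k a p => fderiv ℝ h (fun k => f k a p) (Pi.single k 1) * Dv (G.v i) (f k a) p)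
      (fun k _ => (SymN.comp0 (fun k => (hf1 k).pred) (contDiff_pd hh k)).one_mul ((hf k).2 i))).congr ?_
    intro a p hp
    exact Dv_comp _ (fun k => (hf k).diffAt hp) (hh.differentiable (by simp) _)

theorem SymN.comp2 {n m : ℕ} {f : Fin m → ℝ → R3 → ℝ} {δ : ℝ → R3 → ℝ}
    (hδ : ∃ K, 0 ≤ K ∧ ∀ a, ∀ p ∈ G.D a, 0 ≤ δ a p ∧ δ a p ≤ K)
    (hf : ∀ k, SymN G n δ (f k)) {h : (Fin m → ℝ) → ℝ} (hh : ContDiff ℝ ∞ h)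
    (hO : h =O[𝓝 0] fun z => ‖z‖ ^ 2) :
    SymN G n (fun a p => δ a p ^ 2) (fun a p => h (fun k => f k a p)) := by
  have k0 := (symN_comp_base hδ (fun k => (hf k).zero) hh hO)
  have hd : fderiv ℝ h 0 = 0 := by
    have : HasFDerivAt h (0 : (Fin m → ℝ) →L[ℝ] ℝ) 0 := by
      refine Asymptotics.IsBigO.hasFDerivAt (n := 2) ?_ (by norm_num)
      simpa using hO
    exact this.fderiv
  cases n with
  | zero => exact k0
  | succ n =>
    refine ⟨k0, fun i => ?_⟩
    refine (SymN.sum (fun a p hp => by positivity) Finset.univ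
      (f := fun k a p => fderiv ℝ h (fun k => f k a p) (Pi.single k 1) * Dv (G.v i) (f k a) p)
      (fun k _ => ((SymN.comp1 hδ (fun k => (hf k).pred) (contDiff_pd hh k) (by simp [hd])).mul
        ((hf k).2 i)).mono zero_le_one (by intro a p _; rw [_root_.one_mul, sq]))).congr ?_
    intro a p hp
    exact Dv_comp _ (fun k => (hf k).diffAt hp) (hh.differentiable (by simp) _)

theorem Smb.comp0 {m : ℕ} {f : Fin m → ℝ → R3 → ℝ} (hf : ∀ k, Smb G (fun _ _ => 1) (f k))
    {h : (Fin m → ℝ) → ℝ} (hh : ContDiff ℝ ∞ h) :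
    Smb G (fun _ _ => 1) (fun a p => h (fun k => f k a p)) :=
  fun n => SymN.comp0 (fun k => hf k n) hh

theorem Smb.comp_one {f : ℝ → R3 → ℝ} (hf : Smb G (fun _ _ => 1) f)
    {h : ℝ → ℝ} (hh : ContDiff ℝ ∞ h) :
    Smb G (fun _ _ => 1) (fun a p => h (f a p)) :=
  Smb.comp0 (f := fun _ : Fin 1 => f) (h := fun z => h (z 0)) (fun _ => hf)
    (hh.comp (contDiff_apply ℝ ℝ 0))

theorem Smb.comp1 {m : ℕ} {f : Fin m → ℝ → R3 → ℝ} {δ : ℝ → R3 → ℝ}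
    (hδ : ∃ K, 0 ≤ K ∧ ∀ a, ∀ p ∈ G.D a, 0 ≤ δ a p ∧ δ a p ≤ K)
    (hf : ∀ k, Smb G δ (f k)) {h : (Fin m → ℝ) → ℝ} (hh : ContDiff ℝ ∞ h) (h0 : h 0 = 0) :
    Smb G δ (fun a p => h (fun k => f k a p)) := fun n => SymN.comp1 hδ (fun k => hf k n) hh h0

theorem Smb.comp2 {m : ℕ} {f : Fin m → ℝ → R3 → ℝ} {δ : ℝ → R3 → ℝ}
    (hδ : ∃ K, 0 ≤ K ∧ ∀ a, ∀ p ∈ G.D a, 0 ≤ δ a p ∧ δ a p ≤ K)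
    (hf : ∀ k, Smb G δ (f k)) {h : (Fin m → ℝ) → ℝ} (hh : ContDiff ℝ ∞ h)
    (hO : h =O[𝓝 0] fun z => ‖z‖ ^ 2) :
    Smb G (fun a p => δ a p ^ 2) (fun a p => h (fun k => f k a p)) :=
  fun n => SymN.comp2 hδ (fun k => hf k n) hh hO

end

noncomputable section

/-! ### Calculus of `pd`, solutions of the wave equation -/

theorem contDiff_pd3 {f : R3 → ℝ} (hf : ContDiff ℝ ∞ f) (i : Fin 3) : ContDiff ℝ ∞ (pd i f) :=
  contDiff_pd hf i

theorem pd_add' {f g : R3 → ℝ} {y : R3} (hf : DifferentiableAt ℝ f y)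
    (hg : DifferentiableAt ℝ g y) (i : Fin 3) :
    pd i (fun y => f y + g y) y = pd i f y + pd i g y := by
  simp only [pd]; rw [fderiv_fun_add hf hg]; rfl

theorem pd_sub' {f g : R3 → ℝ} {y : R3} (hf : DifferentiableAt ℝ f y)
    (hg : DifferentiableAt ℝ g y) (i : Fin 3) :
    pd i (fun y => f y - g y) y = pd i f y - pd i g y := by
  simp only [pd]; rw [fderiv_fun_sub hf hg]; rfl

theorem pd_mul' {f g : R3 → ℝ} {y : R3} (hf : DifferentiableAt ℝ f y)
    (hg : DifferentiableAt ℝ g y) (i : Fin 3) :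
    pd i (fun y => f y * g y) y = f y * pd i g y + pd i f y * g y := by
  simp only [pd]; rw [fderiv_fun_mul hf hg]; simp; ring

theorem pd_coord (i m : Fin 3) (y : R3) : pd i (fun y => y m) y = if m = i then 1 else 0 := by
  simp only [pd]
  have : HasFDerivAt (fun y : R3 => y m) (ContinuousLinearMap.proj (R := ℝ) (φ := fun _ : Fin 3 => ℝ) m) y :=
    (ContinuousLinearMap.proj (R := ℝ) (φ := fun _ : Fin 3 => ℝ) m).hasFDerivAt
  rw [this.fderiv]; simp [Pi.single_apply]

theorem diff_coord (m : Fin 3) (y : R3) : DifferentiableAt ℝ (fun y : R3 => y m) y :=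
  differentiableAt_apply m y

theorem contDiff_coord (m : Fin 3) : ContDiff ℝ ∞ (fun y : R3 => y m) := contDiff_apply ℝ ℝ m

theorem pd_cmul {g : R3 → ℝ} {y : R3} (hg : DifferentiableAt ℝ g y) (m i : Fin 3) :
    pd i (fun y => y m * g y) y = y m * pd i g y + (if m = i then 1 else 0) * g y := by
  rw [pd_mul' (diff_coord m y) hg, pd_coord]

theorem pd_comm_at {f : R3 → ℝ} {y : R3} (hf : ContDiffAt ℝ ∞ f y) (i j : Fin 3) :
    pd i (pd j f) y = pd j (pd i f) y := by
  have hs : IsSymmSndFDerivAt ℝ f y := hf.isSymmSndFDerivAt (by simp; exact WithTop.coe_le_coe.2 (le_top : (2:ℕ∞) ≤ ⊤))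
  have hd : DifferentiableAt ℝ (fderiv ℝ f) y :=
    (hf.fderiv_right (m := ∞) (by simp)).differentiableAt (by simp)
  have key : ∀ i j : Fin 3, pd i (pd j f) y
      = fderiv ℝ (fderiv ℝ f) y (Pi.single i 1) (Pi.single j 1) := by
    intro i j
    unfold pd
    rw [fderiv_clm_apply hd (differentiableAt_const _)]
    simp
  rw [key, key]; exact hs _ _

theorem pd_comm {f : R3 → ℝ} (hf : ContDiff ℝ ∞ f) (i j : Fin 3) :
    pd i (pd j f) = pd j (pd i f) := funext fun _ => pd_comm_at hf.contDiffAt i j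

theorem KOp_contDiff {f : R3 → ℝ} (hf : ContDiff ℝ ∞ f) (k : Fin 7) : ContDiff ℝ ∞ (KOp k f) := by
  have h := contDiff_pd3 hf
  have c := contDiff_coord
  fin_cases k <;> simp only [KOp]
  · exact h 0
  · exact h 1
  · exact h 2
  · exact (((c 0).mul (h 0)).add ((c 1).mul (h 1))).add ((c 2).mul (h 2))
  · exact ((c 1).mul (h 0)).add ((c 0).mul (h 1))
  · exact ((c 2).mul (h 0)).add ((c 0).mul (h 2))
  · exact ((c 1).mul (h 2)).sub ((c 2).mul (h 1))

structure IsW (M : ℝ) (w : R3 → ℝ) : Prop where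
  smooth : ContDiff ℝ ∞ w
  wave : ∀ y, pd 0 (pd 0 w) y - pd 1 (pd 1 w) y - pd 2 (pd 2 w) y = 0
  supp : ∀ y : R3, 0 ≤ y 0 → (M + y 0)^2 < y 1 ^ 2 + y 2 ^ 2 → w y = 0

theorem wave_pd {w : R3 → ℝ} (hw : ContDiff ℝ ∞ w)
    (hb : ∀ y, pd 0 (pd 0 w) y - pd 1 (pd 1 w) y - pd 2 (pd 2 w) y = 0) (i : Fin 3) (y : R3) :
    pd 0 (pd 0 (pd i w)) y - pd 1 (pd 1 (pd i w)) y - pd 2 (pd 2 (pd i w)) y = 0 := by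
  have e : ∀ j : Fin 3, pd j (pd j (pd i w)) = pd i (pd j (pd j w)) := by
    intro j
    rw [pd_comm hw j i, pd_comm (contDiff_pd3 hw j) j i]
  have hd : ∀ j : Fin 3, Differentiable ℝ (pd j (pd j w)) := fun j =>
    (contDiff_pd3 (contDiff_pd3 hw j) j).differentiable (by simp)
  rw [e, e, e, ← pd_sub' (hd 0 y) (hd 1 y), ← pd_sub' (f := fun y => pd 0 (pd 0 w) y - pd 1 (pd 1 w) y) ((hd 0 y).sub (hd 1 y)) (hd 2 y)]
  have : (fun y => pd 0 (pd 0 w) y - pd 1 (pd 1 w) y - pd 2 (pd 2 w) y) = fun _ => 0 := funext hb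
  rw [this]; simp [pd]

/-- second derivative of coordinate times function -/
theorem pd2_cmul {g : R3 → ℝ} (hg : ContDiff ℝ ∞ g) (m i : Fin 3) (y : R3) :
    pd i (pd i (fun y => y m * g y)) y
      = y m * pd i (pd i g) y + 2 * (if m = i then 1 else 0) * pd i g y := by
  have h1 : pd i (fun y => y m * g y) = fun y => y m * pd i g y + (if m = i then 1 else 0) * g y :=
    funext fun y => pd_cmul (hg.differentiable (by simp) y) m i
  have hd := contDiff_pd3 hg i
  rw [h1, pd_add' (((contDiff_coord m).mul hd).differentiable (by simp) y)
    ((contDiff_const.mul hg).differentiable (by simp) y), pd_cmul (hd.differentiable (by simp) y),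
    pd_mul' (differentiableAt_const _) (hg.differentiable (by simp) y)]
  simp only [pd]; split_ifs <;> simp <;> ring

theorem pd2_add {f g : R3 → ℝ} (hf : ContDiff ℝ ∞ f) (hg : ContDiff ℝ ∞ g) (i : Fin 3) (y : R3) :
    pd i (pd i (fun y => f y + g y)) y = pd i (pd i f) y + pd i (pd i g) y := by
  have h1 : pd i (fun y => f y + g y) = fun y => pd i f y + pd i g y :=
    funext fun y => pd_add' (hf.differentiable (by simp) y) (hg.differentiable (by simp) y) i
  rw [h1, pd_add' ((contDiff_pd3 hf i).differentiable (by simp) y)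
    ((contDiff_pd3 hg i).differentiable (by simp) y)]

theorem pd2_sub {f g : R3 → ℝ} (hf : ContDiff ℝ ∞ f) (hg : ContDiff ℝ ∞ g) (i : Fin 3) (y : R3) :
    pd i (pd i (fun y => f y - g y)) y = pd i (pd i f) y - pd i (pd i g) y := by
  have h1 : pd i (fun y => f y - g y) = fun y => pd i f y - pd i g y :=
    funext fun y => pd_sub' (hf.differentiable (by simp) y) (hg.differentiable (by simp) y) i
  rw [h1, pd_sub' ((contDiff_pd3 hf i).differentiable (by simp) y)
    ((contDiff_pd3 hg i).differentiable (by simp) y)]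

theorem wave_KOp {w : R3 → ℝ} (hw : ContDiff ℝ ∞ w)
    (hb : ∀ y, pd 0 (pd 0 w) y - pd 1 (pd 1 w) y - pd 2 (pd 2 w) y = 0) (k : Fin 7) (y : R3) :
    pd 0 (pd 0 (KOp k w)) y - pd 1 (pd 1 (KOp k w)) y - pd 2 (pd 2 (KOp k w)) y = 0 := by
  have h := contDiff_pd3 hw
  have c := contDiff_coord
  have cm : ∀ m i, ContDiff ℝ ∞ (fun y : R3 => y m * pd i w y) := fun m i => (c m).mul (h i)
  have b0 := wave_pd hw hb 0 y
  have b1 := wave_pd hw hb 1 y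
  have b2 := wave_pd hw hb 2 y
  have hb' := hb y
  have c01 := congrFun (pd_comm hw 0 1) y
  have c02 := congrFun (pd_comm hw 0 2) y
  have c12 := congrFun (pd_comm hw 1 2) y
  fin_cases k <;> simp only [KOp]
  · exact b0
  · exact b1
  · exact b2
  · change pd 0 (pd 0 (fun y => y 0 * pd 0 w y + y 1 * pd 1 w y + y 2 * pd 2 w y)) y - pd 1 (pd 1 (fun y => y 0 * pd 0 w y + y 1 * pd 1 w y + y 2 * pd 2 w y)) y - pd 2 (pd 2 (fun y => y 0 * pd 0 w y + y 1 * pd 1 w y + y 2 * pd 2 w y)) y = 0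
    have q : ∀ i, pd i (pd i (fun y => y 0 * pd 0 w y + y 1 * pd 1 w y + y 2 * pd 2 w y)) y
        = pd i (pd i (fun y => y 0 * pd 0 w y)) y + pd i (pd i (fun y => y 1 * pd 1 w y)) y
          + pd i (pd i (fun y => y 2 * pd 2 w y)) y := fun i => by
      rw [pd2_add ((cm 0 0).add (cm 1 1)) (cm 2 2), pd2_add (cm 0 0) (cm 1 1)]
    simp only [q, pd2_cmul (h _)]
    simp
    linear_combination y 0 * b0 + y 1 * b1 + y 2 * b2 + 2 * hb'
  · change pd 0 (pd 0 (fun y => y 1 * pd 0 w y + y 0 * pd 1 w y)) y - pd 1 (pd 1 (fun y => y 1 * pd 0 w y + y 0 * pd 1 w y)) y - pd 2 (pd 2 (fun y => y 1 * pd 0 w y + y 0 * pd 1 w y)) y = 0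
    have q : ∀ i, pd i (pd i (fun y => y 1 * pd 0 w y + y 0 * pd 1 w y)) y
        = pd i (pd i (fun y => y 1 * pd 0 w y)) y + pd i (pd i (fun y => y 0 * pd 1 w y)) y
           := fun i => by rw [pd2_add (cm 1 0) (cm 0 1)]
    simp only [q, pd2_cmul (h _)]
    simp
    linear_combination y 1 * b0 + y 0 * b1 + 2 * c01
  · change pd 0 (pd 0 (fun y => y 2 * pd 0 w y + y 0 * pd 2 w y)) y - pd 1 (pd 1 (fun y => y 2 * pd 0 w y + y 0 * pd 2 w y)) y - pd 2 (pd 2 (fun y => y 2 * pd 0 w y + y 0 * pd 2 w y)) y = 0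
    have q : ∀ i, pd i (pd i (fun y => y 2 * pd 0 w y + y 0 * pd 2 w y)) y
        = pd i (pd i (fun y => y 2 * pd 0 w y)) y + pd i (pd i (fun y => y 0 * pd 2 w y)) y
           := fun i => by rw [pd2_add (cm 2 0) (cm 0 2)]
    simp only [q, pd2_cmul (h _)]
    simp
    linear_combination y 2 * b0 + y 0 * b2 + 2 * c02
  · change pd 0 (pd 0 (fun y => y 1 * pd 2 w y - y 2 * pd 1 w y)) y - pd 1 (pd 1 (fun y => y 1 * pd 2 w y - y 2 * pd 1 w y)) y - pd 2 (pd 2 (fun y => y 1 * pd 2 w y - y 2 * pd 1 w y)) y = 0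
    have q : ∀ i, pd i (pd i (fun y => y 1 * pd 2 w y - y 2 * pd 1 w y)) y
        = pd i (pd i (fun y => y 1 * pd 2 w y)) y - pd i (pd i (fun y => y 2 * pd 1 w y)) y
           := fun i => by rw [pd2_sub (cm 1 2) (cm 2 1)]
    simp only [q, pd2_cmul (h _)]
    simp
    linear_combination y 1 * b2 - y 2 * b1 - 2 * c12

theorem IsW.fderiv_zero {M : ℝ} (hM : 0 < M) {w : R3 → ℝ} (h : IsW M w) {y : R3} (h0 : 0 ≤ y 0)
    (hy : (M + y 0)^2 < y 1 ^ 2 + y 2 ^ 2) : fderiv ℝ w y = 0 := by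
  have hop : IsOpen {z : R3 | 0 < z 0 ∧ (M + z 0)^2 < z 1 ^ 2 + z 2 ^ 2} := by
    have c := fun m : Fin 3 => (contDiff_coord m).continuous
    exact (isOpen_lt continuous_const (c 0)).inter (isOpen_lt ((continuous_const.add (c 0)).pow 2)
      (((c 1).pow 2).add ((c 2).pow 2)))
  have hz : ∀ z : R3, 0 < z 0 → (M + z 0)^2 < z 1 ^ 2 + z 2 ^ 2 → fderiv ℝ w z = 0 := by
    intro z h1 h2
    have : w =ᶠ[𝓝 z] fun _ => 0 := by
      filter_upwards [hop.mem_nhds ⟨h1, h2⟩] with x hx using h.supp x hx.1.le hx.2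
    rw [this.fderiv_eq]; simp
  have hc : Continuous (fderiv ℝ w) := h.smooth.continuous_fderiv (by simp)
  have hs : Tendsto (fun s : ℝ => fderiv ℝ w (y + s • (Pi.single 0 1 : R3))) (𝓝[>] 0) (𝓝 (fderiv ℝ w y)) := by
    have : Continuous (fun s : ℝ => fderiv ℝ w (y + s • (Pi.single 0 1 : R3))) := hc.comp (by fun_prop)
    have := (this.tendsto 0).mono_left (nhdsWithin_le_nhds (s := Set.Ioi 0))
    simpa using this
  have he : (fun s : ℝ => fderiv ℝ w (y + s • (Pi.single 0 1 : R3))) =ᶠ[𝓝[>] 0] fun _ => 0 := by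
    have h1 : ∀ᶠ s : ℝ in 𝓝 0, (M + (y 0 + s))^2 < y 1 ^ 2 + y 2 ^ 2 := by
      have hcc : Continuous (fun s : ℝ => (M + (y 0 + s))^2) := by fun_prop
      apply (hcc.tendsto 0).eventually_lt_const
      simpa using hy
    filter_upwards [h1.filter_mono nhdsWithin_le_nhds, self_mem_nhdsWithin] with s hs1 hs2
    have hs2' : (0:ℝ) < s := hs2
    apply hz
    · simp; linarith
    · simpa using hs1
  exact tendsto_nhds_unique (hs.congr' he) tendsto_const_nhds |>.symm ▸ rfl

theorem KOp_of_fderiv_zero {w : R3 → ℝ} {y : R3} (h : fderiv ℝ w y = 0) (k : Fin 7) :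
    KOp k w y = 0 := by
  fin_cases k <;> simp [KOp, pd, h]

theorem IsW.KOp {M : ℝ} (hM : 0 < M) {w : R3 → ℝ} (h : IsW M w) (k : Fin 7) : IsW M (KOp k w) where
  smooth := KOp_contDiff h.smooth k
  wave := wave_KOp h.smooth h.wave k
  supp := fun y h0 hy => KOp_of_fderiv_zero (h.fderiv_zero hM h0 hy) k

end

noncomputable section

/-! ### Representation formula for the wave equation in 2D -/

theorem hasDerivAt_curve {f : R3 → ℝ} {a b c : ℝ → ℝ} {a' b' c' s : ℝ}
    (hf : DifferentiableAt ℝ f ![a s, b s, c s])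
    (ha : HasDerivAt a a' s) (hb : HasDerivAt b b' s) (hc : HasDerivAt c c' s) :
    HasDerivAt (fun s => f ![a s, b s, c s])
      (pd 0 f ![a s, b s, c s] * a' + pd 1 f ![a s, b s, c s] * b'
        + pd 2 f ![a s, b s, c s] * c') s := by
  have h1 : HasDerivAt (fun s => (![a s, b s, c s] : R3)) ![a', b', c'] s := by
    rw [hasDerivAt_pi]
    intro i; fin_cases i
    · exact ha
    · exact hb
    · exact hc
  have h2 := hf.hasFDerivAt.comp_hasDerivAt s h1
  refine h2.congr_deriv ?_
  have : (![a', b', c'] : R3) = a' • (Pi.single 0 1 : R3) + b' • (Pi.single 1 1 : R3)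
      + c' • (Pi.single 2 1 : R3) := by
    ext i; fin_cases i <;> simp
  rw [this]
  simp only [map_add, map_smul, pd, smul_eq_mul]
  ring

theorem continuous_cart {X : Type*} [TopologicalSpace X] {f : R3 → ℝ} (hf : Continuous f)
    {a b c : X → ℝ} (ha : Continuous a) (hb : Continuous b) (hc : Continuous c) :
    Continuous (fun p => f ![a p, b p, c p]) := by
  apply hf.comp
  refine continuous_pi fun i => ?_
  fin_cases i
  · exact ha
  · exact hb
  · exact hc

theorem ii_swap {F : ℝ → ℝ → ℝ} (h : Continuous F.uncurry) (a b c d : ℝ) :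
    ∫ x in a..b, ∫ y in c..d, F x y = ∫ y in c..d, ∫ x in a..b, F x y := by
  apply intervalIntegral_intervalIntegral_swap
  apply (h.continuousOn.integrableOn_compact (isCompact_uIcc.prod isCompact_uIcc)).mono_set
    (Set.prod_mono Set.uIoc_subset_uIcc Set.uIoc_subset_uIcc)

theorem ii_zero_of_third {F : ℝ → ℝ → ℝ → ℝ} (h : Continuous (fun p : ℝ × ℝ × ℝ => F p.1 p.2.1 p.2.2))
    (a b c d u v : ℝ) (h0 : ∀ x y, ∫ z in u..v, F x y z = 0) :
    ∫ x in a..b, ∫ z in u..v, ∫ y in c..d, F x y z = 0 := by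
  have : ∀ x, ∫ z in u..v, ∫ y in c..d, F x y z = 0 := by
    intro x
    rw [ii_swap (F := fun z y => F x y z)]
    · simp [h0]
    · exact h.comp (by fun_prop : Continuous (fun p : ℝ × ℝ => (x, p.2, p.1)))
  simp [this]

section rep
variable {w : R3 → ℝ} (hw : ContDiff ℝ ∞ w)
    (hb : ∀ y, pd 0 (pd 0 w) y - pd 1 (pd 1 w) y - pd 2 (pd 2 w) y = 0) (T x1 x2 : ℝ)

set_option maxHeartbeats 1000000 in
theorem wave_rep (hw : ContDiff ℝ ∞ w)
    (hb : ∀ y, pd 0 (pd 0 w) y - pd 1 (pd 1 w) y - pd 2 (pd 2 w) y = 0) (T x1 x2 : ℝ) :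
    2 * π * w ![T, x1, x2] = ∫ φ in 0..(π/2), ∫ θ in 0..(2*π), sin φ *
      (w ![0, x1 + T * sin φ * cos θ, x2 + T * sin φ * sin θ] + T * sin φ *
        (cos θ * pd 1 w ![0, x1 + T * sin φ * cos θ, x2 + T * sin φ * sin θ]
        + sin θ * pd 2 w ![0, x1 + T * sin φ * cos θ, x2 + T * sin φ * sin θ])
        + T * pd 0 w ![0, x1 + T * sin φ * cos θ, x2 + T * sin φ * sin θ]) := by
  set c : ℝ → ℝ → ℝ → R3 := fun ρ φ θ =>
    ![T - ρ, x1 + ρ * sin φ * cos θ, x2 + ρ * sin φ * sin θ] with hc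
  have hcont : ∀ f : R3 → ℝ, Continuous f →
      Continuous (fun p : ℝ × ℝ × ℝ => f (c p.1 p.2.1 p.2.2)) := by
    intro f hf
    exact continuous_cart hf (by fun_prop) (by fun_prop) (by fun_prop)
  have h1 := contDiff_pd3 hw
  have h2 := fun i j => contDiff_pd3 (h1 j) i
  have dw : Differentiable ℝ w := hw.differentiable (by simp)
  have d1 : ∀ i, Differentiable ℝ (pd i w) := fun i => (h1 i).differentiable (by simp)
  have cw := hcont w hw.continuous
  have c1 := fun i => hcont _ (h1 i).continuous
  have c2 := fun i j => hcont _ (h2 i j).continuous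
  set K : ℝ → ℝ → ℝ → ℝ := fun ρ φ θ => sin φ * (w (c ρ φ θ) + ρ * sin φ *
    (cos θ * pd 1 w (c ρ φ θ) + sin θ * pd 2 w (c ρ φ θ)) + ρ * pd 0 w (c ρ φ θ)) with hK
  set aa : ℝ → ℝ → ℝ → ℝ := fun ρ φ θ => -(cos φ * sin φ) *
    (cos θ * pd 1 w (c ρ φ θ) + sin θ * pd 2 w (c ρ φ θ)) with haa
  set bb : ℝ → ℝ → ℝ → ℝ := fun ρ φ θ =>
    -sin θ * pd 1 w (c ρ φ θ) + cos θ * pd 2 w (c ρ φ θ) with hbb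
  set A : ℝ → ℝ → ℝ → ℝ := fun ρ φ θ => (sin φ ^ 2 - cos φ ^ 2) *
    (cos θ * pd 1 w (c ρ φ θ) + sin θ * pd 2 w (c ρ φ θ)) - cos φ ^ 2 * sin φ * ρ *
    (cos θ ^ 2 * pd 1 (pd 1 w) (c ρ φ θ) + 2 * sin θ * cos θ * pd 1 (pd 2 w) (c ρ φ θ)
      + sin θ ^ 2 * pd 2 (pd 2 w) (c ρ φ θ)) with hA
  set B : ℝ → ℝ → ℝ → ℝ := fun ρ φ θ =>
    -(cos θ * pd 1 w (c ρ φ θ) + sin θ * pd 2 w (c ρ φ θ)) + ρ * sin φ *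
    (sin θ ^ 2 * pd 1 (pd 1 w) (c ρ φ θ) - 2 * sin θ * cos θ * pd 1 (pd 2 w) (c ρ φ θ)
      + cos θ ^ 2 * pd 2 (pd 2 w) (c ρ φ θ)) with hB
  have e21 : pd 2 (pd 1 w) = pd 1 (pd 2 w) := pd_comm hw 2 1
  have e10 : pd 1 (pd 0 w) = pd 0 (pd 1 w) := pd_comm hw 1 0
  have e20 : pd 2 (pd 0 w) = pd 0 (pd 2 w) := pd_comm hw 2 0
  have cA : Continuous (fun p : ℝ × ℝ × ℝ => A p.1 p.2.1 p.2.2) := by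
    have := c1 1; have := c1 2; have := c2 1 1; have := c2 1 2; have := c2 2 2
    simp only [hA]; fun_prop
  have cB : Continuous (fun p : ℝ × ℝ × ℝ => B p.1 p.2.1 p.2.2) := by
    have := c1 1; have := c1 2; have := c2 1 1; have := c2 1 2; have := c2 2 2
    simp only [hB]; fun_prop
  have cK : Continuous (fun p : ℝ × ℝ × ℝ => K p.1 p.2.1 p.2.2) := by
    have := c1 1; have := c1 2; have := c1 0
    simp only [hK]; fun_prop
  -- derivatives
  have dρ : ∀ f : R3 → ℝ, Differentiable ℝ f → ∀ ρ φ θ, HasDerivAt (fun ρ => f (c ρ φ θ))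
      (pd 0 f (c ρ φ θ) * (-1) + pd 1 f (c ρ φ θ) * (sin φ * cos θ)
        + pd 2 f (c ρ φ θ) * (sin φ * sin θ)) ρ := by
    intro f hf ρ φ θ
    refine hasDerivAt_curve (hf _) ?_ ?_ ?_
    · simpa using (hasDerivAt_id ρ).const_sub T
    · simpa [mul_assoc] using ((hasDerivAt_id ρ).mul_const (sin φ * cos θ)).const_add x1
    · simpa [mul_assoc] using ((hasDerivAt_id ρ).mul_const (sin φ * sin θ)).const_add x2
  have dφ : ∀ f : R3 → ℝ, Differentiable ℝ f → ∀ ρ φ θ, HasDerivAt (fun φ => f (c ρ φ θ))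
      (pd 0 f (c ρ φ θ) * 0 + pd 1 f (c ρ φ θ) * (ρ * cos φ * cos θ)
        + pd 2 f (c ρ φ θ) * (ρ * cos φ * sin θ)) φ := by
    intro f hf ρ φ θ
    refine hasDerivAt_curve (hf _) ?_ ?_ ?_
    · exact hasDerivAt_const _ _
    · exact (((hasDerivAt_sin φ).const_mul ρ).mul_const (cos θ)).const_add x1
    · exact (((hasDerivAt_sin φ).const_mul ρ).mul_const (sin θ)).const_add x2
  have dθ : ∀ f : R3 → ℝ, Differentiable ℝ f → ∀ ρ φ θ, HasDerivAt (fun θ => f (c ρ φ θ))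
      (pd 0 f (c ρ φ θ) * 0 + pd 1 f (c ρ φ θ) * (ρ * sin φ * (-sin θ))
        + pd 2 f (c ρ φ θ) * (ρ * sin φ * cos θ)) θ := by
    intro f hf ρ φ θ
    refine hasDerivAt_curve (hf _) ?_ ?_ ?_
    · exact hasDerivAt_const _ _
    · exact (((hasDerivAt_cos θ).const_mul (ρ * sin φ))).const_add x1
    · exact (((hasDerivAt_sin θ).const_mul (ρ * sin φ))).const_add x2
  have dK : ∀ ρ φ θ, HasDerivAt (fun ρ => K ρ φ θ) (A ρ φ θ - B ρ φ θ) ρ := by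
    intro ρ φ θ
    have q0 := dρ w dw ρ φ θ
    have q1 := dρ _ (d1 0) ρ φ θ
    have q2 := dρ _ (d1 1) ρ φ θ
    have q3 := dρ _ (d1 2) ρ φ θ
    have i := hasDerivAt_id' ρ
    have := ((q0.add ((i.mul_const (sin φ)).mul ((q2.const_mul (cos θ)).add
      (q3.const_mul (sin θ))))).add (i.mul q1)).const_mul (sin φ)
    refine this.congr_deriv ?_
    rw [e21, e10, e20]
    have hb' := hb (c ρ φ θ)
    have hs := sin_sq_add_cos_sq θ
    have hs' := sin_sq_add_cos_sq φ
    simp only [hA, hB]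
    have hc2 : cos φ ^ 2 = 1 - sin φ ^ 2 := by linarith
    rw [hc2]
    simp only [Pi.add_apply]
    generalize c ρ φ θ = z at *
    linear_combination (-ρ * sin φ) * hb' + ρ * sin φ * (pd 1 (pd 1 w) z + pd 2 (pd 2 w) z) * hs
  have dA : ∀ ρ φ θ, HasDerivAt (fun φ => aa ρ φ θ) (A ρ φ θ) φ := by
    intro ρ φ θ
    have q2 := dφ _ (d1 1) ρ φ θ
    have q3 := dφ _ (d1 2) ρ φ θ
    have := (((hasDerivAt_cos φ).mul (hasDerivAt_sin φ)).neg).mul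
      ((q2.const_mul (cos θ)).add (q3.const_mul (sin θ)))
    refine this.congr_deriv ?_
    rw [e21]
    simp only [hA]
    simp
    ring
  have dB : ∀ ρ φ θ, HasDerivAt (fun θ => bb ρ φ θ) (B ρ φ θ) θ := by
    intro ρ φ θ
    have q2 := dθ _ (d1 1) ρ φ θ
    have q3 := dθ _ (d1 2) ρ φ θ
    have := (((hasDerivAt_sin θ).neg).mul q2).add ((hasDerivAt_cos θ).mul q3)
    refine this.congr_deriv ?_
    rw [e21]
    simp only [hB]
    simp
    ring
  clear_value A B
  -- integrals
  have iA : ∀ ρ θ, ∫ φ in 0..(π/2), A ρ φ θ = 0 := by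
    intro ρ θ
    rw [intervalIntegral.integral_eq_sub_of_hasDerivAt (fun φ _ => dA ρ φ θ)]
    · simp [haa]
    · exact (cA.comp (by fun_prop : Continuous (fun φ : ℝ => (ρ, φ, θ)))).intervalIntegrable _ _
  have iB : ∀ ρ φ, ∫ θ in 0..(2*π), B ρ φ θ = 0 := by
    intro ρ φ
    rw [intervalIntegral.integral_eq_sub_of_hasDerivAt (fun θ _ => dB ρ φ θ)]
    · simp [hbb, hc]
    · exact (cB.comp (by fun_prop : Continuous (fun θ : ℝ => (ρ, φ, θ)))).intervalIntegrable _ _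
  have iK : ∀ φ θ, K T φ θ = K 0 φ θ + ((∫ ρ in 0..T, A ρ φ θ) - ∫ ρ in 0..T, B ρ φ θ) := by
    intro φ θ
    have hAi := (cA.comp (by fun_prop : Continuous (fun ρ : ℝ => (ρ, φ, θ)))).intervalIntegrable
      (μ := volume) 0 T
    have hBi := (cB.comp (by fun_prop : Continuous (fun ρ : ℝ => (ρ, φ, θ)))).intervalIntegrable
      (μ := volume) 0 T
    simp only [Function.comp_def] at hAi hBi
    rw [← intervalIntegral.integral_sub hAi hBi,
      intervalIntegral.integral_eq_sub_of_hasDerivAt (fun ρ _ => dK ρ φ θ) (hAi.sub hBi)]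
    ring
  have pA : Continuous (fun p : ℝ × ℝ => ∫ ρ in 0..T, A ρ p.1 p.2) := by
    refine intervalIntegral.continuous_parametric_intervalIntegral_of_continuous'
      (f := fun (p : ℝ × ℝ) ρ => A ρ p.1 p.2) ?_ _ _
    exact cA.comp (by fun_prop : Continuous (fun p : (ℝ × ℝ) × ℝ => (p.2, p.1.1, p.1.2)))
  have pB : Continuous (fun p : ℝ × ℝ => ∫ ρ in 0..T, B ρ p.1 p.2) := by
    refine intervalIntegral.continuous_parametric_intervalIntegral_of_continuous'
      (f := fun (p : ℝ × ℝ) ρ => B ρ p.1 p.2) ?_ _ _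
    exact cB.comp (by fun_prop : Continuous (fun p : (ℝ × ℝ) × ℝ => (p.2, p.1.1, p.1.2)))
  have IA : ∫ φ in 0..(π/2), ∫ θ in 0..(2*π), ∫ ρ in 0..T, A ρ φ θ = 0 := by
    rw [ii_swap (F := fun φ θ => ∫ ρ in 0..T, A ρ φ θ) pA]
    exact ii_zero_of_third (F := fun θ ρ φ => A ρ φ θ)
      (cA.comp (by fun_prop : Continuous (fun p : ℝ × ℝ × ℝ => (p.2.1, p.2.2, p.1)))) _ _ _ _ _ _
      (fun θ ρ => iA ρ θ)
  have IB : ∫ φ in 0..(π/2), ∫ θ in 0..(2*π), ∫ ρ in 0..T, B ρ φ θ = 0 := by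
    exact ii_zero_of_third (F := fun φ ρ θ => B ρ φ θ)
      (cB.comp (by fun_prop : Continuous (fun p : ℝ × ℝ × ℝ => (p.2.1, p.1, p.2.2)))) _ _ _ _ _ _
      (fun φ ρ => iB ρ φ)
  have k0 : ∀ φ θ, K 0 φ θ = sin φ * w ![T, x1, x2] := by
    intro φ θ; simp [hK, hc]
  have kT : ∫ φ in 0..(π/2), ∫ θ in 0..(2*π), K T φ θ = 2 * π * w ![T, x1, x2] := by
    have e1 : ∀ φ, ∫ θ in 0..(2*π), K T φ θ = (2 * π) * (sin φ * w ![T, x1, x2]) +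
        ((∫ θ in 0..(2*π), ∫ ρ in 0..T, A ρ φ θ) - ∫ θ in 0..(2*π), ∫ ρ in 0..T, B ρ φ θ) := by
      intro φ
      have j1 := (pA.comp (by fun_prop : Continuous (fun θ : ℝ => (φ, θ)))).intervalIntegrable
        (μ := volume) 0 (2*π)
      have j2 := (pB.comp (by fun_prop : Continuous (fun θ : ℝ => (φ, θ)))).intervalIntegrable
        (μ := volume) 0 (2*π)
      simp only [Function.comp_def] at j1 j2
      simp only [iK, k0]
      rw [intervalIntegral.integral_add (by simp) (j1.sub j2), intervalIntegral.integral_sub j1 j2]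
      simp
      ring
    simp only [e1]
    have j1 : Continuous (fun φ => ∫ θ in 0..(2*π), ∫ ρ in 0..T, A ρ φ θ) :=
      intervalIntegral.continuous_parametric_intervalIntegral_of_continuous'
      (f := fun φ θ => ∫ ρ in 0..T, A ρ φ θ) pA _ _
    have j2 : Continuous (fun φ => ∫ θ in 0..(2*π), ∫ ρ in 0..T, B ρ φ θ) :=
      intervalIntegral.continuous_parametric_intervalIntegral_of_continuous'
      (f := fun φ θ => ∫ ρ in 0..T, B ρ φ θ) pB _ _
    rw [intervalIntegral.integral_add, intervalIntegral.integral_sub, IA, IB]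
    · simp only [intervalIntegral.integral_const_mul, intervalIntegral.integral_mul_const,
        integral_sin]; simp
    · exact j1.intervalIntegrable _ _
    · exact j2.intervalIntegrable _ _
    · exact (by fun_prop : Continuous fun φ => 2 * π * (sin φ * w ![T, x1, x2])).intervalIntegrable _ _
    · exact (j1.sub j2).intervalIntegrable _ _
  rw [← kT]
  simp [hK, hc]

end rep
end

noncomputable section

/-! ### Decay of solutions of the wave equation -/

theorem exists_polar (x1 x2 : ℝ) : ∃ α, x1 = √(x1^2+x2^2) * cos α ∧ x2 = √(x1^2+x2^2) * sin α := by
  refine ⟨Complex.arg ⟨x1, x2⟩, ?_, ?_⟩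
  · have := Complex.norm_mul_cos_arg ⟨x1, x2⟩
    rw [Complex.norm_def, Complex.normSq_mk] at this
    simp only [] at this
    rw [sq, sq]; exact this.symm
  · have := Complex.norm_mul_sin_arg ⟨x1, x2⟩
    rw [Complex.norm_def, Complex.normSq_mk] at this
    simp only [] at this
    rw [sq, sq]; exact this.symm

theorem norm_shift (r R α θ : ℝ) :
    (r * cos α + R * cos θ)^2 + (r * sin α + R * sin θ)^2
      = (r - R)^2 + 4 * r * R * cos ((θ - α)/2) ^ 2 := by
  have h1 := cos_sub θ α
  have h2 : cos (θ - α) = 2 * cos ((θ-α)/2)^2 - 1 := by rw [← cos_two_mul]; ring_nf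
  have h3 := sin_sq_add_cos_sq θ
  have h4 := sin_sq_add_cos_sq α
  linear_combination R^2 * h3 + r^2*h4 + 2*r*R*(h2 - h1)

theorem data_far {x1 x2 M T φ θ : ℝ} (hM : 0 < M) (hT : 0 ≤ T) (hx : (M+T)^2 < x1^2 + x2^2)
    (h0 : 0 ≤ sin φ) : M^2 < (x1 + T * sin φ * cos θ)^2 + (x2 + T * sin φ * sin θ)^2 := by
  obtain ⟨α, e1, e2⟩ := exists_polar x1 x2
  set r := √(x1^2+x2^2) with hr
  have hr2 : r^2 = x1^2+x2^2 := Real.sq_sqrt (by positivity)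
  have hr0 : 0 ≤ r := Real.sqrt_nonneg _
  have h2 : M + T < r := by
    rw [← hr2] at hx
    exact lt_of_pow_lt_pow_left₀ 2 hr0 hx
  rw [e1, e2, norm_shift]
  have h3 : 0 ≤ 4 * r * (T * sin φ) * cos ((θ - α)/2) ^ 2 := by positivity
  have h4 : T * sin φ ≤ T := by nlinarith [sin_le_one φ]
  nlinarith

section data
variable {M : ℝ} (hM : 0 < M) {φ0 φ1 : ℝ × ℝ → ℝ} {w0 : R3 → ℝ}

theorem pd1_vec {w : R3 → ℝ} (hw : ContDiff ℝ ∞ w) (a b c : ℝ) :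
    HasDerivAt (fun s => w ![a, s, c]) (pd 1 w ![a, b, c]) b := by
  have := hasDerivAt_curve (f := w) (a := fun _ => a) (b := fun s => s) (c := fun _ => c) (s := b)
    (hw.differentiable (by simp) _) (hasDerivAt_const _ _) (hasDerivAt_id' b) (hasDerivAt_const _ _)
  simpa using this

theorem pd2_vec {w : R3 → ℝ} (hw : ContDiff ℝ ∞ w) (a b c : ℝ) :
    HasDerivAt (fun s => w ![a, b, s]) (pd 2 w ![a, b, c]) c := by
  have := hasDerivAt_curve (f := w) (a := fun _ => a) (b := fun _ => b) (c := fun s => s) (s := c)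
    (hw.differentiable (by simp) _) (hasDerivAt_const _ _) (hasDerivAt_const _ _) (hasDerivAt_id' c)
  simpa using this

theorem pd_zero_of_data {w : R3 → ℝ} (hw : ContDiff ℝ ∞ w)
    (h : ∀ a b : ℝ, M^2 < a^2 + b^2 → w ![0, a, b] = 0) (a b : ℝ) (hab : M^2 < a^2+b^2) :
    pd 1 w ![0, a, b] = 0 ∧ pd 2 w ![0, a, b] = 0 := by
  constructor
  · have h1 := pd1_vec hw 0 a b
    have : (fun s => w ![0, s, b]) =ᶠ[𝓝 a] fun _ => 0 := by
      have : ∀ᶠ s in 𝓝 a, M^2 < s^2 + b^2 :=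
        ((by fun_prop : Continuous fun s : ℝ => s^2+b^2).tendsto a).eventually_const_lt hab
      filter_upwards [this] with s hs using h s b hs
    exact (h1.congr_of_eventuallyEq this.symm).unique (hasDerivAt_const a 0)
  · have h1 := pd2_vec hw 0 a b
    have : (fun s => w ![0, a, s]) =ᶠ[𝓝 b] fun _ => 0 := by
      have : ∀ᶠ s in 𝓝 b, M^2 < a^2 + s^2 :=
        ((by fun_prop : Continuous fun s : ℝ => a^2+s^2).tendsto b).eventually_const_lt hab
      filter_upwards [this] with s hs using h a s hs
    exact (h1.congr_of_eventuallyEq this.symm).unique (hasDerivAt_const b 0)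

theorem isW_of_data (hM : 0 < M) (hs0 : SuppIn M φ0) (hs1 : SuppIn M φ1)
    (hw0smooth : ContDiff ℝ ∞ w0)
    (hw0eq : ∀ y : Fin 3 → ℝ,
      pd 0 (pd 0 w0) y - pd 1 (pd 1 w0) y - pd 2 (pd 2 w0) y = 0)
    (hw0init : ∀ x : ℝ × ℝ,
      w0 ![0, x.1, x.2] = φ0 x ∧ pd 0 w0 ![0, x.1, x.2] = φ1 x) : IsW M w0 where
  smooth := hw0smooth
  wave := hw0eq
  supp := by
    intro y h0 hy
    have z0 : ∀ a b : ℝ, M^2 < a^2 + b^2 → w0 ![0, a, b] = 0 := fun a b hab => by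
      rw [(hw0init (a, b)).1]; exact hs0 _ hab
    have z1 : ∀ a b : ℝ, M^2 < a^2 + b^2 → pd 0 w0 ![0, a, b] = 0 := fun a b hab => by
      rw [(hw0init (a, b)).2]; exact hs1 _ hab
    have z2 := pd_zero_of_data hw0smooth z0
    have rep := wave_rep hw0smooth hw0eq (y 0) (y 1) (y 2)
    have ey : y = ![y 0, y 1, y 2] := by ext i; fin_cases i <;> rfl
    rw [← ey] at rep
    rw [intervalIntegral.integral_congr (g := fun _ => 0)] at rep
    · simp at rep
      exact rep
    · intro φ hφ
      rw [Set.uIcc_of_le (by positivity)] at hφ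
      have hs : 0 ≤ sin φ := sin_nonneg_of_nonneg_of_le_pi hφ.1 (by linarith [hφ.2, pi_pos])
      simp only
      rw [intervalIntegral.integral_congr (g := fun _ => 0)]
      · simp
      · intro θ _
        have hf := data_far (θ := θ) hM h0 hy hs
        simp only
        rw [z0 _ _ hf, z1 _ _ hf, (z2 _ _ hf).1, (z2 _ _ hf).2]
        simp
end data

theorem small_supp {f : ℝ → ℝ} {a b K δ : ℝ} (hab : a ≤ b) (hK : 0 ≤ K) (hδ : 0 ≤ δ)
    (hf : ∀ x ∈ Set.Ioc a b, |f x| ≤ K)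
    (hs : ∀ x ∈ Set.Ioc a b, ∀ y ∈ Set.Ioc a b, f x ≠ 0 → f y ≠ 0 → |x - y| ≤ δ) :
    |∫ x in a..b, f x| ≤ K * (2 * δ) := by
  rw [intervalIntegral.integral_of_le hab]
  by_cases h : ∃ x ∈ Set.Ioc a b, f x ≠ 0
  · obtain ⟨x0, hx0, hfx0⟩ := h
    have e : ∫ x in Set.Ioc a b, f x = ∫ x in Set.Ioc a b ∩ Set.Icc (x0 - δ) (x0 + δ), f x := by
      apply setIntegral_eq_of_subset_of_forall_sdiff_eq_zero measurableSet_Ioc Set.inter_subset_left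
      intro x hx
      by_contra hne
      apply hx.2
      refine ⟨hx.1, ?_⟩
      have := abs_le.1 (hs x hx.1 x0 hx0 hne hfx0)
      constructor <;> linarith [this.1, this.2]
    rw [e]
    have hm : volume (Set.Ioc a b ∩ Set.Icc (x0 - δ) (x0 + δ)) ≤ ENNReal.ofReal (2 * δ) := by
      refine (measure_mono Set.inter_subset_right).trans ?_
      rw [Real.volume_Icc]; apply le_of_eq; congr 1; ring
    have := norm_setIntegral_le_of_norm_le_const (μ := volume) (f := f) (C := K)
      (s := Set.Ioc a b ∩ Set.Icc (x0 - δ) (x0 + δ)) (lt_of_le_of_lt hm ENNReal.ofReal_lt_top)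
      (fun x hx => hf x hx.1)
    refine this.trans (mul_le_mul_of_nonneg_left ?_ hK)
    exact ENNReal.toReal_le_of_le_ofReal (by positivity) hm
  · push Not at h
    rw [setIntegral_congr_fun measurableSet_Ioc (g := fun _ => 0) (fun x hx => h x hx)]
    simp; positivity

/-- angular measure -/
theorem angle_bound {M r R α : ℝ} (hM : 0 < M) (hr : 0 ≤ r) (hR : 0 < R) {θ1 θ2 : ℝ}
    (h1 : θ1 ∈ Set.Ioc α (α + 2*π)) (h2 : θ2 ∈ Set.Ioc α (α + 2*π))
    (hz1 : (r * cos α + R * cos θ1)^2 + (r * sin α + R * sin θ1)^2 ≤ M^2)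
    (hz2 : (r * cos α + R * cos θ2)^2 + (r * sin α + R * sin θ2)^2 ≤ M^2) :
    |θ1 - θ2| ≤ 4 * π * M / R := by
  have hpi := pi_pos
  rcases lt_or_ge R (2 * M) with hRM | hRM
  · have : |θ1 - θ2| ≤ 2 * π := by
      rw [abs_le]; constructor <;> linarith [h1.1, h1.2, h2.1, h2.2]
    refine this.trans ?_
    rw [le_div_iff₀ hR]; nlinarith
  · have key : ∀ θ ∈ Set.Ioc α (α + 2*π), (r * cos α + R * cos θ)^2 + (r * sin α + R * sin θ)^2 ≤ M^2 →
        |π - (θ - α)| ≤ 2 * π * M / R := by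
      intro θ hθ hz
      rw [norm_shift] at hz
      have hc2 : 0 ≤ cos ((θ - α)/2)^2 := by positivity
      have hrR : R / 2 ≤ r := by
        by_contra hlt
        push Not at hlt
        have : M < R - r := by linarith
        have : 0 ≤ 4 * r * R * cos ((θ - α)/2) ^ 2 := by positivity
        nlinarith
      set β := π - (θ - α) with hβ
      have hcos : cos ((θ-α)/2) = sin (β/2) := by
        rw [← cos_pi_div_two_sub]; congr 1; rw [hβ]; ring
      rw [hcos] at hz
      have hβ1 : |β| ≤ π := by
        rw [abs_le]; constructor <;> linarith [hθ.1, hθ.2]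
      have hsin : |β| / π ≤ |sin (β/2)| := by
        have := mul_abs_le_abs_sin (x := β/2) (by rw [abs_div]; simp; linarith)
        rw [abs_div] at this
        simp at this
        exact this
      have h5 : (|β|/π)^2 ≤ sin (β/2)^2 := by
        rw [← sq_abs (sin (β/2))]
        exact pow_le_pow_left₀ (by positivity) hsin 2
      have h6 : 2 * R^2 * (|β|/π)^2 ≤ M^2 := by
        have h7 : 2 * R^2 ≤ 4 * r * R := by nlinarith
        have : 2 * R^2 * (|β|/π)^2 ≤ 4*r*R * sin (β/2)^2 :=
          mul_le_mul h7 h5 (by positivity) (by positivity)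
        nlinarith [sq_nonneg (r-R)]
      have h8 : (R * (|β|/π))^2 ≤ M^2 := by nlinarith [sq_nonneg (R * (|β|/π))]
      have h9 : R * (|β|/π) ≤ M := le_of_sq_le_sq h8 hM.le
      rw [le_div_iff₀ hR]
      have : R * (|β|/π) * π = |β| * R := by field_simp
      nlinarith
    have k1 := abs_le.1 (key θ1 h1 hz1)
    have k2 := abs_le.1 (key θ2 h2 hz2)
    have e : 4 * π * M / R = 2 * π * M / R + 2 * π * M / R := by ring
    rw [e, abs_le]
    constructor <;> linarith [k1.1, k1.2, k2.1, k2.2]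

/-- polar-angle measure -/
theorem phi_bound {M r T : ℝ} (hM : 0 < M) (hT : 0 < T) {ψ1 ψ2 : ℝ}
    (h1 : 0 ≤ ψ1) (h12 : ψ1 ≤ ψ2) (h2 : ψ2 ≤ π/2)
    (hz1 : |T * cos ψ1 - r| ≤ M) (hz2 : |T * cos ψ2 - r| ≤ M) :
    (ψ2 - ψ1)^2 * (T * √(1 + (r-T)^2)) ≤ π^4 * M^2 * √(1 + 1/(4*M^2)) + 2 * π^2 * M * √(1+4*M^2) := by
  have hpi := pi_pos
  have a1 := abs_le.1 hz1
  have a2 := abs_le.1 hz2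
  have hp1 : 0 ≤ π^4 * M^2 * √(1 + 1/(4*M^2)) := by positivity
  have hp2 : 0 ≤ 2 * π^2 * M * √(1+4*M^2) := by positivity
  have hs : ∀ x, 0 ≤ x → x ≤ π/2 → 2/π * x ≤ sin x := fun x h1 h2 => mul_le_sin h1 h2
  rcases le_or_gt (2*M) (T - r) with hq | hq
  · -- far inside
    have hcd : cos ψ1 - cos ψ2 = 2 * sin ((ψ1+ψ2)/2) * sin ((ψ2-ψ1)/2) := by
      rw [cos_sub_cos]
      have : (ψ1 - ψ2)/2 = -((ψ2-ψ1)/2) := by ring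
      rw [this, sin_neg]; ring
    have s1 := hs ((ψ1+ψ2)/2) (by linarith) (by linarith)
    have s2 := hs ((ψ2-ψ1)/2) (by linarith) (by linarith)
    have b1 : T * (cos ψ1 - cos ψ2) ≤ 2 * M := by rw [mul_sub]; linarith [a1.1,a1.2,a2.1,a2.2]
    have b2 : 2 * (2/π * ((ψ1+ψ2)/2)) * (2/π*((ψ2-ψ1)/2)) ≤ cos ψ1 - cos ψ2 := by
      rw [hcd]
      have : 0 ≤ 2/π*((ψ2-ψ1)/2) := mul_nonneg (by positivity) (by linarith)
      have h0 : 0 ≤ 2/π*((ψ1+ψ2)/2) := mul_nonneg (by positivity) (by linarith)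
      have := mul_le_mul s1 s2 this (h0.trans s1)
      linarith
    have b3 : T * ((ψ1+ψ2) * (ψ2 - ψ1)) ≤ π^2 * M := by
      have e : 2 * (2/π * ((ψ1+ψ2)/2)) * (2/π*((ψ2-ψ1)/2)) = 2/π^2 * ((ψ1+ψ2) * (ψ2 - ψ1)) := by
        field_simp
      rw [e] at b2
      have h7 : T * (2/π^2 * ((ψ1+ψ2) * (ψ2 - ψ1))) ≤ 2 * M :=
        (mul_le_mul_of_nonneg_left b2 hT.le).trans b1
      have h8 := mul_le_mul_of_nonneg_right h7 (sq_nonneg π)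
      have e2 : T * (2/π^2 * ((ψ1+ψ2) * (ψ2 - ψ1))) * π^2 = 2 * (T * ((ψ1+ψ2) * (ψ2 - ψ1))) := by
        field_simp
      linarith
    have b4 : T - r - M ≤ T * (ψ2^2/2) := by
      have := mul_le_mul_of_nonneg_left (one_sub_sq_div_two_le_cos (x := ψ2)) hT.le
      rw [mul_sub, mul_one] at this
      linarith [a2.1, a2.2]
    have b5 : (T - r) ≤ T * ψ2^2 := by linarith
    have b6 : T * (ψ2 * (ψ2 - ψ1)) ≤ π^2 * M := by
      refine le_trans ?_ b3
      apply mul_le_mul_of_nonneg_left _ hT.le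
      apply mul_le_mul_of_nonneg_right _ (by linarith)
      linarith
    have b7 : (T * (ψ2 * (ψ2 - ψ1)))^2 ≤ (π^2 * M)^2 := by
      apply pow_le_pow_left₀ _ b6
      exact mul_nonneg hT.le (mul_nonneg (by linarith) (by linarith))
    have b8 : (ψ2-ψ1)^2 * (T * (T - r)) ≤ π^4 * M^2 := by
      have : (ψ2-ψ1)^2 * (T * (T - r)) ≤ (ψ2-ψ1)^2 * (T * (T * ψ2^2)) := by gcongr
      have e3 : (ψ2-ψ1)^2 * (T * (T * ψ2^2)) = (T * (ψ2 * (ψ2 - ψ1)))^2 := by ring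
      have e4 : (π^2 * M)^2 = π^4 * M^2 := by ring
      linarith
    have b9 : √(1 + (r-T)^2) ≤ (T - r) * √(1 + 1/(4*M^2)) := by
      have hq0 : 0 ≤ T - r := by linarith
      apply Real.sqrt_le_iff.2
      refine ⟨by positivity, ?_⟩
      rw [mul_pow, Real.sq_sqrt (by positivity)]
      have : 1 ≤ (T-r)^2 * (1/(4*M^2)) := by
        rw [mul_one_div, le_div_iff₀ (by positivity)]
        nlinarith
      nlinarith
    calc (ψ2 - ψ1)^2 * (T * √(1 + (r-T)^2)) ≤ (ψ2 - ψ1)^2 * (T * ((T - r) * √(1 + 1/(4*M^2)))) := by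
          gcongr
      _ = (ψ2-ψ1)^2 * (T * (T - r)) * √(1 + 1/(4*M^2)) := by ring
      _ ≤ π^4 * M^2 * √(1 + 1/(4*M^2)) := by gcongr
      _ ≤ _ := by linarith
  · have hTr : -(2*M) ≤ T - r := by
      have := mul_le_mul_of_nonneg_left (cos_le_one ψ1) hT.le
      linarith [a1.1,a1.2,a2.1,a2.2]
    have c1 : T * (1 - cos ψ2) ≤ 3 * M := by rw [mul_sub, mul_one]; linarith [a1.1,a1.2,a2.1,a2.2]
    have c2 : 2/π^2 * ψ2^2 ≤ 1 - cos ψ2 := by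
      have e : cos ψ2 = 1 - 2 * sin (ψ2/2)^2 := by
        have := cos_sq' (ψ2/2)
        have h2 : cos ψ2 = 2 * cos (ψ2/2)^2 - 1 := by rw [← cos_two_mul]; ring_nf
        linarith
      have s1 := hs (ψ2/2) (by linarith) (by linarith)
      have h0 : 0 ≤ 2/π*(ψ2/2) := mul_nonneg (by positivity) (by linarith)
      have := pow_le_pow_left₀ h0 s1 2
      have e2 : (2/π*(ψ2/2))^2 = 1/π^2*ψ2^2 := by field_simp
      rw [e2] at this
      rw [e]
      have e3 : 2/π^2 * ψ2^2 = 2 * (1/π^2*ψ2^2) := by ring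
      linarith
    have c3 : T * ψ2^2 ≤ 2 * π^2 * M := by
      have h7 : T * (2/π^2 * ψ2^2) ≤ 3*M := (mul_le_mul_of_nonneg_left c2 hT.le).trans c1
      have h8 := mul_le_mul_of_nonneg_right h7 (sq_nonneg π)
      have e : T * (2/π^2 * ψ2^2) * π^2 = 2 * (T * ψ2^2) := by field_simp
      have : 0 ≤ π^2 * M := by positivity
      linarith
    have c4 : √(1 + (r-T)^2) ≤ √(1+4*M^2) := by
      apply Real.sqrt_le_sqrt; nlinarith
    have c5 : (ψ2-ψ1)^2 ≤ ψ2^2 := by nlinarith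
    calc (ψ2 - ψ1)^2 * (T * √(1 + (r-T)^2)) ≤ ψ2^2 * (T * √(1+4*M^2)) := by gcongr
      _ = T * ψ2^2 * √(1+4*M^2) := by ring
      _ ≤ 2 * π^2 * M * √(1+4*M^2) := by gcongr
      _ ≤ _ := by linarith

end

noncomputable section

theorem cont_supp_bdd {M : ℝ} {f : ℝ × ℝ → ℝ} (hf : Continuous f)
    (h : ∀ x : ℝ × ℝ, M^2 < x.1^2 + x.2^2 → f x = 0) : ∃ B, 0 ≤ B ∧ ∀ x, |f x| ≤ B := by
  have hc : IsCompact (Set.Icc (-|M|) |M| ×ˢ Set.Icc (-|M|) |M|) := isCompact_Icc.prod isCompact_Icc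
  obtain ⟨B, hB⟩ := hc.exists_bound_of_continuousOn hf.continuousOn
  refine ⟨max B 0, le_max_right _ _, fun x => ?_⟩
  by_cases hx : M^2 < x.1^2+x.2^2
  · rw [h x hx]; simp
  · push Not at hx
    refine (hB x ?_).trans (le_max_left _ _)
    have h1 : |x.1| ≤ |M| := sq_le_sq.1 (by nlinarith [sq_nonneg x.2])
    have h2 : |x.2| ≤ |M| := sq_le_sq.1 (by nlinarith [sq_nonneg x.1])
    exact ⟨abs_le.1 h1, abs_le.1 h2⟩

theorem data_bound {M : ℝ} (hM : 0 < M) {w : R3 → ℝ} (h : IsW M w) :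
    (∀ a b : ℝ, M^2 < a^2 + b^2 → w ![0,a,b] = 0 ∧ ∀ i, pd i w ![0,a,b] = 0) ∧
    ∃ B, 0 ≤ B ∧ ∀ a b : ℝ, |w ![0,a,b]| ≤ B ∧ ∀ i, |pd i w ![0,a,b]| ≤ B := by
  have z : ∀ a b : ℝ, M^2 < a^2 + b^2 → w ![0,a,b] = 0 ∧ ∀ i, pd i w ![0,a,b] = 0 := by
    intro a b hab
    refine ⟨h.supp _ (by simp) (by simpa using hab), fun i => ?_⟩
    have := h.fderiv_zero hM (y := ![0,a,b]) (by simp) (by simpa using hab)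
    simp [pd, this]
  refine ⟨z, ?_⟩
  have c : ∀ f : R3 → ℝ, Continuous f → Continuous (fun x : ℝ × ℝ => f ![0, x.1, x.2]) := by
    intro f hf
    exact continuous_cart hf continuous_const continuous_fst continuous_snd
  obtain ⟨B0, hB0, b0⟩ := cont_supp_bdd (M := M) (c w h.smooth.continuous) (fun x hx => (z _ _ hx).1)
  have : ∀ i, ∃ B, 0 ≤ B ∧ ∀ x : ℝ × ℝ, |pd i w ![0, x.1, x.2]| ≤ B := fun i =>
    cont_supp_bdd (M := M) (c _ (contDiff_pd3 h.smooth i).continuous) (fun x hx => (z _ _ hx).2 i)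
  choose Bi hBi bi using this
  refine ⟨B0 + (Bi 0 + Bi 1 + Bi 2), by linarith [hBi 0, hBi 1, hBi 2], fun a b => ⟨?_, fun i => ?_⟩⟩
  · linarith [b0 (a,b), hBi 0, hBi 1, hBi 2]
  · have := bi i (a,b)
    simp only at this
    fin_cases i <;> simp at this ⊢ <;> linarith [hBi 0, hBi 1, hBi 2]

theorem decay_large {M : ℝ} (hM : 0 < M) {w : R3 → ℝ} (h : IsW M w) :
    ∃ C, 0 ≤ C ∧ ∀ T x1 x2 : ℝ, 1 ≤ T →
      |w ![T,x1,x2]| ≤ C * (√(T * √(1 + (√(x1^2+x2^2) - T)^2)))⁻¹ := by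
  obtain ⟨z, B, hB, hb⟩ := data_bound hM h
  set Kp := π^4 * M^2 * √(1 + 1/(4*M^2)) + 2 * π^2 * M * √(1+4*M^2) with hKp
  have hKp0 : 0 ≤ Kp := by positivity
  refine ⟨32 * π * M * B * (2 * √Kp), by positivity, fun T x1 x2 hT => ?_⟩
  have hT0 : 0 < T := by linarith
  obtain ⟨α, e1, e2⟩ := exists_polar x1 x2
  set r := √(x1^2+x2^2) with hr
  have hr0 : 0 ≤ r := Real.sqrt_nonneg _
  have rep := wave_rep h.smooth h.wave T x1 x2
  set G : ℝ → ℝ → ℝ := fun φ θ => sin φ * (w ![0, x1 + T * sin φ * cos θ, x2 + T * sin φ * sin θ]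
    + T * sin φ * (cos θ * pd 1 w ![0, x1 + T * sin φ * cos θ, x2 + T * sin φ * sin θ]
      + sin θ * pd 2 w ![0, x1 + T * sin φ * cos θ, x2 + T * sin φ * sin θ])
    + T * pd 0 w ![0, x1 + T * sin φ * cos θ, x2 + T * sin φ * sin θ]) with hG
  have rep' : 2 * π * w ![T, x1, x2] = ∫ φ in 0..(π/2), ∫ θ in 0..(2*π), G φ θ := rep
  have hper : ∀ φ, Function.Periodic (G φ) (2*π) := by
    intro φ θ
    simp only [hG, cos_add_two_pi, sin_add_two_pi]
  have hGz : ∀ φ θ, M^2 < (r * cos α + T * sin φ * cos θ)^2 + (r * sin α + T * sin φ * sin θ)^2 →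
      G φ θ = 0 := by
    intro φ θ hφ
    rw [← e1, ← e2] at hφ
    obtain ⟨h1, h2⟩ := z _ _ hφ
    simp only [hG, h1, h2]; ring
  have hGb : ∀ φ θ, 0 ≤ sin φ → |G φ θ| ≤ sin φ * (B * (4 * T)) := by
    intro φ θ hs
    obtain ⟨b0, bi⟩ := hb (x1 + T * sin φ * cos θ) (x2 + T * sin φ * sin θ)
    simp only [hG]
    rw [abs_mul, abs_of_nonneg hs]
    apply mul_le_mul_of_nonneg_left _ hs
    have s1 := sin_le_one φ
    have hTs : |T * sin φ| ≤ T := by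
      rw [abs_of_nonneg (by positivity)]; nlinarith
    have c1 := abs_cos_le_one θ
    have c2 := abs_sin_le_one θ
    refine (abs_add_le _ _).trans ?_
    refine (add_le_add_left (abs_add_le _ _) _).trans ?_
    rw [abs_mul, abs_mul T (pd 0 w _), abs_of_pos hT0]
    have k1 : |cos θ * pd 1 w ![0, x1 + T * sin φ * cos θ, x2 + T * sin φ * sin θ]
      + sin θ * pd 2 w ![0, x1 + T * sin φ * cos θ, x2 + T * sin φ * sin θ]| ≤ 2 * B := by
      refine (abs_add_le _ _).trans ?_
      rw [abs_mul, abs_mul]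
      have := mul_le_mul c1 (bi 1) (abs_nonneg _) zero_le_one
      have := mul_le_mul c2 (bi 2) (abs_nonneg _) zero_le_one
      linarith
    have k2 := mul_le_mul hTs k1 (abs_nonneg _) hT0.le
    have k3 := mul_le_mul_of_nonneg_left (bi 0) hT0.le
    have k4 : B ≤ B * T := le_mul_of_one_le_right hB hT
    linarith
  have hIb : ∀ φ ∈ Set.Ioc 0 (π/2), |∫ θ in 0..(2*π), G φ θ| ≤ 32 * π * M * B := by
    intro φ hφ
    have hs : 0 < sin φ := sin_pos_of_pos_of_lt_pi hφ.1 (by linarith [hφ.2, pi_pos])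
    have e : ∫ θ in 0..(2*π), G φ θ = ∫ θ in α..(α + 2*π), G φ θ := by
      have := (hper φ).intervalIntegral_add_eq 0 α
      rw [zero_add] at this; exact this
    rw [e]
    have := small_supp (f := G φ) (a := α) (b := α + 2*π) (K := sin φ * (B * (4*T)))
      (δ := 4 * π * M / (T * sin φ)) (by linarith [pi_pos]) (by positivity) (by positivity)
      (fun θ _ => hGb φ θ hs.le) (fun θ1 h1 θ2 h2 n1 n2 => by
        refine angle_bound hM hr0 (by positivity) h1 h2 ?_ ?_
        · by_contra hc; exact n1 (hGz _ _ (by push Not at hc; exact hc))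
        · by_contra hc; exact n2 (hGz _ _ (by push Not at hc; exact hc)))
    refine this.trans (le_of_eq ?_)
    field_simp; ring
  have hIs : ∀ φ ∈ Set.Ioc 0 (π/2), (∫ θ in 0..(2*π), G φ θ) ≠ 0 → |T * cos (π/2 - φ) - r| ≤ M := by
    intro φ hφ hne
    by_contra hc
    push Not at hc
    apply hne
    rw [intervalIntegral.integral_congr (g := fun _ => 0)]
    · simp
    · intro θ _
      apply hGz
      rw [norm_shift]
      rw [cos_pi_div_two_sub] at hc
      have hs : 0 < sin φ := sin_pos_of_pos_of_lt_pi hφ.1 (by linarith [hφ.2, pi_pos])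
      have : 0 ≤ 4 * r * (T * sin φ) * cos ((θ - α)/2) ^ 2 := by positivity
      have : M^2 < (T * sin φ - r)^2 := by
        rw [← sq_abs (T * sin φ - r)]
        exact pow_lt_pow_left₀ hc hM.le two_ne_zero
      nlinarith
  set W := T * √(1 + (r - T)^2) with hW
  have hW0 : 0 < W := by positivity
  have main := small_supp (f := fun φ => ∫ θ in 0..(2*π), G φ θ) (a := 0) (b := π/2)
    (K := 32 * π * M * B) (δ := √Kp * (√W)⁻¹) (by positivity) (by positivity) (by positivity) hIb (by
      intro φ1 h1 φ2 h2 n1 n2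
      have k1 := hIs _ h1 n1
      have k2 := hIs _ h2 n2
      have : (φ1 - φ2)^2 * W ≤ Kp := by
        rcases le_total φ1 φ2 with hle | hle
        · have := phi_bound hM hT0 (ψ1 := π/2 - φ2) (ψ2 := π/2 - φ1) (by linarith [h2.2]) (by linarith)
            (by linarith [h1.1]) k2 k1
          refine le_trans (le_of_eq ?_) this
          rw [hW]; ring
        · have := phi_bound hM hT0 (ψ1 := π/2 - φ1) (ψ2 := π/2 - φ2) (by linarith [h1.2]) (by linarith)
            (by linarith [h2.1]) k1 k2
          refine le_trans (le_of_eq ?_) this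
          rw [hW]; ring
      rw [← div_eq_mul_inv, le_div_iff₀ (by positivity)]
      apply Real.le_sqrt_of_sq_le
      rw [mul_pow, sq_abs, Real.sq_sqrt hW0.le]
      exact this)
  rw [← rep'] at main
  have hpi : 1 ≤ 2 * π := by linarith [pi_gt_three]
  have : |w ![T,x1,x2]| ≤ |2 * π * w ![T,x1,x2]| := by
    rw [abs_mul, abs_of_pos (by positivity : 0 < 2*π)]
    nlinarith [abs_nonneg (w ![T,x1,x2])]
  refine this.trans (main.trans (le_of_eq ?_))
  ring

theorem decay_bound {M : ℝ} (hM : 0 < M) {w : R3 → ℝ} (h : IsW M w) :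
    ∃ C, 0 ≤ C ∧ ∀ T x1 x2 : ℝ, 0 ≤ T →
      |w ![T,x1,x2]| ≤ C * ((√(1+T))⁻¹ * (√(√(1 + (√(x1^2+x2^2) - T)^2)))⁻¹) := by
  obtain ⟨C, hC, hb⟩ := decay_large hM h
  -- compact part
  have hcont : Continuous (fun p : ℝ × ℝ × ℝ => w ![p.1, p.2.1, p.2.2]) :=
    continuous_cart h.smooth.continuous continuous_fst (by fun_prop) (by fun_prop)
  have hc : IsCompact (Set.Icc (0:ℝ) 1 ×ˢ Set.Icc (-(M+1)) (M+1) ×ˢ Set.Icc (-(M+1)) (M+1)) :=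
    isCompact_Icc.prod (isCompact_Icc.prod isCompact_Icc)
  obtain ⟨B, hB⟩ := hc.exists_bound_of_continuousOn hcont.continuousOn
  set L := √2 * √(√(1 + (M+1)^2)) with hL
  refine ⟨√2 * C + max B 0 * L, by positivity, fun T x1 x2 hT => ?_⟩
  set r := √(x1^2+x2^2) with hr
  have hr0 : 0 ≤ r := Real.sqrt_nonneg _
  have hr2 : r^2 = x1^2+x2^2 := Real.sq_sqrt (by positivity)
  have hpos : 0 ≤ (√(1+T))⁻¹ * (√(√(1 + (r - T)^2)))⁻¹ := by positivity
  rcases le_or_gt 1 T with h1 | h1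
  · refine (hb T x1 x2 h1).trans ?_
    have e : (√(T * √(1 + (r - T)^2)))⁻¹ ≤ √2 * ((√(1+T))⁻¹ * (√(√(1 + (r - T)^2)))⁻¹) := by
      rw [Real.sqrt_mul (by linarith), mul_inv, ← mul_assoc]
      apply mul_le_mul_of_nonneg_right _ (by positivity)
      rw [← div_eq_mul_inv, inv_eq_one_div, div_le_div_iff₀ (by positivity) (by positivity),
        ← Real.sqrt_mul (by norm_num), _root_.one_mul]
      apply Real.sqrt_le_sqrt; linarith
    calc C * (√(T * √(1 + (r - T)^2)))⁻¹ ≤ C * (√2 * ((√(1+T))⁻¹ * (√(√(1 + (r - T)^2)))⁻¹)) := by gcongr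
      _ ≤ _ := by
        rw [add_mul]
        have : 0 ≤ max B 0 * L * ((√(1+T))⁻¹ * (√(√(1 + (r - T)^2)))⁻¹) := by positivity
        linarith
  · by_cases hsup : (M + T)^2 < x1^2+x2^2
    · rw [h.supp ![T,x1,x2] (by simpa using hT) (by simpa using hsup)]
      simp; positivity
    · push Not at hsup
      have hrM : r ≤ M + T := by
        rw [← hr2] at hsup; exact le_of_sq_le_sq hsup (by linarith)
      have a1 : |x1| ≤ M+1 := abs_le_of_sq_le_sq (by nlinarith [sq_nonneg x2]) (by linarith)
      have a2 : |x2| ≤ M+1 := abs_le_of_sq_le_sq (by nlinarith [sq_nonneg x1]) (by linarith)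
      have b := hB (T, x1, x2) ⟨⟨hT, h1.le⟩, abs_le.1 a1, abs_le.1 a2⟩
      simp only [Real.norm_eq_abs] at b
      have hl : 1 ≤ L * ((√(1+T))⁻¹ * (√(√(1 + (r - T)^2)))⁻¹) := by
        rw [← mul_inv, ← div_eq_mul_inv, le_div_iff₀ (by positivity), _root_.one_mul]
        apply mul_le_mul _ _ (by positivity) (by positivity)
        · apply Real.sqrt_le_sqrt; linarith
        · apply Real.sqrt_le_sqrt; apply Real.sqrt_le_sqrt
          have : (r-T)^2 ≤ (M+1)^2 := by
            apply sq_le_sq'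
            · linarith
            · linarith
          linarith
      have h3 : max B 0 ≤ max B 0 * (L * ((√(1+T))⁻¹ * (√(√(1 + (r - T)^2)))⁻¹)) := by
        nlinarith [le_max_right B 0]
      have h4 : 0 ≤ √2 * C * ((√(1+T))⁻¹ * (√(√(1 + (r - T)^2)))⁻¹) := by positivity
      rw [add_mul, mul_assoc (max B 0)]
      linarith [le_max_left B 0]
end

noncomputable section

/-! ### The radiation field as a limit -/

theorem ii_restrict {f : ℝ → ℝ} (hf : Continuous f) {a b c d : ℝ} (hac : a ≤ c) (hdb : d ≤ b)
    (h1 : ∀ x, a ≤ x → x < c → f x = 0) (h2 : ∀ x, d < x → x ≤ b → f x = 0) :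
    ∫ x in a..b, f x = ∫ x in c..d, f x := by
  have i := fun a b => hf.intervalIntegrable (μ := volume) a b
  rw [← intervalIntegral.integral_add_adjacent_intervals (i a c) (i c b),
    ← intervalIntegral.integral_add_adjacent_intervals (i c d) (i d b)]
  have e1 : ∫ x in a..c, f x = 0 := by
    rw [intervalIntegral.integral_of_le hac, ← integral_Ico_eq_integral_Ioc,
      setIntegral_congr_fun measurableSet_Ico (g := fun _ => 0) (fun x hx => h1 x hx.1 hx.2)]
    simp
  have e2 : ∫ x in d..b, f x = 0 := by
    rw [intervalIntegral.integral_of_le hdb,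
      setIntegral_congr_fun measurableSet_Ioc (g := fun _ => 0) (fun x hx => h2 x hx.1 hx.2)]
    simp
  rw [e1, e2]; ring

/-- point on the plane in the frame `ω, ω^⊥` -/
def zpt (θ a b : ℝ) : R3 := ![0, a * cos θ - b * sin θ, a * sin θ + b * cos θ]

theorem cont_zpt {X : Type*} [TopologicalSpace X] {f : R3 → ℝ} (hf : Continuous f) (θ : ℝ)
    {a b : X → ℝ} (ha : Continuous a) (hb : Continuous b) : Continuous (fun p => f (zpt θ (a p) (b p))) :=
  continuous_cart hf continuous_const (by fun_prop) (by fun_prop)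

theorem tendsto_zpt {X : Type*} {l : Filter X} {f : R3 → ℝ} (hf : Continuous f) (θ : ℝ)
    {a b : X → ℝ} {a0 b0 : ℝ} (ha : Tendsto a l (𝓝 a0)) (hb : Tendsto b l (𝓝 b0)) :
    Tendsto (fun p => f (zpt θ (a p) (b p))) l (𝓝 (f (zpt θ a0 b0))) := by
  have c : Continuous (fun x : ℝ × ℝ => f (zpt θ x.1 x.2)) := cont_zpt hf θ continuous_fst continuous_snd
  have h1 := c.tendsto (a0, b0)
  have h2 := ha.prodMk_nhds hb
  exact h1.comp h2

theorem zpt_norm (θ a b : ℝ) : (a * cos θ - b * sin θ)^2 + (a * sin θ + b * cos θ)^2 = a^2 + b^2 := by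
  linear_combination (a^2+b^2) * sin_sq_add_cos_sq θ

/-- rescaled representation -/
def Hres (w : R3 → ℝ) (θ q T y p : ℝ) : ℝ :=
  cos (y / √T) *
    (w (zpt θ (q + T - T * cos (y/√T) * cos (p/T)) (T * cos (y/√T) * sin (p/T))) / T
     - cos (y/√T) * (cos (θ - p/T) * pd 1 w (zpt θ (q + T - T * cos (y/√T) * cos (p/T)) (T * cos (y/√T) * sin (p/T)))
        + sin (θ - p/T) * pd 2 w (zpt θ (q + T - T * cos (y/√T) * cos (p/T)) (T * cos (y/√T) * sin (p/T))))
     + pd 0 w (zpt θ (q + T - T * cos (y/√T) * cos (p/T)) (T * cos (y/√T) * sin (p/T))))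

theorem rep_res {M : ℝ} (hM : 0 < M) {w : R3 → ℝ} (h : IsW M w) (θ q T : ℝ) (hT : 0 < T) :
    √T * (2 * π * w ![T, (T+q) * cos θ, (T+q) * sin θ])
      = ∫ y in 0..(π/2*√T), ∫ p in (-(π*T))..(π*T), Hres w θ q T y p := by
  have rep := wave_rep h.smooth h.wave T ((T+q) * cos θ) ((T+q) * sin θ)
  set x1 := (T+q) * cos θ with hx1
  set x2 := (T+q) * sin θ with hx2
  set G : ℝ → ℝ → ℝ := fun φ θ => sin φ * (w ![0, x1 + T * sin φ * cos θ, x2 + T * sin φ * sin θ]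
    + T * sin φ * (cos θ * pd 1 w ![0, x1 + T * sin φ * cos θ, x2 + T * sin φ * sin θ]
      + sin θ * pd 2 w ![0, x1 + T * sin φ * cos θ, x2 + T * sin φ * sin θ])
    + T * pd 0 w ![0, x1 + T * sin φ * cos θ, x2 + T * sin φ * sin θ]) with hG
  have rep' : 2 * π * w ![T, x1, x2] = ∫ φ in 0..(π/2), ∫ θ in 0..(2*π), G φ θ := rep
  have hper : ∀ φ, Function.Periodic (G φ) (2*π) := by
    intro φ θ
    simp only [hG, cos_add_two_pi, sin_add_two_pi]
  have hs : 0 < √T := Real.sqrt_pos.2 hT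
  have hpt : ∀ y p, G (π/2 - (√T)⁻¹ * y) (θ + π - T⁻¹ * p) = T * Hres w θ q T y p := by
    intro y p
    have e1 : (√T)⁻¹ * y = y / √T := by ring
    have e2 : T⁻¹ * p = p / T := by ring
    have e3 : cos (θ + π - p/T) = - cos (θ - p/T) := by
      rw [show θ + π - p/T = (θ - p/T) + π by ring, cos_add_pi]
    have e4 : sin (θ + π - p/T) = - sin (θ - p/T) := by
      rw [show θ + π - p/T = (θ - p/T) + π by ring, sin_add_pi]
    have e5 : (![0, x1 + T * cos (y/√T) * -cos (θ - p/T), x2 + T * cos (y/√T) * -sin (θ - p/T)] : R3)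
        = zpt θ (q + T - T * cos (y/√T) * cos (p/T)) (T * cos (y/√T) * sin (p/T)) := by
      rw [zpt, hx1, hx2, cos_sub, sin_sub]
      congr 1
      ext i; fin_cases i
      · simp; ring
      · simp; ring
    simp only [hG, e1, e2, e3, e4, sin_pi_div_two_sub, e5, Hres]
    field_simp
    ring
  have inner : ∀ y, ∫ θ' in 0..(2*π), G (π/2 - (√T)⁻¹ * y) θ'
      = ∫ p in (-(π*T))..(π*T), Hres w θ q T y p := by
    intro y
    have e : ∫ θ' in 0..(2*π), G (π/2 - (√T)⁻¹ * y) θ' = ∫ θ' in θ..(θ + 2*π), G (π/2 - (√T)⁻¹ * y) θ' := by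
      have := (hper (π/2 - (√T)⁻¹ * y)).intervalIntegral_add_eq 0 θ
      rw [zero_add] at this; exact this
    have e2 := intervalIntegral.integral_comp_sub_mul (a := -(π*T)) (b := π*T)
      (fun θ' => G (π/2 - (√T)⁻¹ * y) θ') (c := T⁻¹) (by positivity) (θ+π)
    simp only [hpt] at e2
    rw [intervalIntegral.integral_const_mul] at e2
    have e3 : θ + π - T⁻¹ * (π * T) = θ := by field_simp; ring
    have e4 : θ + π - T⁻¹ * -(π * T) = θ + 2*π := by field_simp; ring
    rw [e3, e4, inv_inv, smul_eq_mul] at e2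
    rw [e]
    exact (mul_left_cancel₀ hT.ne' e2).symm
  have outer := intervalIntegral.integral_comp_sub_mul (a := 0) (b := π/2*√T)
      (fun φ => ∫ θ' in 0..(2*π), G φ θ') (c := (√T)⁻¹) (by positivity) (π/2)
  simp only [inner] at outer
  have e3 : π/2 - (√T)⁻¹ * (π/2*√T) = 0 := by field_simp; ring
  have e4 : π/2 - (√T)⁻¹ * 0 = π/2 := by ring
  rw [e3, e4, inv_inv, smul_eq_mul, ← rep'] at outer
  exact outer.symm

theorem Hres_cont {M : ℝ} {w : R3 → ℝ} (h : IsW M w) (θ q T : ℝ) :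
    Continuous (fun x : ℝ × ℝ => Hres w θ q T x.1 x.2) := by
  have c : ∀ f : R3 → ℝ, Continuous f → Continuous (fun x : ℝ × ℝ =>
      f (zpt θ (q + T - T * cos (x.1/√T) * cos (x.2/T)) (T * cos (x.1/√T) * sin (x.2/T)))) := by
    intro f hf
    exact cont_zpt hf θ (by fun_prop) (by fun_prop)
  have c0 := c w h.smooth.continuous
  have c1 := fun i => c (pd i w) (contDiff_pd3 h.smooth i).continuous
  have c10 := c1 0
  have c11 := c1 1
  have c12 := c1 2
  have k1 : Continuous (fun x : ℝ × ℝ => cos (x.1/√T)) := by fun_prop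
  have k2 : Continuous (fun x : ℝ × ℝ => cos (θ - x.2/T)) := by fun_prop
  have k3 : Continuous (fun x : ℝ × ℝ => sin (θ - x.2/T)) := by fun_prop
  exact k1.mul (((c0.div_const T).sub (k1.mul ((k2.mul c11).add (k3.mul c12)))).add c10)

theorem Hres_zero {M : ℝ} (hM : 0 < M) {w : R3 → ℝ} (h : IsW M w) (θ q T y p : ℝ) (hT : 0 < T)
    (hTq : 2 * (M + |q|) ≤ T) (hy0 : 0 ≤ y) (hy : y ≤ π/2*√T) (hp : |p| ≤ π * T)
    (hne : Hres w θ q T y p ≠ 0) : y ≤ π * √(M+|q|) ∧ |p| ≤ π * M := by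
  have hpi := pi_pos
  obtain ⟨z, _⟩ := data_bound hM h
  have hsT : 0 < √T := Real.sqrt_pos.2 hT
  have hsT2 : √T^2 = T := Real.sq_sqrt hT.le
  set ψ := y / √T with hψ
  have hψ0 : 0 ≤ ψ := by positivity
  have hψ1 : ψ ≤ π/2 := by rw [hψ, div_le_iff₀ hsT]; exact hy
  have hc0 : 0 ≤ cos ψ := cos_nonneg_of_mem_Icc ⟨by linarith, hψ1⟩
  set β := p / T with hβ
  have hβ1 : |β| ≤ π := by rw [hβ, abs_div, abs_of_pos hT, div_le_iff₀ hT]; exact hp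
  have hn : (q + T - T * cos ψ * cos β)^2 + (T * cos ψ * sin β)^2 ≤ M^2 := by
    by_contra hc
    push Not at hc
    apply hne
    rw [← zpt_norm θ] at hc
    obtain ⟨k0, k1⟩ := z _ _ hc
    unfold Hres zpt
    rw [k0, k1, k1, k1]; simp
  have e : (q + T - T * cos ψ * cos β)^2 + (T * cos ψ * sin β)^2
      = (q + T - T * cos ψ)^2 + 4 * (q + T) * (T * cos ψ) * sin (β/2)^2 := by
    have h1 : cos β = 1 - 2 * sin (β/2)^2 := by
      have := cos_sq' (β/2)
      have h2 : cos β = 2 * cos (β/2)^2 - 1 := by rw [← cos_two_mul]; ring_nf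
      linarith
    have h2 := sin_sq_add_cos_sq β
    have : (T * cos ψ * sin β)^2 = (T * cos ψ)^2 * (1 - cos β^2) := by rw [← h2]; ring
    rw [this, h1]; ring
  rw [e] at hn
  have hq1 := abs_le.1 (le_refl |q|)
  have hqT : 0 ≤ q + T := by linarith [hq1.1, abs_nonneg q]
  have p1 : 0 ≤ 4 * (q + T) * (T * cos ψ) * sin (β/2)^2 := by positivity
  have h3 : |q + T - T * cos ψ| ≤ M := abs_le_of_sq_le_sq (by linarith) hM.le
  have h3' := abs_le.1 h3
  constructor
  · have c2 : 2/π^2 * ψ^2 ≤ 1 - cos ψ := by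
      have e : cos ψ = 1 - 2 * sin (ψ/2)^2 := by
        have := cos_sq' (ψ/2)
        have h2 : cos ψ = 2 * cos (ψ/2)^2 - 1 := by rw [← cos_two_mul]; ring_nf
        linarith
      have s1 := mul_le_sin (x := ψ/2) (by linarith) (by linarith)
      have h0 : 0 ≤ 2/π*(ψ/2) := mul_nonneg (by positivity) (by linarith)
      have := pow_le_pow_left₀ h0 s1 2
      have e2 : (2/π*(ψ/2))^2 = 1/π^2*ψ^2 := by field_simp
      rw [e2] at this
      rw [e]
      have e3 : 2/π^2 * ψ^2 = 2 * (1/π^2*ψ^2) := by ring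
      linarith
    have c3 := mul_le_mul_of_nonneg_left c2 hT.le
    have e4 : T * (2/π^2 * ψ^2) = 2 * (y^2/π^2) := by
      rw [hψ, div_pow, hsT2]; field_simp
    rw [e4] at c3
    have c4 : y^2/π^2 ≤ M + |q| := by
      have : 0 ≤ y^2/π^2 := by positivity
      have : T * (1 - cos ψ) = T - T * cos ψ := by ring
      linarith [h3'.1, h3'.2, hq1.1]
    rw [div_le_iff₀ (by positivity)] at c4
    apply le_of_sq_le_sq _ (by positivity)
    rw [mul_pow, Real.sq_sqrt (by positivity)]; linarith
  · have r1 : T/2 ≤ q + T := by linarith [hq1.1]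
    have r2 : T/2 ≤ T * cos ψ := by linarith [h3'.2, hq1.1]
    have s1 : |β|/π ≤ |sin (β/2)| := by
      have := mul_abs_le_abs_sin (x := β/2) (by rw [abs_div]; simp; linarith)
      rw [abs_div] at this
      simp at this
      exact this
    have h5 : (|β|/π)^2 ≤ sin (β/2)^2 := by
      rw [← sq_abs (sin (β/2))]
      exact pow_le_pow_left₀ (by positivity) s1 2
    have h6 : T/2 * (T/2) ≤ (q+T) * (T * cos ψ) := mul_le_mul r1 r2 (by positivity) hqT
    have h7 : T/2 * (T/2) * (|β|/π)^2 ≤ (q+T) * (T * cos ψ) * sin (β/2)^2 :=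
      mul_le_mul h6 h5 (by positivity) (by positivity)
    have h8 : (T * (|β|/π))^2 ≤ M^2 := by nlinarith [sq_nonneg (q + T - T * cos ψ)]
    have h9 : T * (|β|/π) ≤ M := le_of_sq_le_sq h8 hM.le
    have e5 : T * (|β|/π) = |p|/π := by rw [hβ, abs_div, abs_of_pos hT]; field_simp
    rw [e5, div_le_iff₀ hpi] at h9
    linarith

theorem Hres_bdd {M : ℝ} (hM : 0 < M) {w : R3 → ℝ} (h : IsW M w) :
    ∃ K, 0 ≤ K ∧ ∀ θ q T y p, 1 ≤ T → |Hres w θ q T y p| ≤ K := by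
  obtain ⟨_, B, hB, hb⟩ := data_bound hM h
  refine ⟨4 * B, by positivity, fun θ q T y p hT => ?_⟩
  unfold Hres
  set ψ := y / √T
  obtain ⟨b0, bi⟩ := hb ((q + T - T * cos ψ * cos (p/T)) * cos θ - (T * cos ψ * sin (p/T)) * sin θ)
    ((q + T - T * cos ψ * cos (p/T)) * sin θ + (T * cos ψ * sin (p/T)) * cos θ)
  unfold zpt
  set Z : R3 := ![0, (q + T - T * cos ψ * cos (p/T)) * cos θ - (T * cos ψ * sin (p/T)) * sin θ,
    (q + T - T * cos ψ * cos (p/T)) * sin θ + (T * cos ψ * sin (p/T)) * cos θ]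
  have m : ∀ a b : ℝ, |a| ≤ 1 → ∀ K, |b| ≤ K → |a * b| ≤ K := by
    intro a b ha K hb
    rw [abs_mul]
    nlinarith [abs_nonneg a, abs_nonneg b]
  apply m _ _ (abs_cos_le_one _)
  refine (abs_add_le _ _).trans ?_
  have k1 : |w Z / T - cos ψ * (cos (θ - p/T) * pd 1 w Z + sin (θ - p/T) * pd 2 w Z)| ≤ B + (B + B) := by
    refine (abs_sub _ _).trans (add_le_add ?_ ?_)
    · rw [abs_div, abs_of_pos (by linarith : 0 < T)]
      exact (div_le_self (abs_nonneg _) hT).trans b0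
    · apply m _ _ (abs_cos_le_one _)
      refine (abs_add_le _ _).trans (add_le_add ?_ ?_)
      · exact m _ _ (abs_cos_le_one _) _ (bi 1)
      · exact m _ _ (abs_sin_le_one _) _ (bi 2)
  linarith [bi 0]

/-- limiting integrand -/
def Hlim (w : R3 → ℝ) (θ s p : ℝ) : ℝ :=
  pd 0 w (zpt θ s p) - (cos θ * pd 1 w (zpt θ s p) + sin θ * pd 2 w (zpt θ s p))

theorem tends_sin (p : ℝ) : Tendsto (fun T : ℝ => T * sin (p/T)) atTop (𝓝 p) := by
  have h : Tendsto (fun x : ℝ => p * sinc (p / x)) atTop (𝓝 (p * sinc 0)) := by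
    apply Tendsto.const_mul
    exact (continuous_sinc.tendsto 0).comp (tendsto_const_nhds.div_atTop tendsto_id)
  rw [sinc_zero, mul_one] at h
  refine h.congr' ?_
  filter_upwards [eventually_gt_atTop 0] with T hT
  by_cases hp : p = 0
  · simp [hp]
  · rw [sinc_of_ne_zero (by positivity)]
    field_simp

theorem tends_cos (y : ℝ) : Tendsto (fun T : ℝ => T * (1 - cos (y/√T))) atTop (𝓝 (y^2/2)) := by
  have h := tends_sin (y/2)
  have h2 := (h.pow 2).const_mul 2
  have e : 2 * (y/2)^2 = y^2/2 := by ring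
  rw [e] at h2
  have h3 := h2.comp tendsto_sqrt_atTop
  refine h3.congr' ?_
  filter_upwards [eventually_gt_atTop 0] with T hT
  simp only [Function.comp]
  have h1 : cos (y/√T) = 1 - 2 * sin (y/2/√T)^2 := by
    have := cos_sq' (y/2/√T)
    have h2 : cos (y/√T) = 2 * cos (y/2/√T)^2 - 1 := by rw [← cos_two_mul]; ring_nf
    linarith
  rw [h1, mul_pow, Real.sq_sqrt hT.le]; ring

theorem tends_cos1 (y : ℝ) : Tendsto (fun T : ℝ => cos (y/√T)) atTop (𝓝 1) := by
  have := (continuous_cos.tendsto 0).comp ((tendsto_const_nhds (x := y)).div_atTop tendsto_sqrt_atTop)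
  rwa [cos_zero] at this

theorem tends_cosp (p : ℝ) : Tendsto (fun T : ℝ => T * (1 - cos (p/T))) atTop (𝓝 0) := by
  have h := (tends_sin (p/2)).mul ((continuous_sin.tendsto 0).comp
    ((tendsto_const_nhds (x := p/2)).div_atTop tendsto_id))
  rw [sin_zero, mul_zero] at h
  have h2 := h.const_mul 2
  rw [mul_zero] at h2
  refine h2.congr fun T => ?_
  simp only [Function.comp, id]
  have h1 : cos (p/T) = 1 - 2 * sin (p/2/T)^2 := by
    have := cos_sq' (p/2/T)
    have h2 : cos (p/T) = 2 * cos (p/2/T)^2 - 1 := by rw [← cos_two_mul]; ring_nf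
    linarith
  rw [h1]; ring

theorem Hres_tendsto {M : ℝ} {w : R3 → ℝ} (h : IsW M w) (θ q y p : ℝ) :
    Tendsto (fun T => Hres w θ q T y p) atTop (𝓝 (Hlim w θ (q + y^2/2) p)) := by
  have ta : Tendsto (fun T : ℝ => q + T - T * cos (y/√T) * cos (p/T)) atTop (𝓝 (q + y^2/2)) := by
    have h1 := ((tends_cos y).add ((tends_cos1 y).mul (tends_cosp p))).const_add q
    rw [mul_zero, add_zero] at h1
    refine h1.congr fun T => ?_
    ring
  have tb : Tendsto (fun T : ℝ => T * cos (y/√T) * sin (p/T)) atTop (𝓝 p) := by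
    have h1 := (tends_cos1 y).mul (tends_sin p)
    rw [_root_.one_mul] at h1
    refine h1.congr fun T => ?_
    ring
  have tz : ∀ f : R3 → ℝ, Continuous f → Tendsto (fun T : ℝ =>
      f (zpt θ (q + T - T * cos (y/√T) * cos (p/T)) (T * cos (y/√T) * sin (p/T)))) atTop
      (𝓝 (f (zpt θ (q + y^2/2) p))) := by
    intro f hf
    exact tendsto_zpt hf θ ta tb
  have t0 := tz w h.smooth.continuous
  have ti := fun i => tz (pd i w) (contDiff_pd3 h.smooth i).continuous
  have tp : Tendsto (fun T : ℝ => p/T) atTop (𝓝 0) := tendsto_const_nhds.div_atTop tendsto_id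
  have tθ : Tendsto (fun T : ℝ => θ - p/T) atTop (𝓝 θ) := by
    have := tp.const_sub θ
    rwa [sub_zero] at this
  have tc : Tendsto (fun T : ℝ => cos (θ - p/T)) atTop (𝓝 (cos θ)) := (continuous_cos.tendsto θ).comp tθ
  have ts : Tendsto (fun T : ℝ => sin (θ - p/T)) atTop (𝓝 (sin θ)) := (continuous_sin.tendsto θ).comp tθ
  have big := (tends_cos1 y).mul (((t0.div_atTop tendsto_id).sub
    ((tends_cos1 y).mul ((tc.mul (ti 1)).add (ts.mul (ti 2))))).add (ti 0))
  have e : 1 * ((0 - 1 * (cos θ * pd 1 w (zpt θ (q + y^2/2) p) + sin θ * pd 2 w (zpt θ (q + y^2/2) p)))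
    + pd 0 w (zpt θ (q + y^2/2) p)) = Hlim w θ (q + y^2/2) p := by unfold Hlim; ring
  rw [e] at big
  exact big

theorem limit_int {M : ℝ} (hM : 0 < M) {w : R3 → ℝ} (h : IsW M w) (θ q : ℝ) :
    Tendsto (fun T => √T * (2 * π * w ![T, (T+q) * cos θ, (T+q) * sin θ])) atTop
      (𝓝 (∫ y in 0..(π * √(M+|q|)), ∫ p in (-(π*M))..(π*M), Hlim w θ (q + y^2/2) p)) := by
  obtain ⟨K, hK, hb⟩ := Hres_bdd hM h
  have hpi := pi_pos
  have hev : ∀ᶠ T in atTop, √T * (2 * π * w ![T, (T+q) * cos θ, (T+q) * sin θ])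
      = ∫ y in 0..(π * √(M+|q|)), ∫ p in (-(π*M))..(π*M), Hres w θ q T y p := by
    filter_upwards [eventually_gt_atTop 0, eventually_ge_atTop (4 * (M+|q|))] with T hT hT2
    have hq := abs_nonneg q
    rw [rep_res hM h θ q T hT]
    have hTM : M ≤ T := by linarith
    have hYT : π * √(M+|q|) ≤ π/2*√T := by
      have h1 : √(4 * (M+|q|)) ≤ √T := Real.sqrt_le_sqrt hT2
      rw [Real.sqrt_mul (by norm_num), show (4:ℝ) = 2^2 by norm_num, Real.sqrt_sq (by norm_num)] at h1
      nlinarith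
    have hcu := Hres_cont h θ q T
    rw [ii_restrict (c := 0) (d := π * √(M+|q|)) _ le_rfl hYT (fun x h1 h2 => absurd h1 (not_le.2 h2))]
    · apply intervalIntegral.integral_congr
      intro y hy
      rw [Set.uIcc_of_le (by positivity)] at hy
      simp only
      apply ii_restrict (hcu.comp (by fun_prop : Continuous fun p : ℝ => (y, p)))
      · nlinarith
      · nlinarith
      · intro p h1 h2
        by_contra hne
        have := (Hres_zero hM h θ q T y p hT (by linarith) hy.1 (hy.2.trans hYT)
          (abs_le.2 ⟨by linarith, by nlinarith⟩) hne).2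
        linarith [(abs_le.1 this).1]
      · intro p h1 h2
        by_contra hne
        have := (Hres_zero hM h θ q T y p hT (by linarith) hy.1 (hy.2.trans hYT)
          (abs_le.2 ⟨by nlinarith, by linarith⟩) hne).2
        linarith [(abs_le.1 this).2]
    · intro y h1 h2
      rw [intervalIntegral.integral_congr (g := fun _ => 0)]
      · simp
      · intro p hp
        rw [Set.uIcc_of_le (by nlinarith)] at hp
        by_contra hne
        have := (Hres_zero hM h θ q T y p hT (by linarith) (le_trans (by positivity) h1.le) h2
          (abs_le.2 hp) hne).1
        linarith
    · exact intervalIntegral.continuous_parametric_intervalIntegral_of_continuous' hcu _ _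
  refine Tendsto.congr' (hev.mono fun T hT => hT.symm) ?_
  have inner : ∀ y, Tendsto (fun T => ∫ p in (-(π*M))..(π*M), Hres w θ q T y p) atTop
      (𝓝 (∫ p in (-(π*M))..(π*M), Hlim w θ (q + y^2/2) p)) := by
    intro y
    apply intervalIntegral.tendsto_integral_filter_of_dominated_convergence (fun _ => K)
    · exact Eventually.of_forall fun T => ((Hres_cont h θ q T).comp
        (by fun_prop : Continuous fun p : ℝ => (y, p))).aestronglyMeasurable
    · filter_upwards [eventually_ge_atTop 1] with T hT
      exact Eventually.of_forall fun p _ => hb θ q T y p hT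
    · exact intervalIntegrable_const
    · exact Eventually.of_forall fun p _ => Hres_tendsto h θ q y p
  apply intervalIntegral.tendsto_integral_filter_of_dominated_convergence (fun _ => K * |π*M - -(π*M)|)
  · exact Eventually.of_forall fun T =>
      (intervalIntegral.continuous_parametric_intervalIntegral_of_continuous'
        (Hres_cont h θ q T) _ _).aestronglyMeasurable
  · filter_upwards [eventually_ge_atTop 1] with T hT
    refine Eventually.of_forall fun y _ => ?_
    exact intervalIntegral.norm_integral_le_of_norm_le_const fun p _ => hb θ q T y p hT
  · exact intervalIntegrable_const
  · exact Eventually.of_forall fun y _ => inner y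
end

noncomputable section

theorem radon_eq {P : ℝ} {v : ℝ × ℝ → ℝ} {M : ℝ} (hM : 0 < M) (hv : SuppIn M v) (hP : M < P) (s θ : ℝ) :
    radon v s θ = ∫ t in (-P)..P, v (s * cos θ - t * sin θ, s * sin θ + t * cos θ) := by
  unfold radon
  symm
  apply intervalIntegral.integral_eq_integral_of_support_subset
  intro t ht
  rw [Function.mem_support] at ht
  have : t^2 ≤ M^2 := by
    by_contra hc
    push Not at hc
    apply ht
    apply hv
    simp only
    rw [zpt_norm]; nlinarith [sq_nonneg s]
  have := abs_le_of_sq_le_sq this hM.le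
  have := abs_le.1 this
  constructor <;> linarith [this.1, this.2]

theorem radon_zero {v : ℝ × ℝ → ℝ} {M : ℝ} (hM : 0 < M) (hv : SuppIn M v) (s θ : ℝ) (hs : M < s) :
    radon v s θ = 0 := by
  unfold radon
  have : (fun t : ℝ => v (s * cos θ - t * sin θ, s * sin θ + t * cos θ)) = fun _ => 0 := by
    funext t
    apply hv
    simp only
    rw [zpt_norm]; nlinarith [sq_nonneg t]
  rw [this]; simp

section
variable {M : ℝ} {φ0 φ1 : ℝ × ℝ → ℝ} {w0 : R3 → ℝ}

theorem radon_Hlim (hM : 0 < M) (hs0 : SuppIn M φ0) (hs1 : SuppIn M φ1) (h : IsW M w0)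
    (hw0init : ∀ x : ℝ × ℝ, w0 ![0, x.1, x.2] = φ0 x ∧ pd 0 w0 ![0, x.1, x.2] = φ1 x) (s θ : ℝ) :
    radon φ1 s θ - deriv (fun s' => radon φ0 s' θ) s = ∫ p in (-(π*M))..(π*M), Hlim w0 θ s p := by
  have hP : M < π * M := by nlinarith [pi_gt_three]
  rw [radon_eq hM hs1 hP]
  have e0 : ∀ s p, φ0 (s * cos θ - p * sin θ, s * sin θ + p * cos θ) = w0 (zpt θ s p) := fun s p =>
    (hw0init _).1.symm
  have e1 : ∀ s p, φ1 (s * cos θ - p * sin θ, s * sin θ + p * cos θ) = pd 0 w0 (zpt θ s p) := fun s p =>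
    (hw0init _).2.symm
  have c1 := contDiff_pd3 h.smooth
  have hder : HasDerivAt (fun s' => radon φ0 s' θ)
      (∫ p in (-(π*M))..(π*M), (cos θ * pd 1 w0 (zpt θ s p) + sin θ * pd 2 w0 (zpt θ s p))) s := by
    have : (fun s' => radon φ0 s' θ) = fun s' => ∫ p in (-(π*M))..(π*M), w0 (zpt θ s' p) := by
      funext s'
      rw [radon_eq hM hs0 hP]
      simp only [e0]
    rw [this]
    obtain ⟨_, B, hB, hb⟩ := data_bound hM h
    refine (intervalIntegral.hasDerivAt_integral_of_dominated_loc_of_deriv_le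
      (F' := fun s' p => cos θ * pd 1 w0 (zpt θ s' p) + sin θ * pd 2 w0 (zpt θ s' p))
      (bound := fun _ => 2 * B) (s := Set.univ) Filter.univ_mem ?_ ?_ ?_ ?_ ?_ ?_).2
    · exact Eventually.of_forall fun s' =>
        (cont_zpt h.smooth.continuous θ continuous_const continuous_id).aestronglyMeasurable
    · exact (cont_zpt h.smooth.continuous θ continuous_const continuous_id).intervalIntegrable _ _
    · have k := fun i => cont_zpt (c1 i).continuous θ (continuous_const (y := s)) continuous_id
      exact (((k 1).const_mul _).add ((k 2).const_mul _)).aestronglyMeasurable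
    · refine Eventually.of_forall fun p _ s' _ => ?_
      obtain ⟨_, bi⟩ := hb (s' * cos θ - p * sin θ) (s' * sin θ + p * cos θ)
      have m : ∀ a b : ℝ, |a| ≤ 1 → ∀ K, |b| ≤ K → |a * b| ≤ K := by
        intro a b ha K hb
        rw [abs_mul]
        nlinarith [abs_nonneg a, abs_nonneg b]
      rw [Real.norm_eq_abs]
      refine (abs_add_le _ _).trans ?_
      have := m _ _ (abs_cos_le_one θ) _ (bi 1)
      have := m _ _ (abs_sin_le_one θ) _ (bi 2)
      unfold zpt
      linarith
    · exact intervalIntegrable_const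
    · refine Eventually.of_forall fun p _ s' _ => ?_
      have := hasDerivAt_curve (f := w0) (a := fun _ => 0) (b := fun s => s * cos θ - p * sin θ)
        (c := fun s => s * sin θ + p * cos θ) (s := s')
        (h.smooth.differentiable (by simp) _) (hasDerivAt_const _ _)
        (((hasDerivAt_id' s').mul_const (cos θ)).sub_const _)
        (((hasDerivAt_id' s').mul_const (sin θ)).add_const _)
      refine this.congr_deriv ?_
      unfold zpt
      ring
  rw [hder.deriv]
  simp only [e1]
  have k := fun i => cont_zpt (c1 i).continuous θ (continuous_const (y := s)) continuous_id
  rw [← intervalIntegral.integral_sub]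
  · rfl
  · exact (k 0).intervalIntegrable _ _
  · exact (((k 1).const_mul _).add ((k 2).const_mul _)).intervalIntegrable _ _

theorem subst_sqrt (H : ℝ → ℝ) (q : ℝ) :
    ∫ s in Set.Ioi q, H s / √(s - q) = √2 * ∫ y in Set.Ioi 0, H (q + y^2/2) := by
  have him : (fun y : ℝ => q + y^2/2) '' Set.Ioi 0 = Set.Ioi q := by
    ext s
    constructor
    · rintro ⟨y, hy, rfl⟩
      have : 0 < y := hy
      simp only [Set.mem_Ioi]
      nlinarith [pow_pos this 2]
    · intro hs
      have hs' : q < s := hs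
      refine ⟨√(2*(s-q)), Real.sqrt_pos.2 (by linarith), ?_⟩
      simp only
      rw [Real.sq_sqrt (by linarith)]; ring
  have hinj : Set.InjOn (fun y : ℝ => q + y^2/2) (Set.Ioi 0) := by
    intro a ha b hb hab
    have h1 : 0 < a := ha
    have h2 : 0 < b := hb
    simp only at hab
    have : a^2 = b^2 := by linarith
    exact (sq_eq_sq₀ h1.le h2.le).1 this
  have := integral_image_eq_integral_abs_deriv_smul (s := Set.Ioi (0:ℝ)) (f := fun y : ℝ => q + y^2/2)
    (f' := fun y => y) measurableSet_Ioi (fun y hy => by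
      have := (((hasDerivAt_id' y).pow 2).div_const 2).const_add q
      refine (this.congr_deriv ?_).hasDerivWithinAt
      simp) hinj (fun s => H s / √(s - q))
  rw [him] at this
  rw [this, ← integral_const_mul]
  apply setIntegral_congr_fun measurableSet_Ioi
  intro y hy
  have hy' : 0 < y := hy
  simp only [smul_eq_mul]
  rw [abs_of_pos hy', show q + y^2/2 - q = y^2/2 by ring, Real.sqrt_div (by positivity), Real.sqrt_sq hy'.le]
  field_simp

theorem F0_eq (hM : 0 < M) (hs0 : SuppIn M φ0) (hs1 : SuppIn M φ1) (h : IsW M w0)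
    (hw0init : ∀ x : ℝ × ℝ, w0 ![0, x.1, x.2] = φ0 x ∧ pd 0 w0 ![0, x.1, x.2] = φ1 x) (q θ : ℝ) : 2 * π * F0 φ0 φ1 q θ =
    ∫ y in 0..(π * √(M+|q|)), ∫ p in (-(π*M))..(π*M), Hlim w0 θ (q + y^2/2) p := by
  unfold F0
  set H := fun s => radon φ1 s θ - deriv (fun s' => radon φ0 s' θ) s with hH
  have hz : ∀ s, M < s → H s = 0 := by
    intro s hs
    simp only [hH]
    rw [radon_zero hM hs1 s θ hs]
    have : (fun s' => radon φ0 s' θ) =ᶠ[𝓝 s] fun _ => 0 := by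
      filter_upwards [eventually_gt_nhds hs] with s' hs' using radon_zero hM hs0 s' θ hs'
    rw [this.deriv_eq]; simp
  have e := subst_sqrt H q
  have e1 : ∀ s, H s = ∫ p in (-(π*M))..(π*M), Hlim w0 θ s p := fun s =>
    radon_Hlim hM hs0 hs1 h hw0init s θ
  simp only [← e1]
  change 2 * π * (1 / (2 * π * √2) * ∫ s in Set.Ioi q, H s / √(s - q)) = _
  rw [e, intervalIntegral.integral_of_le (by positivity)]
  have e2 : ∫ y in Set.Ioi 0, H (q + y^2/2) = ∫ y in Set.Ioc 0 (π * √(M+|q|)), H (q + y^2/2) := by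
    apply setIntegral_eq_of_subset_of_forall_sdiff_eq_zero measurableSet_Ioi
    · exact fun y hy => hy.1
    · intro y hy
      have h1 : 0 < y := hy.1
      have h2 : π * √(M+|q|) < y := by
        by_contra hc
        push Not at hc
        exact hy.2 ⟨h1, hc⟩
      apply hz
      have h3 : (π * √(M+|q|))^2 < y^2 := pow_lt_pow_left₀ h2 (by positivity) two_ne_zero
      rw [mul_pow, Real.sq_sqrt (by positivity)] at h3
      have h4 : 0 < M + |q| := by positivity
      have h5 : 2 * (M+|q|) ≤ π^2 * (M+|q|) := by
        apply mul_le_mul_of_nonneg_right _ h4.le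
        nlinarith [pi_gt_three]
      have := neg_abs_le q
      linarith
  rw [e2]
  field_simp

theorem rad_limit (hM : 0 < M) (hs0 : SuppIn M φ0) (hs1 : SuppIn M φ1) (h : IsW M w0)
    (hw0init : ∀ x : ℝ × ℝ, w0 ![0, x.1, x.2] = φ0 x ∧ pd 0 w0 ![0, x.1, x.2] = φ1 x) (q θ : ℝ) :
    Tendsto (fun T => √(T+q) * w0 ![T, (T+q) * cos θ, (T+q) * sin θ]) atTop (𝓝 (F0 φ0 φ1 q θ)) := by
  have l := limit_int hM h θ q
  rw [← F0_eq hM hs0 hs1 h hw0init] at l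
  have l2 := (l.const_mul (2*π)⁻¹)
  rw [← mul_assoc, inv_mul_cancel₀ (by positivity), _root_.one_mul] at l2
  have k : Tendsto (fun T : ℝ => √(1 + q/T)) atTop (𝓝 1) := by
    have h1 : Tendsto (fun T : ℝ => q/T) atTop (𝓝 0) := tendsto_const_nhds.div_atTop tendsto_id
    have := (h1.const_add 1).sqrt
    simpa using this
  have l3 := k.mul l2
  rw [_root_.one_mul] at l3
  refine l3.congr' ?_
  filter_upwards [eventually_gt_atTop 0, eventually_ge_atTop (-q)] with T hT hT2
  have e : √(T + q) = √(1 + q/T) * √T := by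
    rw [← Real.sqrt_mul' _ hT.le]
    congr 1; field_simp
  rw [e]; field_simp
end
end

noncomputable section

/-! ### Polar symbols -/

def jb (q : ℝ) : ℝ := √(1 + q^2)

theorem jb_pos (q : ℝ) : 0 < jb q := by unfold jb; positivity
theorem jb_sq (q : ℝ) : jb q ^ 2 = 1 + q^2 := Real.sq_sqrt (by positivity)
theorem one_le_jb (q : ℝ) : 1 ≤ jb q := by
  unfold jb; rw [Real.one_le_sqrt]; nlinarith [sq_nonneg q]
theorem abs_le_jb (q : ℝ) : |q| ≤ jb q := by
  unfold jb; apply Real.le_sqrt_of_sq_le; rw [sq_abs]; linarith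
theorem jb_le (q : ℝ) : jb q ≤ 1 + |q| := by
  unfold jb
  rw [Real.sqrt_le_iff]
  refine ⟨by positivity, ?_⟩
  nlinarith [sq_abs q, abs_nonneg q]
theorem jb_contDiff : ContDiff ℝ ∞ jb := by
  unfold jb
  exact ContDiff.sqrt (by fun_prop) (fun q => by positivity)
theorem jb_hasDeriv (q : ℝ) : HasDerivAt jb (q / jb q) q := by
  have h1 : HasDerivAt (fun q : ℝ => 1 + q^2) (2*q) q := by
    have := ((hasDerivAt_id' q).pow 2).const_add 1
    simpa using this
  have := h1.sqrt (by positivity)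
  refine this.congr_deriv ?_
  unfold jb
  field_simp

def pv : Fin 3 → R3 → R3 :=
  ![fun p => ![jb (p 0), 0, 0], fun p => ![0, p 1, 0], fun _ => ![0, 0, 1]]

theorem pv_smooth (i : Fin 3) : ContDiff ℝ ∞ (pv i) := by
  have h0 : ContDiff ℝ ∞ (fun p : R3 => jb (p 0)) := jb_contDiff.comp (contDiff_coord 0)
  rw [contDiff_pi]
  intro j
  fin_cases i <;> fin_cases j <;> simp [pv] <;> first | exact h0 | exact contDiff_coord 1 | exact contDiff_const

/-- base polar domain in coordinates `(q,t,θ)` -/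
def D0 (M : ℝ) : Set R3 := {p | 1 < p 1 ∧ p 1 < 4 * (p 1 + p 0) ∧ p 0 < M + 1 ∧ |p 2| < 4}

structure PDom (M : ℝ) where
  D : ℝ → Set R3
  hD : ∀ a, IsOpen (D a)
  hsub : ∀ a, D a ⊆ D0 M

def PDom.G {M : ℝ} (P : PDom M) : Geo (Fin 3) := ⟨pv, P.D, pv_smooth, P.hD⟩

theorem D0_open (M : ℝ) : IsOpen (D0 M) := by
  have c := fun m : Fin 3 => (contDiff_coord m).continuous
  exact (isOpen_lt continuous_const (c 1)).inter ((isOpen_lt (c 1) (continuous_const.mul ((c 1).add (c 0)))).inter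
    ((isOpen_lt (c 0) continuous_const).inter (isOpen_lt (c 2).abs continuous_const)))

theorem Dv0 (f : R3 → ℝ) (p : R3) : Dv (pv 0) f p = jb (p 0) * pd 0 f p := by
  have : pv 0 p = jb (p 0) • (Pi.single 0 1 : R3) := by
    ext j; fin_cases j <;> simp [pv]
  simp only [Dv, pd, this, map_smul, smul_eq_mul]
theorem Dv1 (f : R3 → ℝ) (p : R3) : Dv (pv 1) f p = p 1 * pd 1 f p := by
  have : pv 1 p = p 1 • (Pi.single 1 1 : R3) := by
    ext j; fin_cases j <;> simp [pv]
  simp only [Dv, pd, this, map_smul, smul_eq_mul]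
theorem Dv2 (f : R3 → ℝ) (p : R3) : Dv (pv 2) f p = pd 2 f p := by
  have : pv 2 p = (Pi.single 2 1 : R3) := by
    ext j; fin_cases j <;> simp [pv]
  simp only [Dv, pd, this]

/-- partial derivative of a function of one coordinate -/
theorem pd_one (h : ℝ → ℝ) (m i : Fin 3) (p : R3) {h' : ℝ} (hh : HasDerivAt h h' (p m)) :
    pd i (fun p => h (p m)) p = if m = i then h' else 0 := by
  have k : HasFDerivAt (fun y : R3 => y m) (ContinuousLinearMap.proj (R := ℝ) (φ := fun _ : Fin 3 => ℝ) m) p :=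
    (ContinuousLinearMap.proj (R := ℝ) (φ := fun _ : Fin 3 => ℝ) m).hasFDerivAt
  have := hh.comp_hasFDerivAt p k
  simp only [pd]
  have e : fderiv ℝ (fun p : R3 => h (p m)) p = h' • (ContinuousLinearMap.proj (R := ℝ) (φ := fun _ : Fin 3 => ℝ) m) :=
    this.fderiv
  rw [e]; simp [Pi.single_apply]

section
variable {M : ℝ} (P : PDom M)

theorem PDom.Dv0 (f : R3 → ℝ) (p : R3) : Dv (P.G.v 0) f p = jb (p 0) * pd 0 f p := _root_.Dv0 f p
theorem PDom.Dv1 (f : R3 → ℝ) (p : R3) : Dv (P.G.v 1) f p = p 1 * pd 1 f p := _root_.Dv1 f p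
theorem PDom.Dv2 (f : R3 → ℝ) (p : R3) : Dv (P.G.v 2) f p = pd 2 f p := _root_.Dv2 f p

variable {P}
theorem PDom.mem {a : ℝ} {p : R3} (hp : p ∈ P.G.D a) :
    1 < p 1 ∧ p 1 < 4 * (p 1 + p 0) ∧ p 0 < M + 1 ∧ |p 2| < 4 := P.hsub a hp

theorem PDom.jb_le_t (hM : 0 < M) {a : ℝ} {p : R3} (hp : p ∈ P.G.D a) : jb (p 0) ≤ (M+3) * p 1 := by
  obtain ⟨h1, h2, h3, _⟩ := PDom.mem hp
  refine (jb_le _).trans ?_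
  have : |p 0| ≤ (M+2) * p 1 := by
    rw [abs_le]; constructor <;> nlinarith
  nlinarith

variable (P)
theorem s_q_jb : ∀ n, SymN P.G n (fun _ p => jb (p 0)) (fun _ p => p 0) ∧
    SymN P.G n (fun _ p => jb (p 0)) (fun _ p => jb (p 0)) := by
  have b1 : SymN P.G 0 (fun _ p => jb (p 0)) (fun _ p => p 0) :=
    ⟨fun a => (contDiff_coord 0).contDiffOn, 1, zero_le_one, fun a p _ => by
      rw [_root_.one_mul]; exact abs_le_jb _⟩
  have b2 : SymN P.G 0 (fun _ p => jb (p 0)) (fun _ p => jb (p 0)) :=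
    ⟨fun a => (jb_contDiff.comp (contDiff_coord 0)).contDiffOn, 1, zero_le_one, fun a p _ => by
      rw [_root_.one_mul, abs_of_pos (jb_pos _)]⟩
  have hw : ∀ (a : ℝ), ∀ p ∈ P.G.D a, 0 ≤ jb (p 0) := fun _ p _ => (jb_pos _).le
  intro n
  induction n with
  | zero => exact ⟨b1, b2⟩
  | succ n ih =>
    refine ⟨SymN.mk_succ b1 fun i => ?_, SymN.mk_succ b2 fun i => ?_⟩
    · fin_cases i
      · refine ih.2.congr fun a p _ => ?_
        simp only [Fin.zero_eta, P.Dv0, pd_coord]; simp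
      · refine (SymN.zero_mem hw).congr fun a p _ => ?_
        simp only [Fin.mk_one, P.Dv1, pd_coord]; simp
      · refine (SymN.zero_mem hw).congr fun a p _ => ?_
        simp only [Fin.reduceFinMk, P.Dv2, pd_coord]; simp
    · fin_cases i
      · refine ih.1.congr fun a p _ => ?_
        simp only [Fin.zero_eta, P.Dv0, pd_one jb 0 _ p (jb_hasDeriv _)]
        have := jb_pos (p 0)
        simp; field_simp
      · refine (SymN.zero_mem hw).congr fun a p _ => ?_
        simp only [Fin.mk_one, P.Dv1, pd_one jb 0 _ p (jb_hasDeriv _)]; simp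
      · refine (SymN.zero_mem hw).congr fun a p _ => ?_
        simp only [Fin.reduceFinMk, P.Dv2, pd_one jb 0 _ p (jb_hasDeriv _)]; simp

theorem s_q : Smb P.G (fun _ p => jb (p 0)) (fun _ p => p 0) := fun n => (s_q_jb P n).1
theorem s_jb : Smb P.G (fun _ p => jb (p 0)) (fun _ p => jb (p 0)) := fun n => (s_q_jb P n).2

theorem s_cs : ∀ n, SymN P.G n (fun _ _ => 1) (fun _ p => cos (p 2)) ∧
    SymN P.G n (fun _ _ => 1) (fun _ p => sin (p 2)) := by
  have b1 : SymN P.G 0 (fun _ _ => 1) (fun _ p => cos (p 2)) :=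
    ⟨fun a => (contDiff_cos.comp (contDiff_coord 2)).contDiffOn, 1, zero_le_one, fun a p _ => by
      rw [_root_.one_mul]; exact abs_cos_le_one _⟩
  have b2 : SymN P.G 0 (fun _ _ => 1) (fun _ p => sin (p 2)) :=
    ⟨fun a => (contDiff_sin.comp (contDiff_coord 2)).contDiffOn, 1, zero_le_one, fun a p _ => by
      rw [_root_.one_mul]; exact abs_sin_le_one _⟩
  have hw : ∀ (a : ℝ), ∀ p ∈ P.G.D a, 0 ≤ (1:ℝ) := fun _ p _ => zero_le_one
  intro n
  induction n with
  | zero => exact ⟨b1, b2⟩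
  | succ n ih =>
    refine ⟨SymN.mk_succ b1 fun i => ?_, SymN.mk_succ b2 fun i => ?_⟩
    · fin_cases i
      · refine (SymN.zero_mem hw).congr fun a p _ => ?_
        simp only [Fin.zero_eta, P.Dv0, pd_one cos 2 _ p (hasDerivAt_cos _)]; simp
      · refine (SymN.zero_mem hw).congr fun a p _ => ?_
        simp only [Fin.mk_one, P.Dv1, pd_one cos 2 _ p (hasDerivAt_cos _)]; simp
      · refine ih.2.neg.congr fun a p _ => ?_
        simp only [Fin.reduceFinMk, P.Dv2, pd_one cos 2 _ p (hasDerivAt_cos _)]; simp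
    · fin_cases i
      · refine (SymN.zero_mem hw).congr fun a p _ => ?_
        simp only [Fin.zero_eta, P.Dv0, pd_one sin 2 _ p (hasDerivAt_sin _)]; simp
      · refine (SymN.zero_mem hw).congr fun a p _ => ?_
        simp only [Fin.mk_one, P.Dv1, pd_one sin 2 _ p (hasDerivAt_sin _)]; simp
      · refine ih.1.congr fun a p _ => ?_
        simp only [Fin.reduceFinMk, P.Dv2, pd_one sin 2 _ p (hasDerivAt_sin _)]; simp

theorem s_cos : Smb P.G (fun _ _ => 1) (fun _ p => cos (p 2)) := fun n => (s_cs P n).1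
theorem s_sin : Smb P.G (fun _ _ => 1) (fun _ p => sin (p 2)) := fun n => (s_cs P n).2

theorem s_t : Smb P.G (fun _ p => p 1) (fun _ p => p 1) := by
  have b1 : SymN P.G 0 (fun _ p => p 1) (fun _ p => p 1) :=
    ⟨fun a => (contDiff_coord 1).contDiffOn, 1, zero_le_one, fun a p hp => by
      rw [_root_.one_mul, abs_of_pos (by linarith [(PDom.mem hp).1])]⟩
  have hw : ∀ (a : ℝ), ∀ p ∈ P.G.D a, 0 ≤ p 1 := fun _ p hp => by linarith [(PDom.mem hp).1]
  intro n
  induction n with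
  | zero => exact b1
  | succ n ih =>
    refine SymN.mk_succ b1 fun i => ?_
    fin_cases i
    · refine (SymN.zero_mem hw).congr fun a p _ => ?_
      simp only [Fin.zero_eta, P.Dv0, pd_coord]; simp
    · refine ih.congr fun a p _ => ?_
      simp only [Fin.mk_one, P.Dv1, pd_coord]; simp
    · refine (SymN.zero_mem hw).congr fun a p _ => ?_
      simp only [Fin.reduceFinMk, P.Dv2, pd_coord]; simp

variable (hM : 0 < M)

theorem s_r (hM : 0 < M) : Smb P.G (fun _ p => p 1) (fun _ p => p 1 + p 0) :=
  (s_t P).add ((s_q P).mono (by linarith : 0 ≤ M+3) (fun a p hp => PDom.jb_le_t hM hp))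

theorem s_jbi : Smb P.G (fun _ p => (jb (p 0))⁻¹) (fun _ p => (jb (p 0))⁻¹) :=
  (s_jb P).inv zero_lt_one (fun a p _ => ⟨jb_pos _, by rw [_root_.one_mul]⟩)

theorem s_ti : Smb P.G (fun _ p => (p 1)⁻¹) (fun _ p => (p 1)⁻¹) :=
  (s_t P).inv zero_lt_one (fun a p hp => ⟨by linarith [(PDom.mem hp).1], by rw [_root_.one_mul]⟩)

theorem s_ri (hM : 0 < M) : Smb P.G (fun _ p => (p 1)⁻¹) (fun _ p => (p 1 + p 0)⁻¹) :=
  (s_r P hM).inv (c := 1/4) (by norm_num) (fun a p hp => ⟨by linarith [(PDom.mem hp).1], by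
    linarith [(PDom.mem hp).2.1]⟩)

theorem s_sr (hM : 0 < M) : Smb P.G (fun _ p => √(p 1)) (fun _ p => √(p 1 + p 0)) :=
  (s_r P hM).sqrt (c := 1/4) (by norm_num) (fun a p hp => ⟨by linarith [(PDom.mem hp).1], by
    linarith [(PDom.mem hp).2.1]⟩)

theorem s_sri (hM : 0 < M) : Smb P.G (fun _ p => (√(p 1))⁻¹) (fun _ p => (√(p 1 + p 0))⁻¹) :=
  (s_sr P hM).inv (c := 1/2) (by norm_num) (fun a p hp => by
    obtain ⟨h1, h2, _⟩ := PDom.mem hp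
    refine ⟨Real.sqrt_pos.2 (by linarith), ?_⟩
    apply Real.le_sqrt_of_sq_le
    rw [mul_pow, Real.sq_sqrt (by linarith)]; linarith)

variable {P}
theorem Smb.dq {w f : ℝ → R3 → ℝ} (h : Smb P.G w f) :
    Smb P.G (fun a p => (jb (p 0))⁻¹ * w a p) (fun a => pd 0 (f a)) :=
  ((s_jbi P).mul (h.deriv 0)).congr fun a p _ => by
    rw [P.Dv0]; have := jb_pos (p 0); field_simp

theorem Smb.dt {w f : ℝ → R3 → ℝ} (h : Smb P.G w f) :
    Smb P.G (fun a p => (p 1)⁻¹ * w a p) (fun a => pd 1 (f a)) :=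
  ((s_ti P).mul (h.deriv 1)).congr fun a p hp => by
    rw [P.Dv1]; have := (PDom.mem hp).1; field_simp

theorem Smb.dth {w f : ℝ → R3 → ℝ} (h : Smb P.G w f) :
    Smb P.G w (fun a => pd 2 (f a)) :=
  (h.deriv 2).congr fun a p hp => by rw [P.Dv2]

/-- Build a symbol from its polar derivatives. -/
theorem SymN.mkP {n : ℕ} {w f : ℝ → R3 → ℝ} (h : SymN P.G 0 w f)
    (h0 : SymN P.G n w (fun a p => jb (p 0) * pd 0 (f a) p))
    (h1 : SymN P.G n w (fun a p => p 1 * pd 1 (f a) p))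
    (h2 : SymN P.G n w (fun a p => pd 2 (f a) p)) : SymN P.G (n+1) w f := by
  refine SymN.mk_succ h fun i => ?_
  fin_cases i
  · exact h0.congr fun a p _ => by simp only [Fin.zero_eta, P.Dv0]
  · exact h1.congr fun a p _ => by simp only [Fin.mk_one, P.Dv1]
  · exact h2.congr fun a p _ => by simp only [Fin.reduceFinMk, P.Dv2]

theorem SymN.d0 {n : ℕ} {w f : ℝ → R3 → ℝ} (h : SymN P.G (n+1) w f) :
    SymN P.G n w (fun a p => jb (p 0) * pd 0 (f a) p) :=
  (h.2 0).congr fun a p _ => by rw [P.Dv0]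
theorem SymN.d1 {n : ℕ} {w f : ℝ → R3 → ℝ} (h : SymN P.G (n+1) w f) :
    SymN P.G n w (fun a p => p 1 * pd 1 (f a) p) :=
  (h.2 1).congr fun a p _ => by rw [P.Dv1]
theorem SymN.d2 {n : ℕ} {w f : ℝ → R3 → ℝ} (h : SymN P.G (n+1) w f) :
    SymN P.G n w (fun a p => pd 2 (f a) p) :=
  (h.2 2).congr fun a p _ => by rw [P.Dv2]

/-! Polar map -/

def Psi (p : R3) : R3 := ![p 1, (p 1 + p 0) * cos (p 2), (p 1 + p 0) * sin (p 2)]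

theorem Psi_contDiff : ContDiff ℝ ∞ Psi := by
  rw [contDiff_pi]
  have c := contDiff_coord
  intro j
  fin_cases j
  · exact c 1
  · exact ((c 1).add (c 0)).mul (contDiff_cos.comp (c 2))
  · exact ((c 1).add (c 0)).mul (contDiff_sin.comp (c 2))

theorem pd_line (f : R3 → ℝ) (p : R3) (i : Fin 3) (hf : DifferentiableAt ℝ f p) :
    HasDerivAt (fun s => f (Function.update p i s)) (pd i f p) (p i) := by
  have h1 : HasDerivAt (fun s : ℝ => Function.update p i s) (Pi.single i 1 : R3) (p i) := by
    exact hasDerivAt_update p i (p i)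
  have h2 : HasFDerivAt f (fderiv ℝ f p) (Function.update p i (p i)) := by
    rw [Function.update_eq_self]; exact hf.hasFDerivAt
  exact h2.comp_hasDerivAt (p i) h1

theorem Psi_chain {u : R3 → ℝ} {p : R3} (hu : DifferentiableAt ℝ u (Psi p)) :
    pd 0 (fun p => u (Psi p)) p = cos (p 2) * pd 1 u (Psi p) + sin (p 2) * pd 2 u (Psi p) ∧
    pd 1 (fun p => u (Psi p)) p = pd 0 u (Psi p) + cos (p 2) * pd 1 u (Psi p) + sin (p 2) * pd 2 u (Psi p) ∧
    pd 2 (fun p => u (Psi p)) p =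
      (p 1 + p 0) * (-sin (p 2) * pd 1 u (Psi p) + cos (p 2) * pd 2 u (Psi p)) := by
  have hd : DifferentiableAt ℝ (fun p => u (Psi p)) p :=
    hu.comp p (Psi_contDiff.differentiable (by simp) p)
  refine ⟨?_, ?_, ?_⟩
  · have h1 := pd_line _ p 0 hd
    have h2 := hasDerivAt_curve (f := u) (a := fun _ => p 1) (b := fun s => (p 1 + s) * cos (p 2))
      (c := fun s => (p 1 + s) * sin (p 2)) (s := p 0) hu (hasDerivAt_const _ _)
      (((hasDerivAt_id' (p 0)).const_add (p 1)).mul_const (cos (p 2)))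
      (((hasDerivAt_id' (p 0)).const_add (p 1)).mul_const (sin (p 2)))
    have e : (fun s => u (Psi (Function.update p 0 s))) = fun s =>
        u ![p 1, (p 1 + s) * cos (p 2), (p 1 + s) * sin (p 2)] := by
      funext s; simp [Psi]
    rw [e] at h1
    rw [h1.unique h2]
    simp only [Psi]; ring
  · have h1 := pd_line _ p 1 hd
    have h2 := hasDerivAt_curve (f := u) (a := fun s => s) (b := fun s => (s + p 0) * cos (p 2))
      (c := fun s => (s + p 0) * sin (p 2)) (s := p 1) hu (hasDerivAt_id' _)
      (((hasDerivAt_id' (p 1)).add_const (p 0)).mul_const (cos (p 2)))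
      (((hasDerivAt_id' (p 1)).add_const (p 0)).mul_const (sin (p 2)))
    have e : (fun s => u (Psi (Function.update p 1 s))) = fun s =>
        u ![s, (s + p 0) * cos (p 2), (s + p 0) * sin (p 2)] := by
      funext s; simp [Psi]
    rw [e] at h1
    rw [h1.unique h2]
    simp only [Psi]; ring
  · have h1 := pd_line _ p 2 hd
    have h2 := hasDerivAt_curve (f := u) (a := fun s => p 1) (b := fun s => (p 1 + p 0) * cos s)
      (c := fun s => (p 1 + p 0) * sin s) (s := p 2) hu (hasDerivAt_const _ _)
      ((hasDerivAt_cos (p 2)).const_mul _) ((hasDerivAt_sin (p 2)).const_mul _)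
    have e : (fun s => u (Psi (Function.update p 2 s))) = fun s =>
        u ![p 1, (p 1 + p 0) * cos s, (p 1 + p 0) * sin s] := by
      funext s; simp [Psi]
    rw [e] at h1
    rw [h1.unique h2]
    simp only [Psi]; ring

/-- Cartesian derivatives in polar form. -/
def PP : Fin 3 → (R3 → ℝ) → R3 → ℝ :=
  ![fun f p => pd 1 f p - pd 0 f p,
    fun f p => cos (p 2) * pd 0 f p - sin (p 2) * (p 1 + p 0)⁻¹ * pd 2 f p,
    fun f p => sin (p 2) * pd 0 f p + cos (p 2) * (p 1 + p 0)⁻¹ * pd 2 f p]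

theorem PP_eq {u : R3 → ℝ} {p : R3} (hu : DifferentiableAt ℝ u (Psi p)) (hr : p 1 + p 0 ≠ 0)
    (i : Fin 3) : pd i u (Psi p) = PP i (fun p => u (Psi p)) p := by
  obtain ⟨h0, h1, h2⟩ := Psi_chain hu
  have t := sin_sq_add_cos_sq (p 2)
  fin_cases i
  · simp only [PP, Fin.zero_eta, Matrix.cons_val_zero, h0, h1]; ring
  · simp only [PP, Fin.mk_one, Matrix.cons_val_one, Matrix.cons_val_zero, h0, h2]
    have : (p 1 + p 0)⁻¹ * (p 1 + p 0) = 1 := inv_mul_cancel₀ hr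
    linear_combination (-pd 1 u (Psi p)) * t +
      (- sin (p 2) * (sin (p 2) * pd 1 u (Psi p) - cos (p 2) * pd 2 u (Psi p))) * this
  · simp only [PP, Fin.reduceFinMk, Matrix.cons_val, h0, h2]
    have : (p 1 + p 0)⁻¹ * (p 1 + p 0) = 1 := inv_mul_cancel₀ hr
    linear_combination (-pd 2 u (Psi p)) * t +
      (cos (p 2) * (sin (p 2) * pd 1 u (Psi p) - cos (p 2) * pd 2 u (Psi p))) * this

theorem jt_le (hM : 0 < M) {a : ℝ} {p : R3} (hp : p ∈ P.G.D a) : jb (p 0) * (p 1)⁻¹ ≤ (M+3) * 1 := by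
  have h1 := PDom.jb_le_t hM hp
  have h2 := (PDom.mem hp).1
  rw [← div_eq_mul_inv, div_le_iff₀ (by linarith)]; linarith

variable (P) in
theorem s_jt (hM : 0 < M) : Smb P.G (fun _ _ => 1) (fun _ p => jb (p 0) * (p 1)⁻¹) :=
  ((s_jb P).mul (s_ti P)).mono (by linarith) fun a p hp => jt_le hM hp
variable (P) in
theorem s_jr (hM : 0 < M) : Smb P.G (fun _ _ => 1) (fun _ p => jb (p 0) * (p 1 + p 0)⁻¹) :=
  ((s_jb P).mul (s_ri P hM)).mono (by linarith) fun a p hp => jt_le hM hp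

theorem Smb.dt' (hM : 0 < M) {w f : ℝ → R3 → ℝ} (h : Smb P.G w f) :
    Smb P.G (fun a p => (jb (p 0))⁻¹ * w a p) (fun a => pd 1 (f a)) :=
  ((s_jbi P).mul ((s_jt P hM).one_mul (h.deriv 1))).congr fun a p hp => by
    have h2 := (PDom.mem hp).1
    have := jb_pos (p 0)
    rw [P.Dv1]; field_simp

theorem Smb.rth (hM : 0 < M) {w f : ℝ → R3 → ℝ} (h : Smb P.G w f) :
    Smb P.G (fun a p => (jb (p 0))⁻¹ * w a p) (fun a p => (p 1 + p 0)⁻¹ * pd 2 (f a) p) :=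
  ((s_jbi P).mul ((s_jr P hM).one_mul h.dth)).congr fun a p hp => by
    have := jb_pos (p 0)
    field_simp

theorem Smb.PP (hM : 0 < M) {w f : ℝ → R3 → ℝ} (h : Smb P.G w f) (i : Fin 3) :
    Smb P.G (fun a p => (jb (p 0))⁻¹ * w a p) (fun a => PP i (f a)) := by
  have hth := h.rth hM
  fin_cases i
  · exact (h.dt' hM).sub h.dq
  · exact (((s_cos P).one_mul h.dq).sub ((s_sin P).one_mul hth)).congr fun a p _ => by
      simp [_root_.PP]; ring
  · exact (((s_sin P).one_mul h.dq).add ((s_cos P).one_mul hth)).congr fun a p _ => by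
      simp [_root_.PP]; ring
end
end

noncomputable section

/-- local inverse of the polar map near angle `θ` -/
def PsiInv (θ : ℝ) (y : R3) : R3 :=
  ![√((cos θ * y 1 + sin θ * y 2)^2 + (- sin θ * y 1 + cos θ * y 2)^2) - y 0, y 0,
    θ + arctan ((- sin θ * y 1 + cos θ * y 2) / (cos θ * y 1 + sin θ * y 2))]

theorem PsiInv_right {θ : ℝ} {y : R3} (hc : 0 < cos θ * y 1 + sin θ * y 2) :
    Psi (PsiInv θ y) = y := by
  set c := cos θ * y 1 + sin θ * y 2 with hcd
  set s := - sin θ * y 1 + cos θ * y 2 with hsd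
  have t := sin_sq_add_cos_sq θ
  have e1 : cos (arctan (s/c)) * √(c^2+s^2) = c := by
    rw [cos_arctan]
    have : √(c^2+s^2) = c * √(1+(s/c)^2) := by
      rw [show c^2+s^2 = c^2*(1+(s/c)^2) by field_simp, Real.sqrt_mul (by positivity),
        Real.sqrt_sq hc.le]
    rw [this]
    have : 0 < √(1+(s/c)^2) := by positivity
    field_simp
  have e2 : sin (arctan (s/c)) * √(c^2+s^2) = s := by
    rw [sin_arctan]
    have : √(c^2+s^2) = c * √(1+(s/c)^2) := by
      rw [show c^2+s^2 = c^2*(1+(s/c)^2) by field_simp, Real.sqrt_mul (by positivity),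
        Real.sqrt_sq hc.le]
    rw [this]
    have : 0 < √(1+(s/c)^2) := by positivity
    field_simp
  have h0 : PsiInv θ y 0 = √(c^2+s^2) - y 0 := rfl
  have h1 : PsiInv θ y 1 = y 0 := rfl
  have h2 : PsiInv θ y 2 = θ + arctan (s/c) := rfl
  ext j
  fin_cases j
  · simp [Psi, h1]
  · simp only [Psi, h0, h1, h2, Fin.mk_one, Matrix.cons_val_one, Matrix.cons_val_zero, cos_add]
    linear_combination cos θ * e1 - sin θ * e2 + cos θ * hcd - sin θ * hsd + y 1 * t
  · simp only [Psi, h0, h1, h2, Fin.reduceFinMk, Matrix.cons_val, sin_add]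
    linear_combination sin θ * e1 + cos θ * e2 + sin θ * hcd + cos θ * hsd + y 2 * t

theorem PsiInv_left {p : R3} (hr : 0 < p 1 + p 0) : PsiInv (p 2) (Psi p) = p := by
  have t := sin_sq_add_cos_sq (p 2)
  have e1 : cos (p 2) * ((p 1 + p 0) * cos (p 2)) + sin (p 2) * ((p 1 + p 0) * sin (p 2)) = p 1 + p 0 := by
    linear_combination (p 1 + p 0) * t
  have e2 : -sin (p 2) * ((p 1 + p 0) * cos (p 2)) + cos (p 2) * ((p 1 + p 0) * sin (p 2)) = 0 := by ring
  ext j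
  fin_cases j <;> simp only [PsiInv, Psi, Fin.zero_eta, Fin.mk_one, Fin.reduceFinMk, Matrix.cons_val, e1, e2]
  · rw [show (p 1 + p 0)^2 + 0^2 = (p 1 + p 0)^2 by ring, Real.sqrt_sq hr.le]; ring
  · simp

theorem contDiffAt_of_Psi {f : R3 → ℝ} {p : R3} (hr : 0 < p 1 + p 0)
    (h : ContDiffAt ℝ ∞ (fun p => f (Psi p)) p) : ContDiffAt ℝ ∞ f (Psi p) := by
  have e1 : cos (p 2) * (Psi p 1) + sin (p 2) * (Psi p 2) = p 1 + p 0 := by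
    simp only [Psi, Matrix.cons_val]
    linear_combination (p 1 + p 0) * sin_sq_add_cos_sq (p 2)
  have c := contDiff_coord
  have hc : ContDiff ℝ ∞ (fun y : R3 => cos (p 2) * y 1 + sin (p 2) * y 2) :=
    (contDiff_const.mul (c 1)).add (contDiff_const.mul (c 2))
  have hs : ContDiff ℝ ∞ (fun y : R3 => -sin (p 2) * y 1 + cos (p 2) * y 2) :=
    (contDiff_const.mul (c 1)).add (contDiff_const.mul (c 2))
  have hi : ContDiffAt ℝ ∞ (PsiInv (p 2)) (Psi p) := by
    rw [contDiffAt_pi]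
    intro j
    fin_cases j
    · refine ContDiffAt.sub (ContDiffAt.sqrt (((hc.pow 2).add (hs.pow 2)).contDiffAt) ?_) (c 0).contDiffAt
      rw [e1]; positivity
    · exact (c 0).contDiffAt
    · refine contDiffAt_const.add (ContDiffAt.arctan (hs.contDiffAt.div hc.contDiffAt ?_))
      rw [e1]; exact hr.ne'
  rw [← PsiInv_left hr] at h
  have h2 := h.comp (Psi p) hi
  refine h2.congr_of_eventuallyEq ?_
  have : ∀ᶠ y in 𝓝 (Psi p), 0 < cos (p 2) * y 1 + sin (p 2) * y 2 :=
    (isOpen_lt continuous_const hc.continuous).mem_nhds (by simpa [e1] using hr)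
  filter_upwards [this] with y hy
  simp only [Function.comp, PsiInv_right hy]

section
variable {M : ℝ} {P : PDom M} (hM : 0 < M)

theorem PDom.rpos {a : ℝ} {p : R3} (hp : p ∈ P.G.D a) : 0 < p 1 + p 0 := by
  obtain ⟨h1, h2, _⟩ := PDom.mem hp; linarith

theorem Smb.cartAt {w : ℝ → R3 → ℝ} {u : ℝ → R3 → ℝ} (h : Smb P.G w (fun a p => u a (Psi p)))
    {a : ℝ} {p : R3} (hp : p ∈ P.G.D a) : ContDiffAt ℝ ∞ (u a) (Psi p) :=
  contDiffAt_of_Psi (PDom.rpos hp) (h.at hp)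

theorem Smb.cart_eq {w : ℝ → R3 → ℝ} {u : ℝ → R3 → ℝ} (h : Smb P.G w (fun a p => u a (Psi p)))
    (i : Fin 3) {a : ℝ} {p : R3} (hp : p ∈ P.G.D a) :
    pd i (u a) (Psi p) = _root_.PP i (fun p => u a (Psi p)) p :=
  PP_eq ((h.cartAt hp).differentiableAt (by simp)) (PDom.rpos hp).ne' i

theorem Smb.cart (hM : 0 < M) {w : ℝ → R3 → ℝ} {u : ℝ → R3 → ℝ} (h : Smb P.G w (fun a p => u a (Psi p)))
    (i : Fin 3) : Smb P.G (fun a p => (jb (p 0))⁻¹ * w a p) (fun a p => pd i (u a) (Psi p)) :=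
  (h.PP hM i).congr fun a p hp => h.cart_eq i hp

variable (P) in
theorem s_jbi1 : Smb P.G (fun _ _ => 1) (fun _ p => (jb (p 0))⁻¹) :=
  (s_jbi P).mono zero_le_one fun a p _ => by
    rw [_root_.one_mul]; exact inv_le_one_of_one_le₀ (one_le_jb _)

variable (P) in
theorem s_qjb : Smb P.G (fun _ _ => 1) (fun _ p => p 0 * (jb (p 0))⁻¹) :=
  ((s_q P).mul (s_jbi P)).mono zero_le_one fun a p _ => by
    have := jb_pos (p 0)
    field_simp; simp

variable (P) in
theorem s_rt (hM : 0 < M) : Smb P.G (fun _ _ => 1) (fun _ p => (p 1 + p 0) * (p 1)⁻¹) :=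
  ((s_r P hM).mul (s_ti P)).mono zero_le_one fun a p hp => by
    have := (PDom.mem hp).1
    field_simp; simp
variable (P) in
theorem s_tr (hM : 0 < M) : Smb P.G (fun _ _ => 1) (fun _ p => p 1 * (p 1 + p 0)⁻¹) :=
  ((s_t P).mul (s_ri P hM)).mono zero_le_one fun a p hp => by
    have := (PDom.mem hp).1
    field_simp; simp

theorem Smb.cart1 (hM : 0 < M) {w : ℝ → R3 → ℝ} {u : ℝ → R3 → ℝ} (h : Smb P.G w (fun a p => u a (Psi p)))
    (i : Fin 3) : Smb P.G w (fun a p => pd i (u a) (Psi p)) := by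
  have t := h.deriv 0
  have t1 := h.deriv 1
  have t2 := h.deriv 2
  have j := s_jbi1 P
  have q := ((j.one_mul t))
  have r := ((j.one_mul ((s_jt P hM).one_mul t1)))
  have z := ((j.one_mul ((s_jr P hM).one_mul t2)))
  have e : ∀ a, ∀ p ∈ P.G.D a, pd i (u a) (Psi p) = _root_.PP i (fun p => u a (Psi p)) p :=
    fun a p hp => h.cart_eq i hp
  fin_cases i
  · refine (r.sub q).congr fun a p hp => ?_
    rw [e a p hp, P.Dv1, P.Dv0]
    have := jb_pos (p 0); have := (PDom.mem hp).1
    simp only [_root_.PP, Fin.zero_eta, Matrix.cons_val]; field_simp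
  · refine (((s_cos P).one_mul q).sub ((s_sin P).one_mul z)).congr fun a p hp => ?_
    rw [e a p hp, P.Dv2, P.Dv0]
    have := jb_pos (p 0); have := (PDom.rpos hp)
    simp only [_root_.PP, Fin.mk_one, Matrix.cons_val]; field_simp
  · refine (((s_sin P).one_mul q).add ((s_cos P).one_mul z)).congr fun a p hp => ?_
    rw [e a p hp, P.Dv2, P.Dv0]
    have := jb_pos (p 0); have := (PDom.rpos hp)
    simp only [_root_.PP, Fin.reduceFinMk, Matrix.cons_val]; field_simp

theorem Smb.KOp (hM : 0 < M) {w : ℝ → R3 → ℝ} {u : ℝ → R3 → ℝ} (h : Smb P.G w (fun a p => u a (Psi p)))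
    (k : Fin 7) : Smb P.G w (fun a p => KOp k (u a) (Psi p)) := by
  have t := h.deriv 0
  have t1 := h.deriv 1
  have t2 := h.deriv 2
  have qq := (s_qjb P).one_mul t
  have rt := (s_rt P hM).one_mul t1
  have tr := (s_tr P hM).one_mul t2
  have e : ∀ i a, ∀ p ∈ P.G.D a, pd i (u a) (Psi p) = _root_.PP i (fun p => u a (Psi p)) p :=
    fun i a p hp => h.cart_eq i hp
  fin_cases k
  · exact h.cart1 hM 0
  · exact h.cart1 hM 1
  · exact h.cart1 hM 2
  · refine (t1.add qq).congr fun a p hp => ?_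
    simp only [_root_.KOp, Fin.reduceFinMk, Matrix.cons_val, e _ a p hp]
    have := jb_pos (p 0); have := (PDom.rpos hp)
    have s := sin_sq_add_cos_sq (p 2)
    simp only [P.Dv1, P.Dv0, _root_.PP, Matrix.cons_val]
    generalize pd 0 (fun p => u a (Psi p)) p = g0
    simp only [Psi, Matrix.cons_val]
    field_simp
    linear_combination (p 1 + p 0) * g0 * s
  · refine ((((s_cos P).one_mul (rt.sub qq))).sub ((s_sin P).one_mul tr)).congr fun a p hp => ?_
    simp only [_root_.KOp, Fin.reduceFinMk, Matrix.cons_val, e _ a p hp]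
    have := jb_pos (p 0); have := (PDom.rpos hp); have := (PDom.mem hp).1
    simp only [P.Dv1, P.Dv0, P.Dv2, _root_.PP, Matrix.cons_val, Psi]
    field_simp
    ring
  · refine ((((s_sin P).one_mul (rt.sub qq))).add ((s_cos P).one_mul tr)).congr fun a p hp => ?_
    simp only [_root_.KOp, Fin.reduceFinMk, Matrix.cons_val, e _ a p hp]
    have := jb_pos (p 0); have := (PDom.rpos hp); have := (PDom.mem hp).1
    simp only [P.Dv1, P.Dv0, P.Dv2, _root_.PP, Matrix.cons_val, Psi]
    field_simp
    ring
  · refine t2.congr fun a p hp => ?_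
    simp only [_root_.KOp, Fin.reduceFinMk, Matrix.cons_val, e _ a p hp]
    have := (PDom.rpos hp)
    have s := sin_sq_add_cos_sq (p 2)
    simp only [P.Dv2, _root_.PP, Matrix.cons_val]
    generalize pd 2 (fun p => u a (Psi p)) p = g0
    simp only [Psi, Matrix.cons_val]
    field_simp
    linear_combination g0 * s

theorem Smb.Zpow (hM : 0 < M) {w : ℝ → R3 → ℝ} {u : ℝ → R3 → ℝ} (h : Smb P.G w (fun a p => u a (Psi p)))
    (α : List (Fin 7)) : Smb P.G w (fun a p => Zpow α (u a) (Psi p)) := by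
  induction α with
  | nil => exact h
  | cons k l ih => exact Smb.KOp hM (u := fun a => _root_.Zpow l (u a)) ih k

/-! free waves are symbols -/

variable (P) in
theorem s_tri (hM : 0 < M) : Smb P.G (fun _ p => (p 1)⁻¹) (fun _ p => (p 1 + (p 1 + p 0))⁻¹) :=
  ((s_t P).add (s_r P hM)).inv zero_lt_one fun a p hp => by
    have := (PDom.mem hp).1; have := PDom.rpos hp
    constructor <;> linarith

variable (P) in
theorem wave_smbN (hM : 0 < M) (n : ℕ) : ∀ w : R3 → ℝ, IsW M w →
    SymN P.G n (fun _ p => (√(p 1))⁻¹ * (√(jb (p 0)))⁻¹) (fun _ p => w (Psi p)) := by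
  have base : ∀ w : R3 → ℝ, IsW M w →
    SymN P.G 0 (fun _ p => (√(p 1))⁻¹ * (√(jb (p 0)))⁻¹) (fun _ p => w (Psi p)) := by
    intro w hw
    obtain ⟨C, hC, hb⟩ := decay_bound hM hw
    refine ⟨fun a => (hw.smooth.comp Psi_contDiff).contDiffOn, C, hC, fun a p hp => ?_⟩
    obtain ⟨h1, h2, _⟩ := PDom.mem hp
    have hr := PDom.rpos hp
    have := hb (p 1) ((p 1 + p 0) * cos (p 2)) ((p 1 + p 0) * sin (p 2)) (by linarith)
    refine this.trans ?_
    have e : √(((p 1 + p 0) * cos (p 2))^2 + ((p 1 + p 0) * sin (p 2))^2) - p 1 = p 0 := by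
      rw [show ((p 1 + p 0) * cos (p 2))^2 + ((p 1 + p 0) * sin (p 2))^2 = (p 1 + p 0)^2 by
        linear_combination (p 1 + p 0)^2 * sin_sq_add_cos_sq (p 2), Real.sqrt_sq hr.le]
      ring
    rw [e]
    change C * ((√(1 + p 1))⁻¹ * (√(jb (p 0)))⁻¹) ≤ _
    have := jb_pos (p 0)
    have : 0 < √(p 1) := Real.sqrt_pos.2 (by linarith)
    have h5 : (√(1 + p 1))⁻¹ ≤ (√(p 1))⁻¹ := inv_anti₀ this (Real.sqrt_le_sqrt (by linarith))
    exact mul_le_mul_of_nonneg_left (mul_le_mul_of_nonneg_right h5 (by positivity)) hC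
  induction n with
  | zero => exact base
  | succ n ih =>
    intro w hw
    have K : ∀ k : Fin 7, SymN P.G n (fun _ p => (√(p 1))⁻¹ * (√(jb (p 0)))⁻¹)
      (fun _ p => KOp k w (Psi p)) := fun k => ih _ (hw.KOp hM k)
    have hH := ((s_cos P n).one_mul (K 4)).add ((s_sin P n).one_mul (K 5))
    have tt : Smb P.G (fun _ _ => 1) (fun _ p => p 1 * (p 1 + (p 1 + p 0))⁻¹) :=
      ((s_t P).mul (s_tri P hM)).mono zero_le_one fun a p hp => by
        have := (PDom.mem hp).1
        field_simp; simp
    have rr : Smb P.G (fun _ _ => 1) (fun _ p => (p 1 + p 0) * (p 1 + (p 1 + p 0))⁻¹) :=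
      ((s_r P hM).mul (s_tri P hM)).mono zero_le_one fun a p hp => by
        have := (PDom.mem hp).1
        field_simp; simp
    have A1 := (tt n).one_mul ((K 3).add hH)
    have A0 := (((s_jbi1 P) n).one_mul (((s_cos P n).one_mul (K 1)).add ((s_sin P n).one_mul (K 2)))).add
      (((s_qjb P) n).one_mul (((rr n).one_mul (K 3)).sub ((tt n).one_mul hH)))
    have dw : ∀ p, DifferentiableAt ℝ w (Psi p) := fun p => hw.smooth.differentiable (by simp) _
    have s := fun p : R3 => sin_sq_add_cos_sq (p 2)
    refine SymN.mkP (base w hw) (A0.congr fun a p hp => ?_) (A1.congr fun a p hp => ?_)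
      ((K 6).congr fun a p hp => ?_)
    · have := jb_pos (p 0); have := (PDom.rpos hp); have := (PDom.mem hp).1
      have h2 := jb_sq (p 0)
      rw [(Psi_chain (dw p)).1]
      simp only [_root_.KOp, Fin.reduceFinMk, Matrix.cons_val]
      set a0 := pd 0 w (Psi p)
      set a1 := pd 1 w (Psi p)
      set a2 := pd 2 w (Psi p)
      simp only [Psi, Matrix.cons_val]
      field_simp
      linear_combination (p 1 + (p 1 + p 0)) * (cos (p 2) * a1 + sin (p 2) * a2) * h2
        + (p 0 * p 1 * (p 1 + p 0) * a0 - p 0 * 0) * (s p)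
    · have := jb_pos (p 0); have := (PDom.rpos hp); have := (PDom.mem hp).1
      rw [(Psi_chain (dw p)).2.1]
      simp only [_root_.KOp, Fin.reduceFinMk, Matrix.cons_val]
      set a0 := pd 0 w (Psi p)
      set a1 := pd 1 w (Psi p)
      set a2 := pd 2 w (Psi p)
      simp only [Psi, Matrix.cons_val]
      field_simp
      linear_combination (-(p 1 + p 0) * a0) * (s p)
    · rw [(Psi_chain (dw p)).2.2]
      simp only [_root_.KOp, Fin.reduceFinMk, Matrix.cons_val]
      set a0 := pd 0 w (Psi p)
      set a1 := pd 1 w (Psi p)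
      set a2 := pd 2 w (Psi p)
      simp only [Psi, Matrix.cons_val]
      ring

variable (P) in
theorem wave_smb (hM : 0 < M) {w : R3 → ℝ} (hw : IsW M w) :
    Smb P.G (fun _ p => (√(p 1))⁻¹ * (√(jb (p 0)))⁻¹) (fun _ p => w (Psi p)) :=
  fun n => wave_smbN P hM n w hw
end
end

noncomputable section

theorem pd_congr {f g : R3 → ℝ} {p : R3} (h : f =ᶠ[𝓝 p] g) (i : Fin 3) : pd i f p = pd i g p := by
  simp only [pd, h.fderiv_eq]

theorem pd_congr_ev {f g : R3 → ℝ} {p : R3} (h : f =ᶠ[𝓝 p] g) (i : Fin 3) : pd i f =ᶠ[𝓝 p] pd i g := by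
  filter_upwards [eventually_eventually_nhds.2 h] with q hq using pd_congr hq i

theorem pd_smoothAt {f : R3 → ℝ} {p : R3} (h : ContDiffAt ℝ ∞ f p) (i : Fin 3) :
    ContDiffAt ℝ ∞ (pd i f) p :=
  (h.fderiv_right (m := ∞) (by simp)).clm_apply contDiffAt_const

theorem diff_ev {f : R3 → ℝ} {p : R3} (h : ContDiffAt ℝ ∞ f p) : ∀ᶠ q in 𝓝 p, DifferentiableAt ℝ f q := by
  have h1 : ContDiffAt ℝ 1 f p := h.of_le (by simp)
  filter_upwards [h1.eventually (by simp)] with q hq using hq.differentiableAt (by simp)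

/-- the wave operator in polar coordinates -/
theorem polar_box {u : R3 → ℝ} {p : R3} (hu : ContDiffAt ℝ ∞ u (Psi p)) (hr : p 1 + p 0 ≠ 0) :
    pd 0 (pd 0 u) (Psi p) - pd 1 (pd 1 u) (Psi p) - pd 2 (pd 2 u) (Psi p) =
      pd 1 (pd 1 (fun p => u (Psi p))) p - 2 * pd 1 (pd 0 (fun p => u (Psi p))) p
        - (p 1 + p 0)⁻¹ * pd 0 (fun p => u (Psi p)) p
        - ((p 1 + p 0)⁻¹)^2 * pd 2 (pd 2 (fun p => u (Psi p))) p := by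
  have hPc : Continuous Psi := Psi_contDiff.continuous
  have ev : ∀ᶠ q in 𝓝 p, DifferentiableAt ℝ u (Psi q) := hPc.continuousAt.eventually (diff_ev hu)
  have e0 : pd 0 (fun p => u (Psi p)) =ᶠ[𝓝 p] fun p =>
      cos (p 2) * pd 1 u (Psi p) + sin (p 2) * pd 2 u (Psi p) := by
    filter_upwards [ev] with q hq using (Psi_chain hq).1
  have e1 : pd 1 (fun p => u (Psi p)) =ᶠ[𝓝 p] fun p =>
      pd 0 u (Psi p) + (cos (p 2) * pd 1 u (Psi p) + sin (p 2) * pd 2 u (Psi p)) := by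
    filter_upwards [ev] with q hq
    rw [(Psi_chain hq).2.1]; ring
  have e2 : pd 2 (fun p => u (Psi p)) =ᶠ[𝓝 p] fun p =>
      (p 1 + p 0) * (cos (p 2) * pd 2 u (Psi p) - sin (p 2) * pd 1 u (Psi p)) := by
    filter_upwards [ev] with q hq
    rw [(Psi_chain hq).2.2]; ring
  have du : ∀ i, DifferentiableAt ℝ (pd i u) (Psi p) := fun i =>
    (pd_smoothAt hu i).differentiableAt (by simp)
  have dA : ∀ i, DifferentiableAt ℝ (fun p => pd i u (Psi p)) p := fun i =>
    (du i).comp p (Psi_contDiff.differentiable (by simp) p)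
  have dc : DifferentiableAt ℝ (fun p : R3 => cos (p 2)) p := (diff_coord 2 p).cos
  have ds : DifferentiableAt ℝ (fun p : R3 => sin (p 2)) p := (diff_coord 2 p).sin
  have dr : DifferentiableAt ℝ (fun p : R3 => p 1 + p 0) p := (diff_coord 1 p).add (diff_coord 0 p)
  have pc := fun i => pd_one cos 2 i p (hasDerivAt_cos _)
  have ps := fun i => pd_one sin 2 i p (hasDerivAt_sin _)
  have m1 : ∀ i, DifferentiableAt ℝ (fun p : R3 => cos (p 2) * pd i u (Psi p)) p := fun i => dc.mul (dA i)
  have m2 : ∀ i, DifferentiableAt ℝ (fun p : R3 => sin (p 2) * pd i u (Psi p)) p := fun i => ds.mul (dA i)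
  rw [pd_congr e1, pd_congr e0, pd_congr e2, e0.eq_of_nhds]
  rw [pd_add' (dA 0) ((m1 1).fun_add (m2 2)), pd_add' (m1 1) (m2 2), pd_mul' dr ((m1 2).fun_sub (m2 1)),
    pd_sub' (m1 2) (m2 1), pd_add' (diff_coord 1 p) (diff_coord 0 p)]
  simp only [pd_mul' dc (dA _), pd_mul' ds (dA _), pc, ps, pd_coord,
    (Psi_chain (du _)).1, (Psi_chain (du _)).2.1, (Psi_chain (du _)).2.2]
  have s1 := pd_comm_at hu 1 0
  have s2 := pd_comm_at hu 2 0
  have s3 := pd_comm_at hu 2 1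
  have t := sin_sq_add_cos_sq (p 2)
  rw [s1, s2, s3]
  simp only [show (2:Fin 3) ≠ 1 by decide, show (1:Fin 3) ≠ 2 by decide, show (0:Fin 3) ≠ 2 by decide, if_true, if_false]
  generalize pd 0 (pd 0 u) (Psi p) = a00
  generalize pd 0 (pd 1 u) (Psi p) = a01
  generalize pd 0 (pd 2 u) (Psi p) = a02
  generalize pd 1 (pd 1 u) (Psi p) = a11
  generalize pd 1 (pd 2 u) (Psi p) = a12
  generalize pd 2 (pd 2 u) (Psi p) = a22
  generalize pd 1 u (Psi p) = a1
  generalize pd 2 u (Psi p) = a2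
  field_simp
  linear_combination (p 1 + p 0)^2 * (a11 + a22) * t

/-- √r -/
def rt (p : R3) : ℝ := √(p 1 + p 0)

theorem rt_smooth {p : R3} (hr : 0 < p 1 + p 0) : ContDiffAt ℝ ∞ rt p :=
  ContDiffAt.sqrt ((contDiff_coord 1).add (contDiff_coord 0)).contDiffAt hr.ne'

theorem rt_pos {p : R3} (hr : 0 < p 1 + p 0) : 0 < rt p := Real.sqrt_pos.2 hr

theorem pd_rt {p : R3} (hr : 0 < p 1 + p 0) (i : Fin 3) :
    pd i rt p = (if i = 2 then 0 else 1) * ((1/2) * (rt p)⁻¹) := by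
  have h2 := rt_pos hr
  have e : (fun p => rt p * rt p) =ᶠ[𝓝 p] fun p => p 1 + p 0 := by
    have : ∀ᶠ q : R3 in 𝓝 p, 0 < q 1 + q 0 :=
      (isOpen_lt continuous_const ((contDiff_coord 1).continuous.add (contDiff_coord 0).continuous)).mem_nhds hr
    filter_upwards [this] with q hq
    exact Real.mul_self_sqrt hq.le
  have d := (rt_smooth hr).differentiableAt (by simp)
  have := pd_congr e i
  rw [pd_mul' d d, pd_add' (diff_coord 1 p) (diff_coord 0 p), pd_coord, pd_coord] at this
  have h3 : pd i rt p * (2 * rt p) = if i = 2 then 0 else 1 := by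
    rw [show pd i rt p * (2 * rt p) = rt p * pd i rt p + pd i rt p * rt p by ring, this]
    fin_cases i <;> simp
  field_simp
  linarith

theorem rpos_ev {p : R3} (hr : 0 < p 1 + p 0) : ∀ᶠ q : R3 in 𝓝 p, 0 < q 1 + q 0 :=
  (isOpen_lt continuous_const ((contDiff_coord 1).continuous.add (contDiff_coord 0).continuous)).mem_nhds hr

theorem pd_rti {p : R3} (hr : 0 < p 1 + p 0) (i : Fin 3) :
    pd i (fun p => (rt p)⁻¹) p = - (if i = 2 then 0 else 1) * ((1/2) * ((rt p)⁻¹)^3) := by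
  have h2 := rt_pos hr
  have d := (rt_smooth hr).differentiableAt (by simp)
  have di : DifferentiableAt ℝ (fun p => (rt p)⁻¹) p := d.inv h2.ne'
  have e : (fun p => rt p * (rt p)⁻¹) =ᶠ[𝓝 p] fun p => 1 := by
    filter_upwards [rpos_ev hr] with q hq
    exact mul_inv_cancel₀ (rt_pos hq).ne'
  have := pd_congr e i
  rw [pd_mul' d di, pd_rt hr] at this
  have h0 : pd i (fun _ : R3 => (1:ℝ)) p = 0 := by simp [pd]
  rw [h0] at this
  have h3 : pd i (fun p => (rt p)⁻¹) p = - (rt p)⁻¹ * ((if i = 2 then 0 else 1) * (1 / 2 * (rt p)⁻¹) * (rt p)⁻¹) := by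
    field_simp at this ⊢
    linarith
  rw [h3]; ring

theorem box_conv {W : R3 → ℝ} {p : R3} (hW : ContDiffAt ℝ ∞ W p) (hr : 0 < p 1 + p 0) :
    rt p * (pd 1 (pd 1 W) p - 2 * pd 1 (pd 0 W) p - (p 1 + p 0)⁻¹ * pd 0 W p
        - ((p 1 + p 0)⁻¹)^2 * pd 2 (pd 2 W) p) =
      pd 1 (pd 1 (fun p => rt p * W p)) p - 2 * pd 1 (pd 0 (fun p => rt p * W p)) p
        - ((p 1 + p 0)⁻¹)^2 * (rt p * W p / 4 + pd 2 (pd 2 (fun p => rt p * W p)) p) := by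
  have ev : ∀ i, pd i (fun p => rt p * W p) =ᶠ[𝓝 p] fun p =>
      rt p * pd i W p + ((if i = 2 then 0 else 1) * (1/2)) * ((rt p)⁻¹ * W p) := by
    intro i
    filter_upwards [rpos_ev hr, diff_ev hW] with q hq hd
    rw [pd_mul' ((rt_smooth hq).differentiableAt (by simp)) hd, pd_rt hq]; ring
  have d := (rt_smooth hr).differentiableAt (by simp)
  have dW := hW.differentiableAt (by simp)
  have di : DifferentiableAt ℝ (fun p => (rt p)⁻¹) p := d.inv (rt_pos hr).ne'
  have dp : ∀ i, DifferentiableAt ℝ (pd i W) p := fun i => (pd_smoothAt hW i).differentiableAt (by simp)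
  have key : ∀ i j, pd j (pd i (fun p => rt p * W p)) p =
      rt p * pd j (pd i W) p + (if j = 2 then 0 else 1) * (1 / 2 * (rt p)⁻¹) * pd i W p +
      ((if i = 2 then 0 else 1) * (1/2)) * ((rt p)⁻¹ * pd j W p
        - (if j = 2 then 0 else 1) * ((1/2) * ((rt p)⁻¹)^3) * W p) := by
    intro i j
    have dm : DifferentiableAt ℝ (fun p => (rt p)⁻¹ * W p) p := di.fun_mul dW
    rw [pd_congr (ev i), pd_add' (d.fun_mul (dp i)) (dm.const_mul _),
      pd_mul' d (dp i), pd_mul' (differentiableAt_const _) dm,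
      pd_mul' di dW, pd_rt hr, pd_rti hr]
    have h0 : pd j (fun _ : R3 => ((if i = 2 then 0 else 1) * (1/2) : ℝ)) p = 0 := by simp [pd]
    rw [h0]; ring
  rw [key, key, key]
  have hs : (p 1 + p 0) = rt p ^ 2 := (Real.sq_sqrt hr.le).symm
  have h2 := rt_pos hr
  rw [hs]
  simp only [show (2:Fin 3) ≠ 1 by decide, show (1:Fin 3) ≠ 2 by decide, show (0:Fin 3) ≠ 2 by decide, if_true, if_false]
  field_simp
  ring

theorem polar_box_f {u : R3 → ℝ} {p : R3} (hu : ContDiffAt ℝ ∞ u (Psi p)) (hr : 0 < p 1 + p 0) :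
    rt p * (pd 0 (pd 0 u) (Psi p) - pd 1 (pd 1 u) (Psi p) - pd 2 (pd 2 u) (Psi p)) =
      pd 1 (pd 1 (fun p => rt p * u (Psi p))) p - 2 * pd 1 (pd 0 (fun p => rt p * u (Psi p))) p
        - ((p 1 + p 0)⁻¹)^2 * (rt p * u (Psi p) / 4 + pd 2 (pd 2 (fun p => rt p * u (Psi p))) p) := by
  rw [polar_box hu hr.ne']
  exact box_conv (hu.comp p Psi_contDiff.contDiffAt) hr

end

noncomputable section

def Pb (M : ℝ) : PDom M := ⟨fun _ => D0 M, fun _ => D0_open M, fun _ => subset_rfl⟩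

/-- integration from `q = M` -/
theorem int_q_pt {M : ℝ} (hM : 0 < M) : ∃ K, 0 ≤ K ∧ ∀ (g g' : ℝ → ℝ) (q C : ℝ), q < M + 1 → 0 ≤ C →
    (∀ s, q ≤ s → s < M + 1 → HasDerivAt g (g' s) s ∧ |g' s| ≤ C * (√(jb s))⁻¹) →
    (∀ s, M < s → s < M + 1 → g s = 0) → |g q| ≤ K * (C * √(jb q)) := by
  set k := 2 * √(M+3) with hk
  refine ⟨k * √(M+3), by positivity, fun g g' q C hq hC hd h0 => ?_⟩
  have hle : ∀ s, s < M+1 → M + 2 - s ≤ (M+3) * jb s := fun s hs => by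
    have h1 := abs_le_jb s; have h2 := one_le_jb s; have := neg_abs_le s
    nlinarith
  by_cases hqM : M < q
  · rw [h0 q hqM hq, abs_zero]; positivity
  push Not at hqM
  set B : ℝ → ℝ := fun s => C * (k * √(M+2-s)) with hB
  have hBd : ∀ s, s < M+1 → HasDerivAt B (C * (k * (-1 / (2 * √(M+2-s))))) s := by
    intro s hs
    have h1 : HasDerivAt (fun s : ℝ => M+2-s) (-1) s := by
      simpa using (hasDerivAt_id' s).const_sub (M+2)
    exact (((h1.sqrt (by linarith : M+2-s ≠ 0)).const_mul k)).const_mul C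
  have hcmp : ∀ s, s < M+1 → C * (√(jb s))⁻¹ ≤ C * (k * (1 / (2 * √(M+2-s)))) := by
    intro s hs
    apply mul_le_mul_of_nonneg_left _ hC
    have j := jb_pos s
    have hp : 0 < √(M+2-s) := Real.sqrt_pos.2 (by linarith)
    have h3 : √(M+2-s) ≤ √(M+3) * √(jb s) := by
      rw [← Real.sqrt_mul (by linarith)]; exact Real.sqrt_le_sqrt (hle s hs)
    have hj : 0 < √(jb s) := Real.sqrt_pos.2 j
    rw [hk, show 2 * √(M+3) * (1 / (2 * √(M+2-s))) = √(M+3) / √(M+2-s) by field_simp,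
      inv_eq_one_div, div_le_div_iff₀ hj hp]
    linarith
  have hm : M + 1/2 < M + 1 := by linarith
  have main : ∀ σ : ℝ, |σ| ≤ 1 → σ * g q ≤ B q := by
    intro σ hσ
    have hanti : AntitoneOn (fun s => B s - σ * g s) (Set.Icc q (M+1/2)) := by
      refine antitoneOn_of_deriv_nonpos (convex_Icc _ _) ?_ ?_ ?_
      · intro s hs
        have hs1 : s < M+1 := by linarith [hs.2]
        exact ((hBd s hs1).sub ((hd s hs.1 hs1).1.const_mul σ)).continuousAt.continuousWithinAt
      · intro s hs
        rw [interior_Icc] at hs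
        have hs1 : s < M+1 := by linarith [hs.2]
        exact ((hBd s hs1).sub ((hd s hs.1.le hs1).1.const_mul σ)).differentiableAt.differentiableWithinAt
      · intro s hs
        rw [interior_Icc] at hs
        have hs1 : s < M+1 := by linarith [hs.2]
        have hdd := ((hBd s hs1).sub ((hd s hs.1.le hs1).1.const_mul σ)).deriv
        have e : deriv (fun s => B s - σ * g s) s = C * (k * (-1 / (2 * √(M+2-s)))) - σ * g' s := hdd
        rw [e]
        have h1 := (hd s hs.1.le hs1).2
        have h2 := hcmp s hs1
        have h3 : |σ * g' s| ≤ 1 * |g' s| := by rw [abs_mul]; exact mul_le_mul_of_nonneg_right hσ (abs_nonneg _)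
        have h4 := neg_abs_le (σ * g' s)
        have h5 : C * (k * (-1 / (2 * √(M+2-s)))) = - (C * (k * (1 / (2 * √(M+2-s))))) := by ring
        rw [h5]; linarith
    have := hanti ⟨le_rfl, by linarith⟩ ⟨by linarith, le_rfl⟩ (by linarith : q ≤ M+1/2)
    simp only [h0 (M+1/2) (by linarith) hm, mul_zero, sub_zero] at this
    have : 0 ≤ B (M+1/2) := by positivity
    linarith
  have hBq : B q ≤ k * √(M+3) * (C * √(jb q)) := by
    have h3 : √(M+2-q) ≤ √(M+3) * √(jb q) := by
      rw [← Real.sqrt_mul (by linarith)]; exact Real.sqrt_le_sqrt (hle q hq)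
    calc B q ≤ C * (k * (√(M+3) * √(jb q))) := by
          apply mul_le_mul_of_nonneg_left _ hC
          exact mul_le_mul_of_nonneg_left h3 (by positivity)
      _ = _ := by ring
  refine le_trans ?_ hBq
  rw [abs_le']
  have m1 := main 1 (by simp)
  have m2 := main (-1) (by simp)
  constructor <;> linarith

/-- integration from `t = ∞` -/
theorem int_t_pt {k k' : ℝ → ℝ} {t0 C : ℝ} (ht : 0 < t0)
    (hd : ∀ t, t0 ≤ t → HasDerivAt k (k' t) t ∧ |k' t| ≤ C * ((t)⁻¹)^2)
    (hlim : Tendsto k atTop (𝓝 0)) : |k t0| ≤ C * t0⁻¹ := by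
  have main : ∀ σ : ℝ, |σ| ≤ 1 → σ * k t0 ≤ C * t0⁻¹ := by
    intro σ hσ
    have hD : ∀ t, t0 ≤ t → HasDerivAt (fun t => C * t⁻¹ - σ * k t) (C * (-(t^2)⁻¹) - σ * k' t) t := by
      intro t h
      exact ((hasDerivAt_inv (by linarith : t ≠ 0)).const_mul C).sub ((hd t h).1.const_mul σ)
    have hanti : AntitoneOn (fun t => C * t⁻¹ - σ * k t) (Set.Ici t0) := by
      refine antitoneOn_of_deriv_nonpos (convex_Ici _) ?_ ?_ ?_
      · exact fun t h => (hD t h).continuousAt.continuousWithinAt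
      · intro t h
        rw [interior_Ici] at h
        exact (hD t (le_of_lt h)).differentiableAt.differentiableWithinAt
      · intro t h
        rw [interior_Ici] at h
        rw [(hD t (le_of_lt h)).deriv]
        have h1 := (hd t (le_of_lt h)).2
        have h3 : |σ * k' t| ≤ 1 * |k' t| := by rw [abs_mul]; exact mul_le_mul_of_nonneg_right hσ (abs_nonneg _)
        have h4 := neg_abs_le (σ * k' t)
        have : C * (-(t^2)⁻¹) = - (C * (t⁻¹)^2) := by rw [inv_pow]; ring
        rw [this]; linarith
    have lim : Tendsto (fun t => C * t⁻¹ - σ * k t) atTop (𝓝 0) := by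
      have := (tendsto_inv_atTop_zero.const_mul C).sub (hlim.const_mul σ)
      simpa using this
    have := le_of_tendsto lim (b := C * t0⁻¹ - σ * k t0) (by
      filter_upwards [eventually_ge_atTop t0] with t h
      exact hanti Set.self_mem_Ici h h)
    linarith
  rw [abs_le']
  have m1 := main 1 (by simp)
  have m2 := main (-1) (by simp)
  constructor <;> linarith

theorem D0_up_q {M : ℝ} {p : R3} (hp : p ∈ D0 M) {s : ℝ} (h1 : p 0 ≤ s) (h2 : s < M + 1) :
    Function.update p 0 s ∈ D0 M := by
  obtain ⟨a, b, c, d⟩ := hp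
  refine ⟨?_, ?_, ?_, ?_⟩ <;> simp <;> first | assumption | linarith

theorem D0_up_t {M : ℝ} {p : R3} (hp : p ∈ D0 M) {s : ℝ} (h1 : p 1 ≤ s) :
    Function.update p 1 s ∈ D0 M := by
  obtain ⟨a, b, c, d⟩ := hp
  refine ⟨?_, ?_, ?_, ?_⟩ <;> simp <;> first | assumption | linarith

theorem pd_line' {f : R3 → ℝ} {p : R3} {i : Fin 3} {s : ℝ} (hf : DifferentiableAt ℝ f (Function.update p i s)) :
    HasDerivAt (fun s => f (Function.update p i s)) (pd i f (Function.update p i s)) s := by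
  have := pd_line f (Function.update p i s) i hf
  simpa using this

section
variable {M : ℝ} (hM : 0 < M)

theorem D0_at {f : R3 → ℝ} (hf : ContDiffOn ℝ ∞ f (D0 M)) {p : R3} (hp : p ∈ D0 M) :
    ContDiffAt ℝ ∞ f p := hf.contDiffAt ((D0_open M).mem_nhds hp)

theorem int_q (hM : 0 < M) (n : ℕ) : ∀ (ρ : R3 → ℝ), (∀ p ∈ D0 M, 0 ≤ ρ p) →
    (∀ p s, ρ (Function.update p 0 s) = ρ p) → ∀ g : ℝ → R3 → ℝ,
    (∀ a, ContDiffOn ℝ ∞ (g a) (D0 M)) → (∀ a, ∀ p ∈ D0 M, M < p 0 → g a p = 0) →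
    SymN (Pb M).G n (fun _ p => ρ p * (√(jb (p 0)))⁻¹) (fun a => pd 0 (g a)) →
    SymN (Pb M).G n (fun _ p => ρ p * √(jb (p 0))) g := by
  intro ρ hρ0 hρ
  have base : ∀ g : ℝ → R3 → ℝ,
    (∀ a, ContDiffOn ℝ ∞ (g a) (D0 M)) → (∀ a, ∀ p ∈ D0 M, M < p 0 → g a p = 0) →
    SymN (Pb M).G 0 (fun _ p => ρ p * (√(jb (p 0)))⁻¹) (fun a => pd 0 (g a)) →
    SymN (Pb M).G 0 (fun _ p => ρ p * √(jb (p 0))) g := by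
    intro g hg h0 hs
    obtain ⟨K, hK, hit⟩ := int_q_pt hM
    obtain ⟨C, hC, hb⟩ := hs.2
    refine ⟨hg, K * C, by positivity, fun a p hp => ?_⟩
    have hp' : p ∈ D0 M := hp
    have := hit (fun s => g a (Function.update p 0 s)) (fun s => pd 0 (g a) (Function.update p 0 s))
      (p 0) (C * ρ p) hp'.2.2.1 (mul_nonneg hC (hρ0 p hp')) (fun s h1 h2 => by
        have hm := D0_up_q hp' h1 h2
        refine ⟨pd_line' ((D0_at (hg a) hm).differentiableAt (by simp)), ?_⟩
        have := hb a _ hm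
        simpa [hρ, mul_assoc] using this) (fun s h1 h2 => ?_)
    · simp only [Function.update_eq_self] at this
      refine this.trans (le_of_eq ?_); ring
    · by_cases h3 : p 0 ≤ s
      · exact h0 a _ (D0_up_q hp' h3 h2) (by simpa using h1)
      · have hm : Function.update p 0 s ∈ D0 M := by
          obtain ⟨x, y, z, v⟩ := hp'
          refine ⟨?_, ?_, ?_, ?_⟩ <;> simp <;> first | assumption | linarith
        exact h0 a _ hm (by simpa using h1)
  induction n with
  | zero => exact base
  | succ n ih =>
    intro g hg h0 hs
    have hpg : ∀ i a, ContDiffOn ℝ ∞ (pd i (g a)) (D0 M) := fun i a p hp =>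
      (pd_smoothAt (D0_at (hg a) hp) i).contDiffWithinAt
    have hz : ∀ i a, ∀ p ∈ D0 M, M < p 0 → pd i (g a) p = 0 := by
      intro i a p hp hq
      have : g a =ᶠ[𝓝 p] fun _ => 0 := by
        have : D0 M ∩ {p | M < p 0} ∈ 𝓝 p :=
          ((D0_open M).inter (isOpen_lt continuous_const (contDiff_coord 0).continuous)).mem_nhds ⟨hp, hq⟩
        filter_upwards [this] with q hq using h0 a q hq.1 hq.2
      rw [pd_congr this]; simp [pd]
    refine SymN.mkP (base g hg h0 hs.zero) ?_ ?_ ?_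
    · refine ((s_jb (Pb M) n).mul hs.pred).mono zero_le_one fun a p hp => ?_
      have j := jb_pos (p 0)
      have : jb (p 0) * (√(jb (p 0)))⁻¹ = √(jb (p 0)) := by
        rw [← div_eq_mul_inv, Real.div_sqrt]
      rw [_root_.one_mul, show jb (p 0) * (ρ p * (√(jb (p 0)))⁻¹) = ρ p * (jb (p 0) * (√(jb (p 0)))⁻¹) by ring, this]
    · refine ih (fun a p => p 1 * pd 1 (g a) p) (fun a => (contDiff_coord 1).contDiffOn.mul (hpg 1 a))
        (fun a p hp hq => by simp [hz 1 a p hp hq]) ?_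
      refine hs.d1.congr fun a p hp => ?_
      have hp' : p ∈ D0 M := hp
      rw [pd_cmul ((D0_at (hpg 1 a) hp').differentiableAt (by simp)), pd_comm_at (D0_at (hg a) hp') 1 0]
      simp
    · refine ih (fun a p => pd 2 (g a) p) (fun a => hpg 2 a)
        (fun a p hp hq => by simp [hz 2 a p hp hq]) ?_
      refine hs.d2.congr fun a p hp => ?_
      have hp' : p ∈ D0 M := hp
      exact pd_comm_at (D0_at (hg a) hp') 0 2
end
end

noncomputable section
open Function (update)

def Tends0 (M : ℝ) (g : R3 → ℝ) : Prop :=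
  ∀ p ∈ D0 M, Tendsto (fun t => g (update p 1 t)) atTop (𝓝 0)

theorem tend_deriv {M : ℝ} {g : R3 → ℝ} (hg : ContDiffOn ℝ ∞ g (D0 M)) {i : Fin 3} (hi : i ≠ 1)
    {C : ℝ} (hC : 0 ≤ C)
    (hb : ∀ p ∈ D0 M, |pd 1 (pd i g) p| ≤ C * (((p 1)⁻¹)^2 * √(jb (p 0)))) (ht : Tends0 M g) :
    Tends0 M (pd i g) := by
  intro p hp
  obtain ⟨η, hη, hball⟩ : ∃ η, 0 < η ∧ ∀ s, |s - p i| < η → update p i s ∈ D0 M ∧ |s - p i| < 1 := by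
    have hc : ContinuousAt (fun s : ℝ => update p i s) (p i) :=
      (continuous_const.update i continuous_id).continuousAt
    have : ∀ᶠ s in 𝓝 (p i), update p i s ∈ D0 M := hc.eventually (by
      simp only [Function.update_eq_self]; exact (D0_open M).mem_nhds hp)
    obtain ⟨η, h1, h2⟩ := Metric.eventually_nhds_iff.1 this
    refine ⟨min η 1, by positivity, fun s hs => ⟨h2 (by rw [Real.dist_eq]; exact lt_of_lt_of_le hs (min_le_left _ _)), lt_of_lt_of_le hs (min_le_right _ _)⟩⟩
  set B := √(2 + |p 0|) with hB
  have hjb : ∀ s, |s - p i| < η → √(jb (update p i s 0)) ≤ B := by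
    intro s hs
    apply Real.sqrt_le_sqrt
    refine (jb_le _).trans ?_
    have h1 := (hball s hs).2
    by_cases h : i = 0
    · subst h
      simp only [Function.update_self]
      have := abs_sub_abs_le_abs_sub s (p 0); linarith
    · rw [Function.update_of_ne (Ne.symm h)]; linarith
  have hmem : ∀ s t, |s - p i| < η → p 1 ≤ t → update (update p 1 t) i s ∈ D0 M := by
    intro s t hs h
    rw [Function.update_comm hi.symm]
    have := D0_up_t (hball s hs).1 (s := t) (by rw [Function.update_of_ne hi.symm]; exact h)
    exact this
  have hp1 : 1 < p 1 := hp.1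
  have hlip1 : ∀ t, p 1 ≤ t → ∀ s, |s - p i| < η →
      |pd 1 g (update (update p 1 t) i s) - pd 1 g (update p 1 t)| ≤ (C * ((t⁻¹)^2 * B)) * |s - p i| := by
    intro t h s hs
    have hcv : Convex ℝ (Metric.ball (p i) η) := convex_ball _ _
    have := hcv.norm_image_sub_le_of_norm_hasDerivWithin_le
      (f := fun σ => pd 1 g (update (update p 1 t) i σ))
      (f' := fun σ => pd i (pd 1 g) (update (update p 1 t) i σ)) (C := C * ((t⁻¹)^2 * B))
      (x := p i) (y := s) (fun σ hσ => ?_) (fun σ hσ => ?_) (Metric.mem_ball_self hη)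
      (by rwa [Metric.mem_ball, Real.dist_eq])
    · have e : update (update p 1 t) i (p i) = update p 1 t := by
        rw [Function.update_comm hi.symm, Function.update_eq_self]
      simp only [Real.norm_eq_abs, e] at this
      exact this
    · rw [Metric.mem_ball, Real.dist_eq] at hσ
      exact (pd_line' ((pd_smoothAt (D0_at hg (hmem σ t hσ h)) 1).differentiableAt (by simp))).hasDerivWithinAt
    · rw [Metric.mem_ball, Real.dist_eq] at hσ
      rw [Real.norm_eq_abs, pd_comm_at (D0_at hg (hmem σ t hσ h)) i 1]
      refine (hb _ (hmem σ t hσ h)).trans ?_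
      have e1 : update (update p 1 t) i σ 1 = t := by
        rw [Function.update_of_ne hi.symm, Function.update_self]
      have e2 : update (update p 1 t) i σ 0 = update p i σ 0 := by
        rw [Function.update_comm hi.symm, Function.update_of_ne (by decide)]
      rw [e1, e2]
      have := hjb σ hσ
      have : 0 ≤ (t⁻¹)^2 := by positivity
      gcongr
  have hbd : ∀ t, p 1 ≤ t → |pd i g (update p 1 t)| ≤ (C * B) * t⁻¹ := by
    intro t h
    have ht0 : 0 < t := by linarith
    have hdm : update p 1 t ∈ D0 M := D0_up_t hp h
    have hd : HasDerivAt (fun s => g (update (update p 1 t) i s)) (pd i g (update p 1 t)) (p i) := by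
      have := pd_line g (update p 1 t) i ((D0_at hg hdm).differentiableAt (by simp))
      rwa [Function.update_of_ne hi] at this
    rw [← hd.deriv, ← Real.norm_eq_abs]
    refine norm_deriv_le_of_lip' (by positivity) ?_
    filter_upwards [Metric.ball_mem_nhds (p i) hη] with s hs
    rw [Metric.mem_ball, Real.dist_eq] at hs
    have e : update (update p 1 t) i (p i) = update p 1 t := by
      rw [Function.update_comm hi.symm, Function.update_eq_self]
    simp only [Real.norm_eq_abs, e]
    have := int_t_pt (k := fun t => g (update (update p 1 t) i s) - g (update p 1 t))
      (k' := fun t => pd 1 g (update (update p 1 t) i s) - pd 1 g (update p 1 t))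
      (t0 := t) (C := C * B * |s - p i|) ht0 (fun t' ht' => ⟨?_, ?_⟩) ?_
    · refine this.trans (le_of_eq ?_); ring
    · have h1 := hmem s t' hs (h.trans ht')
      have h2 : update p 1 t' ∈ D0 M := D0_up_t hp (h.trans ht')
      rw [Function.update_comm hi.symm] at h1
      simp only [fun t => Function.update_comm hi.symm t s p]
      exact (pd_line' ((D0_at hg h1).differentiableAt (by simp))).sub
        (pd_line' ((D0_at hg h2).differentiableAt (by simp)))
    · refine (hlip1 t' (h.trans ht') s hs).trans (le_of_eq ?_); ring
    · have h1 := ht _ (hball s hs).1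
      have h2 := ht _ hp
      simp only [fun t => Function.update_comm hi.symm t s p]
      simpa using h1.sub h2
  rw [tendsto_zero_iff_abs_tendsto_zero]
  refine squeeze_zero' (Eventually.of_forall fun t => abs_nonneg _)
    (g := fun t => (C * B) * t⁻¹) ?_ (by simpa using tendsto_inv_atTop_zero.const_mul (C * B))
  filter_upwards [eventually_ge_atTop (p 1)] with t h using hbd t h

theorem int_t {M : ℝ} (n : ℕ) : ∀ g : ℝ → R3 → ℝ,
    (∀ a, ContDiffOn ℝ ∞ (g a) (D0 M)) → (∀ a, Tends0 M (g a)) →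
    SymN (Pb M).G (n+1) (fun _ p => ((p 1)⁻¹)^2 * √(jb (p 0))) (fun a => pd 1 (g a)) →
    SymN (Pb M).G n (fun _ p => (p 1)⁻¹ * √(jb (p 0))) g := by
  have base : ∀ g : ℝ → R3 → ℝ,
    (∀ a, ContDiffOn ℝ ∞ (g a) (D0 M)) → (∀ a, Tends0 M (g a)) →
    SymN (Pb M).G 0 (fun _ p => ((p 1)⁻¹)^2 * √(jb (p 0))) (fun a => pd 1 (g a)) →
    SymN (Pb M).G 0 (fun _ p => (p 1)⁻¹ * √(jb (p 0))) g := by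
    intro g hg h0 hs
    obtain ⟨C, hC, hb⟩ := hs.2
    refine ⟨hg, C, hC, fun a p hp => ?_⟩
    have hp' : p ∈ D0 M := hp
    have := int_t_pt (k := fun t => g a (update p 1 t)) (k' := fun t => pd 1 (g a) (update p 1 t))
      (t0 := p 1) (C := C * √(jb (p 0))) (by linarith [hp'.1]) (fun t h => by
        have hm := D0_up_t hp' h
        refine ⟨pd_line' ((D0_at (hg a) hm).differentiableAt (by simp)), ?_⟩
        have := hb a _ hm
        simp only [Function.update_self, Function.update_of_ne (show (0:Fin 3) ≠ 1 by decide)] at this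
        refine this.trans (le_of_eq ?_); ring) (h0 a p hp')
    simp only [Function.update_eq_self] at this
    refine this.trans (le_of_eq ?_); ring
  induction n with
  | zero => exact fun g hg h0 hs => base g hg h0 hs.zero
  | succ n ih =>
    intro g hg h0 hs
    have hpg : ∀ i a, ContDiffOn ℝ ∞ (pd i (g a)) (D0 M) := fun i a p hp =>
      (pd_smoothAt (D0_at (hg a) hp) i).contDiffWithinAt
    refine SymN.mkP (base g hg h0 hs.zero) ?_ ?_ ?_
    · -- jb ∂_q
      have e : SymN (Pb M).G (n+1) (fun _ p => ((p 1)⁻¹)^2 * √(jb (p 0)))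
          (fun a => pd 1 (fun p => jb (p 0) * pd 0 (g a) p)) := by
        refine hs.d0.congr fun a p hp => ?_
        have hp' : p ∈ D0 M := hp
        have hd : DifferentiableAt ℝ (fun p : R3 => jb (p 0)) p :=
          (jb_contDiff.comp (contDiff_coord 0)).differentiable (by simp) p
        rw [pd_mul' hd ((D0_at (hpg 0 a) hp').differentiableAt (by simp)), pd_comm_at (D0_at (hg a) hp') 1 0,
          pd_one jb 0 1 p (jb_hasDeriv _)]
        simp
      refine ih _ (fun a => ((jb_contDiff.comp (contDiff_coord 0)).contDiffOn.mul (hpg 0 a))) (fun a => ?_) e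
      obtain ⟨C, hC, hb⟩ := hs.d0.bound
      have ht := tend_deriv (hg a) (i := 0) (by decide) hC (fun p hp => by
        have := hb a p hp
        rw [pd_comm_at (D0_at (hg a) hp) 1 0]
        refine le_trans ?_ this
        rw [abs_mul, abs_of_pos (jb_pos _)]
        nlinarith [one_le_jb (p 0), abs_nonneg (pd 0 (pd 1 (g a)) p)]) (h0 a)
      intro p hp
      have := (ht p hp).const_mul (jb (p 0))
      simpa [Function.update_of_ne (show (0:Fin 3) ≠ 1 by decide)] using this
    · refine (((s_t (Pb M)) n).mul hs.pred.pred).mono zero_le_one fun a p hp => ?_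
      have := (PDom.mem hp).1
      have hj := jb_pos (p 0)
      field_simp; simp
    · have e : SymN (Pb M).G (n+1) (fun _ p => ((p 1)⁻¹)^2 * √(jb (p 0)))
          (fun a => pd 1 (fun p => pd 2 (g a) p)) := by
        refine hs.d2.congr fun a p hp => ?_
        have hp' : p ∈ D0 M := hp
        exact pd_comm_at (D0_at (hg a) hp') 1 2
      refine ih _ (fun a => (hpg 2 a)) (fun a => ?_) e
      obtain ⟨C, hC, hb⟩ := hs.d2.bound
      exact tend_deriv (hg a) (i := 2) (by decide) hC (fun p hp => by
        have := hb a p hp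
        rwa [pd_comm_at (D0_at (hg a) hp) 1 2]) (h0 a)

/-- a `t`-independent function -/
def TInd (F : R3 → ℝ) : Prop := ∀ p s, F (update p 1 s) = F p

theorem TInd.pd {F : R3 → ℝ} (h : TInd F) (i : Fin 3) : TInd (pd i F) := by
  intro p s
  have key : ∀ c : ℝ, (fun p : R3 => F (p + c • (Pi.single 1 1 : R3))) = F := by
    intro c; funext p
    have : p + c • (Pi.single 1 1 : R3) = update p 1 (p 1 + c) := by
      ext j; by_cases hj : j = 1
      · subst hj; simp
      · simp [hj]
    rw [this, h]
  have e : update p 1 s = p + (s - p 1) • (Pi.single 1 1 : R3) := by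
      ext j; by_cases hj : j = 1
      · subst hj; simp
      · simp [hj]
  simp only [_root_.pd]
  rw [e, ← fderiv_comp_add_right, key]

theorem tind_smb {M : ℝ} (n : ℕ) : ∀ F : R3 → ℝ, TInd F →
    SymN (Pb M).G n (fun _ p => (√(jb (p 0)))⁻¹ + (p 1)⁻¹ * √(jb (p 0))) (fun _ => F) →
    SymN (Pb M).G n (fun _ p => (√(jb (p 0)))⁻¹) (fun _ => F) := by
  have base : ∀ F : R3 → ℝ, TInd F →
    SymN (Pb M).G 0 (fun _ p => (√(jb (p 0)))⁻¹ + (p 1)⁻¹ * √(jb (p 0))) (fun _ => F) →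
    SymN (Pb M).G 0 (fun _ p => (√(jb (p 0)))⁻¹) (fun _ => F) := by
    intro F hF hs
    obtain ⟨C, hC, hb⟩ := hs.2
    refine ⟨hs.1, C, hC, fun a p hp => ?_⟩
    have hp' : p ∈ D0 M := hp
    have lim : Tendsto (fun t : ℝ => C * ((√(jb (p 0)))⁻¹ + t⁻¹ * √(jb (p 0)))) atTop
        (𝓝 (C * ((√(jb (p 0)))⁻¹ + 0 * √(jb (p 0))))) :=
      ((tendsto_inv_atTop_zero.mul_const _).const_add _).const_mul C
    rw [zero_mul, add_zero] at lim
    refine ge_of_tendsto lim ?_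
    filter_upwards [eventually_ge_atTop (p 1)] with t h
    have := hb a _ (D0_up_t hp' h)
    simp only [Function.update_self, Function.update_of_ne (show (0:Fin 3) ≠ 1 by decide)] at this
    rwa [hF] at this
  induction n with
  | zero => exact base
  | succ n ih =>
    intro F hF hs
    refine SymN.mkP (base F hF hs.zero) (ih _ ?_ hs.d0) ?_ (ih _ (hF.pd 2) hs.d2)
    · intro p s
      show jb (update p 1 s 0) * pd 0 F (update p 1 s) = jb (p 0) * pd 0 F p
      rw [hF.pd 0]; simp
    · refine (SymN.zero_mem fun a p hp => by have := jb_pos (p 0); positivity).congr fun a p hp => ?_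
      have : pd 1 F p = 0 := by
        have h1 := pd_line F p 1 (hs.diffAt (a := a) hp)
        simp only [hF p] at h1
        exact h1.unique (hasDerivAt_const _ _)
      rw [this, mul_zero]

section
variable {M : ℝ} (hM : 0 < M)

/-- Asymptotics of a free wave, abstract form. -/
theorem wave_asym (hM : 0 < M) {w : R3 → ℝ} (hw : IsW M w) {F : R3 → ℝ} (hF : ContDiff ℝ ∞ F) (hFt : TInd F)
    (hlim : ∀ p ∈ D0 M, Tendsto (fun t => rt (update p 1 t) * w (Psi (update p 1 t))) atTop (𝓝 (F p))) :
    Smb (Pb M).G (fun _ p => (p 1)⁻¹ * √(jb (p 0))) (fun _ p => rt p * w (Psi p) - F p) ∧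
    Smb (Pb M).G (fun _ p => (√(jb (p 0)))⁻¹) (fun _ => F) := by
  set f : R3 → ℝ := fun p => rt p * w (Psi p) with hf
  have sf : Smb (Pb M).G (fun _ p => (√(jb (p 0)))⁻¹) (fun _ => f) :=
    ((s_sr (Pb M) hM).mul (wave_smb (Pb M) hM hw)).mono zero_le_one fun a p hp => by
      have := (PDom.mem hp).1
      have h1 : 0 < √(p 1) := Real.sqrt_pos.2 (by linarith)
      rw [← mul_assoc, mul_inv_cancel₀ h1.ne', _root_.one_mul]
  have hfs : ContDiffOn ℝ ∞ f (D0 M) := sf.smooth 0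
  have hpf : ∀ i, ContDiffOn ℝ ∞ (pd i f) (D0 M) := fun i p hp =>
      (pd_smoothAt (D0_at hfs hp) i).contDiffWithinAt
  -- h = f_t
  have hz : ∀ p ∈ D0 M, M < p 0 → f p = 0 := by
    intro p hp hq
    have hr : 0 < p 1 + p 0 := by have := hp.1; linarith
    simp only [hf]
    rw [hw.supp (Psi p) (by simp only [Psi, Matrix.cons_val]; linarith [hp.1]), mul_zero]
    simp only [Psi, Matrix.cons_val]
    have e : ((p 1 + p 0) * cos (p 2))^2 + ((p 1 + p 0) * sin (p 2))^2 = (p 1 + p 0)^2 := by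
      linear_combination (p 1 + p 0)^2 * sin_sq_add_cos_sq (p 2)
    rw [e]
    have := hp.1
    nlinarith
  have hz1 : ∀ p ∈ D0 M, M < p 0 → pd 1 f p = 0 := by
    intro p hp hq
    have : f =ᶠ[𝓝 p] fun _ => 0 := by
      have : D0 M ∩ {p | M < p 0} ∈ 𝓝 p :=
        ((D0_open M).inter (isOpen_lt continuous_const (contDiff_coord 0).continuous)).mem_nhds ⟨hp, hq⟩
      filter_upwards [this] with q hq using hz q hq.1 hq.2
    rw [pd_congr this]; simp [pd]
  have eqn : ∀ p ∈ D0 M, pd 0 (pd 1 f) p =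
      (1/2) * (pd 1 (pd 1 f) p - ((p 1 + p 0)⁻¹)^2 * (f p * (1/4) + pd 2 (pd 2 f) p)) := by
    intro p hp
    have hr : 0 < p 1 + p 0 := by have := hp.1; have := hp.2.1; linarith
    have := polar_box_f (u := w) (hw.smooth.contDiffAt) hr
    rw [hw.wave, mul_zero] at this
    rw [pd_comm_at (D0_at hfs hp) 0 1]
    simp only [hf] at this ⊢
    linarith
  have s1 : Smb (Pb M).G (fun _ p => ((p 1)⁻¹)^2 * (√(jb (p 0)))⁻¹) (fun _ => pd 0 (pd 1 f)) := by
    have a1 := (sf.dt.dt).wcongr (w' := fun _ p => ((p 1)⁻¹)^2 * (√(jb (p 0)))⁻¹) fun a p _ => by ring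
    have a2 := (sf.mul_one (Smb.one (1/4))).add sf.dth.dth
    have a3 := (((s_ri (Pb M) hM).mul (s_ri (Pb M) hM)).mul a2).wcongr
      (w' := fun _ p => ((p 1)⁻¹)^2 * (√(jb (p 0)))⁻¹) fun a p _ => by ring
    exact ((a1.sub a3).const_mul (1/2)).congr fun a p hp => by
      rw [eqn p hp]; ring
  have s2 : Smb (Pb M).G (fun _ p => ((p 1)⁻¹)^2 * √(jb (p 0))) (fun _ => pd 1 f) := fun n =>
    int_q hM n (fun p => ((p 1)⁻¹)^2) (fun p _ => by positivity)
      (fun p s => by simp) (fun _ => pd 1 f) (fun _ => hpf 1) (fun _ => hz1) (s1 n)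
  have hd : ∀ p ∈ D0 M, pd 1 (fun p => f p - F p) p = pd 1 f p := by
    intro p hp
    have hFd := hF.differentiable (by simp) p
    rw [pd_sub' ((D0_at hfs hp).differentiableAt (by simp)) hFd]
    have : pd 1 F p = 0 := by
      have h1 := pd_line F p 1 hFd
      simp only [hFt p] at h1
      exact h1.unique (hasDerivAt_const _ _)
    rw [this, sub_zero]
  have s3 : Smb (Pb M).G (fun _ p => (p 1)⁻¹ * √(jb (p 0))) (fun _ p => f p - F p) := fun n =>
    int_t n (fun _ p => f p - F p) (fun _ => hfs.sub hF.contDiffOn) (fun _ p hp => by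
      have := (hlim p hp).sub_const (F p)
      rw [sub_self] at this
      simpa only [hFt p] using this) ((s2 (n+1)).congr fun a p hp => hd p hp)
  refine ⟨s3, fun n => tind_smb n F hFt ?_⟩
  have j0 : ∀ p : R3, 0 ≤ √(jb (p 0)) := fun p => Real.sqrt_nonneg _
  have b1 := sf.mono (w' := fun _ p => (√(jb (p 0)))⁻¹ + (p 1)⁻¹ * √(jb (p 0))) zero_le_one fun a p hp => by
    have := (PDom.mem hp).1; have := j0 p
    have : 0 ≤ (p 1)⁻¹ * √(jb (p 0)) := by positivity
    linarith
  have b2 := s3.mono (w' := fun _ p => (√(jb (p 0)))⁻¹ + (p 1)⁻¹ * √(jb (p 0))) zero_le_one fun a p hp => by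
    have := j0 p
    have : 0 ≤ (√(jb (p 0)))⁻¹ := by positivity
    linarith
  exact ((b1.sub b2).congr fun a p hp => by ring) n
end
end

noncomputable section

/-! ### Parametric integrals -/

theorem param_hasFDeriv {E : Type} [NormedAddCommGroup E] [NormedSpace ℝ E] [ProperSpace E] {F : Type}
    [NormedAddCommGroup F] [NormedSpace ℝ F] [CompleteSpace F] {g : E × ℝ → F} (hg : ContDiff ℝ 1 g) (x : E) :
    HasFDerivAt (fun x => ∫ l in (0:ℝ)..1, g (x, l))
      (∫ l in (0:ℝ)..1, (fderiv ℝ g (x, l)).comp (ContinuousLinearMap.inl ℝ E ℝ)) x := by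
  have hc : Continuous (fun z : E × ℝ => (fderiv ℝ g z).comp (ContinuousLinearMap.inl ℝ E ℝ)) :=
    (hg.continuous_fderiv (by simp)).clm_comp continuous_const
  obtain ⟨C, hC⟩ := ((isCompact_closedBall x 1).prod (isCompact_Icc (a := (0:ℝ)) (b := 1))).exists_bound_of_continuousOn
    hc.continuousOn
  refine intervalIntegral.hasFDerivAt_integral_of_dominated_of_fderiv_le (bound := fun _ => C)
    (F' := fun x l => (fderiv ℝ g (x, l)).comp (ContinuousLinearMap.inl ℝ E ℝ))
    (Metric.closedBall_mem_nhds x one_pos) ?_ ?_ ?_ ?_ ?_ ?_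
  · exact Eventually.of_forall fun y =>
      (hg.continuous.comp (continuous_const.prodMk continuous_id)).aestronglyMeasurable
  · exact (hg.continuous.comp (continuous_const.prodMk continuous_id)).intervalIntegrable _ _
  · exact (hc.comp (continuous_const.prodMk continuous_id)).aestronglyMeasurable
  · refine Eventually.of_forall fun l hl y hy => hC (y, l) ⟨hy, ?_⟩
    rw [Set.uIoc_of_le zero_le_one] at hl
    exact ⟨hl.1.le, hl.2⟩
  · exact intervalIntegrable_const
  · refine Eventually.of_forall fun l hl y hy => ?_
    have h1 : HasFDerivAt (fun y : E => (y, l)) (ContinuousLinearMap.inl ℝ E ℝ) y := hasFDerivAt_prodMk_left y l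
    exact ((hg.differentiable (by simp)).differentiableAt.hasFDerivAt (x := (y,l))).comp y h1

theorem param_contDiff {E : Type} [NormedAddCommGroup E] [NormedSpace ℝ E] [ProperSpace E] (n : ℕ) :
    ∀ {F : Type} [NormedAddCommGroup F] [NormedSpace ℝ F] [CompleteSpace F] {g : E × ℝ → F} (hg : ContDiff ℝ ∞ g),
    ContDiff ℝ n (fun x => ∫ l in (0:ℝ)..1, g (x, l)) := by
  induction n with
  | zero =>
    intro F _ _ _ g hg
    have : Differentiable ℝ (fun x => ∫ l in (0:ℝ)..1, g (x, l)) := fun x =>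
      (param_hasFDeriv (hg.of_le (by simp)) x).differentiableAt
    exact contDiff_zero.2 this.continuous
  | succ n ih =>
    intro F _ _ _ g hg
    have h1 : ∀ x, HasFDerivAt (fun x => ∫ l in (0:ℝ)..1, g (x, l)) _ x := fun x =>
      param_hasFDeriv (hg.of_le (by simp)) x
    refine (contDiff_succ_iff_hasFDerivAt (n := n)).2 ⟨_, ?_, h1⟩
    exact ih (g := fun z => (fderiv ℝ g z).comp (ContinuousLinearMap.inl ℝ E ℝ))
      ((hg.fderiv_right (by simp)).clm_comp contDiff_const)

theorem antider (M : ℝ) {g : R3 → ℝ} (hg : ContDiff ℝ ∞ g) : ∃ h : R3 → ℝ, ContDiff ℝ ∞ h ∧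
    (∀ p, pd 0 h p = g p) ∧ (∀ p, p 0 = M → h p = 0) ∧
    ((∀ p, M ≤ p 0 → g p = 0) → ∀ p, M ≤ p 0 → h p = 0) := by
  set h : R3 → ℝ := fun p => (p 0 - M) * ∫ l in (0:ℝ)..1, g (Function.update p 0 (M + l * (p 0 - M))) with hh
  have hs : ContDiff ℝ ∞ h := by
    refine ((contDiff_coord 0).sub contDiff_const).mul ?_
    refine contDiff_infty.2 fun n => ?_
    refine param_contDiff n (g := fun z : R3 × ℝ => g (Function.update z.1 0 (M + z.2 * (z.1 0 - M)))) ?_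
    refine hg.comp ?_
    refine contDiff_pi.2 fun i => ?_
    have c : ∀ i : Fin 3, ContDiff ℝ ∞ (fun z : R3 × ℝ => z.1 i) := fun i => (contDiff_coord i).comp contDiff_fst
    fin_cases i
    · simpa using contDiff_const.add (contDiff_snd.mul ((c 0).sub contDiff_const))
    · simpa using c 1
    · simpa using c 2
  have hit : ∀ p x, h (Function.update p 0 x) = ∫ s in M..x, g (Function.update p 0 s) := by
    intro p x
    simp only [hh, Function.update_self, Function.update_idem]
    have := intervalIntegral.smul_integral_comp_mul_add (a := 0) (b := 1) (fun s => g (Function.update p 0 s)) (x - M) M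
    simp only [smul_eq_mul, mul_zero, zero_add, mul_one, sub_add_cancel] at this
    rw [← this]
    congr 1
    refine intervalIntegral.integral_congr fun l _ => ?_
    show g _ = g _
    congr 2; ring
  refine ⟨h, hs, fun p => ?_, fun p hp => by simp [hh, hp], fun h0 p hp => ?_⟩
  rotate_left
  · have := hit p (p 0)
    rw [Function.update_eq_self] at this
    rw [this, intervalIntegral.integral_congr (g := fun _ => 0)]
    · simp
    · intro s hs
      rw [Set.uIcc_of_le hp] at hs
      exact h0 _ (by simpa using hs.1)
  have h1 := pd_line h p 0 (hs.differentiable (by simp) p)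
  simp only [hit] at h1
  have hc : Continuous (fun s => g (Function.update p 0 s)) :=
    hg.continuous.comp (continuous_const.update 0 continuous_id)
  have h2 := intervalIntegral.integral_hasDerivAt_right (hc.intervalIntegrable M (p 0))
    (hc.stronglyMeasurableAtFilter _ _) hc.continuousAt
  rw [h1.unique h2, Function.update_eq_self]

def e1 (z : ℝ) : ℝ := ∫ l in (0:ℝ)..1, exp (-(l * z))

theorem e1_contDiff : ContDiff ℝ ∞ e1 := by
  refine contDiff_infty.2 fun n => ?_
  refine param_contDiff n (g := fun z : ℝ × ℝ => exp (-(z.2 * z.1))) ?_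
  exact Real.contDiff_exp.comp (contDiff_snd.mul contDiff_fst).neg

theorem e1_mul (z : ℝ) : z * e1 z = 1 - exp (-z) := by
  have h : ∀ l ∈ Set.uIcc (0:ℝ) 1, HasDerivAt (fun l => - exp (-(l * z))) (z * exp (-(l * z))) l := by
    intro l _
    have : HasDerivAt (fun l : ℝ => -(l * z)) (-(1 * z)) l := ((hasDerivAt_id' l).mul_const z).neg
    have h2 := this.exp.neg
    have e : -(exp (-(l * z)) * -(1 * z)) = z * exp (-(l * z)) := by ring
    rwa [e] at h2
  have := intervalIntegral.integral_eq_sub_of_hasDerivAt h ((by fun_prop : Continuous fun l => z * exp (-(l * z))).intervalIntegrable _ _)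
  rw [intervalIntegral.integral_const_mul] at this
  rw [e1, this]; simp; ring

/-- `K2 y τ = ∫₀^τ e^{-σ y} dσ` -/
def K2 (y τ : ℝ) : ℝ := τ * e1 (τ * y)

theorem K2_mul (y τ : ℝ) : y * K2 y τ = 1 - exp (-(τ * y)) := by
  rw [K2, ← e1_mul]; ring

theorem K2_deriv (y τ : ℝ) : HasDerivAt (K2 y) (exp (-(τ * y))) τ := by
  by_cases hy : y = 0
  · subst hy
    have : K2 0 = fun τ => τ := by funext τ; simp [K2, e1]
    rw [this]; simpa using hasDerivAt_id' τ
  · have : K2 y = fun τ => y⁻¹ * (1 - exp (-(τ * y))) := by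
      funext τ; rw [← K2_mul]; field_simp
    rw [this]
    have h1 : HasDerivAt (fun l : ℝ => -(l * y)) (-(1 * y)) τ := ((hasDerivAt_id' τ).mul_const y).neg
    have h2 := (h1.exp.const_sub 1).const_mul y⁻¹
    have e : y⁻¹ * -(exp (-(τ * y)) * -(1 * y)) = exp (-(τ * y)) := by field_simp
    rwa [e] at h2

theorem K2_contDiff : ContDiff ℝ ∞ (fun z : ℝ × ℝ => K2 z.1 z.2) :=
  contDiff_snd.mul (e1_contDiff.comp (contDiff_snd.mul contDiff_fst))

end

noncomputable section
open Function

/-! ### Profile geometry: coordinates `(q,τ,θ)` -/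

def qv : Fin 3 → R3 → R3 :=
  ![fun p => ![jb (p 0), 0, 0], fun p => ![0, 1, 0], fun _ => ![0, 0, 1]]

theorem qv_smooth (i : Fin 3) : ContDiff ℝ ∞ (qv i) := by
  have h0 : ContDiff ℝ ∞ (fun p : R3 => jb (p 0)) := jb_contDiff.comp (contDiff_coord 0)
  rw [contDiff_pi]
  intro j
  fin_cases i <;> fin_cases j <;> simp [qv] <;> first | exact h0 | exact contDiff_const

def QG (D : Set R3) (hD : IsOpen D) : Geo (Fin 3) := ⟨qv, fun _ => D, qv_smooth, fun _ => hD⟩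

theorem qDv0 (f : R3 → ℝ) (p : R3) : Dv (qv 0) f p = jb (p 0) * pd 0 f p := by
  have : qv 0 p = jb (p 0) • (Pi.single 0 1 : R3) := by
    ext j; fin_cases j <;> simp [qv]
  simp only [Dv, pd, this, map_smul, smul_eq_mul]
theorem qDv1 (f : R3 → ℝ) (p : R3) : Dv (qv 1) f p = pd 1 f p := by
  have : qv 1 p = (Pi.single 1 1 : R3) := by
    ext j; fin_cases j <;> simp [qv]
  simp only [Dv, pd, this]
theorem qDv2 (f : R3 → ℝ) (p : R3) : Dv (qv 2) f p = pd 2 f p := by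
  have : qv 2 p = (Pi.single 2 1 : R3) := by
    ext j; fin_cases j <;> simp [qv]
  simp only [Dv, pd, this]

section
variable {D : Set R3} {hD : IsOpen D}

theorem SymN.mkQ {n : ℕ} {w f : ℝ → R3 → ℝ} (h : SymN (QG D hD) 0 w f)
    (h0 : SymN (QG D hD) n w (fun a p => jb (p 0) * pd 0 (f a) p))
    (h1 : SymN (QG D hD) n w (fun a p => pd 1 (f a) p))
    (h2 : SymN (QG D hD) n w (fun a p => pd 2 (f a) p)) : SymN (QG D hD) (n+1) w f := by
  refine SymN.mk_succ h fun i => ?_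
  fin_cases i
  · exact h0.congr fun a p _ => qDv0 _ _
  · exact h1.congr fun a p _ => qDv1 _ _
  · exact h2.congr fun a p _ => qDv2 _ _

theorem SymN.q0 {n : ℕ} {w f : ℝ → R3 → ℝ} (h : SymN (QG D hD) (n+1) w f) :
    SymN (QG D hD) n w (fun a p => jb (p 0) * pd 0 (f a) p) :=
  (h.2 0).congr fun a p _ => (qDv0 _ _).symm
theorem SymN.q1 {n : ℕ} {w f : ℝ → R3 → ℝ} (h : SymN (QG D hD) (n+1) w f) :
    SymN (QG D hD) n w (fun a p => pd 1 (f a) p) :=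
  (h.2 1).congr fun a p _ => (qDv1 _ _).symm
theorem SymN.q2 {n : ℕ} {w f : ℝ → R3 → ℝ} (h : SymN (QG D hD) (n+1) w f) :
    SymN (QG D hD) n w (fun a p => pd 2 (f a) p) :=
  (h.2 2).congr fun a p _ => (qDv2 _ _).symm

theorem Smb.q0 {w f : ℝ → R3 → ℝ} (h : Smb (QG D hD) w f) :
    Smb (QG D hD) w (fun a p => jb (p 0) * pd 0 (f a) p) := fun n => (h (n+1)).q0
theorem Smb.q1 {w f : ℝ → R3 → ℝ} (h : Smb (QG D hD) w f) :
    Smb (QG D hD) w (fun a p => pd 1 (f a) p) := fun n => (h (n+1)).q1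
theorem Smb.q2 {w f : ℝ → R3 → ℝ} (h : Smb (QG D hD) w f) :
    Smb (QG D hD) w (fun a p => pd 2 (f a) p) := fun n => (h (n+1)).q2
end

def Qf (M b : ℝ) : Set R3 := {p | p 0 < M + 1 ∧ 0 < p 1 ∧ p 1 < b ∧ |p 2| < 4}

theorem Qf_open (M b : ℝ) : IsOpen (Qf M b) := by
  have c : ∀ i : Fin 3, Continuous (fun p : R3 => p i) := fun i => (contDiff_coord i).continuous
  exact (isOpen_lt (c 0) continuous_const).inter ((isOpen_lt continuous_const (c 1)).inter
    ((isOpen_lt (c 1) continuous_const).inter (isOpen_lt (c 2).abs continuous_const)))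

abbrev QfG (M b : ℝ) : Geo (Fin 3) := QG (Qf M b) (Qf_open M b)

/-- transfer of `t`-independent symbols -/
theorem tind_transfer {M b : ℝ} {w : R3 → ℝ} (hw : TInd w) (n : ℕ) : ∀ F : R3 → ℝ, TInd F → ContDiff ℝ ∞ F →
    SymN (Pb M).G n (fun _ => w) (fun _ => F) → SymN (QfG M b) n (fun _ => w) (fun _ => F) := by
  have base : ∀ F : R3 → ℝ, TInd F → ContDiff ℝ ∞ F →
    SymN (Pb M).G 0 (fun _ => w) (fun _ => F) → SymN (QfG M b) 0 (fun _ => w) (fun _ => F) := by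
    intro F hF hs h
    obtain ⟨C, hC, hb⟩ := h.2
    refine ⟨fun a => hs.contDiffOn, C, hC, fun a p hp => ?_⟩
    have hp : p ∈ Qf M b := hp
    have := hb 0 (update p 1 (2 + 2 * |p 0|)) (by
      have h1 := abs_nonneg (p 0)
      have h2 := neg_abs_le (p 0)
      show _ ∧ _ ∧ _ ∧ _
      simp
      exact ⟨by linarith, by linarith, hp.1, hp.2.2.2⟩)
    beta_reduce at this ⊢
    rwa [hF, hw] at this
  induction n with
  | zero => exact base
  | succ n ih =>
    intro F hF hs h
    have hp0 : ∀ i, ContDiff ℝ ∞ (pd i F) := fun i => contDiff_pd3 hs i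
    refine SymN.mkQ (base F hF hs h.zero) (ih _ ?_ ?_ h.d0) ?_ (ih _ (hF.pd 2) (hp0 2) h.d2)
    · intro p s
      show jb (update p 1 s 0) * pd 0 F (update p 1 s) = jb (p 0) * pd 0 F p
      rw [hF.pd 0]; simp
    · exact (jb_contDiff.comp (contDiff_coord 0)).mul (hp0 0)
    · obtain ⟨C, hC, hb⟩ := (base F hF hs h.zero).2
      have hz : SymN (QfG M b) n (fun _ => w) (fun _ _ => 0) := by
        have hz0 := h.pred.weight_nonneg
        exact ih (fun _ => 0) (fun _ _ => rfl) contDiff_const hz0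
      refine hz.congr fun a p hp => ?_
      have h1 := pd_line F p 1 (hs.differentiable (by simp) p)
      simp only [hF p] at h1
      exact h1.unique (hasDerivAt_const _ _)

theorem tind_trans {M b : ℝ} {w F : R3 → ℝ} (hw : TInd w) (hF : TInd F) (hs : ContDiff ℝ ∞ F)
    (h : Smb (Pb M).G (fun _ => w) (fun _ => F)) : Smb (QfG M b) (fun _ => w) (fun _ => F) :=
  fun n => tind_transfer hw n F hF hs (h n)

section
variable (M b : ℝ)
theorem q_q : Smb (QfG M b) (fun _ p => jb (p 0)) (fun _ p => p 0) :=
  tind_trans (fun p s => by simp) (fun p s => by simp) (contDiff_coord 0) (s_q (Pb M))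
theorem q_jb : Smb (QfG M b) (fun _ p => jb (p 0)) (fun _ p => jb (p 0)) :=
  tind_trans (fun p s => by simp) (fun p s => by simp) (jb_contDiff.comp (contDiff_coord 0)) (s_jb (Pb M))
theorem q_cos : Smb (QfG M b) (fun _ _ => 1) (fun _ p => cos (p 2)) :=
  tind_trans (fun p s => by simp) (fun p s => by simp) (contDiff_cos.comp (contDiff_coord 2)) (s_cos (Pb M))
theorem q_sin : Smb (QfG M b) (fun _ _ => 1) (fun _ p => sin (p 2)) :=
  tind_trans (fun p s => by simp) (fun p s => by simp) (contDiff_sin.comp (contDiff_coord 2)) (s_sin (Pb M))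
theorem q_jbi : Smb (QfG M b) (fun _ p => (jb (p 0))⁻¹) (fun _ p => (jb (p 0))⁻¹) :=
  (q_jb M b).inv one_pos fun a p _ => ⟨jb_pos _, by simp⟩
theorem q_tau : Smb (QfG M b) (fun _ _ => 1) (fun _ p => p 1) := by
  have z : ∀ i j : Fin 3, ∀ p : R3, pd i (fun p : R3 => p j) p = if i = j then 1 else 0 := by
    intro i j p; rw [pd_coord]; simp only [eq_comm]
  have base : SymN (QfG M b) 0 (fun _ _ => 1) (fun _ p => p 1) :=
    ⟨fun a => (contDiff_coord 1).contDiffOn, |b|, abs_nonneg _, fun a p hp => by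
      have h1 : 0 < p 1 := hp.2.1
      have h2 : p 1 < b := hp.2.2.1
      rw [abs_of_pos h1]; have := le_abs_self b; linarith⟩
  intro n
  induction n with
  | zero => exact base
  | succ n ih =>
    refine SymN.mkQ base ?_ ?_ ?_
    · refine (SymN.one 0).congr fun a p _ => ?_
      rw [z]; simp
    · refine (SymN.one 1).congr fun a p _ => ?_
      rw [z]; simp
    · refine (SymN.one 0).congr fun a p _ => ?_
      rw [z]; simp

variable {M b}
theorem Smb.qdq {w f : ℝ → R3 → ℝ} (h : Smb (QfG M b) w f) :
    Smb (QfG M b) (fun a p => (jb (p 0))⁻¹ * w a p) (fun a p => pd 0 (f a) p) :=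
  ((q_jbi M b).mul h.q0).congr fun a p _ => by
    rw [← mul_assoc, inv_mul_cancel₀ (jb_pos _).ne', _root_.one_mul]
end

/-- integrable weight -/
def om (q : ℝ) : ℝ := (jb q)⁻¹ * (√(jb q))⁻¹
theorem om_pos (q : ℝ) : 0 < om q := by have := jb_pos q; unfold om; positivity
theorem om_le_one (q : ℝ) : om q ≤ 1 := by
  have := one_le_jb q
  have h1 : 1 ≤ √(jb q) := by rw [Real.one_le_sqrt]; exact this
  unfold om
  exact mul_le_one₀ (inv_le_one_of_one_le₀ this) (by positivity) (inv_le_one_of_one_le₀ h1)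

theorem int_om_pt {M : ℝ} (hM : 0 < M) : ∃ K, 0 ≤ K ∧ ∀ (g g' : ℝ → ℝ) (q C : ℝ), q ≤ M → 0 ≤ C →
    (∀ s, q ≤ s → s ≤ M → HasDerivAt g (g' s) s ∧ |g' s| ≤ C * om s) →
    g M = 0 → |g q| ≤ K * C := by
  set k := 2 * (M+3) * √(M+3) with hk
  refine ⟨k, by positivity, fun g g' q C hq hC hd h0 => ?_⟩
  have hle : ∀ s, s < M+1 → M + 2 - s ≤ (M+3) * jb s := fun s hs => by
    have h1 := abs_le_jb s; have h2 := one_le_jb s; have := neg_abs_le s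
    nlinarith
  set B : ℝ → ℝ := fun s => C * (k * (1 - (√(M+2-s))⁻¹)) with hB
  have hBd : ∀ s, s ≤ M → HasDerivAt B (C * (k * (-(-(-1 / (2 * √(M+2-s))) / (√(M+2-s))^2)))) s := by
    intro s hs
    have h1 : HasDerivAt (fun s : ℝ => M+2-s) (-1) s := by
      simpa using (hasDerivAt_id' s).const_sub (M+2)
    have hp : 0 < √(M+2-s) := Real.sqrt_pos.2 (by linarith)
    exact ((((h1.sqrt (by linarith : M+2-s ≠ 0)).inv hp.ne').const_sub 1).const_mul k).const_mul C
  have hcmp : ∀ s, s ≤ M → C * om s ≤ C * (k * ((1 / (2 * √(M+2-s))) / (√(M+2-s))^2)) := by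
    intro s hs
    apply mul_le_mul_of_nonneg_left _ hC
    have j := jb_pos s
    have hp : 0 < √(M+2-s) := Real.sqrt_pos.2 (by linarith)
    have h3 : √(M+2-s) ≤ √(M+3) * √(jb s) := by
      rw [← Real.sqrt_mul (by linarith)]; exact Real.sqrt_le_sqrt (hle s (by linarith))
    have h4 : √(M+2-s)^2 ≤ (M+3) * jb s := by
      rw [Real.sq_sqrt (by linarith)]; exact hle s (by linarith)
    have hj : 0 < √(jb s) := Real.sqrt_pos.2 j
    rw [hk, show 2 * (M+3) * √(M+3) * ((1 / (2 * √(M+2-s))) / (√(M+2-s))^2) = (M+3) * √(M+3) / (√(M+2-s)^2 * √(M+2-s)) by field_simp,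
      om, ← mul_inv, inv_eq_one_div, div_le_div_iff₀ (by positivity) (by positivity), _root_.one_mul]
    calc √(M+2-s)^2 * √(M+2-s) ≤ ((M+3) * jb s) * (√(M+3) * √(jb s)) :=
          mul_le_mul h4 h3 hp.le (by positivity)
      _ = _ := by ring
  have main : ∀ σ : ℝ, |σ| ≤ 1 → σ * g q ≤ B q := by
    intro σ hσ
    have hanti : AntitoneOn (fun s => B s - σ * g s) (Set.Icc q M) := by
      refine antitoneOn_of_deriv_nonpos (convex_Icc _ _) ?_ ?_ ?_
      · intro s hs
        exact ((hBd s hs.2).sub ((hd s hs.1 hs.2).1.const_mul σ)).continuousAt.continuousWithinAt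
      · intro s hs
        rw [interior_Icc] at hs
        exact ((hBd s hs.2.le).sub ((hd s hs.1.le hs.2.le).1.const_mul σ)).differentiableAt.differentiableWithinAt
      · intro s hs
        rw [interior_Icc] at hs
        have hdd := ((hBd s hs.2.le).sub ((hd s hs.1.le hs.2.le).1.const_mul σ)).deriv
        refine le_of_eq_of_le hdd ?_
        have h1 := (hd s hs.1.le hs.2.le).2
        have h2 := hcmp s hs.2.le
        have h3 : |σ * g' s| ≤ 1 * |g' s| := by rw [abs_mul]; exact mul_le_mul_of_nonneg_right hσ (abs_nonneg _)
        have h4 := neg_abs_le (σ * g' s)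
        have h5 : C * (k * (-(-(-1 / (2 * √(M+2-s))) / (√(M+2-s))^2))) = - (C * (k * ((1 / (2 * √(M+2-s))) / (√(M+2-s))^2))) := by ring
        rw [h5]; linarith
    have := hanti ⟨le_rfl, hq⟩ ⟨hq, le_rfl⟩ hq
    simp only [h0, mul_zero, sub_zero] at this
    have h1 : 0 ≤ B M := by
      have : 1 ≤ √(M+2-M) := by rw [Real.one_le_sqrt]; linarith
      have := inv_le_one_of_one_le₀ this
      have : 0 ≤ 1 - (√(M+2-M))⁻¹ := by linarith
      simp only [hB]; positivity
    linarith
  have hBq : B q ≤ k * C := by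
    have : 0 ≤ (√(M+2-q))⁻¹ := by positivity
    have hk0 : 0 ≤ k := by positivity
    simp only [hB]
    nlinarith [mul_nonneg (mul_nonneg hC hk0) this]
  refine le_trans ?_ hBq
  rw [abs_le]
  have h1 := main 1 (by simp); have h2 := main (-1) (by simp)
  constructor <;> linarith

theorem pd_zero_ge {h : R3 → ℝ} (hs : ContDiff ℝ ∞ h) {M : ℝ} (h0 : ∀ p, M ≤ p 0 → h p = 0) (i : Fin 3) :
    ∀ p, M ≤ p 0 → pd i h p = 0 := by
  have h1 : ∀ p : R3, M < p 0 → pd i h p = 0 := by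
    intro p hp
    have : h =ᶠ[𝓝 p] fun _ => 0 := by
      filter_upwards [(isOpen_lt continuous_const (contDiff_coord 0).continuous).mem_nhds hp] with q hq
        using h0 q (le_of_lt hq)
    rw [pd_congr this]; simp [pd]
  intro p hp
  have hc : Continuous (fun s => pd i h (update p 0 s)) :=
    (contDiff_pd3 hs i).continuous.comp (continuous_const.update 0 continuous_id)
  have ht : Tendsto (fun s => pd i h (update p 0 s)) (𝓝[>] (p 0)) (𝓝 (pd i h (update p 0 (p 0)))) :=
    (hc.tendsto _).mono_left nhdsWithin_le_nhds
  rw [update_eq_self] at ht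
  refine tendsto_nhds_unique ht (tendsto_const_nhds.congr' ?_)
  filter_upwards [self_mem_nhdsWithin] with s hs
  rw [h1]; simp; exact lt_of_le_of_lt hp hs

theorem int_om {M b : ℝ} (hM : 0 < M) (n : ℕ) : ∀ h : R3 → ℝ, ContDiff ℝ ∞ h → (∀ p, M ≤ p 0 → h p = 0) →
    SymN (QfG M b) n (fun _ p => om (p 0)) (fun _ => pd 0 h) → SymN (QfG M b) n (fun _ _ => 1) (fun _ => h) := by
  have base : ∀ h : R3 → ℝ, ContDiff ℝ ∞ h → (∀ p, M ≤ p 0 → h p = 0) →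
    SymN (QfG M b) 0 (fun _ p => om (p 0)) (fun _ => pd 0 h) → SymN (QfG M b) 0 (fun _ _ => 1) (fun _ => h) := by
    intro h hs h0 hg
    obtain ⟨K, hK, hit⟩ := int_om_pt hM
    obtain ⟨C, hC, hb⟩ := hg.2
    refine ⟨fun _ => hs.contDiffOn, K * C, by positivity, fun a p hp => ?_⟩
    have hp : p ∈ Qf M b := hp
    by_cases hq : M ≤ p 0
    · beta_reduce; rw [h0 p hq, abs_zero]; positivity
    have := hit (fun s => h (update p 0 s)) (fun s => pd 0 h (update p 0 s))
      (p 0) C (not_le.1 hq).le hC (fun s h1 h2 => ?_) (h0 _ (by simp))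
    · simpa using this
    · refine ⟨pd_line' (hs.differentiable (by simp) _), ?_⟩
      have := hb a (update p 0 s) (show _ ∧ _ from ⟨by simp; linarith, by simpa using hp.2⟩)
      simpa using this
  induction n with
  | zero => exact base
  | succ n ih =>
    intro h hs h0 hg
    have hc : ∀ i, pd 0 (pd i h) = pd i (pd 0 h) := fun i => by
      funext p; exact pd_comm_at hs.contDiffAt 0 i
    refine SymN.mkQ (base h hs h0 hg.zero) ?_ (ih _ (contDiff_pd3 hs 1) (pd_zero_ge hs h0 1) ?_)
      (ih _ (contDiff_pd3 hs 2) (pd_zero_ge hs h0 2) ?_)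
    · refine ((q_jb M b n).mul hg.pred).mono zero_le_one fun a p hp => ?_
      have h1 := one_le_jb (p 0)
      have h2 := jb_pos (p 0)
      have h3 : 1 ≤ √(jb (p 0)) := by rw [Real.one_le_sqrt]; exact h1
      simp only [om]
      rw [← mul_assoc, mul_inv_cancel₀ h2.ne']
      simpa using inv_le_one_of_one_le₀ h3
    · rw [hc 1]; exact hg.q1
    · rw [hc 2]; exact hg.q2

end

noncomputable section
open Function

/-! ### Characteristics -/

theorem zero_of_pd0 {f : R3 → ℝ} (hf : ContDiff ℝ ∞ f) {M : ℝ} {p : R3}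
    (h : ∀ s, pd 0 f (update p 0 s) = 0) (h0 : f (update p 0 M) = 0) : f p = 0 := by
  have hd : ∀ s, HasDerivAt (fun s => f (update p 0 s)) 0 s := fun s => by
    have := pd_line' (p := p) (i := 0) (s := s) (hf.differentiable (by simp) (update p 0 s))
    rwa [h s] at this
  have := is_const_of_deriv_eq_zero (fun s => (hd s).differentiableAt) (fun s => (hd s).deriv) (p 0) M
  simpa [h0] using this

def QInd (F : R3 → ℝ) : Prop := ∀ p s, F (update p 0 s) = F p

theorem QInd.pd0 {F : R3 → ℝ} (h : QInd F) (hF : ContDiff ℝ ∞ F) (p : R3) : pd 0 F p = 0 := by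
  have h1 := pd_line F p 0 (hF.differentiable (by simp) p)
  simp only [h p] at h1
  exact h1.unique (hasDerivAt_const _ _)

theorem char_exists {M b : ℝ} (hM : 0 < M) {F Dd Ee : R3 → ℝ} (hF : ContDiff ℝ ∞ F) (hFt : TInd F)
    (hF0 : ∀ p, M ≤ p 0 → F p = 0) (hFs : Smb (QfG M b) (fun _ p => (√(jb (p 0)))⁻¹) (fun _ => F))
    (hD : ContDiff ℝ ∞ Dd) (hDt : TInd Dd) (hDq : QInd Dd) (hDs : Smb (QfG M b) (fun _ _ => 1) (fun _ => Dd))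
    (hE : ContDiff ℝ ∞ Ee) (hEt : TInd Ee) (hEq : QInd Ee) (hEs : Smb (QfG M b) (fun _ _ => 1) (fun _ => Ee)) :
    ∃ P A k : R3 → ℝ, ContDiff ℝ ∞ P ∧ ContDiff ℝ ∞ A ∧ ContDiff ℝ ∞ k ∧
      (∀ p, pd 0 P p = k p - 1) ∧ (∀ p, pd 0 A p = pd 0 F p * k p) ∧
      (∀ p, M ≤ p 0 → P p = 0) ∧ (∀ p, M ≤ p 0 → A p = 0) ∧
      (∀ p, pd 1 P p = -(Dd p * A p + Ee p * pd 0 F p)) ∧ (∀ p, p 1 = 0 → P p = 0) ∧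
      Smb (QfG M b) (fun _ p => om (p 0)) (fun _ p => k p - 1) ∧
      Smb (QfG M b) (fun _ _ => 1) (fun _ => P) ∧ Smb (QfG M b) (fun _ _ => 1) (fun _ => A) := by
  set F' := pd 0 F with hF'
  set F'' := pd 0 F' with hF''
  have cF' : ContDiff ℝ ∞ F' := contDiff_pd3 hF 0
  have cF'' : ContDiff ℝ ∞ F'' := contDiff_pd3 cF' 0
  have F't : TInd F' := hFt.pd 0
  have F''t : TInd F'' := F't.pd 0
  set y : R3 → ℝ := fun p => Dd p * F' p with hy
  set c : R3 → ℝ := fun p => y p + Ee p * F'' p with hc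
  have cy : ContDiff ℝ ∞ y := hD.mul cF'
  have cc : ContDiff ℝ ∞ c := cy.add (hE.mul cF'')
  have yt : TInd y := fun p s => by simp only [hy, hDt p s, F't p s]
  have ct : TInd c := fun p s => by simp only [hc, yt p s, hEt p s, F''t p s]
  set k : R3 → ℝ := fun p => 1 - c p * K2 (y p) (p 1) with hk
  have ck : ContDiff ℝ ∞ k :=
    contDiff_const.sub (cc.mul (K2_contDiff.comp (cy.prodMk (contDiff_coord 1))))
  have z' : ∀ p, M ≤ p 0 → F' p = 0 := pd_zero_ge hF hF0 0
  have z'' : ∀ p, M ≤ p 0 → F'' p = 0 := pd_zero_ge cF' z' 0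
  have kz : ∀ p, M ≤ p 0 → k p - 1 = 0 := fun p hp => by simp [hk, hc, hy, z' p hp, z'' p hp]
  obtain ⟨P, cP, P0, PM, PZ⟩ := antider M (ck.sub contDiff_const : ContDiff ℝ ∞ fun p => k p - 1)
  obtain ⟨A, cA, A0, AM, AZ⟩ := antider M (cF'.mul ck : ContDiff ℝ ∞ fun p => F' p * k p)
  have PZ := PZ kz
  have AZ := AZ (fun p hp => by simp [z' p hp])
  have k1 : ∀ p, pd 1 k p = -(y p * k p + Ee p * F'' p) := by
    intro p
    have h1 := pd_line k p 1 (ck.differentiable (by simp) p)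
    simp only [hk, ct p, yt p, update_self] at h1
    have h2 := ((K2_deriv (y p) (p 1)).const_mul (c p)).const_sub 1
    rw [h1.unique h2]
    have := K2_mul (y p) (p 1)
    have h3 : exp (-(p 1 * y p)) = 1 - y p * K2 (y p) (p 1) := by linarith
    rw [h3]; simp only [hk, hc]; ring
  have P1 : ∀ p, pd 1 P p = -(Dd p * A p + Ee p * F' p) := by
    intro p
    have cR : ContDiff ℝ ∞ (fun p => Dd p * A p + Ee p * F' p) := (hD.mul cA).add (hE.mul cF')
    have cf : ContDiff ℝ ∞ (fun p => pd 1 P p + (Dd p * A p + Ee p * F' p)) := (contDiff_pd3 cP 1).add cR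
    have df : ∀ {f : R3 → ℝ}, ContDiff ℝ ∞ f → ∀ p, DifferentiableAt ℝ f p := fun h p =>
      h.differentiable (by simp) p
    have hz : ∀ q, pd 0 (fun p => pd 1 P p + (Dd p * A p + Ee p * F' p)) q = 0 := by
      intro q
      rw [pd_add' (df (contDiff_pd3 cP 1) q) (df cR q), pd_add' (df (hD.mul cA) q) (df (hE.mul cF') q),
        pd_mul' (df hD q) (df cA q), pd_mul' (df hE q) (df cF' q), hDq.pd0 hD, hEq.pd0 hE, A0,
        pd_comm_at cP.contDiffAt 0 1]
      have e : pd 0 P = fun p => k p - 1 := funext P0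
      have e2 : pd 1 (fun p => k p - 1) q = pd 1 k q := by
        rw [pd_sub' (df ck q) (by fun_prop)]; simp [pd]
      rw [e, e2, k1]
      simp only [hy, hF'']; ring
    have := zero_of_pd0 cf (M := M) (p := p) (fun s => hz _) (by
      have h1 : M ≤ (update p 0 M) 0 := by simp
      rw [AZ _ h1, z' _ h1, pd_zero_ge cP PZ 1 _ h1]; simp)
    linarith
  have sF' : Smb (QfG M b) (fun _ p => om (p 0)) (fun _ => F') := hFs.qdq
  have sF'' : Smb (QfG M b) (fun _ p => om (p 0)) (fun _ => F'') := sF'.qdq.mono zero_le_one fun a p _ => by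
    have := inv_le_one_of_one_le₀ (one_le_jb (p 0))
    exact mul_le_mul_of_nonneg_right this (om_pos _).le
  have up : ∀ f, Smb (QfG M b) (fun _ p => om (p 0)) f → Smb (QfG M b) (fun _ _ => 1) f := fun f h =>
    h.mono zero_le_one fun a p _ => by simpa using om_le_one (p 0)
  have sy : Smb (QfG M b) (fun _ p => om (p 0)) (fun _ => y) := hDs.one_mul sF'
  have sc : Smb (QfG M b) (fun _ p => om (p 0)) (fun _ => c) := sy.add (hEs.one_mul sF'')
  have sK : Smb (QfG M b) (fun _ _ => 1) (fun _ p => K2 (y p) (p 1)) := by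
    have := Smb.comp0 (G := QfG M b) (f := ![fun _ => y, fun _ p => p 1]) (h := fun z => K2 (z 0) (z 1)) (by
      intro i; fin_cases i
      · exact up _ sy
      · exact q_tau M b) (K2_contDiff.comp ((contDiff_apply ℝ ℝ 0).prodMk (contDiff_apply ℝ ℝ 1)))
    exact this
  have sk : Smb (QfG M b) (fun _ p => om (p 0)) (fun _ p => k p - 1) :=
    (sc.mul_one sK).neg.congr fun a p _ => by simp only [hk]; ring
  have sP : Smb (QfG M b) (fun _ _ => 1) (fun _ => P) := fun n =>
    int_om hM n P cP PZ ((sk n).congr fun a p _ => P0 p)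
  have sA : Smb (QfG M b) (fun _ _ => 1) (fun _ => A) := fun n =>
    int_om hM n A cA AZ ((((sF'.mul_one ((up _ sk).add (Smb.one 1)))) n).congr fun a p _ => by
      rw [A0 p]; ring)
  refine ⟨P, A, k, cP, cA, ck, P0, A0, PZ, AZ, P1, ?_, sk, sP, sA⟩
  intro p hp
  refine zero_of_pd0 cP (M := M) (fun s => ?_) (PM _ (by simp))
  rw [P0]; simp [hk, K2, hp]

end

noncomputable section
open Function

theorem gron {s0 M b C : ℝ} (X X' : ℝ → ℝ → ℝ)
    (hc : ContinuousOn (fun z : ℝ × ℝ => X z.1 z.2) (Set.Icc s0 M ×ˢ Set.Icc 0 b))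
    (h0 : ∀ s ∈ Set.Icc s0 M, X s 0 = 0)
    (hd : ∀ s ∈ Set.Icc s0 M, ∀ τ ∈ Set.Ioo 0 b, HasDerivAt (X s) (X' s τ) τ) (hC : 0 ≤ C)
    (hX : ∀ s ∈ Set.Icc s0 M, ∀ τ ∈ Set.Ioo 0 b, ∀ B, (∀ s' ∈ Set.Icc s0 M, |X s' τ| ≤ B) →
      |X' s τ| ≤ C * B) :
    ∀ s ∈ Set.Icc s0 M, ∀ τ ∈ Set.Icc 0 b, X s τ = 0 := by
  intro s hs τ hτ
  set l := 2 * C + 1 with hl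
  have hl0 : 0 < l := by positivity
  set h : ℝ × ℝ → ℝ := fun z => exp (-(l * z.2)) * |X z.1 z.2| with hh
  have hK : IsCompact (Set.Icc s0 M ×ˢ Set.Icc (0:ℝ) b) := isCompact_Icc.prod isCompact_Icc
  obtain ⟨z, hz, hmax⟩ := hK.exists_isMaxOn (f := h) (⟨(s, τ), Set.mk_mem_prod hs hτ⟩ : Set.Nonempty _)
    ((by fun_prop : Continuous fun z : ℝ × ℝ => exp (-(l * z.2))).continuousOn.mul hc.abs)
  have hN : ∀ s ∈ Set.Icc s0 M, ∀ τ ∈ Set.Icc 0 b, |X s τ| ≤ h z * exp (l * τ) := by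
    intro s hs τ hτ
    have : h (s, τ) ≤ h z := hmax (Set.mk_mem_prod hs hτ)
    simp only [hh] at this ⊢
    have h1 := mul_le_mul_of_nonneg_right this (exp_pos (l * τ)).le
    have h2 : exp (-(l * τ)) * |X s τ| * exp (l * τ) = |X s τ| := by
      rw [exp_neg]; field_simp
    linarith
  set N := h z with hNd
  have hN0 : 0 ≤ N := by simp only [hNd, hh]; positivity
  have main : ∀ σ : ℝ, |σ| ≤ 1 → σ * X z.1 z.2 ≤ C * N / l * exp (l * z.2) := by
    intro σ hσ
    have hBd : ∀ t, HasDerivAt (fun t => C * N / l * exp (l * t)) (C * N * exp (l * t)) t := by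
      intro t
      have h1 : HasDerivAt (fun t => l * t) (l * 1) t := (hasDerivAt_id' t).const_mul l
      have h2 := h1.exp.const_mul (C * N / l)
      have e : C * N / l * (exp (l * t) * (l * 1)) = C * N * exp (l * t) := by field_simp
      rwa [e] at h2
    have hXc : ContinuousOn (X z.1) (Set.Icc 0 b) :=
      hc.comp (f := fun t => (z.1, t)) (by fun_prop) (fun t ht => ⟨hz.1, ht⟩)
    have hmono : MonotoneOn (fun t => C * N / l * exp (l * t) - σ * X z.1 t) (Set.Icc 0 b) := by
      refine monotoneOn_of_deriv_nonneg (convex_Icc _ _) ?_ ?_ ?_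
      · exact (by fun_prop : Continuous fun t => C * N / l * exp (l * t)).continuousOn.sub
          (hXc.const_mul σ |>.congr fun t _ => rfl)
      · intro t ht
        rw [interior_Icc] at ht
        exact ((hBd t).sub ((hd _ hz.1 t ht).const_mul σ)).differentiableAt.differentiableWithinAt
      · intro t ht
        rw [interior_Icc] at ht
        refine le_of_le_of_eq ?_ ((hBd t).sub ((hd _ hz.1 t ht).const_mul σ)).deriv.symm
        have h1 := hX z.1 hz.1 t ht _ (fun s' hs' => hN s' hs' t ⟨ht.1.le, ht.2.le⟩)
        have h3 : |σ * X' z.1 t| ≤ 1 * |X' z.1 t| := by rw [abs_mul]; exact mul_le_mul_of_nonneg_right hσ (abs_nonneg _)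
        have h4 := le_abs_self (σ * X' z.1 t)
        rw [← mul_assoc] at h1
        linarith
    have := hmono ⟨le_rfl, by linarith [hz.2.1, hz.2.2]⟩ hz.2 hz.2.1
    simp only [h0 _ hz.1, mul_zero, sub_zero, exp_zero, mul_one] at this
    have : 0 ≤ C * N / l := by positivity
    linarith
  have h1 : |X z.1 z.2| ≤ C * N / l * exp (l * z.2) := by
    rw [abs_le]; have a := main 1 (by simp); have b := main (-1) (by simp)
    constructor <;> linarith
  have h2 : N ≤ C * N / l := by
    have := mul_le_mul_of_nonneg_left h1 (exp_pos (-(l * z.2))).le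
    have e : exp (-(l * z.2)) * (C * N / l * exp (l * z.2)) = C * N / l := by
      rw [exp_neg]; field_simp
    rw [e] at this
    exact this
  have h3 : N = 0 := by
    rw [le_div_iff₀ hl0] at h2
    nlinarith
  have := hN s hs τ hτ
  rw [h3, zero_mul] at this
  exact abs_eq_zero.1 (le_antisymm this (abs_nonneg _))

/-! slab -/
def Sl (T : ℝ) : Set R3 := {p | 0 ≤ p 1 ∧ p 1 < T}

theorem Sl_nhds {T : ℝ} {p : R3} (h0 : 0 < p 1) (h1 : p 1 < T) : Sl T ∈ 𝓝 p := by
  have c : Continuous (fun p : R3 => p 1) := (contDiff_coord 1).continuous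
  have : {p : R3 | 0 < p 1} ∩ {p | p 1 < T} ∈ 𝓝 p :=
    ((isOpen_lt continuous_const c).inter (isOpen_lt c continuous_const)).mem_nhds ⟨h0, h1⟩
  exact mem_of_superset this fun q hq => ⟨le_of_lt hq.1, hq.2⟩

theorem Sl_unique {T : ℝ} (hT : 0 < T) : UniqueDiffOn ℝ (Sl T) := by
  refine uniqueDiffOn_convex ?_ ⟨![0, T/2, 0], ?_⟩
  · intro x hx y hy a b ha hb hab
    simp only [Sl, Set.mem_setOf_eq, Pi.add_apply, Pi.smul_apply, smul_eq_mul] at hx hy ⊢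
    constructor
    · exact add_nonneg (mul_nonneg ha hx.1) (mul_nonneg hb hy.1)
    · rcases ha.eq_or_lt with rfl | ha
      · have : b = 1 := by linarith
        subst this; simpa using hy.2
      · nlinarith
  · exact mem_interior_iff_mem_nhds.2 (Sl_nhds (by simp; linarith) (by simp; linarith))

def WD (T : ℝ) (v : R3 → R3) (f : R3 → ℝ) (p : R3) : ℝ := fderivWithin ℝ f (Sl T) p (v p)

theorem WD_smooth {T : ℝ} (hT : 0 < T) {v : R3 → R3} (hv : ContDiff ℝ ∞ v) {f : R3 → ℝ} (hf : ContDiffOn ℝ ∞ f (Sl T)) :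
    ContDiffOn ℝ ∞ (WD T v f) (Sl T) :=
  (hf.fderivWithin (Sl_unique hT) (m := ∞) (by simp)).clm_apply hv.contDiffOn

theorem WD_eq {T : ℝ} {v : R3 → R3} {f : R3 → ℝ} {p : R3} (h0 : 0 < p 1) (h1 : p 1 < T) :
    WD T v f p = Dv v f p := by
  rw [WD, fderivWithin_of_mem_nhds (Sl_nhds h0 h1), Dv]

def ez : Fin 3 → R3 → R3 := fun i _ => Pi.single i 1

theorem WD_line {T : ℝ} {f : R3 → ℝ} (hf : ContDiffOn ℝ ∞ f (Sl T)) {p : R3} (hp : p ∈ Sl T) {i : Fin 3} (hi : i ≠ 1) :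
    HasDerivAt (fun s => f (update p i s)) (WD T (ez i) f p) (p i) := by
  have h1 : HasDerivAt (fun s : ℝ => update p i s) (Pi.single i 1 : R3) (p i) := hasDerivAt_update p i (p i)
  have h2 : HasFDerivWithinAt f (fderivWithin ℝ f (Sl T) p) (Sl T) (update p i (p i)) := by
    rw [update_eq_self]; exact ((hf p hp).differentiableWithinAt (by simp)).hasFDerivWithinAt
  exact h2.comp_hasDerivAt (p i) h1 (Eventually.of_forall fun s => by
    simpa [Sl, update_of_ne hi.symm] using hp)

/-! shift in the first coordinate -/
def Th (P : R3 → ℝ) (p : R3) : R3 := update p 0 (p 0 + P p)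

theorem Th_chain {P f : R3 → ℝ} {p : R3} (hP : DifferentiableAt ℝ P p) (hf : DifferentiableAt ℝ f (Th P p)) (i : Fin 3) :
    pd i (fun p => f (Th P p)) p = pd i f (Th P p) + pd i P p * pd 0 f (Th P p) := by
  have e : Th P = fun p => p + P p • (Pi.single 0 1 : R3) := by
    funext p j; fin_cases j <;> simp [Th]
  have h1 : HasFDerivAt (Th P) (ContinuousLinearMap.id ℝ R3 + (fderiv ℝ P p).smulRight (Pi.single 0 1 : R3)) p := by
    rw [e]; exact (hasFDerivAt_id p).add (hP.hasFDerivAt.smul_const _)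
  have h2 := hf.hasFDerivAt.comp p h1
  simp only [pd]
  have e2 : fderiv ℝ (fun p => f (Th P p)) p = _ := h2.fderiv
  rw [e2]; simp

theorem Th_smooth {P : R3 → ℝ} (hP : ContDiff ℝ ∞ P) : ContDiff ℝ ∞ (Th P) := by
  have e : Th P = fun p => p + P p • (Pi.single 0 1 : R3) := by
    funext p j; fin_cases j <;> simp [Th]
  rw [e]; exact contDiff_id.add (hP.smul contDiff_const)

theorem Th_one (P : R3 → ℝ) (p : R3) : Th P p 1 = p 1 := by simp [Th]
theorem Th_zero (P : R3 → ℝ) (p : R3) : Th P p 0 = p 0 + P p := by simp [Th]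

end

noncomputable section
open Function

theorem upd0 (a b c s : ℝ) : update (![a, b, c] : R3) 0 s = ![s, b, c] := by
  funext i; fin_cases i <;> simp [update]
theorem upd1 (a b c s : ℝ) : update (![a, b, c] : R3) 1 s = ![a, s, c] := by
  funext i; fin_cases i <;> simp [update]

theorem ez_smooth (i : Fin 3) : ContDiff ℝ ∞ (ez i) := contDiff_const

theorem WD_pd {T : ℝ} {f : R3 → ℝ} {p : R3} (h0 : 0 < p 1) (h1 : p 1 < T) (i : Fin 3) :
    WD T (ez i) f p = pd i f p := WD_eq h0 h1

theorem Sl_at {T : ℝ} {f : R3 → ℝ} (hf : ContDiffOn ℝ ∞ f (Sl T)) {p : R3} (h0 : 0 < p 1) (h1 : p 1 < T) :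
    ContDiffAt ℝ ∞ f p := hf.contDiffAt (Sl_nhds h0 h1)

theorem Sl_ev {T : ℝ} {p : R3} (h0 : 0 < p 1) (h1 : p 1 < T) : ∀ᶠ q in 𝓝 p, 0 < q 1 ∧ q 1 < T := by
  have c : Continuous (fun p : R3 => p 1) := (contDiff_coord 1).continuous
  exact ((isOpen_lt continuous_const c).inter (isOpen_lt c continuous_const)).mem_nhds ⟨h0, h1⟩

theorem prof_char {T M : ℝ} (hT : 0 < T) {W F Dd Ee P A k : R3 → ℝ} (hW : ContDiffOn ℝ ∞ W (Sl T))
    (hW0 : ∀ p, p 1 = 0 → W p = F p) (hWM : ∀ p, 0 < p 1 → p 1 < T → M ≤ p 0 → W p = 0)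
    (hpde : ∀ p, 0 < p 1 → p 1 < T → pd 1 (pd 0 W) p = (Dd p * W p + Ee p * pd 0 W p) * pd 0 (pd 0 W) p)
    (hF : ContDiff ℝ ∞ F) (hFt : TInd F) (hDq : QInd Dd) (hEq : QInd Ee)
    (hDc : ContDiff ℝ ∞ Dd) (hEc : ContDiff ℝ ∞ Ee)
    (hP : ContDiff ℝ ∞ P) (hA : ContDiff ℝ ∞ A) (hk : ContDiff ℝ ∞ k)
    (dP : ∀ p, pd 0 P p = k p - 1) (dA : ∀ p, pd 0 A p = pd 0 F p * k p)
    (PM : ∀ p, M ≤ p 0 → P p = 0) (AM : ∀ p, M ≤ p 0 → A p = 0)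
    (dP1 : ∀ p, pd 1 P p = -(Dd p * A p + Ee p * pd 0 F p)) (P0 : ∀ p, p 1 = 0 → P p = 0) :
    ∀ p, 0 < p 1 → p 1 < T → W (Th P p) = A p := by
  intro p h0 h1
  rcases le_or_gt M (p 0) with hpM | hpM
  · have e : Th P p = p := by funext j; fin_cases j <;> simp [Th, PM p hpM]
    rw [e, hWM p h0 h1 hpM, AM p hpM]
  set W1 := WD T (ez 0) W with hW1
  set W2 := WD T (ez 0) W1 with hW2
  have cW1 : ContDiffOn ℝ ∞ W1 (Sl T) := WD_smooth hT (ez_smooth 0) hW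
  have cW2 : ContDiffOn ℝ ∞ W2 (Sl T) := WD_smooth hT (ez_smooth 0) cW1
  have W1eq : ∀ p, 0 < p 1 → p 1 < T → W1 p = pd 0 W p := fun p h0 h1 => WD_pd h0 h1 0
  have W1pd : ∀ p, 0 < p 1 → p 1 < T → ∀ i, pd i W1 p = pd i (pd 0 W) p := by
    intro p h0 h1 i
    have : W1 =ᶠ[𝓝 p] pd 0 W := by
      filter_upwards [Sl_ev h0 h1] with q hq using W1eq q hq.1 hq.2
    simp only [pd, this.fderiv_eq]
  have W2eq : ∀ p, 0 < p 1 → p 1 < T → W2 p = pd 0 (pd 0 W) p := fun p h0 h1 =>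
    (WD_pd h0 h1 0).trans (W1pd p h0 h1 0)
  have hPd : ∀ p, DifferentiableAt ℝ P p := fun p => hP.differentiable (by simp) p
  have dA0 : ∀ p, 0 < p 1 → p 1 < T → HasDerivAt (fun s => W (Th P (update p 0 s)) - A (update p 0 s))
      ((W1 (Th P p) - pd 0 F p) * k p) (p 0) := by
    intro p h0 h1
    have h0' : 0 < Th P p 1 := by rwa [Th_one]
    have h1' : Th P p 1 < T := by rwa [Th_one]
    have hd : DifferentiableAt ℝ W (Th P p) := (Sl_at hW h0' h1').differentiableAt (by simp)
    have hd1 : DifferentiableAt ℝ (fun p => W (Th P p)) p :=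
      hd.comp p ((Th_smooth hP).differentiable (by simp) p)
    have := (pd_line (fun p => W (Th P p)) p 0 hd1).sub (pd_line A p 0 (hA.differentiable (by simp) p))
    rw [Th_chain (hPd p) hd, dA, dP, ← W1eq _ h0' h1'] at this
    have this' : HasDerivAt (fun s => W (Th P (update p 0 s)) - A (update p 0 s)) _ (p 0) := this
    convert this' using 1; ring
  set θ := p 2 with hθ
  have hp : p = ![p 0, p 1, θ] := by funext j; fin_cases j <;> simp [hθ]
  have A0bd : ∀ τ, 0 < τ → τ < T → ∀ s0 B K, (∀ s ∈ Set.Icc s0 M, |W1 (Th P ![s, τ, θ]) - pd 0 F ![s, τ, θ]| ≤ B) →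
      (∀ s ∈ Set.Icc s0 M, |k ![s, τ, θ]| ≤ K) → 0 ≤ B → 0 ≤ K → ∀ s ∈ Set.Icc s0 M,
      |W (Th P ![s, τ, θ]) - A ![s, τ, θ]| ≤ B * K * (M - s0) := by
    intro τ hτ hτT s0 B K hB hK B0 K0 s hs
    have hd : ∀ s, HasDerivAt (fun s => W (Th P ![s, τ, θ]) - A ![s, τ, θ])
      ((W1 (Th P ![s, τ, θ]) - pd 0 F ![s, τ, θ]) * k ![s, τ, θ]) s := by
      intro s
      have := dA0 ![s, τ, θ] hτ hτT
      simp only [upd0] at this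
      exact this
    have hm := (convex_Icc s0 M).norm_image_sub_le_of_norm_hasDerivWithin_le
      (f := fun s => W (Th P ![s, τ, θ]) - A ![s, τ, θ]) (C := B * K)
      (fun x hx => (hd x).hasDerivWithinAt) (fun x hx => by
        rw [norm_mul, Real.norm_eq_abs, Real.norm_eq_abs]
        exact mul_le_mul (hB x hx) (hK x hx) (abs_nonneg _) B0)
      (Set.mem_Icc.2 ⟨hs.1.trans hs.2, le_rfl⟩ : M ∈ Set.Icc s0 M) hs
    have e : Th P ![M, τ, θ] = ![M, τ, θ] := by
      funext j; fin_cases j <;> simp [Th, PM ![M, τ, θ] (by simp)]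
    beta_reduce at hm
    rw [e, hWM ![M, τ, θ] hτ hτT (by simp), AM ![M, τ, θ] (by simp), sub_zero, sub_zero, Real.norm_eq_abs, Real.norm_eq_abs] at hm
    refine hm.trans (mul_le_mul_of_nonneg_left ?_ (by positivity))
    rw [abs_le]; constructor <;> linarith [hs.1, hs.2]
  set s0 := p 0
  set b := p 1
  set X : ℝ → ℝ → ℝ := fun s τ => W1 (Th P ![s, τ, θ]) - pd 0 F ![s, τ, θ] with hX
  have hK : IsCompact (Set.Icc s0 M ×ˢ Set.Icc (0:ℝ) b) := isCompact_Icc.prod isCompact_Icc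
  have cvec : Continuous (fun z : ℝ × ℝ => (![z.1, z.2, θ] : R3)) := by
    refine continuous_pi fun i => ?_
    fin_cases i <;> simp <;> fun_prop
  have cTh : Continuous (fun z : ℝ × ℝ => Th P ![z.1, z.2, θ]) := (Th_smooth hP).continuous.comp cvec
  have mp : Set.MapsTo (fun z : ℝ × ℝ => Th P ![z.1, z.2, θ]) (Set.Icc s0 M ×ˢ Set.Icc (0:ℝ) b) (Sl T) := by
    intro z hz
    simp only [Sl]
    have := hz.2
    constructor
    · rw [Th_one]; exact this.1
    · rw [Th_one]; exact this.2.trans_lt h1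
  have cX : ContinuousOn (fun z : ℝ × ℝ => X z.1 z.2) (Set.Icc s0 M ×ˢ Set.Icc 0 b) :=
    (cW1.continuousOn.comp cTh.continuousOn mp).sub ((contDiff_pd3 hF 0).continuous.comp cvec).continuousOn
  obtain ⟨K1, hK1⟩ := hK.exists_bound_of_continuousOn (f := fun z : ℝ × ℝ => k ![z.1, z.2, θ]) (hk.continuous.comp cvec).continuousOn
  obtain ⟨K2, hK2⟩ := hK.exists_bound_of_continuousOn (f := fun z : ℝ × ℝ => Dd ![z.1, z.2, θ]) (hDc.continuous.comp cvec).continuousOn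
  obtain ⟨K3, hK3⟩ := hK.exists_bound_of_continuousOn (f := fun z : ℝ × ℝ => Ee ![z.1, z.2, θ]) (hEc.continuous.comp cvec).continuousOn
  obtain ⟨K4, hK4⟩ := hK.exists_bound_of_continuousOn (f := fun z : ℝ × ℝ => W2 (Th P ![z.1, z.2, θ])) (cW2.continuousOn.comp cTh.continuousOn mp)
  have mem : ∀ s ∈ Set.Icc s0 M, ∀ τ ∈ Set.Ioo 0 b, ((s, τ) : ℝ × ℝ) ∈ Set.Icc s0 M ×ˢ Set.Icc (0:ℝ) b :=
    fun s hs τ hτ => ⟨hs, hτ.1.le, hτ.2.le⟩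
  have hX0 : ∀ s ∈ Set.Icc s0 M, ∀ τ ∈ Set.Icc 0 b, X s τ = 0 := by
    refine gron (C := (|K2| * (|K1| * (M - s0)) + |K3|) * |K4|) X
      (fun s τ => (Dd ![s,τ,θ] * (W (Th P ![s,τ,θ]) - A ![s,τ,θ]) + Ee ![s,τ,θ] * X s τ) * W2 (Th P ![s,τ,θ]))
      cX ?_ ?_ (by have : 0 ≤ M - s0 := by linarith
                   positivity) ?_
    · intro s hs
      simp only [hX]
      have e : Th P ![s, 0, θ] = ![s, 0, θ] := by
        funext j; fin_cases j <;> simp [Th, P0 ![s, 0, θ] (by simp)]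
      rw [e]
      have hm : (![s, 0, θ] : R3) ∈ Sl T := by simp [Sl, hT]
      have a := WD_line hW hm (i := 0) (by decide)
      have c := pd_line F ![s, 0, θ] 0 (hF.differentiable (by simp) _)
      have e2 : (fun s_1 => W (update ![s, 0, θ] 0 s_1)) = fun s_1 => F (update ![s, 0, θ] 0 s_1) := by
        funext x; rw [upd0]; exact hW0 _ (by simp)
      rw [e2] at a
      rw [← hW1] at a
      rw [a.unique c, sub_self]
    · intro s hs τ hτ
      set p : R3 := ![s, τ, θ] with hp
      have q0 : 0 < Th P p 1 := by rw [Th_one]; simpa [hp] using hτ.1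
      have q1 : Th P p 1 < T := by rw [Th_one]; simpa [hp] using hτ.2.trans h1
      have hd : DifferentiableAt ℝ W1 (Th P p) := (Sl_at cW1 q0 q1).differentiableAt (by simp)
      have hd1 : DifferentiableAt ℝ (fun p => W1 (Th P p)) p :=
        hd.comp p ((Th_smooth hP).differentiable (by simp) p)
      have := (pd_line (fun p => W1 (Th P p)) p 1 hd1).sub
        (pd_line (pd 0 F) p 1 ((contDiff_pd3 hF 0).differentiable (by simp) p))
      have z : pd 1 (pd 0 F) p = 0 := by
        have h2 := pd_line (pd 0 F) p 1 ((contDiff_pd3 hF 0).differentiable (by simp) p)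
        have : (fun s => pd 0 F (update p 1 s)) = fun _ => pd 0 F p := by
          funext s; exact hFt.pd 0 p s
        rw [this] at h2
        exact h2.unique (hasDerivAt_const _ _)
      rw [Th_chain (hPd p) hd, W1pd _ q0 q1, W1pd _ q0 q1, z, hpde _ q0 q1, dP1, ← W1eq _ q0 q1, ← W2eq _ q0 q1] at this
      have eD : Dd (Th P p) = Dd p := hDq p _
      have eE : Ee (Th P p) = Ee p := hEq p _
      rw [eD, eE] at this
      have e1 : p 1 = τ := by simp [hp]
      rw [e1] at this
      have e3 : (fun s => W1 (Th P (update p 1 s)) - pd 0 F (update p 1 s)) = X s := by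
        funext x; rw [hp, upd1]
      have this' : HasDerivAt (fun s => W1 (Th P (update p 1 s)) - pd 0 F (update p 1 s)) _ τ := this
      rw [e3] at this'
      convert this' using 1
      simp only [hX, ← hp]; ring
    · intro s hs τ hτ B hB
      have hm := mem s hs τ hτ
      have B0 : 0 ≤ B := (abs_nonneg _).trans (hB s hs)
      have b1 := A0bd τ hτ.1 (hτ.2.trans h1) s0 B |K1| hB (fun s hs => (hK1 _ (mem s hs τ hτ)).trans (le_abs_self _))
        B0 (abs_nonneg _) s hs
      have b2 : |Dd ![s,τ,θ]| ≤ |K2| := (hK2 _ hm).trans (le_abs_self _)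
      have b3 : |Ee ![s,τ,θ]| ≤ |K3| := (hK3 _ hm).trans (le_abs_self _)
      have b4 : |W2 (Th P ![s,τ,θ])| ≤ |K4| := (hK4 _ hm).trans (le_abs_self _)
      rw [abs_mul]
      have : |Dd ![s,τ,θ] * (W (Th P ![s,τ,θ]) - A ![s,τ,θ]) + Ee ![s,τ,θ] * X s τ| ≤
          |K2| * (B * |K1| * (M - s0)) + |K3| * B := by
        refine (abs_add_le _ _).trans ?_
        rw [abs_mul, abs_mul]
        exact add_le_add (mul_le_mul b2 b1 (abs_nonneg _) (abs_nonneg _)) (mul_le_mul b3 (hB s hs) (abs_nonneg _) (abs_nonneg _))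
      calc _ ≤ (|K2| * (B * |K1| * (M - s0)) + |K3| * B) * |K4| :=
            mul_le_mul this b4 (abs_nonneg _) ((abs_nonneg _).trans this)
        _ = _ := by ring
  have fin := A0bd b h0 h1 s0 0 |K1| (fun s hs => by rw [show W1 (Th P ![s, b, θ]) - pd 0 F ![s, b, θ] = 0 from hX0 s hs b ⟨h0.le, le_rfl⟩, abs_zero])
    (fun s hs => (hK1 (s, b) ⟨hs, h0.le, le_rfl⟩).trans (le_abs_self _)) le_rfl (abs_nonneg _) s0 ⟨le_rfl, hpM.le⟩
  rw [zero_mul, zero_mul] at fin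
  have := abs_eq_zero.1 (le_antisymm fin (abs_nonneg _))
  rw [← hp] at this
  linarith

end

noncomputable section
open Function

theorem SymN.union {ι : Type} {G1 G2 G : Geo ι} (h1 : G1.v = G.v) (h2 : G2.v = G.v)
    (hD : ∀ a, ∀ p ∈ G.D a, p ∈ G1.D a ∨ p ∈ G2.D a) (n : ℕ) : ∀ {w f : ℝ → R3 → ℝ},
    (∀ a, ∀ p ∈ G.D a, 0 ≤ w a p) → SymN G1 n w f → SymN G2 n w f → SymN G n w f := by
  have base : ∀ {w f : ℝ → R3 → ℝ}, (∀ a, ∀ p ∈ G.D a, 0 ≤ w a p) → SymN G1 0 w f → SymN G2 0 w f → SymN G 0 w f := by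
    intro w f hw a b
    refine ⟨fun c p hp => ?_, ?_⟩
    · rcases hD c p hp with h | h
      · exact (a.at h).contDiffWithinAt
      · exact (b.at h).contDiffWithinAt
    · obtain ⟨C1, hC1, H1⟩ := a.bound
      obtain ⟨C2, hC2, H2⟩ := b.bound
      refine ⟨C1 + C2, by positivity, fun c p hp => ?_⟩
      have w0 := hw c p hp
      rcases hD c p hp with h | h
      · have := H1 c p h; nlinarith
      · have := H2 c p h; nlinarith
  induction n with
  | zero => exact base
  | succ n ih =>
    intro w f hw a b
    refine SymN.mk_succ (base hw a.zero b.zero) fun i => ih hw ?_ ?_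
    · have := a.2 i; rwa [h1] at this
    · have := b.2 i; rwa [h2] at this

def Qn (M b Q : ℝ) : Set R3 := {p | -Q < p 0} ∩ Qf M b
def Qr (M b Q : ℝ) : Set R3 := {p | p 0 < -Q} ∩ Qf M b
theorem Qn_open (M b Q : ℝ) : IsOpen (Qn M b Q) :=
  (isOpen_lt continuous_const (contDiff_coord 0).continuous).inter (Qf_open M b)
theorem Qr_open (M b Q : ℝ) : IsOpen (Qr M b Q) :=
  (isOpen_lt (contDiff_coord 0).continuous continuous_const).inter (Qf_open M b)

theorem near_symN {M b T Q : ℝ} (hT : 0 < T) (hb : b < T) (n : ℕ) : ∀ f : R3 → ℝ, ContDiffOn ℝ ∞ f (Sl T) →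
    SymN (QG (Qn M b Q) (Qn_open M b Q)) n (fun _ _ => 1) (fun _ => f) := by
  have sub : Qn M b Q ⊆ Sl T := fun p hp => ⟨hp.2.2.1.le, hp.2.2.2.1.trans hb⟩
  have base : ∀ f : R3 → ℝ, ContDiffOn ℝ ∞ f (Sl T) →
    SymN (QG (Qn M b Q) (Qn_open M b Q)) 0 (fun _ _ => 1) (fun _ => f) := by
    intro f hf
    refine ⟨fun _ => hf.mono sub, ?_⟩
    have hK : IsCompact (Set.univ.pi ![Set.Icc (-Q) (M+1), Set.Icc 0 b, Set.Icc (-4) (4:ℝ)] : Set R3) :=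
      isCompact_univ_pi fun i => by fin_cases i <;> exact isCompact_Icc
    obtain ⟨C, hC⟩ := hK.exists_bound_of_continuousOn (f := f) (hf.continuousOn.mono fun p hp => by
      have := hp 1 trivial
      exact ⟨this.1, this.2.trans_lt hb⟩)
    refine ⟨|C|, abs_nonneg _, fun a p hp => ?_⟩
    rw [_root_.mul_one]
    refine (hC p fun i _ => ?_).trans (le_abs_self _)
    obtain ⟨h0, h1, h2, h3, h4⟩ := hp
    rw [abs_lt] at h4
    have h0' : -Q < p 0 := h0
    fin_cases i
    · exact ⟨h0'.le, h1.le⟩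
    · exact ⟨h2.le, h3.le⟩
    · exact ⟨h4.1.le, h4.2.le⟩
  induction n with
  | zero => exact base
  | succ n ih =>
    intro f hf
    refine SymN.mk_succ (base f hf) fun i => ?_
    exact (ih _ (WD_smooth hT (qv_smooth i) hf)).congr fun a p hp => (WD_eq hp.2.2.1 (hp.2.2.2.1.trans hb)).symm

theorem far_symN {M b T Q0 CP : ℝ} (hb : b < T) (hQ0 : -Q0 < M + 1) {P k : R3 → ℝ} (hP : ContDiff ℝ ∞ P) (hk : ContDiff ℝ ∞ k)
    (dP : ∀ p, pd 0 P p = k p - 1) (hk2 : ∀ p ∈ Qr M b Q0, 1 / 2 ≤ k p)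
    (hCP : 0 ≤ CP) (hPb : ∀ p ∈ Qf M b, |P p| ≤ CP)
    (Ps : Smb (QfG M b) (fun _ _ => 1) (fun _ => P)) (ks : Smb (QfG M b) (fun _ p => om (p 0)) (fun _ p => k p - 1)) (n : ℕ) :
    ∀ f : R3 → ℝ, ContDiffOn ℝ ∞ f {p | 0 < p 1 ∧ p 1 < T} →
      SymN (QG (Qr M b Q0) (Qr_open M b Q0)) n (fun _ _ => 1) (fun _ p => f (Th P p)) →
      SymN (QG (Qr M b (Q0 + CP)) (Qr_open M b (Q0 + CP))) n (fun _ _ => 1) (fun _ => f) := by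
  set G := QG (Qr M b Q0) (Qr_open M b Q0) with hG
  have op : IsOpen {p : R3 | 0 < p 1 ∧ p 1 < T} := by
    have c : Continuous (fun p : R3 => p 1) := (contDiff_coord 1).continuous
    exact (isOpen_lt continuous_const c).inter (isOpen_lt c continuous_const)
  have res : ∀ {w f : ℝ → R3 → ℝ}, Smb (QfG M b) w f → Smb G w f := fun h => h.restrict _ rfl (fun _ => Set.inter_subset_right)
  have surj : ∀ p ∈ Qr M b (Q0 + CP), ∃ s ∈ Qr M b Q0, Th P s = p := by
    intro p hp
    have hp0 : p 0 < -(Q0 + CP) := hp.1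
    obtain ⟨h1, h2, h3, h4⟩ := hp.2
    have mem : ∀ s, s ≤ p 0 + CP → update p 0 s ∈ Qr M b Q0 := by
      intro s hs
      refine ⟨?_, ?_, ?_, ?_, ?_⟩
      · show update p 0 s 0 < -Q0
        rw [update_self]; linarith
      · rw [update_self]; linarith
      · rw [update_of_ne (by decide)]; exact h2
      · rw [update_of_ne (by decide)]; exact h3
      · rw [update_of_ne (by decide)]; exact h4
    have cont : Continuous (fun s => s + P (update p 0 s)) :=
      continuous_id.add (hP.continuous.comp (continuous_const.update 0 continuous_id))
    have a := hPb _ (mem (p 0 - CP) (by linarith)).2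
    have c := hPb _ (mem (p 0 + CP) le_rfl).2
    rw [abs_le] at a c
    obtain ⟨s, hs, he⟩ := intermediate_value_Icc (show p 0 - CP ≤ p 0 + CP by linarith) cont.continuousOn
      (show p 0 ∈ Set.Icc _ _ from ⟨by linarith, by linarith⟩)
    refine ⟨update p 0 s, mem s hs.2, ?_⟩
    have he' : s + P (update p 0 s) = p 0 := he
    simp only [Th, update_self, he', update_idem, update_eq_self]
  have base : ∀ f : R3 → ℝ, ContDiffOn ℝ ∞ f {p | 0 < p 1 ∧ p 1 < T} →
      SymN G 0 (fun _ _ => 1) (fun _ p => f (Th P p)) →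
      SymN (QG (Qr M b (Q0 + CP)) (Qr_open M b (Q0 + CP))) 0 (fun _ _ => 1) (fun _ => f) := by
    intro f hf h
    refine ⟨fun _ => hf.mono fun p hp => ⟨hp.2.2.1, hp.2.2.2.1.trans hb⟩, ?_⟩
    obtain ⟨C, hC, H⟩ := h.bound
    refine ⟨C, hC, fun a p hp => ?_⟩
    obtain ⟨s, hs, rfl⟩ := surj p hp
    exact H a s hs
  -- symbols
  have kss : Smb G (fun _ _ => 1) (fun _ => k) := by
    have : Smb G (fun _ _ => 1) (fun _ p => k p - 1) :=
      (res ks).mono zero_le_one fun a p _ => by rw [_root_.one_mul]; exact om_le_one _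
    exact (this.add (Smb.one 1)).congr fun a p _ => by ring
  have kis : Smb G (fun _ _ => 1) (fun _ p => (k p)⁻¹) :=
    (kss.inv (c := 1/2) (by norm_num) fun a p hp => ⟨one_pos, by simpa using hk2 p hp⟩).wcongr (fun a p _ => by simp)
  have rat : Smb G (fun _ _ => 1) (fun _ p => jb (Th P p 0) * (jb (p 0))⁻¹) := by
    have h1 : Smb G (fun _ _ => 1) (fun _ p => ((p 0) * (jb (p 0))⁻¹ + P p * (jb (p 0))⁻¹)) := by
      refine Smb.add ?_ ?_
      · exact ((res (q_q M b)).mul (res (q_jbi M b))).wcongr (fun a p _ => by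
          have := jb_pos (p 0); field_simp)
      · refine ((res Ps).mul (res (q_jbi M b))).mono zero_le_one fun a p _ => ?_
        rw [_root_.one_mul, _root_.one_mul]
        exact inv_le_one_of_one_le₀ (one_le_jb _)
    have h2 : Smb G (fun _ _ => 1) (fun _ p => (jb (p 0))⁻¹) := by
      refine (res (q_jbi M b)).mono zero_le_one fun a p _ => ?_
      rw [_root_.one_mul]
      exact inv_le_one_of_one_le₀ (one_le_jb _)
    have h3 := ((h1.one_mul h1).add (h2.one_mul h2)).sqrt (c := 1 / (2 + 2 * CP^2)) (by positivity) (fun a p hp => ⟨one_pos, by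
      have e : (p 0 * (jb (p 0))⁻¹ + P p * (jb (p 0))⁻¹) * (p 0 * (jb (p 0))⁻¹ + P p * (jb (p 0))⁻¹) + (jb (p 0))⁻¹ * (jb (p 0))⁻¹
         = (1 + (p 0 + P p)^2) / (1 + (p 0)^2) := by
        rw [← jb_sq (p 0)]; have := jb_pos (p 0); field_simp; ring
      rw [e, _root_.mul_one, div_le_div_iff₀ (by positivity) (by positivity), _root_.one_mul]
      have h := hPb p hp.2
      rw [abs_le] at h
      have h2 : (P p)^2 ≤ CP^2 := by nlinarith
      nlinarith [sq_nonneg (p 0 + 2 * P p), sq_nonneg (CP * (p 0 + P p))]⟩)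
    refine (h3.wcongr (w' := fun _ _ => 1) (fun a p _ => by simp)).congr fun a p _ => ?_
    have e : (p 0 * (jb (p 0))⁻¹ + P p * (jb (p 0))⁻¹) * (p 0 * (jb (p 0))⁻¹ + P p * (jb (p 0))⁻¹) + (jb (p 0))⁻¹ * (jb (p 0))⁻¹
         = (jb (p 0 + P p) * (jb (p 0))⁻¹)^2 := by
      rw [mul_pow, jb_sq]; ring
    rw [e, Real.sqrt_sq (mul_nonneg (jb_pos _).le (inv_nonneg.2 (jb_pos _).le)), Th_zero]
  have jbi1 : Smb G (fun _ _ => 1) (fun _ p => (jb (p 0))⁻¹) :=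
    (res (q_jbi M b)).mono zero_le_one fun a p _ => by
      rw [_root_.one_mul]; exact inv_le_one_of_one_le₀ (one_le_jb _)
  induction n with
  | zero => exact base
  | succ n ih =>
    intro f hf h
    have chain : ∀ p ∈ Qr M b Q0, ∀ i, pd i (fun p => f (Th P p)) p = pd i f (Th P p) + pd i P p * pd 0 f (Th P p) := by
      intro p hp i
      refine Th_chain (hP.differentiable (by simp) p) ((hf.contDiffAt (op.mem_nhds ?_)).differentiableAt (by simp)) i
      show 0 < Th P p 1 ∧ Th P p 1 < T
      rw [Th_one]; exact ⟨hp.2.2.1, hp.2.2.2.1.trans hb⟩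
    have kp : ∀ p ∈ Qr M b Q0, k p ≠ 0 := fun p hp => by have := hk2 p hp; linarith
    have c0 : ∀ p ∈ Qr M b Q0, pd 0 f (Th P p) = (k p)⁻¹ * pd 0 (fun p => f (Th P p)) p := by
      intro p hp
      rw [chain p hp, dP]; have := kp p hp; field_simp; ring
    have sm : ∀ i, ContDiffOn ℝ ∞ (pd i f) {p | 0 < p 1 ∧ p 1 < T} := fun i =>
      (hf.fderiv_of_isOpen op (by simp)).clm_apply contDiffOn_const
    have H0 : SymN G n (fun _ _ => 1) (fun _ p => jb (p 0) * pd 0 (fun p => f (Th P p)) p) := h.q0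
    have H0' : SymN G n (fun _ _ => 1) (fun _ p => pd 0 (fun p => f (Th P p)) p) :=
      ((jbi1 n).one_mul H0).congr fun a p _ => by
        rw [← mul_assoc, inv_mul_cancel₀ (jb_pos _).ne', _root_.one_mul]
    have dPi : ∀ i, i ≠ 0 → Smb G (fun _ _ => 1) (fun _ p => pd i P p) := by
      intro i hi
      fin_cases i
      · exact absurd rfl hi
      · exact (res Ps).q1
      · exact (res Ps).q2
    have ci : ∀ i, i ≠ 0 → SymN G n (fun _ _ => 1) (fun _ p => pd i (fun p => f (Th P p)) p) →
        SymN G n (fun _ _ => 1) (fun _ p => pd i f (Th P p)) := by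
      intro i hi hh
      refine (hh.sub ((dPi i hi n).one_mul ((kis n).one_mul H0'))).congr fun a p hp => ?_
      beta_reduce
      rw [← c0 p hp, chain p hp i]; ring
    refine SymN.mkQ (base f hf h.zero) (ih _ ?_ ?_) (ih _ (sm 1) (ci 1 (by decide) h.q1)) (ih _ (sm 2) (ci 2 (by decide) h.q2))
    · exact (jb_contDiff.comp (contDiff_coord 0)).contDiffOn.mul (sm 0)
    · refine ((rat n).one_mul ((kis n).one_mul H0)).congr fun a p hp => ?_
      beta_reduce
      rw [c0 p hp]; have := jb_pos (p 0); field_simp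

end

noncomputable section
open Function

def Wf (V : ℝ → ℝ → ℝ → ℝ) (p : R3) : ℝ := V (p 0) (p 2) (p 1)
def Ff (φ0 φ1 : ℝ × ℝ → ℝ) (p : R3) : ℝ := F0 φ0 φ1 (p 0) (p 2)
def Df (d : Fin 3 → Fin 3 → ℝ) (p : R3) : ℝ := ∑ i : Fin 3, ∑ j : Fin 3, d i j * omegaHat (p 2) i * omegaHat (p 2) j
def Ef (e : Fin 3 → Fin 3 → Fin 3 → ℝ) (p : R3) : ℝ :=
  ∑ i : Fin 3, ∑ j : Fin 3, ∑ k : Fin 3, e i j k * omegaHat (p 2) i * omegaHat (p 2) j * omegaHat (p 2) k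

theorem om_smooth (i : Fin 3) : ContDiff ℝ ∞ (fun p : R3 => omegaHat (p 2) i) := by
  fin_cases i
  · exact contDiff_const
  · exact contDiff_cos.comp (contDiff_coord 2)
  · exact contDiff_sin.comp (contDiff_coord 2)

theorem Df_smooth (d) : ContDiff ℝ ∞ (Df d) :=
  ContDiff.sum fun i _ => ContDiff.sum fun j _ => (contDiff_const.mul (om_smooth i)).mul (om_smooth j)
theorem Ef_smooth (e) : ContDiff ℝ ∞ (Ef e) :=
  ContDiff.sum fun i _ => ContDiff.sum fun j _ => ContDiff.sum fun k _ =>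
    ((contDiff_const.mul (om_smooth i)).mul (om_smooth j)).mul (om_smooth k)

theorem Df_smb {ι : Type} {G : Geo ι} (h : ∀ i, Smb G (fun _ _ => 1) (fun _ p => omegaHat (p 2) i)) (d) :
    Smb G (fun _ _ => 1) (fun _ => Df d) := by
  refine (Smb.fsum (m := 2) (f := fun i _ p => ∑ j : Fin 3, d i j * omegaHat (p 2) i * omegaHat (p 2) j) fun i => ?_)
  refine (Smb.fsum (m := 2) (f := fun j _ p => d i j * omegaHat (p 2) i * omegaHat (p 2) j) fun j => ?_)
  exact (((Smb.one (d i j)).one_mul (h i)).one_mul (h j))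
theorem Ef_smb {ι : Type} {G : Geo ι} (h : ∀ i, Smb G (fun _ _ => 1) (fun _ p => omegaHat (p 2) i)) (e) :
    Smb G (fun _ _ => 1) (fun _ => Ef e) := by
  refine (Smb.fsum (m := 2) (f := fun i _ p => ∑ j : Fin 3, ∑ k : Fin 3, e i j k * omegaHat (p 2) i * omegaHat (p 2) j * omegaHat (p 2) k) fun i => ?_)
  refine (Smb.fsum (m := 2) (f := fun j _ p => ∑ k : Fin 3, e i j k * omegaHat (p 2) i * omegaHat (p 2) j * omegaHat (p 2) k) fun j => ?_)
  refine (Smb.fsum (m := 2) (f := fun k _ p => e i j k * omegaHat (p 2) i * omegaHat (p 2) j * omegaHat (p 2) k) fun k => ?_)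
  exact (((Smb.one (e i j k)).one_mul (h i)).one_mul (h j)).one_mul (h k)

theorem q_om (M b : ℝ) (i : Fin 3) : Smb (QfG M b) (fun _ _ => 1) (fun _ p => omegaHat (p 2) i) := by
  fin_cases i
  · exact Smb.one (-1)
  · exact q_cos M b
  · exact q_sin M b

section
variable {M T : ℝ} {d : Fin 3 → Fin 3 → ℝ} {e : Fin 3 → Fin 3 → Fin 3 → ℝ} {φ0 φ1 : ℝ × ℝ → ℝ} {V : ℝ → ℝ → ℝ → ℝ}

theorem Wf_smooth (hV : IsProfileSol M d e φ0 φ1 T V) : ContDiffOn ℝ ∞ (Wf V) (Sl T) := by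
  refine hV.1.comp (g := fun p : ℝ × ℝ × ℝ => V p.1 p.2.1 p.2.2) (f := fun p : R3 => (p 0, p 2, p 1)) (t := {p : ℝ × ℝ × ℝ | 0 ≤ p.2.2 ∧ p.2.2 < T}) ?_ ?_
  · exact ((contDiff_coord 0).prodMk ((contDiff_coord 2).prodMk (contDiff_coord 1))).contDiffOn
  · intro p hp; exact hp

theorem Wf_zero (hV : IsProfileSol M d e φ0 φ1 T V) (p : R3) (h : p 1 = 0) : Wf V p = Ff φ0 φ1 p := by
  rw [Wf, h]; exact hV.2.2.2.1 _ _

theorem Wf_supp (hV : IsProfileSol M d e φ0 φ1 T V) (p : R3) (h : p ∈ Sl T) (hM : M ≤ p 0) : Wf V p = 0 := by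
  rcases hM.eq_or_lt with h1 | h1
  · have c : Tendsto (fun s => Wf V (update p 0 s)) (𝓝[>] (p 0)) (𝓝 (Wf V p)) := by
      have := (WD_line (Wf_smooth hV) h (i := 0) (by decide)).continuousAt
      have h2 : Tendsto (fun s => Wf V (update p 0 s)) (𝓝 (p 0)) (𝓝 (Wf V (update p 0 (p 0)))) := this
      rw [update_eq_self] at h2
      exact h2.mono_left nhdsWithin_le_nhds
    refine tendsto_nhds_unique c (tendsto_const_nhds.congr' ?_)
    filter_upwards [self_mem_nhdsWithin] with s hs
    have hs' : p 0 < s := hs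
    rw [Wf, update_self]; exact (hV.2.2.1 _ _ _ (by linarith)).symm
  · exact hV.2.2.1 _ _ _ h1

theorem Ff_smooth (hT : 0 < T) (hV : IsProfileSol M d e φ0 φ1 T V) : ContDiff ℝ ∞ (Ff φ0 φ1) := by
  have e1 : Ff φ0 φ1 = Wf V ∘ fun p => update p 1 0 := by
    funext p; rw [comp, Wf_zero hV _ (by simp)]; simp [Ff]
  rw [e1, ← contDiffOn_univ]
  refine (Wf_smooth hV).comp (t := Sl T) ?_ fun p _ => by simp [Sl, hT]
  refine ContDiff.contDiffOn (contDiff_pi.2 fun i => ?_)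
  fin_cases i
  · simpa [update] using contDiff_coord 0
  · simpa [update] using contDiff_const
  · simpa [update] using contDiff_coord 2

theorem Ff_supp (hT : 0 < T) (hV : IsProfileSol M d e φ0 φ1 T V) (p : R3) (h : M ≤ p 0) : Ff φ0 φ1 p = 0 := by
  have e1 : Ff φ0 φ1 p = Wf V (update p 1 0) := by
    rw [Wf_zero hV _ (by simp)]; simp [Ff]
  rw [e1]; exact Wf_supp hV _ (by simp [Sl, hT]) (by simpa using h)

theorem Ff_tind : TInd (Ff φ0 φ1) := fun p s => by simp [Ff]

theorem Wf_pde (hV : IsProfileSol M d e φ0 φ1 T V) (p : R3) (h0 : 0 < p 1) (h1 : p 1 < T) :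
    pd 1 (pd 0 (Wf V)) p = (Df d p * Wf V p + Ef e p * pd 0 (Wf V) p) * pd 0 (pd 0 (Wf V)) p := by
  have op : IsOpen {p : R3 | 0 < p 1 ∧ p 1 < T} := by
    have c : Continuous (fun p : R3 => p 1) := (contDiff_coord 1).continuous
    exact (isOpen_lt continuous_const c).inter (isOpen_lt c continuous_const)
  have hW : ContDiffOn ℝ ∞ (Wf V) {p : R3 | 0 < p 1 ∧ p 1 < T} := (Wf_smooth hV).mono fun p hp => ⟨hp.1.le, hp.2⟩
  have hW' : ContDiffOn ℝ ∞ (pd 0 (Wf V)) {p : R3 | 0 < p 1 ∧ p 1 < T} :=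
      (hW.fderiv_of_isOpen op (by simp)).clm_apply contDiffOn_const
  have dq : ∀ p : R3, 0 < p 1 → p 1 < T → deriv (fun q' => V q' (p 2) (p 1)) (p 0) = pd 0 (Wf V) p := by
    intro p h0 h1
    have := pd_line (Wf V) p 0 ((hW.contDiffAt (op.mem_nhds ⟨h0, h1⟩)).differentiableAt (by simp))
    simp only [Wf, update_self] at this
    simpa [Wf] using this.deriv
  have dqq : deriv (fun q' => deriv (fun q'' => V q'' (p 2) (p 1)) q') (p 0) = pd 0 (pd 0 (Wf V)) p := by
    have := pd_line (pd 0 (Wf V)) p 0 ((hW'.contDiffAt (op.mem_nhds ⟨h0, h1⟩)).differentiableAt (by simp))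
    have e1 : (fun s => pd 0 (Wf V) (update p 0 s)) = fun q' => deriv (fun q'' => V q'' (p 2) (p 1)) q' := by
      funext s
      rw [← dq (update p 0 s) (by simpa using h0) (by simpa using h1)]; simp
    rw [e1] at this; exact this.deriv
  have dqt : deriv (fun τ' => deriv (fun q' => V q' (p 2) τ') (p 0)) (p 1) = pd 1 (pd 0 (Wf V)) p := by
    have := pd_line (pd 0 (Wf V)) p 1 ((hW'.contDiffAt (op.mem_nhds ⟨h0, h1⟩)).differentiableAt (by simp))
    rw [← this.deriv]
    refine EventuallyEq.deriv_eq ?_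
    filter_upwards [Ioo_mem_nhds h0 h1] with s hs
    rw [← dq (update p 1 s) (by simpa using hs.1) (by simpa using hs.2)]; simp
  have := hV.2.2.2.2 (p 0) (p 2) (p 1) h0.le h1
  rw [dqt, dqq, dq p h0 h1] at this
  rw [sub_eq_zero] at this
  rw [this, show V (p 0) (p 2) (p 1) = Wf V p from rfl]
  generalize Wf V p = w
  generalize pd 0 (Wf V) p = w1
  generalize pd 0 (pd 0 (Wf V)) p = w2
  simp only [Df, Ef, Fin.sum_univ_three]
  ring

theorem w0_asym (hM : 0 < M) (hs0 : SuppIn M φ0) (hs1 : SuppIn M φ1) {w0 : R3 → ℝ} (h : IsW M w0)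
    (hw0init : ∀ x : ℝ × ℝ, w0 ![0, x.1, x.2] = φ0 x ∧ pd 0 w0 ![0, x.1, x.2] = φ1 x)
    (hT : 0 < T) (hV : IsProfileSol M d e φ0 φ1 T V) :
    Smb (Pb M).G (fun _ p => (p 1)⁻¹ * √(jb (p 0))) (fun _ p => rt p * w0 (Psi p) - Ff φ0 φ1 p) ∧
      Smb (Pb M).G (fun _ p => (√(jb (p 0)))⁻¹) (fun _ => Ff φ0 φ1) := by
  refine wave_asym hM h (Ff_smooth hT hV) Ff_tind fun p hp => ?_
  have := rad_limit hM hs0 hs1 h hw0init (p 0) (p 2)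
  simpa [rt, Psi, Ff] using this

theorem prof_smb (hM : 0 < M) (hT : 0 < T) (hV : IsProfileSol M d e φ0 φ1 T V) {b : ℝ} (hb : b < T)
    (hF : Smb (Pb M).G (fun _ p => (√(jb (p 0)))⁻¹) (fun _ => Ff φ0 φ1)) :
    Smb (QfG M b) (fun _ _ => 1) (fun _ => Wf V) := by
  have hFs : Smb (QfG M b) (fun _ p => (√(jb (p 0)))⁻¹) (fun _ => Ff φ0 φ1) :=
    tind_trans (fun p s => by simp) Ff_tind (Ff_smooth hT hV) hF
  obtain ⟨P, A, k, hP, hA, hk, dP, dA, PM, AM, dP1, P0, ks, Ps, As⟩ := char_exists (b := b) hM (Ff_smooth hT hV) Ff_tind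
    (Ff_supp hT hV) hFs (Df_smooth d) (fun p s => by simp [Df]) (fun p s => by simp [Df]) (Df_smb (q_om M b) d)
    (Ef_smooth e) (fun p s => by simp [Ef]) (fun p s => by simp [Ef]) (Ef_smb (q_om M b) e)
  have hWA := prof_char hT (Wf_smooth hV) (Wf_zero hV) (fun p h0 h1 h => Wf_supp hV p ⟨h0.le, h1⟩ h) (Wf_pde hV)
    (Ff_smooth hT hV) Ff_tind (fun p s => by simp [Df]) (fun p s => by simp [Ef]) (Df_smooth d) (Ef_smooth e)
    hP hA hk dP dA PM AM dP1 P0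
  obtain ⟨CP, hCP, HP⟩ := Ps.bound
  obtain ⟨Ck, hCk, Hk⟩ := ks.bound
  set Q0 := 2 * Ck with hQ0
  intro n
  have far := far_symN (M := M) (b := b) (T := T) (Q0 := Q0) (CP := CP) hb (by linarith) hP hk dP (by
    intro p hp
    have h1 := Hk 0 p hp.2
    have h0 : p 0 < -Q0 := hp.1
    have h2 : om (p 0) ≤ (jb (p 0))⁻¹ := by
      rw [om]
      refine mul_le_of_le_one_right (inv_nonneg.2 (jb_pos _).le) (inv_le_one_of_one_le₀ ?_)
      rw [Real.one_le_sqrt]; exact one_le_jb _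
    have h3 : 2 * Ck ≤ jb (p 0) := by
      have := abs_le_jb (p 0); have := neg_le_abs (p 0); linarith
    have h4 : Ck * om (p 0) ≤ 1 / 2 := by
      refine (mul_le_mul_of_nonneg_left h2 hCk).trans ?_
      rw [← div_eq_mul_inv, div_le_iff₀ (jb_pos _)]; linarith
    rw [abs_le] at h1
    linarith [h1.1]) hCP (fun p hp => by simpa using HP 0 p hp) Ps ks n (Wf V) ((Wf_smooth hV).mono fun p hp => ⟨hp.1.le, hp.2⟩)
    (((As.restrict (QG (Qr M b Q0) (Qr_open M b Q0)) rfl (fun _ => Set.inter_subset_right)) n).congr fun a p hp =>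
      hWA p hp.2.2.1 (hp.2.2.2.1.trans hb))
  have near := near_symN (M := M) (b := b) (Q := Q0 + CP + 1) hT hb n (Wf V) (Wf_smooth hV)
  refine SymN.union (G := QfG M b) (G1 := QG (Qr M b (Q0+CP)) (Qr_open M b (Q0+CP))) (G2 := QG (Qn M b (Q0+CP+1)) (Qn_open M b (Q0+CP+1))) rfl rfl ?_ n (fun _ _ _ => zero_le_one) far near
  intro a p hp
  rcases lt_or_ge (p 0) (-(Q0 + CP)) with h | h
  · exact Or.inl ⟨h, hp⟩
  · refine Or.inr ⟨?_, hp⟩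
    show -(Q0 + CP + 1) < p 0
    linarith
end
end

noncomputable section
open Function

def kap (a : ℝ) (p : R3) : R3 := ![p 0, a * √(1 + p 1), p 2]

theorem kap_upd1 (a : ℝ) (p : R3) (s : ℝ) : kap a (update p 1 s) = update (kap a p) 1 (a * √(1 + s)) := by
  funext i; fin_cases i <;> simp [kap, update]
theorem kap_upd0 (a : ℝ) (p : R3) (s : ℝ) : kap a (update p 0 s) = update (kap a p) 0 s := by
  funext i; fin_cases i <;> simp [kap, update]
theorem kap_upd2 (a : ℝ) (p : R3) (s : ℝ) : kap a (update p 2 s) = update (kap a p) 2 s := by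
  funext i; fin_cases i <;> simp [kap, update]

theorem kap_smooth (a : ℝ) {p : R3} (hp : 0 < p 1) : ContDiffAt ℝ ∞ (kap a) p := by
  rw [contDiffAt_pi]
  intro i
  fin_cases i
  · exact (contDiff_coord 0).contDiffAt
  · exact contDiffAt_const.mul (((contDiff_const.add (contDiff_coord 1)).contDiffAt).sqrt (by positivity))
  · exact (contDiff_coord 2).contDiffAt

theorem kap_chain {f : R3 → ℝ} {a : ℝ} {p : R3} (hp : 0 < p 1) (hf : DifferentiableAt ℝ f (kap a p)) :
    pd 0 (fun p => f (kap a p)) p = pd 0 f (kap a p) ∧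
    pd 1 (fun p => f (kap a p)) p = a / (2 * √(1 + p 1)) * pd 1 f (kap a p) ∧
    pd 2 (fun p => f (kap a p)) p = pd 2 f (kap a p) := by
  have hd : DifferentiableAt ℝ (fun p => f (kap a p)) p :=
    hf.comp p ((kap_smooth a hp).differentiableAt (by simp))
  refine ⟨?_, ?_, ?_⟩
  · have h1 := pd_line _ p 0 hd
    simp only [kap_upd0] at h1
    have h2 := pd_line f (kap a p) 0 hf
    exact h1.unique h2
  · have h1 := pd_line _ p 1 hd
    simp only [kap_upd1] at h1
    have h2 := pd_line f (kap a p) 1 hf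
    have h3 : HasDerivAt (fun s => a * √(1 + s)) (a * (1 / (2 * √(1 + p 1)))) (p 1) := by
      have := ((hasDerivAt_id' (p 1)).const_add 1).sqrt (by positivity)
      exact this.const_mul a
    have h4 := HasDerivAt.comp (p 1) (h₂ := fun s => f (update (kap a p) 1 s)) (h := fun s => a * √(1 + s)) h2 h3
    rw [h1.unique h4]; ring
  · have h1 := pd_line _ p 2 hd
    simp only [kap_upd2] at h1
    have h2 := pd_line f (kap a p) 2 hf
    exact h1.unique h2

section
variable {M b : ℝ} (P : PDom M)

theorem s_tt : Smb P.G (fun _ _ => 1) (fun _ p => p 1 * (2 * (1 + p 1))⁻¹) := by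
  have h1 : Smb P.G (fun _ p => p 1) (fun _ p => 2 * (1 + p 1)) := by
    have : Smb P.G (fun _ p => p 1) (fun _ _ => 1) := (Smb.one 1).mono zero_le_one fun a p hp => by
      have := (PDom.mem hp).1; linarith
    exact (this.add (s_t P)).const_mul 2
  refine ((s_t P).mul (h1.inv one_pos fun a p hp => ?_)).wcongr fun a p hp => ?_
  · have := (PDom.mem hp).1; constructor <;> linarith
  · have := (PDom.mem hp).1; field_simp

theorem kap_symN (hκ : ∀ a, ∀ p ∈ P.D a, kap a p ∈ Qf M b) (n : ℕ) : ∀ (w f : R3 → ℝ),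
    SymN (QfG M b) n (fun _ => w) (fun _ => f) → SymN P.G n (fun a p => w (kap a p)) (fun a p => f (kap a p)) := by
  have pos : ∀ a, ∀ p ∈ P.D a, 0 < p 1 := fun a p hp => by have := (P.hsub a hp).1; linarith
  have base : ∀ (w f : R3 → ℝ),
    SymN (QfG M b) 0 (fun _ => w) (fun _ => f) → SymN P.G 0 (fun a p => w (kap a p)) (fun a p => f (kap a p)) := by
    intro w f h
    refine ⟨fun a p hp => ?_, ?_⟩
    · have h1 : ContDiffAt ℝ ∞ f (kap a p) := SymN.at h (a := a) (hκ a p hp)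
      exact (h1.comp p (kap_smooth a (pos a p hp))).contDiffWithinAt
    · obtain ⟨C, hC, H⟩ := h.bound
      exact ⟨C, hC, fun a p hp => H a _ (hκ a p hp)⟩
  induction n with
  | zero => exact base
  | succ n ih =>
    intro w f h
    have ch : ∀ a, ∀ p ∈ P.D a, _ := fun a p hp => kap_chain (pos a p hp) (SymN.diffAt h (a := a) (hκ a p hp))
    refine SymN.mkP (base w f h.zero) ?_ ?_ ?_
    · refine (ih w _ h.q0).congr fun a p hp => ?_
      rw [(ch a p hp).1]; rfl
    · have h2 := ih w _ (((q_tau M b) n).one_mul h.q1)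
      refine ((s_tt P n).one_mul h2).congr fun a p hp => ?_
      beta_reduce
      rw [(ch a p hp).2.1]
      have e1 : kap a p 1 = a * √(1 + p 1) := rfl
      have h3 := pos a p hp
      have e2 : √(1 + p 1) * √(1 + p 1) = 1 + p 1 := Real.mul_self_sqrt (by positivity)
      have e3 : (√(1 + p 1))⁻¹ = (1 + p 1)⁻¹ * √(1 + p 1) := by
        nth_rewrite 2 [← e2]; have : 0 < √(1 + p 1) := by positivity
        field_simp
      rw [e1, div_eq_mul_inv, mul_inv, e3, mul_inv]; ring
    · refine (ih w _ h.q2).congr fun a p hp => ?_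
      rw [(ch a p hp).2.2]

theorem kap_smb (hκ : ∀ a, ∀ p ∈ P.D a, kap a p ∈ Qf M b) {w f : R3 → ℝ}
    (h : Smb (QfG M b) (fun _ => w) (fun _ => f)) : Smb P.G (fun a p => w (kap a p)) (fun a p => f (kap a p)) :=
  fun n => kap_symN P hκ n w f (h n)

theorem mv_zero {T : ℝ} (hb : b < T) {f : R3 → ℝ} (hf : ContDiffOn ℝ ∞ f (Sl T)) (h0 : ∀ p : R3, p 1 = 0 → f p = 0)
    {C : ℝ} (hC : ∀ p ∈ Qf M b, |pd 1 f p| ≤ C) {p : R3} (hp : p ∈ Qf M b) : |f p| ≤ C * p 1 := by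
  obtain ⟨h1, h2, h3, h4⟩ := hp
  have cont : ContinuousOn (fun s => f (update p 1 s)) (Set.Icc 0 (p 1)) := by
    refine hf.continuousOn.comp (by fun_prop) fun s hs => ?_
    simp only [Sl]; show 0 ≤ update p 1 s 1 ∧ update p 1 s 1 < T
    rw [update_self]; exact ⟨hs.1, by linarith [hs.2]⟩
  have der : ∀ s ∈ Set.Ioo 0 (p 1), HasDerivAt (fun s => f (update p 1 s)) (pd 1 f (update p 1 s)) s := by
    intro s hs
    have hd : DifferentiableAt ℝ f (update p 1 s) :=
      (Sl_at hf (by rw [update_self]; exact hs.1) (by rw [update_self]; linarith [hs.2])).differentiableAt (by simp)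
    exact pd_line' hd
  obtain ⟨c, hc, he⟩ := exists_hasDerivAt_eq_slope _ _ h2 cont der
  have e0 : f (update p 1 0) = 0 := h0 _ (by simp)
  rw [update_eq_self, e0, sub_zero, sub_zero] at he
  have hm : update p 1 c ∈ Qf M b := by
    refine ⟨by simpa using h1, by simpa using hc.1, by simpa using hc.2.trans h3, by simpa using h4⟩
  have := hC _ hm
  rw [he, abs_div, abs_of_pos h2, div_le_iff₀ h2] at this
  exact this

theorem kap0_symN {T : ℝ} (hT : 0 < T) (hb : b < T) (hκ : ∀ a, ∀ p ∈ P.D a, kap a p ∈ Qf M b) (hpos : ∀ a, ∀ p ∈ P.D a, 0 < a)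
    (n : ℕ) : ∀ (f : R3 → ℝ),
    ContDiffOn ℝ ∞ f (Sl T) → (∀ p : R3, p 1 = 0 → f p = 0) → Smb (QfG M b) (fun _ _ => 1) (fun _ => f) →
    SymN P.G n (fun a p => a * √(p 1)) (fun a p => f (kap a p)) := by
  have pos : ∀ a, ∀ p ∈ P.D a, 0 < p 1 := fun a p hp => by have := (P.hsub a hp).1; linarith
  have base : ∀ (f : R3 → ℝ),
    ContDiffOn ℝ ∞ f (Sl T) → (∀ p : R3, p 1 = 0 → f p = 0) → Smb (QfG M b) (fun _ _ => 1) (fun _ => f) →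
    SymN P.G 0 (fun a p => a * √(p 1)) (fun a p => f (kap a p)) := by
    intro f hf h0 h
    refine ⟨(kap_symN P hκ 0 _ f (h 0)).smooth, ?_⟩
    obtain ⟨C, hC, H⟩ := h.q1.bound
    refine ⟨C * 2, by positivity, fun a p hp => ?_⟩
    have := mv_zero hb hf h0 (C := C) (fun p hp => by simpa using H 0 p hp) (hκ a p hp)
    have e1 : kap a p 1 = a * √(1 + p 1) := rfl
    have h1 := (P.hsub a hp).1
    have h2 : √(1 + p 1) ≤ 2 * √(p 1) := by
      rw [Real.sqrt_le_left (by positivity), mul_pow, Real.sq_sqrt (by linarith)]; linarith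
    have h3 := hpos a p hp
    rw [e1] at this
    refine this.trans ?_
    have : a * √(1 + p 1) ≤ a * (2 * √(p 1)) := mul_le_mul_of_nonneg_left h2 h3.le
    calc _ ≤ C * (a * (2 * √(p 1))) := mul_le_mul_of_nonneg_left this hC
      _ = _ := by ring
  have QS : ∀ p ∈ Qf M b, 0 < p 1 ∧ p 1 < T := fun p hp => ⟨hp.2.1, hp.2.2.1.trans hb⟩
  have zer : ∀ (f : R3 → ℝ), ContDiffOn ℝ ∞ f (Sl T) → (∀ p : R3, p 1 = 0 → f p = 0) → ∀ i, i ≠ 1 →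
      ∀ p : R3, p 1 = 0 → WD T (ez i) f p = 0 := by
    intro f hf h0 i hi p hp
    have h1 := WD_line hf (show p ∈ Sl T from ⟨hp.ge, by rw [hp]; exact hT⟩) hi
    have : (fun s => f (update p i s)) = fun _ => 0 := by
      funext s; exact h0 _ (by rw [update_of_ne hi.symm]; exact hp)
    rw [this] at h1
    exact h1.unique (hasDerivAt_const _ _)
  induction n with
  | zero => exact base
  | succ n ih =>
    intro f hf h0 h
    have ch : ∀ a, ∀ p ∈ P.D a, _ := fun a p hp => kap_chain (pos a p hp) (Smb.diffAt h (a := a) (hκ a p hp))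
    refine SymN.mkP (base f hf h0 h) ?_ ?_ ?_
    · refine (ih (fun p => jb (p 0) * WD T (ez 0) f p) ?_ ?_ ?_).congr fun a p hp => ?_
      · exact (jb_contDiff.comp (contDiff_coord 0)).contDiffOn.mul (WD_smooth hT (ez_smooth 0) hf)
      · intro p hp; rw [zer f hf h0 0 (by decide) p hp, mul_zero]
      · exact h.q0.congr fun a p hp => by rw [WD_pd (QS p hp).1 (QS p hp).2]
      · rw [WD_pd (QS _ (hκ a p hp)).1 (QS _ (hκ a p hp)).2, (ch a p hp).1]; rfl
    · have h2 := ih (fun p => p 1 * WD T (ez 1) f p) ((contDiff_coord 1).contDiffOn.mul (WD_smooth hT (ez_smooth 1) hf))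
        (fun p hp => by rw [hp, zero_mul])
        (((q_tau M b).one_mul h.q1).congr fun a p hp => by rw [WD_pd (QS p hp).1 (QS p hp).2])
      refine ((s_tt P n).one_mul h2).congr fun a p hp => ?_
      beta_reduce
      rw [(ch a p hp).2.1, WD_pd (QS _ (hκ a p hp)).1 (QS _ (hκ a p hp)).2]
      have e1 : kap a p 1 = a * √(1 + p 1) := rfl
      have h3 := pos a p hp
      have e2 : √(1 + p 1) * √(1 + p 1) = 1 + p 1 := Real.mul_self_sqrt (by positivity)
      have e3 : (√(1 + p 1))⁻¹ = (1 + p 1)⁻¹ * √(1 + p 1) := by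
        nth_rewrite 2 [← e2]; have : 0 < √(1 + p 1) := by positivity
        field_simp
      rw [e1, div_eq_mul_inv, mul_inv, e3, mul_inv]; ring
    · refine (ih (fun p => WD T (ez 2) f p) ?_ ?_ ?_).congr fun a p hp => ?_
      · exact WD_smooth hT (ez_smooth 2) hf
      · intro p hp; rw [zer f hf h0 2 (by decide) p hp]
      · exact h.q2.congr fun a p hp => by rw [WD_pd (QS p hp).1 (QS p hp).2]
      · rw [WD_pd (QS _ (hκ a p hp)).1 (QS _ (hκ a p hp)).2, (ch a p hp).2.2]
end
end

noncomputable section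
open Function

/-! the nonlinearity on symbols -/
section
variable {ι : Type} {G : Geo ι} {g : Fin 3 → Fin 3 → ℝ → (Fin 3 → ℝ) → ℝ} {d : Fin 3 → Fin 3 → ℝ}
  {e : Fin 3 → Fin 3 → Fin 3 → ℝ}

theorem g_smooth4 (hg : ∀ i j, ContDiff ℝ ∞ (fun q : ℝ × (Fin 3 → ℝ) => g i j q.1 q.2)) (i j : Fin 3) :
    ContDiff ℝ ∞ (fun z : Fin 4 → ℝ => g i j (z 0) (fun k => z k.succ)) :=
  (hg i j).comp ((contDiff_apply ℝ ℝ 0).prodMk (contDiff_pi.2 fun k => contDiff_apply ℝ ℝ k.succ))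

theorem lin_smooth4 (i j : Fin 3) :
    ContDiff ℝ ∞ (fun z : Fin 4 → ℝ => cMink i j + d i j * z 0 + ∑ k : Fin 3, e i j k * z k.succ) :=
  (contDiff_const.add (contDiff_const.mul (contDiff_apply ℝ ℝ 0))).add
    (ContDiff.sum fun k _ => contDiff_const.mul (contDiff_apply ℝ ℝ k.succ))

theorem g_bigO4 (hgexp : ∀ i j,
      (fun q : ℝ × (Fin 3 → ℝ) =>
          g i j q.1 q.2 - (cMink i j + d i j * q.1 + ∑ k : Fin 3, e i j k * q.2 k))
        =O[𝓝 (0 : ℝ × (Fin 3 → ℝ))] fun q => ‖q.1‖ ^ 2 + ‖q.2‖ ^ 2) (i j : Fin 3) :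
    (fun z : Fin 4 → ℝ => g i j (z 0) (fun k => z k.succ) - (cMink i j + d i j * z 0 + ∑ k : Fin 3, e i j k * z k.succ))
      =O[𝓝 0] fun z => ‖z‖ ^ 2 := by
  have c : Continuous (fun z : Fin 4 → ℝ => ((z 0, fun k : Fin 3 => z k.succ) : ℝ × (Fin 3 → ℝ))) := by fun_prop
  have h1 := (hgexp i j).comp_tendsto (k := fun z : Fin 4 → ℝ => ((z 0, fun k : Fin 3 => z k.succ) : ℝ × (Fin 3 → ℝ)))
    (l' := 𝓝 0) (c.tendsto' _ _ rfl)
  refine h1.trans (IsBigO.of_bound 2 (Eventually.of_forall fun z => ?_))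
  have a1 : ‖z 0‖ ≤ ‖z‖ := norm_le_pi_norm z 0
  have a2 : ‖(fun k : Fin 3 => z k.succ)‖ ≤ ‖z‖ := (pi_norm_le_iff_of_nonneg (norm_nonneg _)).2 fun k => norm_le_pi_norm z _
  simp only [comp, norm_pow, norm_norm]
  rw [Real.norm_of_nonneg (by positivity)]
  have := pow_le_pow_left₀ (norm_nonneg _) a1 2
  have := pow_le_pow_left₀ (norm_nonneg _) a2 2
  linarith

theorem J_lin {δ δ2 : ℝ → R3 → ℝ} (hg : ∀ i j, ContDiff ℝ ∞ (fun q : ℝ × (Fin 3 → ℝ) => g i j q.1 q.2))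
    (hgexp : ∀ i j,
      (fun q : ℝ × (Fin 3 → ℝ) =>
          g i j q.1 q.2 - (cMink i j + d i j * q.1 + ∑ k : Fin 3, e i j k * q.2 k))
        =O[𝓝 (0 : ℝ × (Fin 3 → ℝ))] fun q => ‖q.1‖ ^ 2 + ‖q.2‖ ^ 2)
    (hδ : ∃ K, 0 ≤ K ∧ ∀ a, ∀ p ∈ G.D a, 0 ≤ δ a p ∧ δ a p ≤ K)
    {u : ℝ → R3 → ℝ} {u1 : Fin 3 → ℝ → R3 → ℝ} {u2 : Fin 3 → Fin 3 → ℝ → R3 → ℝ}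
    (h0 : Smb G δ u) (h1 : ∀ k, Smb G δ (u1 k)) (h2 : ∀ i j, Smb G δ2 (u2 i j)) :
    Smb G (fun a p => δ a p * δ2 a p) (fun a p => ∑ i : Fin 3, ∑ j : Fin 3,
      (g i j (u a p) (fun k => u1 k a p) - cMink i j) * u2 i j a p) := by
  refine (Smb.fsum (m := 2) (f := fun i a p => ∑ j : Fin 3, (g i j (u a p) (fun k => u1 k a p) - cMink i j) * u2 i j a p) fun i => ?_)
  refine (Smb.fsum (m := 2) (f := fun j a p => (g i j (u a p) (fun k => u1 k a p) - cMink i j) * u2 i j a p) fun j => ?_)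
  refine Smb.mul ?_ (h2 i j)
  have hz : ∀ k : Fin 4, Smb G δ ((Fin.cons u u1 : Fin 4 → ℝ → R3 → ℝ) k) := fun k => by
    refine Fin.cases ?_ (fun k => ?_) k
    · simpa using h0
    · simpa using h1 k
  have e0 : g i j 0 0 - cMink i j = 0 := by
    have := (hgexp i j).eq_zero_imp.self_of_nhds
    simpa using this (by simp)
  have := Smb.comp1 (h := fun z : Fin 4 → ℝ => g i j (z 0) (fun k => z k.succ) - cMink i j) hδ hz
    ((g_smooth4 hg i j).sub contDiff_const) e0
  simpa using this

theorem J_quad {δ δ2 : ℝ → R3 → ℝ} (hg : ∀ i j, ContDiff ℝ ∞ (fun q : ℝ × (Fin 3 → ℝ) => g i j q.1 q.2))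
    (hgexp : ∀ i j,
      (fun q : ℝ × (Fin 3 → ℝ) =>
          g i j q.1 q.2 - (cMink i j + d i j * q.1 + ∑ k : Fin 3, e i j k * q.2 k))
        =O[𝓝 (0 : ℝ × (Fin 3 → ℝ))] fun q => ‖q.1‖ ^ 2 + ‖q.2‖ ^ 2)
    (hδ : ∃ K, 0 ≤ K ∧ ∀ a, ∀ p ∈ G.D a, 0 ≤ δ a p ∧ δ a p ≤ K)
    {u : ℝ → R3 → ℝ} {u1 : Fin 3 → ℝ → R3 → ℝ} {u2 : Fin 3 → Fin 3 → ℝ → R3 → ℝ}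
    (h0 : Smb G δ u) (h1 : ∀ k, Smb G δ (u1 k)) (h2 : ∀ i j, Smb G δ2 (u2 i j)) :
    Smb G (fun a p => δ a p ^ 2 * δ2 a p) (fun a p => ∑ i : Fin 3, ∑ j : Fin 3,
      (g i j (u a p) (fun k => u1 k a p) - (cMink i j + d i j * u a p + ∑ k : Fin 3, e i j k * u1 k a p)) * u2 i j a p) := by
  refine (Smb.fsum (m := 2) (f := fun i a p => ∑ j : Fin 3, (g i j (u a p) (fun k => u1 k a p) - (cMink i j + d i j * u a p + ∑ k : Fin 3, e i j k * u1 k a p)) * u2 i j a p) fun i => ?_)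
  refine (Smb.fsum (m := 2) (f := fun j a p => (g i j (u a p) (fun k => u1 k a p) - (cMink i j + d i j * u a p + ∑ k : Fin 3, e i j k * u1 k a p)) * u2 i j a p) fun j => ?_)
  refine Smb.mul ?_ (h2 i j)
  have hz : ∀ k : Fin 4, Smb G δ ((Fin.cons u u1 : Fin 4 → ℝ → R3 → ℝ) k) := fun k => by
    refine Fin.cases ?_ (fun k => ?_) k
    · simpa using h0
    · simpa using h1 k
  have := Smb.comp2 hδ hz ((g_smooth4 hg i j).sub (lin_smooth4 (d := d) (e := e) i j)) (g_bigO4 hgexp i j)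
  simpa using this

theorem c_sum (m : Fin 3 → Fin 3 → ℝ) : ∑ i : Fin 3, ∑ j : Fin 3, cMink i j * m i j = m 0 0 - m 1 1 - m 2 2 := by
  simp [cMink, Fin.sum_univ_three]; ring
end

/-! the main polar domain -/

def PEs (M b a : ℝ) : Set R3 :=
  {p | (0 < a ∧ a < 1) ∧ 1 < a * p 1 ∧ a^2 * (1 + p 1) < b^2 ∧ -3 < 4 * (a * p 0) ∧ p 0 < M + 1 ∧ |p 2| < 4}

theorem PEs_open (M b a : ℝ) : IsOpen (PEs M b a) := by
  unfold PEs
  refine isOpen_const.and ((isOpen_lt ?_ ?_).and ((isOpen_lt ?_ ?_).and ((isOpen_lt ?_ ?_).and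
    ((isOpen_lt ?_ ?_).and (isOpen_lt ?_ ?_))))) <;> fun_prop

theorem PEs_sub (M b a : ℝ) : PEs M b a ⊆ D0 M := by
  rintro p ⟨⟨h0, h1⟩, h2, h3, h4, h5, h6⟩
  refine ⟨?_, ?_, h5, h6⟩
  · by_contra h; nlinarith
  · by_contra h; nlinarith

def PC (M b : ℝ) : PDom M := ⟨fun a => PEs M b a ∩ {p | a * p 1 < 2},
  fun a => (PEs_open M b a).inter (isOpen_lt (by fun_prop) (by fun_prop)), fun a p hp => PEs_sub M b a hp.1⟩
def PT (M b : ℝ) : PDom M := ⟨fun a => PEs M b a ∩ {p | 2 < a * p 1},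
  fun a => (PEs_open M b a).inter (isOpen_lt (by fun_prop) (by fun_prop)), fun a p hp => PEs_sub M b a hp.1⟩

section
variable {M b : ℝ} {P : PDom M} {χ : ℝ → ℝ}

theorem pe_kap (hb0 : 0 < b) (hP : ∀ a, P.D a ⊆ PEs M b a) : ∀ a, ∀ p ∈ P.D a, kap a p ∈ Qf M b := by
  intro a p hp
  obtain ⟨⟨h0, h1⟩, h2, h3, h4, h5, h6⟩ := hP a hp
  have ht := (P.hsub a hp).1
  refine ⟨h5, ?_, ?_, h6⟩
  · show 0 < a * √(1 + p 1)
    positivity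
  · show a * √(1 + p 1) < b
    refine lt_of_pow_lt_pow_left₀ 2 hb0.le ?_
    rwa [mul_pow, Real.sq_sqrt (by linarith)]

theorem pe_ajb (hM : 0 < M) (hP : ∀ a, P.D a ⊆ PEs M b a) : ∀ a, ∀ p ∈ P.D a, 0 < a ∧ a < 1 ∧ a * jb (p 0) ≤ M + 3 := by
  intro a p hp
  obtain ⟨⟨h0, h1⟩, h2, h3, h4, h5, h6⟩ := hP a hp
  refine ⟨h0, h1, ?_⟩
  have h7 := jb_le (p 0)
  have : a * |p 0| ≤ M + 2 := by
    rcases abs_cases (p 0) with ⟨h, _⟩ | ⟨h, _⟩ <;> rw [h] <;> nlinarith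
  nlinarith

theorem s_a (hP : ∀ a, P.D a ⊆ PEs M b a) : Smb P.G (fun a _ => a) (fun a _ => a) :=
  (Smb.const (fun a => a)).wcongr fun a p hp => abs_of_pos (hP a hp).1.1

theorem s_aq (hP : ∀ a, P.D a ⊆ PEs M b a) : Smb P.G (fun a p => a * jb (p 0)) (fun a p => a * p 0) :=
  (s_a hP).mul (s_q P)

theorem s_aq1 (hM : 0 < M) (hP : ∀ a, P.D a ⊆ PEs M b a) : Smb P.G (fun a p => 1) (fun a p => a * p 0) :=
  (s_aq hP).mono (K := M+3) (by linarith) fun a p hp => by have := (pe_ajb hM hP a p hp).2.2; linarith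

theorem s_Y (hM : 0 < M) (hP : ∀ a, P.D a ⊆ PEs M b a) (hχ : ContDiff ℝ ∞ χ) :
    Smb P.G (fun _ _ => 1) (fun a p => χ (-3 * a * p 0)) :=
  ((s_aq1 hM hP).comp_one (h := fun s => χ (-3 * s)) (hχ.comp (contDiff_const.mul contDiff_id))).congr fun a p _ => by
    beta_reduce; congr 1; ring

theorem s_Y1 (hM : 0 < M) (hP : ∀ a, P.D a ⊆ PEs M b a) (hχ : ContDiff ℝ ∞ χ) (hχ1 : ∀ s : ℝ, s ≤ 1 → χ s = 1) :
    Smb P.G (fun a p => a * jb (p 0)) (fun a p => 1 - χ (-3 * a * p 0)) := by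
  have := Smb.comp1 (G := P.G) (m := 1) (f := fun _ a p => a * p 0) (δ := fun a p => a * jb (p 0))
    ⟨M+3, by linarith, fun a p hp => ⟨by
      have := (pe_ajb hM hP a p hp).1; have := jb_pos (p 0); positivity, (pe_ajb hM hP a p hp).2.2⟩⟩
    (fun _ => s_aq hP) (h := fun z => 1 - χ (-3 * z 0)) (contDiff_const.sub (hχ.comp (contDiff_const.mul (contDiff_apply ℝ ℝ 0))))
    (by simp [hχ1 0])
  exact this.congr fun a p _ => by beta_reduce; congr 2; ring

theorem Y_pd (hχ : ContDiff ℝ ∞ χ) (a : ℝ) (p : R3) :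
    pd 0 (fun p => χ (-3 * a * p 0)) p = -3 * a * deriv χ (-3 * a * p 0) ∧ pd 1 (fun p => χ (-3 * a * p 0)) p = 0 := by
  have h : HasDerivAt (fun s => χ (-3 * a * s)) (-3 * a * deriv χ (-3 * a * p 0)) (p 0) := by
    have h1 : HasDerivAt χ (deriv χ (-3 * a * p 0)) (-3 * a * p 0) := (hχ.differentiable (by simp) _).hasDerivAt
    have := h1.comp (p 0) ((hasDerivAt_id' (p 0)).const_mul (-3 * a))
    refine this.congr_deriv ?_
    ring
  constructor
  · rw [pd_one _ 0 0 p h]; simp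
  · rw [pd_one _ 0 1 p h]; simp

theorem s_Yq (hM : 0 < M) (hP : ∀ a, P.D a ⊆ PEs M b a) (hχ : ContDiff ℝ ∞ χ) :
    Smb P.G (fun a _ => a) (fun a => pd 0 (fun p => χ (-3 * a * p 0))) :=
  (((s_a hP).mul_one (s_Y hM hP (χ := deriv χ) (by
    rw [show (∞ : WithTop ℕ∞) = ∞ + 1 from rfl] at hχ
    exact (contDiff_succ_iff_deriv.1 hχ).2.2))).const_mul (-3)).congr fun a p _ => by
      rw [(Y_pd hχ a p).1]; ring

theorem Smb.TT (hM : 0 < M) {w f : ℝ → R3 → ℝ} (h : Smb P.G w f) (i : Fin 3) :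
    Smb P.G (fun a p => (p 1)⁻¹ * w a p) (fun a p => _root_.PP i (f a) p - omegaHat (p 2) i * pd 0 (f a) p) := by
  have hth : Smb P.G (fun a p => (p 1)⁻¹ * w a p) (fun a p => (p 1 + p 0)⁻¹ * pd 2 (f a) p) := (s_ri P hM).mul h.dth
  fin_cases i
  · exact h.dt.congr fun a p _ => by simp [_root_.PP, omegaHat]
  · exact ((s_sin P).one_mul hth).neg.congr fun a p _ => by simp [_root_.PP, omegaHat]; ring
  · exact ((s_cos P).one_mul hth).congr fun a p _ => by simp [_root_.PP, omegaHat]; ring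

theorem s_om (P : PDom M) (i : Fin 3) : Smb P.G (fun _ _ => 1) (fun _ p => omegaHat (p 2) i) := by
  fin_cases i
  · exact Smb.one (-1)
  · exact s_cos P
  · exact s_sin P

/-- `-2⟂` of the rescaled wave operator -/
def Lop (f : R3 → ℝ) (p : R3) : ℝ := pd 1 (pd 1 f) p - 2 * pd 1 (pd 0 f) p - ((p 1 + p 0)⁻¹)^2 * (f p / 4 + pd 2 (pd 2 f) p)

theorem Lop_congr {f f' : R3 → ℝ} {p : R3} (h : f =ᶠ[𝓝 p] f') : Lop f p = Lop f' p := by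
  simp only [Lop]
  rw [pd_congr (pd_congr_ev h 1) 1, pd_congr (pd_congr_ev h 0) 1, pd_congr (pd_congr_ev h 2) 2, h.self_of_nhds]

/-- remainder of the rescaled wave operator -/
theorem Smb.Lrem (hM : 0 < M) {w f : ℝ → R3 → ℝ} (h : Smb P.G w f) :
    Smb P.G (fun a p => ((p 1)⁻¹)^2 * w a p) (fun a p => Lop (f a) p + 2 * pd 1 (pd 0 (f a)) p) := by
  have h1 : Smb P.G (fun a p => ((p 1)⁻¹)^2 * w a p) (fun a => pd 1 (pd 1 (f a))) := h.dt.dt.wcongr fun a p _ => by ring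
  have h2 : Smb P.G (fun a p => ((p 1)⁻¹)^2 * w a p) (fun a p => ((p 1 + p 0)⁻¹)^2 * (f a p / 4 + pd 2 (pd 2 (f a)) p)) :=
    (((s_ri P hM).mul (s_ri P hM)).mul ((h.const_mul (1/4)).add h.dth.dth)).congr (fun a p _ => by ring) |>.wcongr fun a p _ => by ring
  exact (h1.sub h2).congr fun a p _ => by simp only [Lop]; ring
end
end

noncomputable section
open Function

/-- everything needed for the error estimate -/
structure Cx (M b T : ℝ) (d : Fin 3 → Fin 3 → ℝ) (e : Fin 3 → Fin 3 → Fin 3 → ℝ) (φ0 φ1 : ℝ × ℝ → ℝ)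
    (g : Fin 3 → Fin 3 → ℝ → (Fin 3 → ℝ) → ℝ) (χ : ℝ → ℝ) (V : ℝ → ℝ → ℝ → ℝ) (w0 : R3 → ℝ)
    (ua : ℝ → R3 → ℝ) : Prop where
  hM : 0 < M
  hb0 : 0 < b
  hbT : b < T
  hV : IsProfileSol M d e φ0 φ1 T V
  hχ : ContDiff ℝ ∞ χ
  hχ1 : ∀ s : ℝ, s ≤ 1 → χ s = 1
  hχ0 : ∀ s : ℝ, 2 ≤ s → χ s = 0
  hg : ∀ i j, ContDiff ℝ ∞ (fun q : ℝ × (Fin 3 → ℝ) => g i j q.1 q.2)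
  hgexp : ∀ i j,
      (fun q : ℝ × (Fin 3 → ℝ) =>
          g i j q.1 q.2 - (cMink i j + d i j * q.1 + ∑ k : Fin 3, e i j k * q.2 k))
        =O[𝓝 (0 : ℝ × (Fin 3 → ℝ))] fun q => ‖q.1‖ ^ 2 + ‖q.2‖ ^ 2
  hw : IsW M w0
  hua : ∀ ε t r θ : ℝ, 0 < r →
      ua ε ![t, r * Real.cos θ, r * Real.sin θ]
        = ε * χ (ε * t) * w0 ![t, r * Real.cos θ, r * Real.sin θ]
          + ε / Real.sqrt r * (1 - χ (ε * t)) * χ (-3 * ε * (r - t)) *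
              V (r - t) θ (ε * Real.sqrt (1 + t))
  asy : Smb (Pb M).G (fun _ p => (p 1)⁻¹ * √(jb (p 0))) (fun _ p => rt p * w0 (Psi p) - Ff φ0 φ1 p)
  hF : Smb (Pb M).G (fun _ p => (√(jb (p 0)))⁻¹) (fun _ => Ff φ0 φ1)
  hW : Smb (QfG M b) (fun _ _ => 1) (fun _ => Wf V)

/-- the nonlinear operator -/
def JJ (g : Fin 3 → Fin 3 → ℝ → (Fin 3 → ℝ) → ℝ) (u : R3 → ℝ) (y : R3) : ℝ :=
  ∑ i : Fin 3, ∑ j : Fin 3, g i j (u y) (fun k => pd k u y) * pd i (pd j u) y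

theorem JJ_split (g) (u : R3 → ℝ) (y : R3) : JJ g u y =
    (pd 0 (pd 0 u) y - pd 1 (pd 1 u) y - pd 2 (pd 2 u) y)
     + ∑ i : Fin 3, ∑ j : Fin 3, (g i j (u y) (fun k => pd k u y) - cMink i j) * pd i (pd j u) y := by
  rw [← c_sum (fun i j => pd i (pd j u) y), ← Finset.sum_add_distrib]
  refine Finset.sum_congr rfl fun i _ => ?_
  rw [← Finset.sum_add_distrib]
  exact Finset.sum_congr rfl fun j _ => by ring

theorem JJ_split2 (g) (d : Fin 3 → Fin 3 → ℝ) (e : Fin 3 → Fin 3 → Fin 3 → ℝ) (u : R3 → ℝ) (y : R3) : JJ g u y =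
    (pd 0 (pd 0 u) y - pd 1 (pd 1 u) y - pd 2 (pd 2 u) y)
     + ∑ i : Fin 3, ∑ j : Fin 3, (d i j * u y + ∑ k : Fin 3, e i j k * pd k u y) * pd i (pd j u) y
     + ∑ i : Fin 3, ∑ j : Fin 3, (g i j (u y) (fun k => pd k u y) - (cMink i j + d i j * u y + ∑ k : Fin 3, e i j k * pd k u y)) * pd i (pd j u) y := by
  rw [← c_sum (fun i j => pd i (pd j u) y), ← Finset.sum_add_distrib, ← Finset.sum_add_distrib]
  refine Finset.sum_congr rfl fun i _ => ?_
  rw [← Finset.sum_add_distrib, ← Finset.sum_add_distrib]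
  exact Finset.sum_congr rfl fun j _ => by ring

def YW (χ : ℝ → ℝ) (V : ℝ → ℝ → ℝ → ℝ) (a : ℝ) (p : R3) : ℝ := χ (-3 * a * p 0) * Wf V (kap a p)
def ff (χ : ℝ → ℝ) (V : ℝ → ℝ → ℝ → ℝ) (w0 : R3 → ℝ) (a : ℝ) (p : R3) : ℝ :=
  YW χ V a p + χ (a * p 1) * (rt p * w0 (Psi p) - YW χ V a p)

theorem Lop_add {f g : R3 → ℝ} {p : R3} (hf : ContDiffAt ℝ ∞ f p) (hg : ContDiffAt ℝ ∞ g p) :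
    Lop (fun p => f p + g p) p = Lop f p + Lop g p := by
  have ev : ∀ i, pd i (fun p => f p + g p) =ᶠ[𝓝 p] fun p => pd i f p + pd i g p := fun i => by
    filter_upwards [diff_ev hf, diff_ev hg] with q h1 h2 using pd_add' h1 h2 i
  have d : ∀ {f : R3 → ℝ}, ContDiffAt ℝ ∞ f p → ∀ i, DifferentiableAt ℝ (pd i f) p := fun h i =>
    (pd_smoothAt h i).differentiableAt (by simp)
  simp only [Lop]
  rw [pd_congr (ev 1) 1, pd_congr (ev 0) 1, pd_congr (ev 2) 2, pd_add' (d hf _) (d hg _), pd_add' (d hf _) (d hg _),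
    pd_add' (d hf _) (d hg _)]
  ring

theorem Lop_mul {h h' h'' : ℝ → ℝ} {g : R3 → ℝ} {p : R3} (hh : ∀ s, HasDerivAt h (h' s) s) (hh' : ∀ s, HasDerivAt h' (h'' s) s)
    (hg : ContDiffAt ℝ ∞ g p) :
    Lop (fun p => h (p 1) * g p) p = h (p 1) * Lop g p + (2 * (h' (p 1) * pd 1 g p) + h'' (p 1) * g p - 2 * (h' (p 1) * pd 0 g p)) := by
  have dX : ∀ p : R3, DifferentiableAt ℝ (fun p : R3 => h (p 1)) p := fun p => (hh _).differentiableAt.comp p (diff_coord 1 p)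
  have dX' : ∀ p : R3, DifferentiableAt ℝ (fun p : R3 => h' (p 1)) p := fun p => (hh' _).differentiableAt.comp p (diff_coord 1 p)
  have ev : ∀ i, pd i (fun p => h (p 1) * g p) =ᶠ[𝓝 p] fun p => h (p 1) * pd i g p + (if i = 1 then 1 else 0) * (h' (p 1) * g p) := fun i => by
    filter_upwards [diff_ev hg] with q h1
    rw [pd_mul' (dX q) h1, pd_one h 1 i q (hh _)]
    fin_cases i <;> simp
  have d : ∀ i, DifferentiableAt ℝ (pd i g) p := fun i => (pd_smoothAt hg i).differentiableAt (by simp)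
  have dg := hg.differentiableAt (by simp)
  have e0 : pd 1 (fun p => h (p 1) * pd 0 g p) p = h (p 1) * pd 1 (pd 0 g) p + h' (p 1) * pd 0 g p := by
    rw [pd_mul' (dX p) (d 0), pd_one h 1 1 p (hh _)]; simp
  have e2 : pd 2 (fun p => h (p 1) * pd 2 g p) p = h (p 1) * pd 2 (pd 2 g) p := by
    rw [pd_mul' (dX p) (d 2), pd_one h 1 2 p (hh _)]; simp
  have e1 : pd 1 (fun p => h (p 1) * pd 1 g p + h' (p 1) * g p) p = h (p 1) * pd 1 (pd 1 g) p + 2 * (h' (p 1) * pd 1 g p) + h'' (p 1) * g p := by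
    rw [pd_add' (f := fun p => h (p 1) * pd 1 g p) (g := fun p => h' (p 1) * g p) ((dX p).mul (d 1)) ((dX' p).mul dg), pd_mul' (dX p) (d 1), pd_mul' (dX' p) dg, pd_one h 1 1 p (hh _), pd_one h' 1 1 p (hh' _)]
    simp; ring
  have f0 := ev 0
  have f1 := ev 1
  have f2 := ev 2
  simp only [if_true, show ¬ (0 : Fin 3) = 1 by decide, show ¬ (2 : Fin 3) = 1 by decide, if_false, zero_mul, add_zero, one_mul] at f0 f1 f2
  simp only [Lop]
  rw [pd_congr f1 1, pd_congr f0 1, pd_congr f2 2, e0, e1, e2]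
  ring

section
variable {M b T : ℝ} {d : Fin 3 → Fin 3 → ℝ} {e : Fin 3 → Fin 3 → Fin 3 → ℝ} {φ0 φ1 : ℝ × ℝ → ℝ}
    {g : Fin 3 → Fin 3 → ℝ → (Fin 3 → ℝ) → ℝ} {χ : ℝ → ℝ} {V : ℝ → ℝ → ℝ → ℝ} {w0 : R3 → ℝ}
    {ua : ℝ → R3 → ℝ} {P : PDom M}

theorem ua_polar (c : Cx M b T d e φ0 φ1 g χ V w0 ua) (a : ℝ) {p : R3} (hr : 0 < p 1 + p 0) :
    ua a (Psi p) = a * (rt p)⁻¹ * ff χ V w0 a p := by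
  have h := c.hua a (p 1) (p 1 + p 0) (p 2) hr
  have h1 := rt_pos hr
  have e1 : p 1 + p 0 - p 1 = p 0 := by ring
  rw [e1] at h
  show ua a ![p 1, (p 1 + p 0) * cos (p 2), (p 1 + p 0) * sin (p 2)] = _
  rw [h]
  simp only [ff, YW, Psi, Wf, kap, rt] at h1 ⊢
  simp only [Matrix.cons_val]
  field_simp
  ring

theorem s_Wk (c : Cx M b T d e φ0 φ1 g χ V w0 ua) (hP : ∀ a, P.D a ⊆ PEs M b a) :
    Smb P.G (fun _ _ => 1) (fun a p => Wf V (kap a p)) := kap_smb P (pe_kap c.hb0 hP) (w := fun _ => 1) c.hW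

theorem s_YW (c : Cx M b T d e φ0 φ1 g χ V w0 ua) (hP : ∀ a, P.D a ⊆ PEs M b a) :
    Smb P.G (fun _ _ => 1) (YW χ V) := (s_Y c.hM hP c.hχ).one_mul (s_Wk c hP)

theorem s_ua (c : Cx M b T d e φ0 φ1 g χ V w0 ua) (hP : ∀ a, P.D a ⊆ PEs M b a) (hf : Smb P.G (fun _ _ => 1) (ff χ V w0)) :
    Smb P.G (fun a p => a * (√(p 1))⁻¹) (fun a p => ua a (Psi p)) :=
  (((s_a hP).mul (s_sri P c.hM)).mul_one hf).congr fun a p hp => ua_polar c a (PDom.rpos hp)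

theorem box_ua (c : Cx M b T d e φ0 φ1 g χ V w0 ua) (hP : ∀ a, P.D a ⊆ PEs M b a) (hf : Smb P.G (fun _ _ => 1) (ff χ V w0))
    {a : ℝ} {p : R3} (hp : p ∈ P.G.D a) :
    pd 0 (pd 0 (ua a)) (Psi p) - pd 1 (pd 1 (ua a)) (Psi p) - pd 2 (pd 2 (ua a)) (Psi p) =
      a * (rt p)⁻¹ * Lop (ff χ V w0 a) p := by
  have hr := PDom.rpos hp
  have h := polar_box_f ((s_ua c hP hf).cartAt hp) hr
  have ev : (fun p => rt p * ua a (Psi p)) =ᶠ[𝓝 p] fun p => (fun _ => a) (p 1) * ff χ V w0 a p := by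
    filter_upwards [rpos_ev hr] with q hq
    have := rt_pos hq
    rw [ua_polar c a hq]; field_simp
  have h2 : rt p * (pd 0 (pd 0 (ua a)) (Psi p) - pd 1 (pd 1 (ua a)) (Psi p) - pd 2 (pd 2 (ua a)) (Psi p)) =
    Lop (fun p => rt p * ua a (Psi p)) p := h
  rw [Lop_congr ev, Lop_mul (h' := fun _ => 0) (h'' := fun _ => 0) (fun s => hasDerivAt_const _ _) (fun s => hasDerivAt_const _ _) (hf.at hp)] at h2
  have := rt_pos hr
  field_simp
  simp at h2
  linarith

theorem jbi_le {a : ℝ} {p : R3} : (jb (p 0))⁻¹ ≤ 1 := inv_le_one_of_one_le₀ (one_le_jb _)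

/-- the non-box part, crude -/
theorem J_crude (c : Cx M b T d e φ0 φ1 g χ V w0 ua) (hP : ∀ a, P.D a ⊆ PEs M b a) (hf : Smb P.G (fun _ _ => 1) (ff χ V w0)) :
    Smb P.G (fun a p => (a * (√(p 1))⁻¹) * ((jb (p 0))⁻¹ * (a * (√(p 1))⁻¹))) (fun a p => ∑ i : Fin 3, ∑ j : Fin 3,
      (g i j (ua a (Psi p)) (fun k => pd k (ua a) (Psi p)) - cMink i j) * pd i (pd j (ua a)) (Psi p)) := by
  have h := s_ua c hP hf
  refine J_lin (u := fun a p => ua a (Psi p)) (u1 := fun k a p => pd k (ua a) (Psi p)) (u2 := fun i j a p => pd i (pd j (ua a)) (Psi p)) c.hg c.hgexp ⟨1, zero_le_one, fun a p hp => ?_⟩ h (fun k => h.cart1 c.hM k) (fun i j => ?_)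
  · obtain ⟨⟨h0, h1⟩, h2⟩ := hP a hp
    have h3 := (PDom.mem hp).1
    refine ⟨by positivity, ?_⟩
    have : (√(p 1))⁻¹ ≤ 1 := inv_le_one_of_one_le₀ (Real.one_le_sqrt.2 h3.le)
    have : 0 < (√(p 1))⁻¹ := by positivity
    nlinarith
  · exact (h.cart1 c.hM j).cart c.hM i

theorem s_1t (P : PDom M) : Smb P.G (fun _ p => √(p 1)) (fun _ p => √(1 + p 1)) := by
  have : Smb P.G (fun _ p => p 1) (fun _ _ => 1) := (Smb.one 1).mono zero_le_one fun a p hp => by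
      have := (PDom.mem hp).1; linarith
  exact (this.add (s_t P)).sqrt one_pos fun a p hp => by
    have := (PDom.mem hp).1; constructor <;> linarith

theorem s_1ti (P : PDom M) : Smb P.G (fun _ p => (√(p 1))⁻¹) (fun _ p => (√(1 + p 1))⁻¹) :=
  (s_1t P).inv one_pos fun a p hp => by
    have := (PDom.mem hp).1
    refine ⟨by positivity, ?_⟩
    rw [one_mul]; exact Real.sqrt_le_sqrt (by linarith)

theorem YW_t (c : Cx M b T d e φ0 φ1 g χ V w0 ua) (hP : ∀ a, P.D a ⊆ PEs M b a) {a : ℝ} {p : R3} (hp : p ∈ P.G.D a) :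
    pd 1 (YW χ V a) p = (a * (√(1 + p 1))⁻¹ * (1/2)) * (χ (-3 * a * p 0) * pd 1 (Wf V) (kap a p)) := by
  have hk := pe_kap c.hb0 hP a p hp
  have h0 := (PDom.mem hp).1
  have hd : DifferentiableAt ℝ (Wf V) (kap a p) := c.hW.diffAt (a := 0) hk
  have hY : DifferentiableAt ℝ (fun p : R3 => χ (-3 * a * p 0)) p := (s_Y c.hM hP c.hχ).diffAt hp
  have hWk : DifferentiableAt ℝ (fun p : R3 => Wf V (kap a p)) p := (s_Wk c hP).diffAt hp
  have := pd_mul' hY hWk 1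
  have e1 : pd 1 (YW χ V a) p = pd 1 (fun p => χ (-3 * a * p 0) * Wf V (kap a p)) p := rfl
  rw [e1, this, (Y_pd c.hχ a p).2, (kap_chain (by linarith) hd).2.1]
  field_simp
  ring

theorem s_YWt (c : Cx M b T d e φ0 φ1 g χ V w0 ua) (hP : ∀ a, P.D a ⊆ PEs M b a) :
    Smb P.G (fun a p => a * (√(p 1))⁻¹) (fun a => pd 1 (YW χ V a)) :=
  ((((s_a hP).mul (s_1ti P)).const_mul (1/2)).mul_one ((s_Y c.hM hP c.hχ).one_mul
    (kap_smb P (pe_kap c.hb0 hP) (w := fun _ => 1) c.hW.q1))).congr fun a p hp => by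
      rw [YW_t c hP hp]; ring
end
end

noncomputable section
open Function
section
variable {M b T : ℝ} {d : Fin 3 → Fin 3 → ℝ} {e : Fin 3 → Fin 3 → Fin 3 → ℝ} {φ0 φ1 : ℝ × ℝ → ℝ}
    {g : Fin 3 → Fin 3 → ℝ → (Fin 3 → ℝ) → ℝ} {χ : ℝ → ℝ} {V : ℝ → ℝ → ℝ → ℝ} {w0 : R3 → ℝ}
    {ua : ℝ → R3 → ℝ}

theorem PC_P (M b a : ℝ) : (PC M b).D a ⊆ PEs M b a := fun p hp => hp.1
theorem PT_P (M b a : ℝ) : (PT M b).D a ⊆ PEs M b a := fun p hp => hp.1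

theorem pc_ti {a : ℝ} {p : R3} (hp : p ∈ PEs M b a) : 0 < a ∧ a < 1 ∧ 0 < (p 1)⁻¹ ∧ (p 1)⁻¹ ≤ a ∧ 0 < (√(p 1))⁻¹ ∧ (√(p 1))⁻¹ ≤ √a := by
  obtain ⟨⟨h0, h1⟩, h2, h3⟩ := hp
  have ht : 0 < p 1 := by by_contra h; nlinarith
  have h4 : (p 1)⁻¹ ≤ a := by rw [inv_le_iff_one_le_mul₀ ht]; linarith
  refine ⟨h0, h1, by positivity, h4, by positivity, ?_⟩
  rw [← Real.sqrt_inv]; exact Real.sqrt_le_sqrt h4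

theorem c_X (hχ : ContDiff ℝ ∞ χ) : Smb (PC M b).G (fun _ _ => 1) (fun a p => χ (a * p 1)) := by
  have : Smb (PC M b).G (fun _ _ => 1) (fun a p => a * p 1) :=
    ((s_a (PC_P M b)).mul (s_t (PC M b))).mono zero_le_two fun a p hp => by
      have : a * p 1 < 2 := hp.2
      linarith
  exact this.comp_one hχ

theorem c_f0 (c : Cx M b T d e φ0 φ1 g χ V w0 ua) : Smb (PC M b).G (fun _ _ => 1) (fun _ p => rt p * w0 (Psi p)) :=
  ((s_sr (PC M b) c.hM).mul (wave_smb (PC M b) c.hM c.hw)).mono zero_le_one fun a p hp => by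
    have h1 := (PDom.mem hp).1
    have h2 : (√(jb (p 0)))⁻¹ ≤ 1 := inv_le_one_of_one_le₀ (Real.one_le_sqrt.2 (one_le_jb _))
    rw [← mul_assoc, mul_inv_cancel₀ (by positivity)]; linarith

theorem c_ff (c : Cx M b T d e φ0 φ1 g χ V w0 ua) : Smb (PC M b).G (fun _ _ => 1) (ff χ V w0) :=
  (s_YW c (PC_P M b)).add ((c_X c.hχ).one_mul ((c_f0 c).sub (s_YW c (PC_P M b))))

/-- matching of the free wave and the profile -/
theorem c_g (c : Cx M b T d e φ0 φ1 g χ V w0 ua) :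
    Smb (PC M b).G (fun a _ => √a) (fun a p => rt p * w0 (Psi p) - YW χ V a p) := by
  have hT : 0 < T := c.hb0.trans c.hbT
  have bd : ∀ a, ∀ p ∈ (PC M b).G.D a, a * √(jb (p 0)) ≤ √(M + 3) * √a := by
    intro a p hp
    have h1 := pe_ajb c.hM (PC_P M b) a p hp
    have h2 : √a * √(jb (p 0)) ≤ √(M+3) := by
      rw [← Real.sqrt_mul h1.1.le]; exact Real.sqrt_le_sqrt h1.2.2
    have h3 : a = √a * √a := (Real.mul_self_sqrt h1.1.le).symm
    calc a * √(jb (p 0)) = √a * (√a * √(jb (p 0))) := by rw [← mul_assoc, ← h3]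
      _ ≤ √a * √(M+3) := by gcongr
      _ = _ := by ring
  have g1 : Smb (PC M b).G (fun a _ => √a) (fun a p => rt p * w0 (Psi p) - Ff φ0 φ1 p) :=
    (c.asy.restrict (PC M b).G rfl fun a => (PC M b).hsub a).mono (K := √(M+3)) (by positivity) fun a p hp => by
      refine le_trans ?_ (bd a p hp)
      have := (pc_ti hp.1).2.2.2.1
      gcongr
  have hF := c.hF.restrict (PC M b).G rfl fun a => (PC M b).hsub a
  have g2 : Smb (PC M b).G (fun a _ => √a) (fun a p => (1 - χ (-3 * a * p 0)) * Ff φ0 φ1 p) :=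
    ((s_Y1 c.hM (PC_P M b) c.hχ c.hχ1).mul hF).mono (K := √(M+3)) (by positivity) fun a p hp => by
      refine le_trans (le_of_eq ?_) (bd a p hp)
      have h1 : 0 < √(jb (p 0)) := Real.sqrt_pos.2 (jb_pos _)
      have h3 : jb (p 0) = √(jb (p 0)) * √(jb (p 0)) := (Real.mul_self_sqrt (jb_pos _).le).symm
      generalize √(jb (p 0)) = s at h1 h3 ⊢
      rw [h3]; field_simp
  have hFs : Smb (QfG M b) (fun _ _ => 1) (fun _ => Ff φ0 φ1) :=
    (tind_trans (M := M) (b := b) (w := fun p => (√(jb (p 0)))⁻¹) (fun p s => by simp) Ff_tind (Ff_smooth hT c.hV) c.hF).mono zero_le_one fun a p hp => by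
      rw [one_mul]; exact inv_le_one_of_one_le₀ (Real.one_le_sqrt.2 (one_le_jb _))
  have g3 : Smb (PC M b).G (fun a p => a * √(p 1)) (fun a p => Wf V (kap a p) - Ff φ0 φ1 (kap a p)) := fun n =>
    kap0_symN (PC M b) hT c.hbT (pe_kap c.hb0 (PC_P M b)) (fun a p hp => hp.1.1.1) n (fun p => Wf V p - Ff φ0 φ1 p)
      ((Wf_smooth c.hV).sub (Ff_smooth hT c.hV).contDiffOn) (fun p hp => by rw [Wf_zero c.hV p hp, sub_self]) (c.hW.sub hFs)
  have g4 : Smb (PC M b).G (fun a _ => √a) (fun a p => Wf V (kap a p) - Ff φ0 φ1 p) :=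
    (g3.congr fun a p _ => by simp [Ff, kap]).mono (K := √2) (by positivity) fun a p hp => by
      have h1 := hp.1.1.1
      have h2 : a * p 1 < 2 := hp.2
      have h3 : √a * √(p 1) ≤ √2 := by rw [← Real.sqrt_mul h1.le]; exact Real.sqrt_le_sqrt h2.le
      have h4 : a = √a * √a := (Real.mul_self_sqrt h1.le).symm
      calc a * √(p 1) = √a * (√a * √(p 1)) := by rw [← mul_assoc, ← h4]
        _ ≤ √a * √2 := by gcongr
        _ = _ := by ring
  exact ((g1.add g2).sub ((s_Y c.hM (PC_P M b) c.hχ).one_mul g4)).congr fun a p _ => by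
    simp only [YW]; ring

theorem f0_L (c : Cx M b T d e φ0 φ1 g χ V w0 ua) {p : R3} (hr : 0 < p 1 + p 0) : Lop (fun p => rt p * w0 (Psi p)) p = 0 := by
  have h : rt p * (pd 0 (pd 0 w0) (Psi p) - pd 1 (pd 1 w0) (Psi p) - pd 2 (pd 2 w0) (Psi p)) =
    Lop (fun p => rt p * w0 (Psi p)) p := polar_box_f c.hw.smooth.contDiffAt hr
  rw [← h, c.hw.wave, mul_zero]

theorem c_L (c : Cx M b T d e φ0 φ1 g χ V w0 ua) :
    Smb (PC M b).G (fun a p => a * √a * (jb (p 0))⁻¹ + a^2) (fun a => Lop (ff χ V w0 a)) := by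
  have hg := c_g c
  have hX := c_X (M := M) (b := b) c.hχ
  have hYW := s_YW c (PC_P M b)
  have hχd : ContDiff ℝ ∞ (deriv χ) := by
    have := c.hχ
    rw [show (∞ : WithTop ℕ∞) = ∞ + 1 from rfl] at this
    exact (contDiff_succ_iff_deriv.1 this).2.2
  have dX : ∀ a s, HasDerivAt (fun s => χ (a * s)) (deriv χ (a * s) * a) s := fun a s => by
    have h1 : HasDerivAt χ (deriv χ (a * s)) (a * s) := (c.hχ.differentiable (by simp) _).hasDerivAt
    have := h1.comp s ((hasDerivAt_id' s).const_mul a)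
    rwa [mul_one] at this
  have dX' : ∀ a s, HasDerivAt (fun s => deriv χ (a * s) * a) (deriv (deriv χ) (a * s) * a * a) s := fun a s => by
    have h1 : HasDerivAt (deriv χ) (deriv (deriv χ) (a * s)) (a * s) := (hχd.differentiable (by simp) _).hasDerivAt
    have := (h1.comp s ((hasDerivAt_id' s).const_mul a)).mul_const a
    rwa [mul_one] at this
  have pX : ∀ a, pd 1 (fun p : R3 => χ (a * p 1)) = fun p => deriv χ (a * p 1) * a := fun a => by
    funext p; rw [pd_one _ 1 1 p (dX a (p 1))]; simp
  have pX' : ∀ a, pd 1 (fun p : R3 => deriv χ (a * p 1) * a) = fun p => deriv (deriv χ) (a * p 1) * a * a := fun a => by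
    funext p; rw [pd_one _ 1 1 p (dX' a (p 1))]; simp
  have hXt := hX.dt
  have hXtt := hXt.dt' c.hM
  simp only [pX] at hXt hXtt
  simp only [pX'] at hXtt
  have ww : ∀ {f : ℝ → R3 → ℝ}, Smb (PC M b).G (fun a p => (p 1)⁻¹ * (jb (p 0))⁻¹ * √a) f → Smb (PC M b).G (fun a p => a * √a * (jb (p 0))⁻¹ + a^2) f :=
    fun h => h.mono zero_le_one fun a p hp => by
      have h1 := pc_ti hp.1
      have := jb_pos (p 0)
      calc (p 1)⁻¹ * (jb (p 0))⁻¹ * √a ≤ a * (jb (p 0))⁻¹ * √a := by have := h1.2.2.2.1; gcongr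
        _ ≤ _ := by nlinarith [sq_nonneg a]
  have b1 := ww ((hXt.mul (hg.dt' c.hM)).wcongr fun a p _ => by ring)
  have b2 := ww ((hXtt.mul hg).wcongr fun a p _ => by ring)
  have b3 := ww ((hXt.mul hg.dq).wcongr fun a p _ => by ring)
  have b4 : Smb (PC M b).G (fun a p => a * √a * (jb (p 0))⁻¹ + a^2) (fun a p => Lop (YW χ V a) p + 2 * pd 1 (pd 0 (YW χ V a)) p) :=
    (hYW.Lrem c.hM).mono zero_le_one fun a p hp => by
      have h1 := pc_ti hp.1
      have := jb_pos (p 0)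
      have h2 : ((p 1)⁻¹)^2 ≤ a^2 := by have := h1.2.2.2.1; have := h1.2.2.1; gcongr
      have : 0 ≤ a * √a * (jb (p 0))⁻¹ := by have := h1.1; positivity
      linarith
  have b5 : Smb (PC M b).G (fun a p => a * √a * (jb (p 0))⁻¹ + a^2) (fun a p => pd 1 (pd 0 (YW χ V a)) p) :=
    ((s_YWt c (PC_P M b)).dq.congr fun a p hp => pd_comm_at (hYW.at hp) 1 0).mono zero_le_one fun a p hp => by
      have h1 := pc_ti hp.1
      have := jb_pos (p 0)
      have h2 := h1.2.2.2.2.2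
      have h0 := h1.1
      calc (jb (p 0))⁻¹ * (a * (√(p 1))⁻¹) ≤ (jb (p 0))⁻¹ * (a * √a) := by gcongr
        _ ≤ _ := by nlinarith [sq_nonneg a]
  have b6 := ((Smb.one 1).sub hX).one_mul (b4.sub (b5.const_mul 2))
  refine (b6.add (((b1.const_mul 2).add b2).sub (b3.const_mul 2))).congr fun a p hp => ?_
  have hgp := hg.at hp
  have hyp := hYW.at hp
  have hXp := hX.at hp
  have e1 : Lop (ff χ V w0 a) p = Lop (YW χ V a) p + Lop (fun p => χ (a * p 1) * (rt p * w0 (Psi p) - YW χ V a p)) p :=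
    Lop_add (f := YW χ V a) (g := fun p => χ (a * p 1) * (rt p * w0 (Psi p) - YW χ V a p)) hyp (hXp.mul hgp)
  have e2 := Lop_mul (dX a) (dX' a) hgp
  have e3 : Lop (fun p => (rt p * w0 (Psi p) - YW χ V a p) + YW χ V a p) p = Lop (fun p => rt p * w0 (Psi p) - YW χ V a p) p + Lop (YW χ V a) p :=
    Lop_add (f := fun p => rt p * w0 (Psi p) - YW χ V a p) (g := YW χ V a) hgp hyp
  simp only [sub_add_cancel] at e3
  rw [f0_L c (PDom.rpos hp)] at e3
  rw [e1, e2]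
  have : Lop (fun p => rt p * w0 (Psi p) - YW χ V a p) p = - Lop (YW χ V a) p := by linarith
  rw [this]; ring

theorem c_J (c : Cx M b T d e φ0 φ1 g χ V w0 ua) :
    Smb (PC M b).G (fun a p => a^3 * ((jb (p 0))⁻¹ + √a)) (fun a p => JJ g (ua a) (Psi p)) := by
  have hf := c_ff c
  have h1 := ((s_a (PC_P M b)).mul (s_sri (PC M b) c.hM)).mul (c_L c)
  have h2 := h1.congr fun a p hp => box_ua c (PC_P M b) hf hp
  have h3 : Smb (PC M b).G (fun a p => a^3 * ((jb (p 0))⁻¹ + √a)) _ := h2.mono zero_le_one fun a p hp => by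
    have h1 := pc_ti hp.1
    have := jb_pos (p 0)
    have h2 := h1.2.2.2.2.2
    have h0 := h1.1
    have h4 : a = √a * √a := (Real.mul_self_sqrt h0.le).symm
    have e1 : a * √a * (a * √a * (jb (p 0))⁻¹ + a^2) = a^3 * ((jb (p 0))⁻¹ + √a) := by
      calc a * √a * (a * √a * (jb (p 0))⁻¹ + a^2) = a * a * (√a * √a) * (jb (p 0))⁻¹ + a^3 * √a := by ring
        _ = _ := by rw [← h4]; ring
    rw [one_mul, ← e1]
    gcongr
  have h5 := J_crude c (PC_P M b) hf
  have h6 : Smb (PC M b).G (fun a p => a^3 * ((jb (p 0))⁻¹ + √a)) _ := h5.mono zero_le_one fun a p hp => by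
    have h1 := pc_ti hp.1
    have := jb_pos (p 0)
    have h2 := h1.2.2.2.2.2
    have h0 := h1.1
    have h4 : a = √a * √a := (Real.mul_self_sqrt h0.le).symm
    have h5 : 0 ≤ a^3 * √a := by positivity
    calc (a * (√(p 1))⁻¹) * ((jb (p 0))⁻¹ * (a * (√(p 1))⁻¹)) ≤ (a * √a) * ((jb (p 0))⁻¹ * (a * √a)) := by gcongr
      _ = a * a * (√a * √a) * (jb (p 0))⁻¹ := by ring
      _ = a^3 * (jb (p 0))⁻¹ := by rw [← h4]; ring
      _ ≤ _ := by linarith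
  exact (h3.add h6).congr fun a p _ => JJ_split g (ua a) (Psi p)
end
end

noncomputable section
open Function
section
variable {M b T : ℝ} {d : Fin 3 → Fin 3 → ℝ} {e : Fin 3 → Fin 3 → Fin 3 → ℝ} {φ0 φ1 : ℝ × ℝ → ℝ}
    {g : Fin 3 → Fin 3 → ℝ → (Fin 3 → ℝ) → ℝ} {χ : ℝ → ℝ} {V : ℝ → ℝ → ℝ → ℝ} {w0 : R3 → ℝ}
    {ua : ℝ → R3 → ℝ}

theorem t_ff (c : Cx M b T d e φ0 φ1 g χ V w0 ua) {a : ℝ} {p : R3} (hp : p ∈ (PT M b).G.D a) :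
    ff χ V w0 a p = YW χ V a p := by
  have : 2 < a * p 1 := hp.2
  simp only [ff, c.hχ0 _ this.le]; ring

theorem t_f (c : Cx M b T d e φ0 φ1 g χ V w0 ua) : Smb (PT M b).G (fun _ _ => 1) (ff χ V w0) :=
  (s_YW c (PT_P M b)).congr fun a p hp => t_ff c hp

theorem t_ev {f f' : ℝ → R3 → ℝ} (h : ∀ a, ∀ p ∈ (PT M b).G.D a, f a p = f' a p) {a : ℝ} {p : R3} (hp : p ∈ (PT M b).G.D a) :
    f a =ᶠ[𝓝 p] f' a := by
  filter_upwards [((PT M b).hD a).mem_nhds hp] with q hq using h a q hq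

theorem t_ta {f : ℝ → R3 → ℝ} (h : Smb (PT M b).G (fun a p => (p 1)⁻¹ * (a * (√(p 1))⁻¹)) f) : Smb (PT M b).G (fun a p => a * (a * (√(p 1))⁻¹)) f :=
  h.mono zero_le_one fun a p hp => by
    have h1 := pc_ti hp.1
    rw [one_mul]
    exact mul_le_mul_of_nonneg_right h1.2.2.2.1 (mul_pos h1.1 h1.2.2.2.2.1).le

theorem t_dq {w f : ℝ → R3 → ℝ} (h : Smb (PT M b).G w f) : Smb (PT M b).G w (fun a => pd 0 (f a)) :=
  ((s_jbi1 (PT M b)).one_mul (h.deriv 0)).congr fun a p _ => by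
    rw [PDom.Dv0]; have := jb_pos (p 0); field_simp

/-- derivative of the profile part -/
theorem t_fq (c : Cx M b T d e φ0 φ1 g χ V w0 ua) : Smb (PT M b).G (fun a _ => a) (fun a p =>
      pd 0 (YW χ V a) p - χ (-3 * a * p 0) * pd 0 (Wf V) (kap a p)) ∧
    Smb (PT M b).G (fun a _ => a) (fun a p =>
      pd 0 (pd 0 (YW χ V a)) p - χ (-3 * a * p 0) * pd 0 (pd 0 (Wf V)) (kap a p)) := by
  have hκ := pe_kap c.hb0 (PT_P M b)
  have hY := s_Y c.hM (PT_P M b) c.hχ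
  have hYq := s_Yq c.hM (PT_P M b) c.hχ
  have hW0 := s_Wk c (PT_P M b)
  have qW1 : Smb (QfG M b) (fun _ p => 1) (fun _ => pd 0 (Wf V)) := c.hW.qdq.mono zero_le_one fun a p _ => by
    simpa using jbi_le (a := a) (p := p)
  have hW1 : Smb (PT M b).G (fun _ _ => 1) (fun a p => pd 0 (Wf V) (kap a p)) := kap_smb _ hκ (w := fun _ => 1) qW1
  have k1 : ∀ a, ∀ p ∈ (PT M b).G.D a, pd 0 (fun p => Wf V (kap a p)) p = pd 0 (Wf V) (kap a p) := fun a p hp =>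
    (kap_chain (by linarith [(PDom.mem hp).1]) (c.hW.diffAt (a := 0) (hκ a p hp))).1
  have k2 : ∀ a, ∀ p ∈ (PT M b).G.D a, pd 0 (fun p => pd 0 (Wf V) (kap a p)) p = pd 0 (pd 0 (Wf V)) (kap a p) := fun a p hp =>
    (kap_chain (by linarith [(PDom.mem hp).1]) (qW1.diffAt (a := 0) (hκ a p hp))).1
  have e1 : ∀ a, ∀ p ∈ (PT M b).G.D a, pd 0 (YW χ V a) p =
      χ (-3 * a * p 0) * pd 0 (Wf V) (kap a p) + pd 0 (fun p => χ (-3 * a * p 0)) p * Wf V (kap a p) := fun a p hp => by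
    rw [← k1 a p hp]; exact pd_mul' (hY.diffAt hp) (hW0.diffAt hp) 0
  have g1 := hYq.mul_one hW0
  refine ⟨g1.congr fun a p hp => by rw [e1 a p hp]; ring, ?_⟩
  refine ((hYq.mul_one hW1).add (t_dq g1)).congr fun a p hp => ?_
  rw [pd_congr (t_ev (f := fun a => pd 0 (YW χ V a)) (f' := fun a p => χ (-3 * a * p 0) * pd 0 (Wf V) (kap a p) + pd 0 (fun p => χ (-3 * a * p 0)) p * Wf V (kap a p)) e1 hp) 0,
    pd_add' (f := fun p => χ (-3 * a * p 0) * pd 0 (Wf V) (kap a p)) (g := fun p => pd 0 (fun p => χ (-3 * a * p 0)) p * Wf V (kap a p)) ((hY.diffAt hp).mul (hW1.diffAt hp)) (g1.diffAt hp),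
    pd_mul' (hY.diffAt hp) (hW1.diffAt hp), k2 a p hp]
  ring

/-- the leading part of the radial derivatives -/
theorem t_U (c : Cx M b T d e φ0 φ1 g χ V w0 ua) : Smb (PT M b).G (fun a p => a * (a * (√(p 1))⁻¹)) (fun a p =>
      pd 0 (fun p => ua a (Psi p)) p - a * (rt p)⁻¹ * (χ (-3 * a * p 0) * pd 0 (Wf V) (kap a p))) ∧
    Smb (PT M b).G (fun a p => a * (a * (√(p 1))⁻¹)) (fun a p =>
      pd 0 (pd 0 (fun p => ua a (Psi p))) p - a * (rt p)⁻¹ * (χ (-3 * a * p 0) * pd 0 (pd 0 (Wf V)) (kap a p))) := by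
  have hf := s_YW c (PT_P M b)
  have hc : Smb (PT M b).G (fun a p => a * (√(p 1))⁻¹) (fun a p => a * (rt p)⁻¹) := (s_a (PT_P M b)).mul (s_sri (PT M b) c.hM)
  have hr1 := s_ri (PT M b) c.hM
  have e0 : ∀ a, ∀ p ∈ (PT M b).G.D a, ua a (Psi p) = a * (rt p)⁻¹ * YW χ V a p := fun a p hp => by
    rw [ua_polar c a (PDom.rpos hp), t_ff c hp]
  have ec : ∀ a, ∀ p ∈ (PT M b).G.D a, pd 0 (fun p => a * (rt p)⁻¹) p = -(1/2) * ((p 1 + p 0)⁻¹ * (a * (rt p)⁻¹)) := fun a p hp => by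
    have hr := PDom.rpos hp
    have di : DifferentiableAt ℝ (fun p => (rt p)⁻¹) p := (s_sri (PT M b) c.hM).diffAt hp
    rw [pd_mul' (f := fun _ => a) (differentiableAt_const a) di, pd_rti hr, show pd 0 (fun _ : R3 => a) p = 0 by simp [pd]]
    have h1 : (p 1 + p 0)⁻¹ = ((rt p)⁻¹)^2 := by rw [inv_pow, rt, Real.sq_sqrt hr.le]
    rw [h1]; simp; ring
  have hz := hr1.mul hc
  have g1 := ((hz.mul_one hf).const_mul (-(1/2)))
  have e1 : ∀ a, ∀ p ∈ (PT M b).G.D a, pd 0 (fun p => ua a (Psi p)) p =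
      a * (rt p)⁻¹ * pd 0 (YW χ V a) p + (-(1/2)) * ((p 1 + p 0)⁻¹ * (a * (rt p)⁻¹) * YW χ V a p) := fun a p hp => by
    rw [pd_congr (t_ev e0 hp) 0, pd_mul' (hc.diffAt hp) (hf.diffAt hp), ec a p hp]
    ring
  have w1 : ∀ {f : ℝ → R3 → ℝ}, Smb (PT M b).G (fun a p => (a * (√(p 1))⁻¹) * a) f → Smb (PT M b).G (fun a p => a * (a * (√(p 1))⁻¹)) f :=
    fun h => h.wcongr fun a p _ => by ring
  refine ⟨((w1 (hc.mul (t_fq c).1)).add (t_ta g1)).congr fun a p hp => by rw [e1 a p hp]; ring, ?_⟩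
  refine (((w1 (hc.mul (t_fq c).2)).add (t_ta (t_dq g1))).add ((t_ta (hz.mul_one (t_dq hf))).const_mul (-(1/2)))).congr fun a p hp => ?_
  rw [pd_congr (t_ev (f := fun a => pd 0 (fun p => ua a (Psi p))) (f' := fun a p => a * (rt p)⁻¹ * pd 0 (YW χ V a) p + (-(1/2)) * ((p 1 + p 0)⁻¹ * (a * (rt p)⁻¹) * YW χ V a p)) e1 hp) 0,
    pd_add' (f := fun p => a * (rt p)⁻¹ * pd 0 (YW χ V a) p) (g := fun p => (-(1/2)) * ((p 1 + p 0)⁻¹ * (a * (rt p)⁻¹) * YW χ V a p)) ((hc.diffAt hp).mul ((t_dq hf).diffAt hp)) (g1.diffAt hp),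
    pd_mul' (hc.diffAt hp) ((t_dq hf).diffAt hp), ec a p hp]
  ring
end
end

noncomputable section
open Function
section
variable {M b T : ℝ} {d : Fin 3 → Fin 3 → ℝ} {e : Fin 3 → Fin 3 → Fin 3 → ℝ} {φ0 φ1 : ℝ × ℝ → ℝ}
    {g : Fin 3 → Fin 3 → ℝ → (Fin 3 → ℝ) → ℝ} {χ : ℝ → ℝ} {V : ℝ → ℝ → ℝ → ℝ} {w0 : R3 → ℝ}
    {ua : ℝ → R3 → ℝ}

theorem om_pd0 (i : Fin 3) (p : R3) : pd 0 (fun p : R3 => omegaHat (p 2) i) p = 0 := by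
  have h : DifferentiableAt ℝ (fun p : R3 => omegaHat (p 2) i) p := (om_smooth i).contDiffAt.differentiableAt (by simp)
  have := pd_line _ p 0 h
  simp only [update, show ¬ (2 : Fin 3) = 0 by decide, dite_false] at this
  exact this.unique (hasDerivAt_const _ _)

/-- Cartesian derivatives to leading order -/
theorem t_u1 (c : Cx M b T d e φ0 φ1 g χ V w0 ua) (k : Fin 3) : Smb (PT M b).G (fun a p => a * (a * (√(p 1))⁻¹)) (fun a p =>
      pd k (ua a) (Psi p) - omegaHat (p 2) k * pd 0 (fun p => ua a (Psi p)) p) := by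
  have h := s_ua c (PT_P M b) (t_f c)
  exact (t_ta (h.TT c.hM k)).congr fun a p hp => by rw [h.cart_eq k hp]

theorem t_u2 (c : Cx M b T d e φ0 φ1 g χ V w0 ua) (i j : Fin 3) : Smb (PT M b).G (fun a p => a * (a * (√(p 1))⁻¹)) (fun a p =>
      pd i (pd j (ua a)) (Psi p) - omegaHat (p 2) i * omegaHat (p 2) j * pd 0 (pd 0 (fun p => ua a (Psi p))) p) := by
  have h := s_ua c (PT_P M b) (t_f c)
  have hj := h.cart1 c.hM j
  have h1 := t_dq (t_u1 c j)
  refine ((t_ta (hj.TT c.hM i)).add ((s_om (PT M b) i).one_mul h1)).congr fun a p hp => ?_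
  have h2 : pd 0 (fun p => pd j (ua a) (Psi p)) p = omegaHat (p 2) j * pd 0 (pd 0 (fun p => ua a (Psi p))) p +
      pd 0 (fun p => pd j (ua a) (Psi p) - omegaHat (p 2) j * pd 0 (fun p => ua a (Psi p)) p) p := by
    rw [pd_sub' (f := fun p => pd j (ua a) (Psi p)) (g := fun p => omegaHat (p 2) j * pd 0 (fun p => ua a (Psi p)) p) (hj.diffAt hp)
      ((((s_om (PT M b) j).diffAt hp)).mul ((t_dq h).diffAt hp)), pd_mul' ((s_om (PT M b) j).diffAt hp) ((t_dq h).diffAt hp), om_pd0]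
    ring
  rw [hj.cart_eq (u := fun a => pd j (ua a)) i hp, h2]
  ring

/-- the quadratic part -/
theorem t_N (c : Cx M b T d e φ0 φ1 g χ V w0 ua) : Smb (PT M b).G (fun a p => a * (a * (√(p 1))⁻¹)^2) (fun a p =>
      (∑ i : Fin 3, ∑ j : Fin 3, (d i j * ua a (Psi p) + ∑ k : Fin 3, e i j k * pd k (ua a) (Psi p)) * pd i (pd j (ua a)) (Psi p))
      - (a * (rt p)⁻¹)^2 * χ (-3 * a * p 0)^2 * pd 1 (pd 0 (Wf V)) (kap a p)) := by
  have h := s_ua c (PT_P M b) (t_f c)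
  have hq := t_dq h
  have hqq := t_dq hq
  have ho := s_om (PT M b)
  have w1 : ∀ {f : ℝ → R3 → ℝ}, Smb (PT M b).G (fun a p => (a * (√(p 1))⁻¹) * (a * (a * (√(p 1))⁻¹))) f → Smb (PT M b).G (fun a p => a * (a * (√(p 1))⁻¹)^2) f :=
    fun h => h.wcongr fun a p _ => by ring
  have hs1 : Smb (PT M b).G (fun a p => a * (a * (√(p 1))⁻¹)^2) (fun a p => ∑ i : Fin 3, ∑ j : Fin 3,
     ((d i j * ua a (Psi p) + ∑ k : Fin 3, e i j k * pd k (ua a) (Psi p)) * (pd i (pd j (ua a)) (Psi p) - omegaHat (p 2) i * omegaHat (p 2) j * pd 0 (pd 0 (fun p => ua a (Psi p))) p)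
      + omegaHat (p 2) i * omegaHat (p 2) j * pd 0 (pd 0 (fun p => ua a (Psi p))) p * ∑ k : Fin 3, e i j k * (pd k (ua a) (Psi p) - omegaHat (p 2) k * pd 0 (fun p => ua a (Psi p)) p))) := by
    refine (Smb.fsum (m := 2) (f := fun i a p => ∑ j : Fin 3, ((d i j * ua a (Psi p) + ∑ k : Fin 3, e i j k * pd k (ua a) (Psi p)) * (pd i (pd j (ua a)) (Psi p) - omegaHat (p 2) i * omegaHat (p 2) j * pd 0 (pd 0 (fun p => ua a (Psi p))) p)
      + omegaHat (p 2) i * omegaHat (p 2) j * pd 0 (pd 0 (fun p => ua a (Psi p))) p * ∑ k : Fin 3, e i j k * (pd k (ua a) (Psi p) - omegaHat (p 2) k * pd 0 (fun p => ua a (Psi p)) p))) fun i => ?_)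
    refine (Smb.fsum (m := 2) (f := fun j a p => ((d i j * ua a (Psi p) + ∑ k : Fin 3, e i j k * pd k (ua a) (Psi p)) * (pd i (pd j (ua a)) (Psi p) - omegaHat (p 2) i * omegaHat (p 2) j * pd 0 (pd 0 (fun p => ua a (Psi p))) p)
      + omegaHat (p 2) i * omegaHat (p 2) j * pd 0 (pd 0 (fun p => ua a (Psi p))) p * ∑ k : Fin 3, e i j k * (pd k (ua a) (Psi p) - omegaHat (p 2) k * pd 0 (fun p => ua a (Psi p)) p))) fun j => ?_)
    have k1 : Smb (PT M b).G (fun a p => a * (√(p 1))⁻¹) (fun a p => ∑ k : Fin 3, e i j k * pd k (ua a) (Psi p)) :=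
      Smb.fsum (m := 2) (f := fun k a p => e i j k * pd k (ua a) (Psi p)) fun k => (h.cart1 c.hM k).const_mul _
    have k2 : Smb (PT M b).G (fun a p => a * (a * (√(p 1))⁻¹)) (fun a p => ∑ k : Fin 3, e i j k * (pd k (ua a) (Psi p) - omegaHat (p 2) k * pd 0 (fun p => ua a (Psi p)) p)) :=
      Smb.fsum (m := 2) (f := fun k a p => e i j k * (pd k (ua a) (Psi p) - omegaHat (p 2) k * pd 0 (fun p => ua a (Psi p)) p)) fun k => (t_u1 c k).const_mul _
    exact (w1 (((h.const_mul (d i j)).add k1).mul (t_u2 c i j))).add (w1 ((((ho i).one_mul (ho j)).one_mul hqq).mul k2))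
  have hD := Df_smb ho d
  have hE := Ef_smb ho e
  have hc : Smb (PT M b).G (fun a p => a * (√(p 1))⁻¹) (fun a p => a * (rt p)⁻¹) := (s_a (PT_P M b)).mul (s_sri (PT M b) c.hM)
  have hY := s_Y c.hM (PT_P M b) c.hχ
  have hc' := hc.mul_one hY
  have hW := s_Wk c (PT_P M b)
  have hW2 : Smb (PT M b).G (fun _ _ => 1) (fun a p => pd 0 (pd 0 (Wf V)) (kap a p)) :=
    kap_smb _ (pe_kap c.hb0 (PT_P M b)) (w := fun _ => 1) (c.hW.qdq.qdq.mono zero_le_one fun a p _ => by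
      have := jbi_le (a := a) (p := p)
      have := inv_pos.2 (jb_pos (p 0))
      nlinarith)
  have hv := (hD.one_mul h).add (hE.one_mul hq)
  have hs2 := w1 (hv.mul (t_U c).2)
  have hs3 := w1 ((hc'.mul_one hW2).mul (hE.one_mul (t_U c).1))
  refine ((hs1.add hs2).add hs3).congr fun a p hp => ?_
  have hk := pe_kap c.hb0 (PT_P M b) a p hp
  rw [Wf_pde c.hV (kap a p) hk.2.1 (hk.2.2.1.trans c.hbT), show Df d (kap a p) = Df d p from rfl, show Ef e (kap a p) = Ef e p from rfl]
  have eU : ua a (Psi p) = a * (rt p)⁻¹ * (χ (-3 * a * p 0) * Wf V (kap a p)) := by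
    rw [ua_polar c a (PDom.rpos hp), t_ff c hp]; rfl
  have es : ∀ U Uq Uqq : ℝ, ∑ i : Fin 3, ∑ j : Fin 3, omegaHat (p 2) i * omegaHat (p 2) j * Uqq * (d i j * U + ∑ k : Fin 3, e i j k * (omegaHat (p 2) k * Uq)) = (Df d p * U + Ef e p * Uq) * Uqq := by
    intro U Uq Uqq
    simp only [Df, Ef, Fin.sum_univ_three]; ring
  have es2 : ∀ (U Uq Uqq : ℝ) (u1 : Fin 3 → ℝ) (u2 : Fin 3 → Fin 3 → ℝ),
      ∑ i : Fin 3, ∑ j : Fin 3, (d i j * U + ∑ k : Fin 3, e i j k * u1 k) * u2 i j =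
      (∑ i : Fin 3, ∑ j : Fin 3, ((d i j * U + ∑ k : Fin 3, e i j k * u1 k) * (u2 i j - omegaHat (p 2) i * omegaHat (p 2) j * Uqq)
      + omegaHat (p 2) i * omegaHat (p 2) j * Uqq * ∑ k : Fin 3, e i j k * (u1 k - omegaHat (p 2) k * Uq))) + (Df d p * U + Ef e p * Uq) * Uqq := by
    intro U Uq Uqq u1 u2
    rw [← es, ← Finset.sum_add_distrib]
    refine Finset.sum_congr rfl fun i _ => ?_
    rw [← Finset.sum_add_distrib]
    refine Finset.sum_congr rfl fun j _ => ?_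
    simp only [Fin.sum_univ_three]; ring
  rw [es2 (ua a (Psi p)) (pd 0 (fun p => ua a (Psi p)) p) (pd 0 (pd 0 (fun p => ua a (Psi p))) p) (fun k => pd k (ua a) (Psi p)) (fun i j => pd i (pd j (ua a)) (Psi p))]
  beta_reduce
  generalize (∑ i : Fin 3, ∑ j : Fin 3, ((d i j * ua a (Psi p) + _) * _ + _) : ℝ) = S
  rw [eU]
  ring

theorem t_J (c : Cx M b T d e φ0 φ1 g χ V w0 ua) :
    Smb (PT M b).G (fun a p => a^3 * (p 1)⁻¹ + a * (((p 1)⁻¹)^2 * (√(p 1))⁻¹)) (fun a p => JJ g (ua a) (Psi p)) := by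
  have hf := t_f c
  have h := s_ua c (PT_P M b) hf
  have hY := s_Y c.hM (PT_P M b) c.hχ
  have hY1 := s_Y1 c.hM (PT_P M b) c.hχ c.hχ1
  have hYq := s_Yq c.hM (PT_P M b) c.hχ
  have hκ := pe_kap c.hb0 (PT_P M b)
  have ha := s_a (PT_P M b)
  have hc : Smb (PT M b).G (fun a p => a * (√(p 1))⁻¹) (fun a p => a * (rt p)⁻¹) := ha.mul (s_sri (PT M b) c.hM)
  have hc1 : Smb (PT M b).G (fun a p => a * (√(p 1))⁻¹) (fun a p => a * (√(1 + p 1))⁻¹) := ha.mul (s_1ti (PT M b))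
  have hWt : Smb (PT M b).G (fun _ _ => 1) (fun a p => pd 1 (Wf V) (kap a p)) := kap_smb _ hκ (w := fun _ => 1) c.hW.q1
  have hWqt : Smb (PT M b).G (fun _ p => (jb (p 0))⁻¹) (fun a p => pd 0 (pd 1 (Wf V)) (kap a p)) :=
    (kap_smb _ hκ (w := fun p => (jb (p 0))⁻¹ * 1) c.hW.q1.qdq).wcongr fun a p _ => by simp [kap]
  have sq : ∀ a, ∀ p ∈ (PT M b).G.D a, (√(p 1))⁻¹ * (√(p 1))⁻¹ = (p 1)⁻¹ := fun a p hp => by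
    rw [← mul_inv, Real.mul_self_sqrt (by linarith [(PDom.mem hp).1])]
  -- weights
  have W1 : ∀ {f : ℝ → R3 → ℝ}, Smb (PT M b).G (fun a p => a^3 * ((√(p 1))⁻¹ * (√(p 1))⁻¹)) f → Smb (PT M b).G (fun a p => a^3 * (p 1)⁻¹ + a * (((p 1)⁻¹)^2 * (√(p 1))⁻¹)) f :=
    fun h => h.mono zero_le_one fun a p hp => by
      have h1 := pc_ti hp.1
      have : 0 ≤ a * (((p 1)⁻¹)^2 * (√(p 1))⁻¹) := by
        have := h1.1; have := h1.2.2.1; have := h1.2.2.2.2.1; positivity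
      rw [sq a p hp]; linarith
  -- cubic part
  have r1 := J_quad (u := fun a p => ua a (Psi p)) (u1 := fun k a p => pd k (ua a) (Psi p)) (u2 := fun i j a p => pd i (pd j (ua a)) (Psi p)) c.hg c.hgexp ⟨1, zero_le_one, fun a p hp => by
      have h1 := pc_ti hp.1
      have h2 : √a ≤ 1 := Real.sqrt_le_one.2 h1.2.1.le
      refine ⟨(mul_pos h1.1 h1.2.2.2.2.1).le, ?_⟩
      nlinarith [h1.1, h1.2.2.2.2.2, h1.2.2.2.2.1]⟩ h (fun k => h.cart1 c.hM k) (fun i j => (h.cart1 c.hM j).cart1 c.hM i)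
  have r1' : Smb (PT M b).G (fun a p => a^3 * (p 1)⁻¹ + a * (((p 1)⁻¹)^2 * (√(p 1))⁻¹)) _ := W1 (r1.mono zero_le_one fun a p hp => by
    have h1 := pc_ti hp.1
    have h2 : (√(p 1))⁻¹ ≤ 1 := h1.2.2.2.2.2.trans (Real.sqrt_le_one.2 h1.2.1.le)
    have h3 : 0 ≤ a^3 * ((√(p 1))⁻¹ * (√(p 1))⁻¹) := by have := h1.1; positivity
    calc _ = a^3 * ((√(p 1))⁻¹ * (√(p 1))⁻¹) * (√(p 1))⁻¹ := by ring
      _ ≤ a^3 * ((√(p 1))⁻¹ * (√(p 1))⁻¹) * 1 := by gcongr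
      _ = _ := by ring)
  have r2 := W1 ((t_N c).wcongr fun a p _ => by ring)
  -- remainder of the box
  have r3 : Smb (PT M b).G (fun a p => a^3 * (p 1)⁻¹ + a * (((p 1)⁻¹)^2 * (√(p 1))⁻¹)) _ :=
    (hc.mul (hf.Lrem c.hM)).mono zero_le_one fun a p hp => by
      have h1 := pc_ti hp.1
      have : 0 ≤ a^3 * (p 1)⁻¹ := by have := h1.1; have := h1.2.2.1; positivity
      linarith
  have r4 := W1 (((hc.mul hc1).mul (hYq.mul_one hWt)).wcongr fun a p _ => by ring)
  -- the resonant bracket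
  have r5 := W1 (((hc.mul hc).mul ((hY.one_mul hY1).mul hWqt)).wcongr fun a p _ => by
    have := jb_pos (p 0); field_simp)
  have hs : Smb (PT M b).G (fun _ p => (√(p 1))⁻¹) (fun _ p => (√(1 + p 1) + rt p)⁻¹) :=
    ((s_1t (PT M b)).add (s_sr (PT M b) c.hM)).inv one_pos fun a p hp => by
      have := (PDom.mem hp).1
      refine ⟨by positivity, ?_⟩
      rw [one_mul]
      have h1 : √(p 1) ≤ √(1 + p 1) := Real.sqrt_le_sqrt (by linarith)
      have := rt_pos (PDom.rpos hp)
      change √(p 1) ≤ √(1 + p 1) + rt p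
      linarith
  have h1q : Smb (PT M b).G (fun _ p => jb (p 0)) (fun _ p => 1 - p 0) :=
    ((Smb.one 1).mono zero_le_one fun a p _ => by rw [one_mul]; exact one_le_jb _).sub (s_q (PT M b))
  have r6 : Smb (PT M b).G (fun a p => a^3 * (p 1)⁻¹ + a * (((p 1)⁻¹)^2 * (√(p 1))⁻¹)) _ :=
    W1 ((((hc.mul hc).mul ((s_1ti (PT M b)).mul hs)).mul (hY.one_mul (h1q.mul hWqt))).mono zero_le_one fun a p hp => by
      have h1 := pc_ti hp.1
      have := h1.1
      have := jb_pos (p 0)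
      calc _ = a^2 * ((√(p 1))⁻¹ * (√(p 1))⁻¹) * ((√(p 1))⁻¹ * (√(p 1))⁻¹) := by field_simp
        _ ≤ a^2 * ((√(p 1))⁻¹ * (√(p 1))⁻¹) * a := by
          have := h1.2.2.2.1
          rw [← sq a p hp] at this
          gcongr
        _ = _ := by ring)
  refine (((r1'.add r2).add (r3.sub r4)).add (r6.sub r5)).congr fun a p hp => ?_
  rw [JJ_split2 g d e, box_ua c (PT_P M b) hf hp]
  have hr := PDom.rpos hp
  have h0 := (PDom.mem hp).1
  have hWa := c.hW.at (a := 0) (hκ a p hp)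
  have e1 : pd 1 (pd 0 (ff χ V w0 a)) p = a * (√(1 + p 1))⁻¹ * (1/2) * (pd 0 (fun p => χ (-3 * a * p 0)) p * pd 1 (Wf V) (kap a p) + χ (-3 * a * p 0) * pd 0 (pd 1 (Wf V)) (kap a p)) := by
    have hA : DifferentiableAt ℝ (fun p : R3 => a * (√(1 + p 1))⁻¹ * (1/2)) p := (hc1.diffAt hp).mul_const _
    have dY := hY.diffAt hp
    have dW := hWt.diffAt hp
    have e2 : pd 0 (fun p : R3 => a * (√(1 + p 1))⁻¹ * (1/2)) p = 0 := by
      have := pd_line _ p 0 hA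
      simp only [update, show ¬ (1 : Fin 3) = 0 by decide, dite_false] at this
      exact this.unique (hasDerivAt_const _ _)
    rw [pd_comm_at (hf.at hp) 1 0, pd_congr (t_ev (f := fun a => pd 1 (ff χ V w0 a)) (f' := fun a p => (a * (√(1 + p 1))⁻¹ * (1/2)) * (χ (-3 * a * p 0) * pd 1 (Wf V) (kap a p))) (fun a p hp => by
      rw [pd_congr (t_ev (fun a p hp => t_ff c hp) hp) 1, YW_t c (PT_P M b) hp]) hp) 0,
      pd_mul' (f := fun p : R3 => a * (√(1 + p 1))⁻¹ * (1/2)) (g := fun p => χ (-3 * a * p 0) * pd 1 (Wf V) (kap a p)) hA (dY.mul dW), e2, pd_mul' dY dW,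
      (kap_chain (by linarith) (c.hW.q1.diffAt (a := 0) (hκ a p hp))).1]
    ring
  have e3 := pd_comm_at hWa 1 0
  rw [e1, e3]
  have e4 : (rt p)⁻¹ * (rt p)⁻¹ - (rt p)⁻¹ * (√(1 + p 1))⁻¹ = (rt p)⁻¹ * (rt p)⁻¹ * ((√(1 + p 1))⁻¹ * (√(1 + p 1) + rt p)⁻¹) * (1 - p 0) := by
    have h1 := rt_pos hr
    have h2 : 0 < √(1 + p 1) := by positivity
    have h3 : rt p * rt p = p 1 + p 0 := Real.mul_self_sqrt hr.le
    have h4 : √(1 + p 1) * √(1 + p 1) = 1 + p 1 := Real.mul_self_sqrt (by linarith)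
    have h5 : 1 - p 0 = (√(1 + p 1) - rt p) * (√(1 + p 1) + rt p) := by linarith
    rw [h5]; field_simp
  generalize (∑ i : Fin 3, ∑ j : Fin 3, (d i j * ua a (Psi p) + _) * _ : ℝ) = S
  generalize (∑ i : Fin 3, ∑ j : Fin 3, (g i j _ _ - _) * _ : ℝ) = S'
  linear_combination (a^2 * χ (-3 * a * p 0) * pd 0 (pd 1 (Wf V)) (kap a p)) * e4
end
end

noncomputable section
open Function

/-! Cartesian regions: symbols for the Klainerman fields -/
def kv : Fin 7 → R3 → R3 :=
  ![fun _ => ![1,0,0], fun _ => ![0,1,0], fun _ => ![0,0,1], fun y => ![y 0, y 1, y 2], fun y => ![y 1, y 0, 0],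
    fun y => ![y 2, 0, y 0], fun y => ![0, - y 2, y 1]]

theorem kv_smooth (k : Fin 7) : ContDiff ℝ ∞ (kv k) := by
  rw [contDiff_pi]
  have c := contDiff_coord
  intro i
  fin_cases k <;> fin_cases i <;> simp only [kv, Matrix.cons_val] <;> first | exact contDiff_const | exact c _ | exact (c 2).neg

theorem Dv_kv (k : Fin 7) (f : R3 → ℝ) : Dv (kv k) f = KOp k f := by
  funext y
  have h : ∀ v : R3, fderiv ℝ f y v = v 0 * pd 0 f y + v 1 * pd 1 f y + v 2 * pd 2 f y := by
    intro v
    have : v = v 0 • Pi.single 0 1 + v 1 • Pi.single 1 1 + v 2 • Pi.single 2 1 := by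
      funext i; fin_cases i <;> simp
    conv_lhs => rw [this]
    simp only [map_add, map_smul, smul_eq_mul, pd]
  rw [Dv, h]
  fin_cases k <;> simp [kv, KOp] <;> ring

structure CDom where
  D : ℝ → Set R3
  hD : ∀ a, IsOpen (D a)
def CDom.G (P : CDom) : Geo (Fin 7) := ⟨kv, P.D, kv_smooth, P.hD⟩

variable {P : CDom}

theorem Smb.ck {w f : ℝ → R3 → ℝ} (h : Smb P.G w f) (k : Fin 7) : Smb P.G w (fun a => _root_.KOp k (f a)) :=
  (h.deriv k).congr fun a p _ => (congrFun (Dv_kv k (f a)) p).symm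

theorem Smb.cz {w f : ℝ → R3 → ℝ} (h : Smb P.G w f) (α : List (Fin 7)) : Smb P.G w (fun a => _root_.Zpow α (f a)) := by
  induction α with
  | nil => exact h
  | cons k α ih => exact ih.ck k

theorem Smb.cpd {w f : ℝ → R3 → ℝ} (h : Smb P.G w f) (k : Fin 3) : Smb P.G w (fun a => pd k (f a)) := by
  fin_cases k
  exacts [h.ck 0, h.ck 1, h.ck 2]

/-- pointwise decay rate of free waves -/
def dw (y : R3) : ℝ := (√(1 + y 0))⁻¹ * (√(jb (√(y 1^2 + y 2^2) - y 0)))⁻¹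

theorem w_smb {M : ℝ} (hM : 0 < M) (hP : ∀ a, ∀ y ∈ P.D a, 0 < y 0) {w : R3 → ℝ} (h : IsW M w) :
    Smb P.G (fun _ => dw) (fun _ => w) := by
  have base : ∀ w, IsW M w → SymN P.G 0 (fun _ => dw) (fun _ => w) := fun w h => by
    refine ⟨fun a => h.smooth.contDiffOn, ?_⟩
    obtain ⟨C, h0, hC⟩ := decay_bound hM h
    refine ⟨C, h0, fun a y hy => ?_⟩
    have := hC (y 0) (y 1) (y 2) (hP a y hy).le
    have e : ![y 0, y 1, y 2] = y := by funext i; fin_cases i <;> rfl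
    rwa [e] at this
  intro n
  induction n generalizing w with
  | zero => exact base w h
  | succ n ih => exact SymN.mk_succ (base w h) fun k => (ih (h.KOp hM k)).congr fun a p _ => congrFun (Dv_kv k w) p

theorem polar4 (x1 x2 : ℝ) : ∃ α, |α| < 4 ∧ x1 = √(x1^2+x2^2) * cos α ∧ x2 = √(x1^2+x2^2) * sin α := by
  have h1 := Complex.norm_mul_cos_arg ⟨x1, x2⟩
  have h2 := Complex.norm_mul_sin_arg ⟨x1, x2⟩
  rw [Complex.norm_def, Complex.normSq_mk] at h1 h2
  have e : x1 * x1 + x2 * x2 = x1^2 + x2^2 := by ring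
  rw [e] at h1 h2
  exact ⟨Complex.arg ⟨x1, x2⟩, (Complex.abs_arg_le_pi _).trans_lt (by linarith [pi_lt_four]), h1.symm, h2.symm⟩

theorem ua_cart {M b T : ℝ} {d : Fin 3 → Fin 3 → ℝ} {e : Fin 3 → Fin 3 → Fin 3 → ℝ} {φ0 φ1 : ℝ × ℝ → ℝ}
    {g : Fin 3 → Fin 3 → ℝ → (Fin 3 → ℝ) → ℝ} {χ : ℝ → ℝ} {V : ℝ → ℝ → ℝ → ℝ} {w0 : R3 → ℝ}
    {ua : ℝ → R3 → ℝ} (c : Cx M b T d e φ0 φ1 g χ V w0 ua) (a : ℝ) {y : R3} (hy : 0 < y 1^2 + y 2^2)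
    (h : a * y 0 ≤ 1 ∨ 2 ≤ -3 * a * (√(y 1^2 + y 2^2) - y 0)) : ua a y = a * χ (a * y 0) * w0 y := by
  obtain ⟨θ, -, h1, h2⟩ := polar4 (y 1) (y 2)
  have h3 := c.hua a (y 0) (√(y 1^2+y 2^2)) θ (Real.sqrt_pos.2 hy)
  rw [← h1, ← h2] at h3
  have e : ![y 0, y 1, y 2] = y := by funext i; fin_cases i <;> rfl
  rw [e] at h3
  rw [h3]
  rcases h with h | h
  · rw [c.hχ1 _ h]; ring
  · rw [c.hχ0 _ h]; ring

def PA : CDom := ⟨fun a => {y | (0 < a ∧ a < 1) ∧ 0 < y 0 ∧ a * y 0 < 1 ∧ 0 < y 1^2 + y 2^2}, fun a => by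
  have c : ∀ i : Fin 3, Continuous (fun p : R3 => p i) := fun i => (contDiff_coord i).continuous
  exact isOpen_const.inter ((isOpen_lt continuous_const (c 0)).inter ((isOpen_lt (continuous_const.mul (c 0)) continuous_const).inter
    (isOpen_lt continuous_const (((c 1).pow 2).add ((c 2).pow 2)))))⟩

def PB : CDom := ⟨fun a => {y | (0 < a ∧ a < 1) ∧ 1 < a * y 0 ∧ a * y 0 < 2 ∧ 0 < y 1^2 + y 2^2 ∧ 2 < -3 * a * (√(y 1^2 + y 2^2) - y 0)}, fun a => by
  have c : ∀ i : Fin 3, Continuous (fun p : R3 => p i) := fun i => (contDiff_coord i).continuous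
  have c2 := ((c 1).pow 2).add ((c 2).pow 2)
  exact isOpen_const.inter ((isOpen_lt continuous_const (continuous_const.mul (c 0))).inter ((isOpen_lt (continuous_const.mul (c 0)) continuous_const).inter
    ((isOpen_lt continuous_const c2).inter (isOpen_lt continuous_const (continuous_const.mul ((continuous_sqrt.comp c2).sub (c 0)))))))⟩

theorem cd_ev {f f' : ℝ → R3 → ℝ} (h : ∀ a, ∀ p ∈ P.G.D a, f a p = f' a p) {a : ℝ} {p : R3} (hp : p ∈ P.G.D a) :
    f a =ᶠ[𝓝 p] f' a := by
  filter_upwards [(P.hD a).mem_nhds hp] with q hq using h a q hq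

theorem dw_le (y : R3) : 0 < y 0 → 0 < dw y ∧ dw y ≤ 1 := fun h => by
  have h1 : (√(1 + y 0))⁻¹ ≤ 1 := inv_le_one_of_one_le₀ (Real.one_le_sqrt.2 (by linarith))
  have h2 : (√(jb (√(y 1^2 + y 2^2) - y 0)))⁻¹ ≤ 1 := inv_le_one_of_one_le₀ (Real.one_le_sqrt.2 (one_le_jb _))
  have h3 := jb_pos (√(y 1^2 + y 2^2) - y 0)
  refine ⟨by unfold dw; positivity, mul_le_one₀ h1 (by positivity) h2⟩

section
variable {M b T : ℝ} {d : Fin 3 → Fin 3 → ℝ} {e : Fin 3 → Fin 3 → Fin 3 → ℝ} {φ0 φ1 : ℝ × ℝ → ℝ}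
    {g : Fin 3 → Fin 3 → ℝ → (Fin 3 → ℝ) → ℝ} {χ : ℝ → ℝ} {V : ℝ → ℝ → ℝ → ℝ} {w0 : R3 → ℝ}
    {ua : ℝ → R3 → ℝ}

theorem cd_a (hP : ∀ a, ∀ y ∈ P.D a, 0 < a) : Smb P.G (fun a _ => a) (fun a _ => a) :=
  (Smb.const (fun a => a)).wcongr fun a p hp => abs_of_pos (hP a p hp)

/-- the error near the initial time -/
theorem a_J (c : Cx M b T d e φ0 φ1 g χ V w0 ua) :
    Smb PA.G (fun a y => (a * dw y) * (a * dw y)) (fun a => JJ g (ua a)) := by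
  have hw := w_smb (P := PA) c.hM (fun a y hy => hy.2.1) c.hw
  have e0 : ∀ a, ∀ y ∈ PA.G.D a, ua a y = a * w0 y := fun a y hy => by
    rw [ua_cart c a hy.2.2.2 (Or.inl hy.2.2.1.le), c.hχ1 _ hy.2.2.1.le]; ring
  have hu : Smb PA.G (fun a y => a * dw y) ua := ((cd_a (P := PA) fun a y hy => hy.1.1).mul hw).congr e0
  have hJ := J_lin (u := ua) (u1 := fun k a => pd k (ua a)) (u2 := fun i j a => pd i (pd j (ua a))) c.hg c.hgexp
    ⟨1, zero_le_one, fun a y hy => by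
      have h1 := dw_le y hy.2.1
      have h2 : 0 < a := hy.1.1
      have h3 : a < 1 := hy.1.2
      exact ⟨mul_nonneg h2.le h1.1.le, by nlinarith⟩⟩ hu (fun k => hu.cpd k) (fun i j => (hu.cpd j).cpd i)
  refine hJ.congr fun a y hy => ?_
  rw [JJ_split]
  have hk : ∀ k, pd k (pd k (ua a)) y = a * pd k (pd k w0) y := fun k => by
    have e1 : ∀ a, ∀ y ∈ PA.G.D a, pd k (ua a) y = a * pd k w0 y := fun a y hy => by
      rw [pd_congr (cd_ev e0 hy) k, pd_mul' (f := fun _ => a) (differentiableAt_const a) (hw.diffAt hy)]; simp [pd]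
    rw [pd_congr (cd_ev (f := fun a => pd k (ua a)) (f' := fun a y => a * pd k w0 y) e1 hy) k, pd_mul' (f := fun _ => a) (differentiableAt_const a) ((hw.cpd k).diffAt hy)]; simp [pd]
  rw [hk, hk, hk, ← mul_sub, ← mul_sub, c.hw.wave, mul_zero, zero_add]

theorem b_y (i : Fin 3) : Smb PB.G (fun _ _ => 1) (fun a y => a * y i) := by
  have ha : Smb PB.G (fun _ _ => 1) (fun a _ => a) := (cd_a (P := PB) fun a y hy => hy.1.1).mono zero_le_one fun a p hp => by
    rw [one_mul]; exact hp.1.2.le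
  have base : ∀ i, SymN PB.G 0 (fun _ _ => 1) (fun a y => a * y i) := fun i => by
    refine ⟨fun a => (contDiff_const.mul (contDiff_coord i)).contDiffOn, 2, zero_le_two, fun a y hy => ?_⟩
    obtain ⟨⟨h0, h1⟩, h2, h3, h4, h5⟩ := hy
    set r := √(y 1^2 + y 2^2) with hr
    have e1 : |y 1| ≤ r := Real.abs_le_sqrt (by nlinarith [sq_nonneg (y 2)])
    have e2 : |y 2| ≤ r := Real.abs_le_sqrt (by nlinarith [sq_nonneg (y 1)])
    have e3 : a * r ≤ 2 := by nlinarith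
    rw [abs_mul, abs_of_pos h0]
    fin_cases i
    · simp only [Fin.zero_eta, Fin.isValue]
      rw [← abs_of_pos h0, ← abs_mul, abs_of_pos (by linarith : 0 < a * y 0)]; linarith
    · simp only [Fin.mk_one, Fin.isValue]; nlinarith
    · simp only [Fin.reduceFinMk, Fin.isValue]; nlinarith
  intro n
  induction n generalizing i with
  | zero => exact base i
  | succ n ih =>
    refine SymN.mk_succ (base i) fun k => ?_
    have hD : ∀ a y, Dv (PB.G.v k) (fun y => a * y i) y = a * kv k y i := fun a y => by
      have : HasFDerivAt (fun y : R3 => a * y i) (a • ContinuousLinearMap.proj (R := ℝ) (φ := fun _ : Fin 3 => ℝ) i) y :=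
        ((ContinuousLinearMap.proj (R := ℝ) (φ := fun _ : Fin 3 => ℝ) i).hasFDerivAt).const_mul a
      rw [Dv, this.fderiv]; rfl
    have hz : SymN PB.G n (fun _ _ => 1) (fun _ _ => 0) := SymN.one 0
    refine SymN.congr (f := fun a y => a * kv k y i) ?_ fun a p _ => hD a p
    fin_cases k <;> fin_cases i <;> simp only [kv, Matrix.cons_val, Matrix.cons_val_zero, Matrix.cons_val_one, Fin.isValue, Fin.zero_eta, Fin.mk_one, Fin.reduceFinMk, mul_zero, mul_one] <;>
      first | exact hz | exact ha n | exact ih _ | (simp only [mul_neg]; exact (ih 2).neg)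

/-- the error deep inside the light cone -/
theorem b_J (c : Cx M b T d e φ0 φ1 g χ V w0 ua) :
    Smb PB.G (fun a y => a^2 * a^2) (fun a => JJ g (ua a)) := by
  have ht : ∀ a, ∀ y ∈ PB.D a, 0 < y 0 := fun a y hy => by
    obtain ⟨⟨h0, h1⟩, h2, h3, h4, h5⟩ := hy
    by_contra h; nlinarith
  have hW : ∀ w, IsW M w → Smb PB.G (fun a y => a) (fun _ => w) := fun w hw =>
    (w_smb (P := PB) c.hM ht hw).mono (K := √(3/2)) (by positivity) fun a y hy => by
      have h6 := ht a y hy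
      obtain ⟨⟨h0, h1⟩, h2, h3, h4, h5⟩ := hy
      set q := √(y 1^2 + y 2^2) - y 0 with hq
      have h7 : 2 / (3 * a) ≤ jb q := by
        have := (neg_le_abs q).trans (abs_le_jb q)
        rw [div_le_iff₀ (by positivity)]; nlinarith
      have h8 : a⁻¹ ≤ 1 + y 0 := by rw [inv_le_iff_one_le_mul₀ h0]; nlinarith
      have h9 := jb_pos q
      rw [dw, ← mul_inv, ← Real.sqrt_mul (by positivity), ← Real.sqrt_inv]
      have : a = √(a^2) := (Real.sqrt_sq h0.le).symm
      conv_rhs => rw [this, ← Real.sqrt_mul (by norm_num)]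
      refine Real.sqrt_le_sqrt ?_
      rw [inv_le_iff_one_le_mul₀ (by positivity)]
      calc (1 : ℝ) = 3/2 * a^2 * (a⁻¹ * (2 / (3 * a))) := by field_simp
        _ ≤ _ := by gcongr
  have hw := hW _ c.hw
  have ha := cd_a (P := PB) fun a y hy => hy.1.1
  have hX : ∀ {h : ℝ → ℝ}, ContDiff ℝ ∞ h → Smb PB.G (fun _ _ => 1) (fun a y => h (a * y 0)) := fun h => (b_y 0).comp_one h
  have hχd : ∀ {h : ℝ → ℝ}, ContDiff ℝ ∞ h → ContDiff ℝ ∞ (deriv h) := fun h => by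
    rw [show (∞ : WithTop ℕ∞) = ∞ + 1 from rfl] at h
    exact (contDiff_succ_iff_deriv.1 h).2.2
  have e0 : ∀ a, ∀ y ∈ PB.G.D a, ua a y = a * (χ (a * y 0) * w0 y) := fun a y hy => by
    rw [ua_cart c a hy.2.2.2.1 (Or.inr hy.2.2.2.2.le)]; ring
  have hu : Smb PB.G (fun a y => a^2) ua := ((ha.mul ((hX c.hχ).one_mul hw)).wcongr fun a p _ => by ring).congr e0
  have hJ := J_lin (u := ua) (u1 := fun k a => pd k (ua a)) (u2 := fun i j a => pd i (pd j (ua a))) c.hg c.hgexp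
    ⟨1, zero_le_one, fun a y hy => by
      have h2 : 0 < a := hy.1.1
      have h3 : a < 1 := hy.1.2
      exact ⟨by positivity, by nlinarith⟩⟩ hu (fun k => hu.cpd k) (fun i j => (hu.cpd j).cpd i)
  -- improved decay of the time derivative
  have hm : Smb PB.G (fun _ _ => 1) (fun a y => (a * y 0 * (a * y 0) - (a * y 1 * (a * y 1) + a * y 2 * (a * y 2)))⁻¹) :=
    (((b_y 0).one_mul (b_y 0)).sub (((b_y 1).one_mul (b_y 1)).add ((b_y 2).one_mul (b_y 2)))).inv (c := 2/3) (by norm_num) (fun a y hy => by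
      obtain ⟨⟨h0, h1⟩, h2, h3, h4, h5⟩ := hy
      refine ⟨one_pos, ?_⟩
      have e1 : √(y 1^2 + y 2^2) ^ 2 = y 1^2 + y 2^2 := Real.sq_sqrt h4.le
      have e2 := Real.sqrt_nonneg (y 1^2 + y 2^2)
      set r := √(y 1^2 + y 2^2)
      have e3 : a * y 0 * (a * y 0) - (a * y 1 * (a * y 1) + a * y 2 * (a * y 2)) = (a * y 0 - a * r) * (a * y 0 + a * r) := by
        linear_combination (a^2) * e1
      rw [e3]
      have e4 : 0 ≤ a * r := by positivity
      nlinarith) |>.wcongr fun a p _ => by norm_num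
  have hwt : Smb PB.G (fun a y => a * a) (fun _ => pd 0 w0) := by
    refine (hm.one_mul (ha.mul ((((b_y 0).one_mul (hW _ (c.hw.KOp c.hM 3))).sub ((b_y 1).one_mul (hW _ (c.hw.KOp c.hM 4)))).sub ((b_y 2).one_mul (hW _ (c.hw.KOp c.hM 5)))))).congr fun a y hy => ?_
    obtain ⟨⟨h0, h1⟩, h2, h3, h4, h5⟩ := hy
    have e1 : √(y 1^2 + y 2^2) ^ 2 = y 1^2 + y 2^2 := Real.sq_sqrt h4.le
    have e2 := Real.sqrt_nonneg (y 1^2 + y 2^2)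
    set r := √(y 1^2 + y 2^2)
    have e3 : a * y 0 * (a * y 0) - (a * y 1 * (a * y 1) + a * y 2 * (a * y 2)) = (a * y 0 - a * r) * (a * y 0 + a * r) := by
      linear_combination (a^2) * e1
    have e4 : 0 ≤ a * r := by positivity
    have e5 : 0 < a * y 0 * (a * y 0) - (a * y 1 * (a * y 1) + a * y 2 * (a * y 2)) := by
      rw [e3]; exact mul_pos (by linarith) (by linarith)
    rw [eq_inv_mul_iff_mul_eq₀ e5.ne']
    simp [KOp]; ring
  have r1 := (ha.mul ((hX (hχd c.hχ)).one_mul (ha.mul hwt))).const_mul 2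
  have r2 := ha.mul ((hX (hχd (hχd c.hχ))).one_mul ((ha.mul ha).mul hw))
  refine ((hJ.add (r1.wcongr fun a p _ => by ring)).add (r2.wcongr fun a p _ => by ring)).congr fun a y hy => ?_
  rw [JJ_split]
  have dX : ∀ {h : ℝ → ℝ}, ContDiff ℝ ∞ h → ∀ s, HasDerivAt (fun s => h (a * s)) (deriv h (a * s) * a) s := fun {h} hh s => by
    have h1 : HasDerivAt h (deriv h (a * s)) (a * s) := (hh.differentiable (by simp) _).hasDerivAt
    have := h1.comp s ((hasDerivAt_id' s).const_mul a)
    rwa [mul_one] at this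
  have pX : ∀ {h : ℝ → ℝ}, ContDiff ℝ ∞ h → ∀ (i : Fin 3) (p : R3), pd i (fun p : R3 => h (a * p 0)) p = if i = 0 then deriv h (a * p 0) * a else 0 := fun hh i p => by
    rw [pd_one _ 0 i p (dX hh (p 0))]; fin_cases i <;> simp
  have dh : ∀ {h : ℝ → ℝ}, ContDiff ℝ ∞ h → ∀ p : R3, DifferentiableAt ℝ (fun p : R3 => h (a * p 0)) p := fun {h} hh p =>
    DifferentiableAt.comp (g := fun s => h (a * s)) p (dX hh (p 0)).differentiableAt (diff_coord 0 p)
  have dw0 : ∀ p, DifferentiableAt ℝ w0 p := fun p => c.hw.smooth.differentiable (by simp) p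
  have dwk : ∀ k p, DifferentiableAt ℝ (pd k w0) p := fun k p => (contDiff_pd3 c.hw.smooth k).differentiable (by simp) p
  have cm : ∀ (f : R3 → ℝ) (k : Fin 3) (p : R3), DifferentiableAt ℝ f p → pd k (fun p => a * f p) p = a * pd k f p := fun f k p hf => by
    rw [pd_mul' (f := fun _ => a) (differentiableAt_const a) hf]; simp [pd]
  have ev : ∀ k, pd k (ua a) =ᶠ[𝓝 y] fun p => a * (χ (a * p 0) * pd k w0 p + (if k = 0 then deriv χ (a * p 0) * a else 0) * w0 p) := fun k => by
    refine (pd_congr_ev (cd_ev e0 hy) k).trans (Eventually.of_forall fun p => ?_)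
    rw [cm (fun p => χ (a * p 0) * w0 p) k p ((dh c.hχ p).mul (dw0 p)), pd_mul' (dh c.hχ p) (dw0 p), pX c.hχ]
  have f1 : pd 1 (pd 1 (ua a)) y = a * (χ (a * y 0) * pd 1 (pd 1 w0) y) := by
    rw [pd_congr (ev 1) 1]
    simp only [one_ne_zero, if_false, zero_mul, add_zero]
    rw [cm (fun p => χ (a * p 0) * pd 1 w0 p) 1 y ((dh c.hχ y).mul (dwk 1 y)), pd_mul' (dh c.hχ y) (dwk 1 y), pX c.hχ]; simp
  have f2 : pd 2 (pd 2 (ua a)) y = a * (χ (a * y 0) * pd 2 (pd 2 w0) y) := by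
    rw [pd_congr (ev 2) 2]
    simp only [show ¬ (2 : Fin 3) = 0 by decide, if_false, zero_mul, add_zero]
    rw [cm (fun p => χ (a * p 0) * pd 2 w0 p) 2 y ((dh c.hχ y).mul (dwk 2 y)), pd_mul' (dh c.hχ y) (dwk 2 y), pX c.hχ]; simp
  have f0 : pd 0 (pd 0 (ua a)) y = a * (χ (a * y 0) * pd 0 (pd 0 w0) y + 2 * (deriv χ (a * y 0) * a * pd 0 w0 y) + deriv (deriv χ) (a * y 0) * a * a * w0 y) := by
    have g1 := dh c.hχ y
    have g2 : DifferentiableAt ℝ (fun p : R3 => deriv χ (a * p 0) * a) y := (dh (hχd c.hχ) y).mul_const a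
    have g3 : pd 0 (fun p : R3 => deriv χ (a * p 0) * a) y = deriv (deriv χ) (a * y 0) * a * a := by
      rw [pd_mul' (g := fun _ => a) (dh (hχd c.hχ) y) (differentiableAt_const a), pX (hχd c.hχ), show pd 0 (fun _ : R3 => a) y = 0 by simp [pd], if_pos rfl]; ring
    rw [pd_congr (ev 0) 0]
    simp only [if_true]
    rw [cm (fun p => χ (a * p 0) * pd 0 w0 p + deriv χ (a * p 0) * a * w0 p) 0 y ((g1.mul (dwk 0 y)).add (g2.mul (dw0 y))),
      pd_add' (f := fun p => χ (a * p 0) * pd 0 w0 p) (g := fun p => deriv χ (a * p 0) * a * w0 p) (g1.mul (dwk 0 y)) (g2.mul (dw0 y)),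
      pd_mul' g1 (dwk 0 y), pd_mul' g2 (dw0 y), pX c.hχ, g3, if_pos rfl]
    ring
  rw [f0, f1, f2]
  linear_combination (a * χ (a * y 0)) * c.hw.wave y
end
end

noncomputable section
open Function

theorem zero_germ {g : Fin 3 → Fin 3 → ℝ → (Fin 3 → ℝ) → ℝ} {u : R3 → ℝ} {y : R3} (h : u =ᶠ[𝓝 y] fun _ => 0)
    (α : List (Fin 7)) : Zpow α (JJ g u) y = 0 := by
  have h0 : ∀ {f : R3 → ℝ}, f =ᶠ[𝓝 y] (fun _ => 0) → ∀ᶠ z in 𝓝 y, fderiv ℝ f z = 0 := fun {f} hf => by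
    filter_upwards [eventually_eventually_nhds.2 hf] with z hz
    rw [EventuallyEq.fderiv_eq hz]; simp
  have h1 : ∀ {f : R3 → ℝ}, f =ᶠ[𝓝 y] (fun _ => 0) → ∀ k, pd k f =ᶠ[𝓝 y] fun _ => 0 := fun {f} hf k => by
    filter_upwards [h0 hf] with z hz; simp [pd, hz]
  have h2 : JJ g u =ᶠ[𝓝 y] fun _ => 0 := by
    have : ∀ᶠ z in 𝓝 y, ∀ i j, pd i (pd j u) z = 0 := eventually_all.2 fun i => eventually_all.2 fun j => h1 (h1 h j) i
    filter_upwards [this] with z hz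
    simp [JJ, hz]
  have h3 : Zpow α (JJ g u) =ᶠ[𝓝 y] fun _ => 0 := by
    induction α with
    | nil => exact h2
    | cons i l ih => filter_upwards [h0 ih] with z hz using KOp_of_fderiv_zero hz i
  exact h3.self_of_nhds

section
variable {M b T : ℝ} {d : Fin 3 → Fin 3 → ℝ} {e : Fin 3 → Fin 3 → Fin 3 → ℝ} {φ0 φ1 : ℝ × ℝ → ℝ}
    {g : Fin 3 → Fin 3 → ℝ → (Fin 3 → ℝ) → ℝ} {χ : ℝ → ℝ} {V : ℝ → ℝ → ℝ → ℝ} {w0 : R3 → ℝ}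
    {ua : ℝ → R3 → ℝ}

theorem z_out (c : Cx M b T d e φ0 φ1 g χ V w0 ua) (a : ℝ) {y : R3} (h0 : 0 < y 0) (h : M + y 0 < √(y 1^2 + y 2^2))
    (α : List (Fin 7)) : Zpow α (JJ g (ua a)) y = 0 := by
  apply zero_germ
  have c0 : ∀ᶠ z : R3 in 𝓝 y, 0 < z 0 := (isOpen_lt (by fun_prop) (by fun_prop)).mem_nhds h0
  have c1 : ∀ᶠ z : R3 in 𝓝 y, M + z 0 < √(z 1^2 + z 2^2) := (isOpen_lt (by fun_prop) (by fun_prop)).mem_nhds h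
  filter_upwards [c0, c1] with z k0 k1
  have hM := c.hM
  obtain ⟨θ, -, h1, h2⟩ := polar4 (z 1) (z 2)
  have h3 := c.hua a (z 0) (√(z 1^2+z 2^2)) θ (by linarith)
  rw [← h1, ← h2] at h3
  have hz : ![z 0, z 1, z 2] = z := by ext i; fin_cases i <;> rfl
  rw [hz] at h3
  rw [h3, c.hw.supp z k0.le ((Real.lt_sqrt (by linarith)).1 k1), c.hV.2.2.1 _ _ _ (by linarith)]; ring

theorem z_in (c : Cx M b T d e φ0 φ1 g χ V w0 ua) (a : ℝ) {y : R3} (h0 : 2 < a * y 0) (hr : 0 < y 1^2 + y 2^2)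
    (h : 2 < -3 * a * (√(y 1^2 + y 2^2) - y 0)) (α : List (Fin 7)) : Zpow α (JJ g (ua a)) y = 0 := by
  apply zero_germ
  have c0 : ∀ᶠ z : R3 in 𝓝 y, 2 < a * z 0 := (isOpen_lt (by fun_prop) (by fun_prop)).mem_nhds h0
  have c1 : ∀ᶠ z : R3 in 𝓝 y, 0 < z 1^2 + z 2^2 := (isOpen_lt (by fun_prop) (by fun_prop)).mem_nhds hr
  have c2 : ∀ᶠ z : R3 in 𝓝 y, 2 < -3 * a * (√(z 1^2 + z 2^2) - z 0) := (isOpen_lt (by fun_prop) (by fun_prop)).mem_nhds h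
  filter_upwards [c0, c1, c2] with z k0 k1 k2
  rw [ua_cart c a k1 (Or.inr k2.le), c.hχ0 _ k0.le]; ring

/-- pointwise bounds for the error -/
theorem pw (c : Cx M b T d e φ0 φ1 g χ V w0 ua) (α : List (Fin 7)) : ∃ C, 0 ≤ C ∧ ∀ a t x1 x2 : ℝ, 0 < a → a < 1 → 0 < t →
    a^2 * (1 + t) < b^2 → 0 < x1^2 + x2^2 →
    let F := Zpow α (JJ g (ua a)) ![t, x1, x2]
    let q := √(x1^2+x2^2) - t
    (M < q → F = 0) ∧ (a * t < 1 → |F| ≤ C * (a^2 * (1+t)⁻¹ * (jb q)⁻¹)) ∧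
    (1 < a * t → a * t < 2 → |F| ≤ C * (a^3 * ((jb q)⁻¹ + √a))) ∧
    (2 < a * t → a * q < -3/4 → F = 0) ∧
    (2 < a * t → |F| ≤ C * (a^3 * t⁻¹ + a * ((t⁻¹)^2 * (√t)⁻¹))) := by
  obtain ⟨C1, hC1, H1⟩ := ((a_J c).cz α).bound
  obtain ⟨C2, hC2, H2⟩ := ((b_J c).cz α).bound
  obtain ⟨C3, hC3, H3⟩ := ((c_J c).Zpow c.hM α).bound
  obtain ⟨C4, hC4, H4⟩ := ((t_J c).Zpow c.hM α).bound
  refine ⟨C1 + C2 + C3 + C4, by positivity, fun a t x1 x2 ha ha1 ht hb hx => ?_⟩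
  intro F q
  obtain ⟨θ, hθ, h1, h2⟩ := polar4 x1 x2
  have hP : Psi ![q, t, θ] = ![t, x1, x2] := by
    have : t + q = √(x1^2+x2^2) := by ring
    simp only [Psi, Matrix.cons_val_zero, Matrix.cons_val_one, Matrix.cons_val]
    rw [this, ← h1, ← h2]
  have jp := jb_pos q
  have mC : ∀ {Ci X : ℝ}, Ci ≤ C1 + C2 + C3 + C4 → 0 ≤ X → |F| ≤ Ci * X → |F| ≤ (C1 + C2 + C3 + C4) * X := fun hi hX h =>
    h.trans (mul_le_mul_of_nonneg_right hi hX)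
  have zo : M < q → F = 0 := fun h => z_out c a (y := ![t, x1, x2]) ht (by show M + t < √(x1^2+x2^2); simp only [q] at h; linarith) α
  have zi : 2 < a * t → a * q < -2/3 → F = 0 := fun h h' =>
    z_in c a (y := ![t, x1, x2]) h hx (by show 2 < -3 * a * q; linarith) α
  refine ⟨zo, fun h => ?_, fun h h' => ?_, fun h h' => zi h (by linarith), fun h => ?_⟩
  · refine mC (Ci := C1) (by linarith) (by positivity) ?_
    have := H1 a ![t, x1, x2] ⟨⟨ha, ha1⟩, ht, h, hx⟩
    refine this.trans_eq ?_
    have e : dw ![t, x1, x2] = (√(1 + t))⁻¹ * (√(jb q))⁻¹ := rfl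
    have e1 : (√(1 + t))⁻¹ * (√(1 + t))⁻¹ = (1 + t)⁻¹ := by rw [← mul_inv, Real.mul_self_sqrt (by linarith)]
    have e2 : (√(jb q))⁻¹ * (√(jb q))⁻¹ = (jb q)⁻¹ := by rw [← mul_inv, Real.mul_self_sqrt jp.le]
    show C1 * (a * dw ![t, x1, x2] * (a * dw ![t, x1, x2])) = _
    rw [e, ← e1, ← e2]; ring
  · by_cases hq : -3 < 4 * (a * q)
    · by_cases hq' : q < M + 1
      · refine mC (Ci := C3) (by linarith) (by positivity) ?_
        have := H3 a ![q, t, θ] ⟨⟨⟨ha, ha1⟩, h, hb, hq, hq', hθ⟩, h'⟩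
        beta_reduce at this
        rw [hP] at this
        exact this
      · rw [zo (by linarith)]; simp; positivity
    · have := H2 a ![t, x1, x2] ⟨⟨ha, ha1⟩, h, h', hx, by show 2 < -3 * a * q; linarith⟩
      refine mC (Ci := C2) (by linarith) (by positivity) (this.trans ?_)
      refine mul_le_mul_of_nonneg_left ?_ hC2
      have h5 : a ≤ √a := Real.le_sqrt_of_sq_le (by nlinarith)
      have h6 : 0 < (jb q)⁻¹ := by positivity
      calc a^2 * a^2 = a^3 * a := by ring
        _ ≤ _ := mul_le_mul_of_nonneg_left (by linarith) (by positivity)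
  · by_cases hq : -3 < 4 * (a * q)
    · by_cases hq' : q < M + 1
      · refine mC (Ci := C4) (by linarith) (by positivity) ?_
        have := H4 a ![q, t, θ] ⟨⟨⟨ha, ha1⟩, by show 1 < a * t; linarith, hb, hq, hq', hθ⟩, h⟩
        beta_reduce at this
        rw [hP] at this
        exact this
      · rw [zo (by linarith)]; simp; positivity
    · rw [zi h (by linarith)]; simp; positivity
end

theorem l2_rad {f : ℝ × ℝ → ℝ} {K κ l t M : ℝ} (hK : 0 ≤ K) (hκ : 0 ≤ κ) (hl : 0 ≤ l) (ht : 0 < t) (hM : 0 < M)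
    (h : ∀ᵐ x : ℝ × ℝ, ((√(x.1^2+x.2^2) - t < -l ∨ M < √(x.1^2+x.2^2) - t) → f x = 0) ∧
      |f x| ≤ K * ((jb (√(x.1^2+x.2^2) - t))⁻¹ + κ)) :
    (eLpNorm f 2 volume).toReal ≤ K * √(16 * (t + M) * (4 + κ^2 * (l + M))) := by
  have hX : 0 ≤ 16 * (t + M) * (4 + κ^2 * (l + M)) := by positivity
  set Hf : ℝ → ℝ := fun r => (t + M) * K^2 * 2 * ((1 + (r - t)^2)⁻¹ + Set.indicator (Set.Icc (t - l) (t + M)) (fun _ => κ^2) r) with hHf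
  have i1 : Integrable fun r : ℝ => (1 + (r - t)^2)⁻¹ := integrable_inv_one_add_sq.comp_sub_right t
  have i2 : Integrable (Set.indicator (Set.Icc (t - l) (t + M)) (fun _ : ℝ => κ^2)) :=
    (integrable_indicator_iff measurableSet_Icc).2 (integrableOn_const (by simp))
  have iH : Integrable Hf := (i1.add i2).const_mul _
  have vH : ∫ r, Hf r = (t + M) * K^2 * 2 * (π + κ^2 * (l + M)) := by
    have e1 : ∫ r : ℝ, (1 + (r - t)^2)⁻¹ = π := by
      rw [integral_sub_right_eq_self (fun r : ℝ => (1 + r^2)⁻¹) t, integral_univ_inv_one_add_sq]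
    rw [hHf, integral_const_mul, integral_add i1 i2, e1, integral_indicator measurableSet_Icc, setIntegral_const]
    simp only [Measure.real, Real.volume_Icc, smul_eq_mul]
    rw [ENNReal.toReal_ofReal (by linarith)]; ring
  have nH : ∀ r, 0 ≤ Hf r := fun r => by
    have : 0 ≤ Set.indicator (Set.Icc (t - l) (t + M)) (fun _ : ℝ => κ^2) r := Set.indicator_nonneg (fun _ _ => by positivity) r
    have h2 : 0 ≤ t + M := by positivity
    simp only [hHf]; positivity
  set S : ℝ → ℝ := fun r => Set.indicator (Set.Icc (t - l) (t + M)) (fun r => K^2 * ((jb (r - t))⁻¹ + κ)^2) r with hS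
  have hSH : ∀ r, 0 < r → r * S r ≤ Hf r := fun r hr => by
    by_cases hm : r ∈ Set.Icc (t - l) (t + M)
    · simp only [hS, hHf, Set.indicator_of_mem hm]
      have e1 : (1 + (r - t)^2)⁻¹ = ((jb (r - t))⁻¹)^2 := by rw [inv_pow, jb_sq]
      rw [e1]
      have e2 : ((jb (r - t))⁻¹ + κ)^2 ≤ 2 * (((jb (r - t))⁻¹)^2 + κ^2) := by nlinarith [sq_nonneg ((jb (r - t))⁻¹ - κ)]
      calc r * (K^2 * ((jb (r - t))⁻¹ + κ)^2) ≤ (t + M) * (K^2 * (2 * (((jb (r - t))⁻¹)^2 + κ^2))) := by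
            gcongr; exact hm.2
        _ = _ := by ring
    · have := nH r
      simp only [hS, Set.indicator_of_notMem hm] at this ⊢; simpa using this
  have key : ∫⁻ x, ‖f x‖ₑ^(2:ℝ) ≤ ENNReal.ofReal (K^2 * (16 * (t + M) * (4 + κ^2 * (l + M)))) := by
    calc ∫⁻ x, ‖f x‖ₑ^(2:ℝ) ≤ ∫⁻ x : ℝ × ℝ, ENNReal.ofReal (S (√(x.1^2+x.2^2))) := by
          refine lintegral_mono_ae ?_
          filter_upwards [h] with x hx
          rw [Real.enorm_eq_ofReal_abs, ENNReal.ofReal_rpow_of_nonneg (abs_nonneg _) (by norm_num)]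
          apply ENNReal.ofReal_le_ofReal
          by_cases hm : √(x.1^2+x.2^2) ∈ Set.Icc (t - l) (t + M)
          · simp only [hS, Set.indicator_of_mem hm]
            rw [← mul_pow, Real.rpow_two]
            exact pow_le_pow_left₀ (abs_nonneg _) hx.2 2
          · have : f x = 0 := hx.1 (by
              by_contra hc; push Not at hc
              exact hm ⟨by linarith [hc.1], by linarith [hc.2]⟩)
            simp [hS, Set.indicator_of_notMem hm, this]
      _ = ∫⁻ p in polarCoord.target, ENNReal.ofReal p.1 • ENNReal.ofReal (S (√((polarCoord.symm p).1^2+(polarCoord.symm p).2^2))) :=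
          (lintegral_comp_polarCoord_symm _).symm
      _ ≤ ∫⁻ p in polarCoord.target, ENNReal.ofReal (Hf p.1) := by
          refine setLIntegral_mono' polarCoord.open_target.measurableSet fun p hp => ?_
          have hp1 : 0 < p.1 := hp.1
          have e : (polarCoord.symm p).1^2+(polarCoord.symm p).2^2 = p.1^2 := by
            simp only [polarCoord_symm_apply]
            linear_combination p.1^2 * (Real.sin_sq_add_cos_sq p.2)
          rw [e, Real.sqrt_sq hp1.le, smul_eq_mul, ← ENNReal.ofReal_mul hp1.le]
          exact ENNReal.ofReal_le_ofReal (hSH _ hp1)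
      _ = ∫⁻ p in Set.Ioi (0:ℝ) ×ˢ Set.Ioo (-π) π, ENNReal.ofReal (Hf p.1) * (fun _ => 1) p.2 := by simp [polarCoord_target]
      _ = (∫⁻ r in Set.Ioi (0:ℝ), ENNReal.ofReal (Hf r)) * ∫⁻ _ in Set.Ioo (-π) π, 1 := by
          rw [Measure.volume_eq_prod, ← Measure.prod_restrict]
          exact lintegral_prod_mul iH.1.aemeasurable.ennreal_ofReal.restrict aemeasurable_const
      _ ≤ ENNReal.ofReal ((t + M) * K^2 * 2 * (π + κ^2 * (l + M))) * ENNReal.ofReal (2 * π) := by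
          gcongr
          · rw [← vH, ofReal_integral_eq_lintegral_ofReal iH (Eventually.of_forall nH)]
            exact setLIntegral_le_lintegral _ _
          · rw [setLIntegral_const, one_mul, Real.volume_Ioo]; exact ENNReal.ofReal_le_ofReal (by linarith)
      _ = ENNReal.ofReal (((t + M) * K^2 * 2 * (π + κ^2 * (l + M))) * (2 * π)) := (ENNReal.ofReal_mul' (by positivity)).symm
      _ ≤ _ := by
          apply ENNReal.ofReal_le_ofReal
          have h4 := pi_lt_four
          have h5 : 0 ≤ κ^2 * (l + M) := by positivity
          have h6 : 0 ≤ (t + M) * K^2 := by positivity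
          have h7 : (π + κ^2 * (l + M)) * π ≤ (4 + κ^2 * (l + M)) * 4 :=
            mul_le_mul (by linarith) h4.le pi_pos.le (by positivity)
          nlinarith [mul_le_mul_of_nonneg_left h7 h6]
  rw [eLpNorm_eq_lintegral_rpow_enorm_toReal (by norm_num) (by norm_num), ← Real.sqrt_sq hK, ← Real.sqrt_mul (sq_nonneg _)]
  refine ENNReal.toReal_le_of_le_ofReal (Real.sqrt_nonneg _) ?_
  simp only [ENNReal.toReal_ofNat]
  refine (ENNReal.rpow_le_rpow key (by norm_num)).trans_eq ?_
  rw [ENNReal.ofReal_rpow_of_nonneg (by positivity) (by norm_num), Real.sqrt_eq_rpow]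
end

noncomputable section
open Function

theorem slice {M b T : ℝ} {d : Fin 3 → Fin 3 → ℝ} {e : Fin 3 → Fin 3 → Fin 3 → ℝ} {φ0 φ1 : ℝ × ℝ → ℝ}
    {g : Fin 3 → Fin 3 → ℝ → (Fin 3 → ℝ) → ℝ} {χ : ℝ → ℝ} {V : ℝ → ℝ → ℝ → ℝ} {w0 : R3 → ℝ}
    {ua : ℝ → R3 → ℝ} (c : Cx M b T d e φ0 φ1 g χ V w0 ua) (α : List (Fin 7)) : ∃ D, 0 ≤ D ∧ ∀ a t : ℝ, 0 < a → a < 1 → 0 < t →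
    a^2 * (1 + t) < b^2 → a * t ≠ 1 → a * t ≠ 2 →
    let N := (eLpNorm (fun x : ℝ × ℝ => Zpow α (JJ g (ua a)) ![t, x.1, x.2]) 2 volume).toReal
    (a * t < 2 → N ≤ D * (a^2 * (√t)⁻¹)) ∧ (2 < a * t → N ≤ D * (a^2 * √a * (√t)⁻¹ + √a * (t⁻¹)^2)) := by
  obtain ⟨C, hC, H⟩ := pw c α
  have hM := c.hM
  set B := 16 * (1 + M) * (6 + M) with hB
  have hB0 : 0 < B := by positivity
  refine ⟨2 * (C * √B), by positivity, fun a t ha ha1 ht hb n1 n2 => ?_⟩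
  intro N
  have hsa : 0 < √a := Real.sqrt_pos.2 ha
  have hst : 0 < √t := Real.sqrt_pos.2 ht
  have sqa : √a * √a = a := Real.mul_self_sqrt ha.le
  have sqt : √t * √t = t := Real.mul_self_sqrt ht.le
  have nz : ∀ᵐ x : ℝ × ℝ, 0 < x.1^2 + x.2^2 := by
    filter_upwards [compl_mem_ae_iff.2 (measure_singleton (0 : ℝ × ℝ))] with x hx
    by_contra hc
    have h1 : x.1 = 0 := by nlinarith [sq_nonneg x.1, sq_nonneg x.2]
    have h2 : x.2 = 0 := by nlinarith [sq_nonneg x.1, sq_nonneg x.2]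
    exact hx (Prod.ext h1 h2)
  have q0 : ∀ x : ℝ × ℝ, ¬ √(x.1^2+x.2^2) - t < -t := fun x h => by linarith [Real.sqrt_nonneg (x.1^2+x.2^2)]
  have sq : ∀ {Y s : ℝ}, Y ≤ B * s → √Y ≤ √B * √s := fun h => (Real.sqrt_le_sqrt h).trans_eq (Real.sqrt_mul hB0.le _)
  constructor
  · intro h2
    rcases lt_or_gt_of_ne n1 with h1 | h1
    · have := l2_rad (f := fun x : ℝ × ℝ => Zpow α (JJ g (ua a)) ![t, x.1, x.2]) (K := C * (a^2 * (1+t)⁻¹)) (κ := 0) (l := t) (t := t)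
        (M := M) (by positivity) le_rfl ht.le ht hM (by
          filter_upwards [nz] with x hx
          have := H a t x.1 x.2 ha ha1 ht hb hx
          exact ⟨fun hq => this.1 (hq.resolve_left (q0 x)), (this.2.1 h1).trans_eq (by ring)⟩)
      refine this.trans ?_
      have e1 : √(16 * (t + M) * (4 + 0^2 * (t + M))) ≤ √B * √(1+t) := sq (by rw [hB]; nlinarith [mul_pos hM ht, mul_pos hM hM, mul_pos (mul_pos hM hM) ht])
      have e2 : (1 + t)⁻¹ * √(1 + t) ≤ (√t)⁻¹ := by
        have : (1 + t)⁻¹ * √(1 + t) = (√(1 + t))⁻¹ := by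
          have h3 : 0 < √(1+t) := Real.sqrt_pos.2 (by linarith)
          have h4 : 1 + t = √(1+t) * √(1+t) := (Real.mul_self_sqrt (by linarith)).symm
          nth_rewrite 1 [h4]; field_simp
        rw [this]
        exact inv_anti₀ hst (Real.sqrt_le_sqrt (by linarith))
      calc _ ≤ C * (a^2 * (1+t)⁻¹) * (√B * √(1+t)) := by gcongr
        _ = C * √B * (a^2 * ((1 + t)⁻¹ * √(1 + t))) := by ring
        _ ≤ C * √B * (a^2 * (√t)⁻¹) := by gcongr
        _ ≤ _ := by
          have : 0 ≤ C * √B * (a^2 * (√t)⁻¹) := by positivity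
          linarith
    · have t1 : 1 < t := by nlinarith
      have := l2_rad (f := fun x : ℝ × ℝ => Zpow α (JJ g (ua a)) ![t, x.1, x.2]) (K := C * a^3) (κ := √a) (l := t) (t := t)
        (M := M) (by positivity) hsa.le ht.le ht hM (by
          filter_upwards [nz] with x hx
          have := H a t x.1 x.2 ha ha1 ht hb hx
          exact ⟨fun hq => this.1 (hq.resolve_left (q0 x)), (this.2.2.1 h1 h2).trans_eq (by ring)⟩)
      refine this.trans ?_
      have e1 : √(16 * (t + M) * (4 + √a^2 * (t + M))) ≤ √B * √t := sq (by
        have k1 : t + M ≤ (1 + M) * t := by nlinarith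
        have k2 : 4 + √a^2 * (t + M) ≤ 6 + M := by rw [pow_two, sqa]; nlinarith
        have := mul_le_mul k1 k2 (by positivity) (by positivity)
        rw [hB]; linarith)
      calc _ ≤ C * a^3 * (√B * √t) := by gcongr
        _ = C * √B * (a^2 * ((a * t) * (√t)⁻¹)) := by nth_rewrite 2 [← sqt]; field_simp
        _ ≤ C * √B * (a^2 * (2 * (√t)⁻¹)) := by gcongr
        _ = _ := by ring
  · intro h2
    have t1 : 1 < t := by nlinarith
    have := l2_rad (f := fun x : ℝ × ℝ => Zpow α (JJ g (ua a)) ![t, x.1, x.2]) (K := C * (a^3 * t⁻¹ + a * ((t⁻¹)^2 * (√t)⁻¹)) * (√a)⁻¹)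
      (κ := √a) (l := a⁻¹) (t := t) (M := M) (by positivity) hsa.le (by positivity) ht hM (by
        filter_upwards [nz] with x hx
        have := H a t x.1 x.2 ha ha1 ht hb hx
        refine ⟨fun hq => hq.elim (fun h => this.2.2.2.1 h2 ?_) this.1, (this.2.2.2.2 h2).trans ?_⟩
        · have := mul_lt_mul_of_pos_left h ha
          rw [mul_neg, mul_inv_cancel₀ ha.ne'] at this
          linarith
        · have h5 := inv_pos.2 (jb_pos (√(x.1^2+x.2^2) - t))
          calc _ = C * (a^3 * t⁻¹ + a * ((t⁻¹)^2 * (√t)⁻¹)) * (√a)⁻¹ * √a := by field_simp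
            _ ≤ _ := by gcongr; linarith)
    refine this.trans ?_
    have e1 : √(16 * (t + M) * (4 + √a^2 * (a⁻¹ + M))) ≤ √B * √t := sq (by
      have k1 : t + M ≤ (1 + M) * t := by nlinarith
      have k2 : 4 + √a^2 * (a⁻¹ + M) ≤ 6 + M := by rw [pow_two, sqa, mul_add, mul_inv_cancel₀ ha.ne']; nlinarith
      have := mul_le_mul k1 k2 (by positivity) (by positivity)
      rw [hB]; linarith)
    calc _ ≤ C * (a^3 * t⁻¹ + a * ((t⁻¹)^2 * (√t)⁻¹)) * (√a)⁻¹ * (√B * √t) := by gcongr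
      _ = C * √B * (a^2 * (a * (√a)⁻¹) * (t⁻¹ * √t) + a * (√a)⁻¹ * (t⁻¹)^2 * ((√t)⁻¹ * √t)) := by ring
      _ = C * √B * (a^2 * √a * (√t)⁻¹ + √a * (t⁻¹)^2) := by
        have k1 : a * (√a)⁻¹ = √a := by nth_rewrite 1 [← sqa]; field_simp
        have k2 : t⁻¹ * √t = (√t)⁻¹ := by nth_rewrite 1 [← sqt]; field_simp
        rw [k1, k2, inv_mul_cancel₀ hst.ne', mul_one]
      _ ≤ _ := by
        have : 0 ≤ C * √B * (a^2 * √a * (√t)⁻¹ + √a * (t⁻¹)^2) := by positivity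
        linarith

theorem h_half {s : ℝ} (hs : 0 ≤ s) : Integrable (Set.indicator (Set.Ioc 0 s) fun t : ℝ => t^(-1/2:ℝ)) ∧
    ∫ t, Set.indicator (Set.Ioc 0 s) (fun t : ℝ => t^(-1/2:ℝ)) t = 2 * √s := by
  refine ⟨(integrable_indicator_iff measurableSet_Ioc).2 ((intervalIntegrable_iff_integrableOn_Ioc_of_le hs).1
    (intervalIntegral.intervalIntegrable_rpow' (by norm_num))), ?_⟩
  rw [integral_indicator measurableSet_Ioc, ← intervalIntegral.integral_of_le hs, integral_rpow (Or.inl (by norm_num)), Real.sqrt_eq_rpow]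
  norm_num
  ring

theorem h_two {s : ℝ} (hs : 0 < s) : Integrable (Set.indicator (Set.Ioi s) fun t : ℝ => t^(-2:ℝ)) ∧
    ∫ t, Set.indicator (Set.Ioi s) (fun t : ℝ => t^(-2:ℝ)) t = s⁻¹ := by
  refine ⟨(integrable_indicator_iff measurableSet_Ioi).2 (integrableOn_Ioi_rpow_of_lt (by norm_num) hs), ?_⟩
  rw [integral_indicator measurableSet_Ioi, integral_Ioi_rpow_of_lt (by norm_num) hs]
  norm_num
  rw [Real.rpow_neg_one]

theorem final_est {M b T : ℝ} {d : Fin 3 → Fin 3 → ℝ} {e : Fin 3 → Fin 3 → Fin 3 → ℝ} {φ0 φ1 : ℝ × ℝ → ℝ}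
    {g : Fin 3 → Fin 3 → ℝ → (Fin 3 → ℝ) → ℝ} {χ : ℝ → ℝ} {V : ℝ → ℝ → ℝ → ℝ} {w0 : R3 → ℝ}
    {ua : ℝ → R3 → ℝ} (c : Cx M b T d e φ0 φ1 g χ V w0 ua) (α : List (Fin 7)) :
    ∃ C : ℝ, 0 < C ∧ ∃ ε0 : ℝ, 0 < ε0 ∧ ∀ ε : ℝ, 0 < ε → ε < ε0 →
      (∫ t in Set.Ioc (0 : ℝ) (b ^ 2 / ε ^ 2 - 1),
        (eLpNorm (fun x : ℝ × ℝ => Zpow α (JJ g (ua ε)) ![t, x.1, x.2]) 2 volume).toReal) ≤ C * ε ^ ((3 : ℝ) / 2) := by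
  obtain ⟨D, hD, H⟩ := slice c α
  have hb := c.hb0
  refine ⟨D * (5 + 2 * b) + 1, by positivity, min 1 b, lt_min one_pos hb, fun a ha ha' => ?_⟩
  obtain ⟨ha1, hab⟩ := lt_min_iff.1 ha'
  have hsa : 0 < √a := Real.sqrt_pos.2 ha
  have sqa : √a * √a = a := Real.mul_self_sqrt ha.le
  have hT : 0 ≤ b^2/a^2 - 1 := by
    rw [sub_nonneg, one_le_div (by positivity)]; nlinarith
  obtain ⟨i1, v1⟩ := h_half (s := 2/a) (by positivity)
  obtain ⟨i2, v2⟩ := h_half hT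
  obtain ⟨i3, v3⟩ := h_two (s := 2/a) (by positivity)
  set h1 := Set.indicator (Set.Ioc 0 (2/a)) fun t : ℝ => t^(-1/2:ℝ) with e1
  set h2 := Set.indicator (Set.Ioc 0 (b^2/a^2 - 1)) fun t : ℝ => t^(-1/2:ℝ) with e2
  set h3 := Set.indicator (Set.Ioi (2/a)) fun t : ℝ => t^(-2:ℝ) with e3
  have n1 : ∀ t, 0 ≤ h1 t := Set.indicator_nonneg fun t ht => Real.rpow_nonneg ht.1.le _
  have n2 : ∀ t, 0 ≤ h2 t := Set.indicator_nonneg fun t ht => Real.rpow_nonneg ht.1.le _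
  have n3 : ∀ t, 0 ≤ h3 t := Set.indicator_nonneg fun t ht => Real.rpow_nonneg ((by positivity : 0 ≤ 2/a).trans (le_of_lt ht)) _
  have iH : Integrable fun t => D * (a^2 * h1 t + (a^2 * √a * h2 t + √a * h3 t)) :=
    ((i1.const_mul _).add ((i2.const_mul _).add (i3.const_mul _))).const_mul _
  have nH : ∀ t, 0 ≤ D * (a^2 * h1 t + (a^2 * √a * h2 t + √a * h3 t)) := fun t => by
    have := n1 t; have := n2 t; have := n3 t; positivity
  have vH : ∫ t, D * (a^2 * h1 t + (a^2 * √a * h2 t + √a * h3 t)) =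
      D * (a^2 * (2 * √(2/a)) + (a^2 * √a * (2 * √(b^2/a^2 - 1)) + √a * (2/a)⁻¹)) := by
    rw [integral_const_mul, integral_add (g := fun t => a^2 * √a * h2 t + √a * h3 t) (i1.const_mul _) ((i2.const_mul _).add (i3.const_mul _)),
      integral_add (i2.const_mul _) (i3.const_mul _), integral_const_mul, integral_const_mul, integral_const_mul, v1, v2, v3]
  have fin : ∀ x : ℝ, ∀ᵐ t : ℝ, t ≠ x := fun x => compl_mem_ae_iff.2 (measure_singleton x)
  refine (integral_mono_of_nonneg (g := fun t => D * (a^2 * h1 t + (a^2 * √a * h2 t + √a * h3 t)))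
    (Eventually.of_forall fun _ => ENNReal.toReal_nonneg) iH.integrableOn ?_).trans ?_
  · filter_upwards [ae_restrict_mem measurableSet_Ioc, ae_restrict_of_ae (fin (1/a)), ae_restrict_of_ae (fin (2/a)),
      ae_restrict_of_ae (fin (b^2/a^2 - 1))] with t ht t1 t2 t3
    have hlt : t < b^2/a^2 - 1 := lt_of_le_of_ne ht.2 t3
    have k := H a t ha ha1 ht.1 (by
      have : 1 + t < b^2/a^2 := by linarith
      rw [lt_div_iff₀ (by positivity)] at this; linarith)
      (fun h => t1 (by rw [eq_div_iff ha.ne']; linarith)) (fun h => t2 (by rw [eq_div_iff ha.ne']; linarith))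
    have r1 : t^(-1/2:ℝ) = (√t)⁻¹ := by rw [Real.sqrt_eq_rpow, ← Real.rpow_neg ht.1.le]; norm_num
    have r2 : t^(-2:ℝ) = (t⁻¹)^2 := by rw [Real.rpow_neg ht.1.le, Real.rpow_two, inv_pow]
    have p1 := n1 t; have p2 := n2 t; have p3 := n3 t
    have m2 : h2 t = (√t)⁻¹ := by rw [e2, Set.indicator_of_mem ht, r1]
    rcases lt_or_gt_of_ne t2 with hh | hh
    · refine (k.1 (by rw [lt_div_iff₀ ha] at hh; linarith)).trans (mul_le_mul_of_nonneg_left ?_ hD)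
      have m1 : h1 t = (√t)⁻¹ := by rw [e1, Set.indicator_of_mem (show t ∈ Set.Ioc 0 (2/a) from ⟨ht.1, hh.le⟩), r1]
      rw [← m1]
      have : 0 ≤ a^2 * √a * h2 t + √a * h3 t := by positivity
      linarith
    · refine (k.2 (by rw [div_lt_iff₀ ha] at hh; linarith)).trans (mul_le_mul_of_nonneg_left ?_ hD)
      have m3 : h3 t = (t⁻¹)^2 := by rw [e3, Set.indicator_of_mem (show t ∈ Set.Ioi (2/a) from hh), r2]
      rw [m2, m3]
      have : 0 ≤ a^2 * h1 t := by positivity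
      linarith
  · refine (setIntegral_le_integral iH (Eventually.of_forall nH)).trans ?_
    rw [vH]
    have s1 : √(2/a) ≤ 2 * (√a)⁻¹ := by
      rw [Real.sqrt_div (by norm_num), div_eq_mul_inv]
      gcongr
      exact (Real.sqrt_le_left (by norm_num)).2 (by norm_num)
    have s2 : √(b^2/a^2 - 1) ≤ b/a := (Real.sqrt_le_left (by positivity)).2 (by rw [div_pow]; linarith)
    have s3 : a^((3:ℝ)/2) = a * √a := by
      rw [Real.sqrt_eq_rpow]; nth_rewrite 2 [← Real.rpow_one a]; rw [← Real.rpow_add ha]; norm_num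
    have k1 : a * (√a)⁻¹ = √a := by nth_rewrite 1 [← sqa]; field_simp
    rw [s3]
    calc _ ≤ D * (a^2 * (2 * (2 * (√a)⁻¹)) + (a^2 * √a * (2 * (b/a)) + √a * (2/a)⁻¹)) := by gcongr
      _ = D * (4 * (a * (a * (√a)⁻¹)) + (2 * b * (a * √a) + a * √a / 2)) := by field_simp; ring
      _ ≤ _ := by
        rw [k1]
        have : 0 ≤ a * √a := by positivity
        nlinarith [mul_nonneg hD this]
end
/-- Lemma 2.4: the error `J_a = Σ g_ij(u_a, ∇u_a) ∂_ij u_a` of the approximate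
solution `u_a` satisfies `∫_0^{b²/ε²−1} ‖Z^α J_a(t,·)‖_{L²} dt ≤ C ε^{3/2}`. -/
theorem approximate_solution_error_estimate
    (M : ℝ) (hM : 0 < M)
    (φ0 φ1 : ℝ × ℝ → ℝ)
    (hφ0 : ContDiff ℝ (⊤ : ℕ∞) φ0) (hφ1 : ContDiff ℝ (⊤ : ℕ∞) φ1)
    (hs0 : SuppIn M φ0) (hs1 : SuppIn M φ1)
    (d : Fin 3 → Fin 3 → ℝ)
    (hdsymm : ∀ i j, d i j = d j i) (hd00 : d 0 0 = 0)
    (hdne : ∃ i j : Fin 3, (i, j) ≠ ((0 : Fin 3), (0 : Fin 3)) ∧ d i j ≠ 0)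
    (e : Fin 3 → Fin 3 → Fin 3 → ℝ)
    (hnull : NullCondFails e)
    (hne : φ0 ≠ 0 ∨ φ1 ≠ 0)
    (g : Fin 3 → Fin 3 → ℝ → (Fin 3 → ℝ) → ℝ)
    (hgsmooth : ∀ i j, ContDiff ℝ (⊤ : ℕ∞) (fun q : ℝ × (Fin 3 → ℝ) => g i j q.1 q.2))
    (hgsymm : ∀ i j u p, g i j u p = g j i u p)
    (hgexp : ∀ i j,
      (fun q : ℝ × (Fin 3 → ℝ) =>
          g i j q.1 q.2 - (cMink i j + d i j * q.1 + ∑ k : Fin 3, e i j k * q.2 k))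
        =O[𝓝 (0 : ℝ × (Fin 3 → ℝ))] fun q => ‖q.1‖ ^ 2 + ‖q.2‖ ^ 2)
    (w0 : (Fin 3 → ℝ) → ℝ)
    (hw0smooth : ContDiff ℝ (⊤ : ℕ∞) w0)
    (hw0eq : ∀ y : Fin 3 → ℝ,
      pd 0 (pd 0 w0) y - pd 1 (pd 1 w0) y - pd 2 (pd 2 w0) y = 0)
    (hw0init : ∀ x : ℝ × ℝ,
      w0 ![0, x.1, x.2] = φ0 x ∧ pd 0 w0 ![0, x.1, x.2] = φ1 x)
    (χ : ℝ → ℝ) (hχ : ContDiff ℝ (⊤ : ℕ∞) χ)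
    (hχ1 : ∀ s : ℝ, s ≤ 1 → χ s = 1) (hχ0 : ∀ s : ℝ, 2 ≤ s → χ s = 0)
    (V : ℝ → ℝ → ℝ → ℝ)
    (hV : IsProfileSol M d e φ0 φ1 (tau0 M d e φ0 φ1) V)
    (ua : ℝ → (Fin 3 → ℝ) → ℝ)
    (hua : ∀ ε t r θ : ℝ, 0 < r →
      ua ε ![t, r * Real.cos θ, r * Real.sin θ]
        = ε * χ (ε * t) * w0 ![t, r * Real.cos θ, r * Real.sin θ]
          + ε / Real.sqrt r * (1 - χ (ε * t)) * χ (-3 * ε * (r - t)) *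
              V (r - t) θ (ε * Real.sqrt (1 + t)))
    :
    ∀ b : ℝ, 0 < b → b < tau0 M d e φ0 φ1 → ∀ α : List (Fin 7),
      ∃ C : ℝ, 0 < C ∧ ∃ ε0 : ℝ, 0 < ε0 ∧ ∀ ε : ℝ, 0 < ε → ε < ε0 →
        (∫ t in Set.Ioc (0 : ℝ) (b ^ 2 / ε ^ 2 - 1),
          (eLpNorm
            (fun x : ℝ × ℝ =>
              Zpow α
                (fun y => ∑ i : Fin 3, ∑ j : Fin 3,
                  g i j (ua ε y) (fun k => pd k (ua ε) y) * pd i (pd j (ua ε)) y)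
                ![t, x.1, x.2])
            2 volume).toReal)
          ≤ C * ε ^ ((3 : ℝ) / 2) := by
  intro b hb0 hbT α
  have hT := hb0.trans hbT
  have hw := isW_of_data hM hs0 hs1 hw0smooth hw0eq hw0init
  obtain ⟨h1, h2⟩ := w0_asym hM hs0 hs1 hw hw0init hT hV
  exact final_est ⟨hM, hb0, hbT, hV, hχ, hχ1, hχ0, hgsmooth, hgexp, hw, hua, h1, h2, prof_smb hM hT hV hbT h2⟩ α
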